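/- Let c be a real number with 1 < c < 3581/3106. Then there exist constants c₀ > 0 and r₀ > 0 such that for every integer r ≥ r₀, the number ℬ₃(r) of ordered triples (p₁, p₂, p₃) of primes with X/8 < pⱼ ≤ X (j = 1,2,3), where X = r^{1/c}, satisfying ⌊p₁^c⌋ + ⌊p₂^c⌋ + ⌊p₃^c⌋ = r, is at least c₀ · r^{3/c − 1}/(log r)³. -/

import Mathlib

open Real MeasureTheory
open Finset (Ioc Icc Ico range mem_Ioc mem_Icc mem_Ico mem_range mem_filter)
open ArithmeticFunction (vonMangoldt)

/-- `countSolFloor c r s` is the number of ordered `s`-tuples of primes `p₁, …, pₛ` with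
`X/8 < pⱼ ≤ X` (where `X = r^{1/c}`) and `⌊p₁^c⌋ + ⋯ + ⌊pₛ^c⌋ = r`. -/
noncomputable def countSolFloor (c : ℝ) (r : ℕ) (s : ℕ) : ℕ :=
  Nat.card {p : Fin s → ℕ //
    (∀ j, (p j).Prime ∧ (r : ℝ) ^ (1/c) / 8 < (p j : ℝ) ∧ (p j : ℝ) ≤ (r : ℝ) ^ (1/c)) ∧
    (∑ j, ⌊(p j : ℝ) ^ c⌋) = (r : ℤ)}

/-- additive character -/
noncomputable def ee (x : ℝ) : ℂ := Complex.exp (2 * π * x * Complex.I)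

lemma ee_add (x y : ℝ) : ee (x + y) = ee x * ee y := by
  unfold ee; rw [← Complex.exp_add]; congr 1; push_cast; ring

lemma ee_zero : ee 0 = 1 := by simp [ee]

lemma norm_ee (x : ℝ) : ‖ee x‖ = 1 := by
  unfold ee
  have : (2 * π * x * Complex.I : ℂ) = ((2 * π * x : ℝ) : ℂ) * Complex.I := by push_cast; ring
  rw [this, Complex.norm_exp_ofReal_mul_I]

lemma ee_int (n : ℤ) : ee n = 1 := by
  unfold ee
  rw [Complex.exp_eq_one_iff]
  exact ⟨n, by push_cast; ring⟩

lemma ee_ne_zero (x : ℝ) : ee x ≠ 0 := by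
  unfold ee; exact Complex.exp_ne_zero _

lemma ee_neg (x : ℝ) : ee (-x) = (starRingEnd ℂ) (ee x) := by
  unfold ee
  rw [← Complex.exp_conj]
  congr 1
  have : (2 * π * x * Complex.I : ℂ) = ((2 * π * x : ℝ) : ℂ) * Complex.I := by push_cast; ring
  rw [this, map_mul, Complex.conj_I, Complex.conj_ofReal]
  push_cast; ring

lemma ee_sub (x y : ℝ) : ee (x - y) = ee x * (starRingEnd ℂ) (ee y) := by
  rw [sub_eq_add_neg, ee_add, ee_neg]

lemma ee_eq (x : ℝ) : ee x = (Real.cos (2 * π * x) : ℂ) + (Real.sin (2 * π * x) : ℂ) * Complex.I := by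
  unfold ee
  have : (2 * π * x * Complex.I : ℂ) = ((2 * π * x : ℝ) : ℂ) * Complex.I := by push_cast; ring
  rw [this, Complex.exp_mul_I, Complex.ofReal_cos, Complex.ofReal_sin]

/-- `1/(1-e(d))` -/
noncomputable def klg (d : ℝ) : ℂ := 1 / 2 + (Real.cos (π * d) / Real.sin (π * d) / 2 : ℝ) * Complex.I

lemma klg_mul {d : ℝ} (h : Real.sin (π * d) ≠ 0) : (1 - ee d) * klg d = 1 := by
  have h2 : 2 * π * d = 2 * (π * d) := by ring
  rw [ee_eq, klg, h2, Real.cos_two_mul, Real.sin_two_mul]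
  have hs : Real.sin (π * d) ^ 2 = 1 - Real.cos (π * d) ^ 2 := by
    have := Real.sin_sq_add_cos_sq (π * d); linarith
  generalize Real.sin (π * d) = a at *
  generalize Real.cos (π * d) = b at *
  have ha : (a : ℂ) ≠ 0 := by exact_mod_cast h
  have hs' : (a : ℂ) ^ 2 = 1 - (b : ℂ) ^ 2 := by exact_mod_cast hs
  push_cast
  field_simp
  have hI : Complex.I ^ 2 = -1 := Complex.I_sq
  linear_combination (-2 * (b:ℂ) * Complex.I) * hs' + (-2 * (a:ℂ) * b ^ 2) * hI

lemma sin_pi_ge {d ρ : ℝ} (h0 : 0 < ρ) (h1 : ρ ≤ d) (h2 : d ≤ 1 - ρ) : 2 * ρ ≤ Real.sin (π * d) := by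
  rcases le_total d (1/2) with h | h
  · have := Real.mul_le_sin (x := π * d) (mul_nonneg Real.pi_pos.le (by linarith)) (by nlinarith [Real.pi_pos])
    have h3 : 2 / π * (π * d) = 2 * d := by field_simp
    linarith
  · have := Real.mul_le_sin (x := π * (1 - d)) (mul_nonneg Real.pi_pos.le (by linarith)) (by nlinarith [Real.pi_pos])
    have h3 : 2 / π * (π * (1 - d)) = 2 * (1 - d) := by field_simp
    have h4 : Real.sin (π * (1 - d)) = Real.sin (π * d) := by
      rw [show π * (1 - d) = π - π * d by ring, Real.sin_pi_sub]
    linarith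

lemma norm_klg_le {d ρ : ℝ} (h0 : 0 < ρ) (h1 : ρ ≤ d) (h2 : d ≤ 1 - ρ) : ‖klg d‖ ≤ 1 / (4 * ρ) := by
  have hs := sin_pi_ge h0 h1 h2
  have hs0 : 0 < Real.sin (π * d) := by linarith
  have hsq : ‖klg d‖ ^ 2 = 1 / (2 * Real.sin (π * d)) ^ 2 := by
    rw [← Complex.normSq_eq_norm_sq, klg, Complex.normSq_apply]
    simp only [Complex.add_re, Complex.mul_re, Complex.add_im, Complex.mul_im, Complex.ofReal_re,
      Complex.ofReal_im, Complex.I_re, Complex.I_im]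
    norm_num
    field_simp
    have := Real.sin_sq_add_cos_sq (π * d); linarith
  have : ‖klg d‖ ^ 2 ≤ (1 / (4 * ρ)) ^ 2 := by
    rw [hsq, one_div_pow]
    apply one_div_le_one_div_of_le (by positivity)
    nlinarith
  exact le_of_sq_le_sq this (by positivity) |> fun h => h

lemma klg_sub_norm {d d' : ℝ} (h0 : 0 < d) (h1 : d ≤ d') (h2 : d' < 1) :
    ‖klg d' - klg d‖ = (Real.cos (π * d) / Real.sin (π * d) - Real.cos (π * d') / Real.sin (π * d')) / 2 := by
  have e1 : klg d' - klg d = ((Real.cos (π * d') / Real.sin (π * d') / 2 - Real.cos (π * d) / Real.sin (π * d) / 2 : ℝ) : ℂ) * Complex.I := by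
    unfold klg; push_cast; ring
  rw [e1, norm_mul, Complex.norm_I, mul_one, Complex.norm_real, Real.norm_eq_abs, abs_of_nonpos]
  · ring
  · have s1 : 0 < Real.sin (π * d) := Real.sin_pos_of_pos_of_lt_pi (by positivity) (by nlinarith [Real.pi_pos])
    have s2 : 0 < Real.sin (π * d') := Real.sin_pos_of_pos_of_lt_pi (mul_pos Real.pi_pos (by linarith)) (by nlinarith [Real.pi_pos])
    have s3 : 0 ≤ Real.sin (π * d' - π * d) := Real.sin_nonneg_of_nonneg_of_le_pi (by nlinarith [Real.pi_pos]) (by nlinarith [Real.pi_pos])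
    rw [Real.sin_sub] at s3
    have : Real.cos (π * d') / Real.sin (π * d') ≤ Real.cos (π * d) / Real.sin (π * d) := by
      rw [div_le_div_iff₀ s2 s1]; linarith
    linarith

/-- Kusmin–Landau, discrete form. -/
lemma kusmin_landau (f : ℕ → ℝ) (m : ℕ) (ρ : ℝ) (ν : ℤ) (h0 : 0 < ρ)
    (hd : ∀ i < m, ρ ≤ f (i+1) - f i - ν ∧ f (i+1) - f i - ν ≤ 1 - ρ)
    (hm : ∀ i, i + 1 < m → f (i+1) - f i ≤ f (i+2) - f (i+1)) :
    ‖∑ i ∈ range m, ee (f i)‖ ≤ 1 / ρ := by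
  set d : ℕ → ℝ := fun i => f (i+1) - f i - ν with hdd
  have hE : ∀ i, ee (f (i+1)) = ee (f i) * ee (d i) := by
    intro i
    rw [← ee_add, hdd]
    have : f (i+1) = (f i + (f (i+1) - f i - ν)) + ν := by ring
    conv_lhs => rw [this, ee_add, ee_int, mul_one]
  have hsin : ∀ i < m, Real.sin (π * d i) ≠ 0 := by
    intro i hi
    have := sin_pi_ge h0 (hd i hi).1 (hd i hi).2
    intro h; simp only [hdd] at h; linarith
  have key : ∀ k, k < m → ‖∑ i ∈ range (k+1), ee (f i) + ee (f (k+1)) * klg (d k)‖ ≤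
      1 / (4 * ρ) + (Real.cos (π * d 0) / Real.sin (π * d 0) - Real.cos (π * d k) / Real.sin (π * d k)) / 2 := by
    intro k
    induction k with
    | zero =>
      intro h
      have h1 := klg_mul (hsin 0 h)
      have : ∑ i ∈ range (0+1), ee (f i) + ee (f (0+1)) * klg (d 0) = ee (f 0) * klg (d 0) := by
        simp only [zero_add, Finset.range_one, Finset.sum_singleton]
        have h2 := hE 0
        simp only [zero_add] at h2
        rw [h2]
        linear_combination -(ee (f 0)) * h1
      rw [this, norm_mul, norm_ee]
      have := norm_klg_le h0 (hd 0 h).1 (hd 0 h).2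
      simp only [hdd] at *
      linarith
    | succ k ih =>
      intro h
      have ih := ih (by omega)
      have h1 := klg_mul (hsin (k+1) h)
      have e1 : ∑ i ∈ range (k+1+1), ee (f i) + ee (f (k+1+1)) * klg (d (k+1)) =
        (∑ i ∈ range (k+1), ee (f i) + ee (f (k+1)) * klg (d k)) + ee (f (k+1)) * (klg (d (k+1)) - klg (d k)) := by
        rw [Finset.sum_range_succ, hE (k+1)]
        linear_combination -(ee (f (k+1))) * h1
      rw [e1]
      refine (norm_add_le _ _).trans ?_
      rw [norm_mul, norm_ee, one_mul]
      have a1 := hd k (by omega)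
      have a2 := hd (k+1) h
      have a3 := hm k h
      rw [klg_sub_norm (d := d k) (d' := d (k+1)) (by simp only [hdd]; linarith) (by simp only [hdd]; linarith) (by simp only [hdd]; linarith)]
      linarith
  have cotb : ∀ i < m, |Real.cos (π * d i) / Real.sin (π * d i)| ≤ 1 / (2 * ρ) := by
    intro i hi
    have := sin_pi_ge h0 (hd i hi).1 (hd i hi).2
    have h5 : 2 * ρ ≤ Real.sin (π * d i) := this
    rw [abs_div, abs_of_pos (by linarith : 0 < Real.sin (π * d i))]
    exact div_le_div₀ zero_le_one (Real.abs_cos_le_one _) (by positivity) h5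
  rcases Nat.eq_zero_or_pos m with rfl | hmp
  · simp; positivity
  · obtain ⟨k, rfl⟩ := Nat.exists_eq_succ_of_ne_zero hmp.ne'
    have h1 := key k (by omega)
    have h2 := norm_klg_le h0 (hd k (by omega)).1 (hd k (by omega)).2
    have h3 := cotb k (by omega)
    have h4 := cotb 0 (by omega)
    have h5 : ‖∑ i ∈ range (k+1), ee (f i)‖ ≤ ‖∑ i ∈ range (k+1), ee (f i) + ee (f (k+1)) * klg (d k)‖ + ‖klg (d k)‖ := by
      have : ∑ i ∈ range (k+1), ee (f i) = (∑ i ∈ range (k+1), ee (f i) + ee (f (k+1)) * klg (d k)) - ee (f (k+1)) * klg (d k) := by ring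
      conv_lhs => rw [this]
      refine (norm_sub_le _ _).trans ?_
      rw [norm_mul, norm_ee, one_mul]
    have h2' : ‖klg (d k)‖ ≤ 1 / (4 * ρ) := h2
    rw [abs_le] at h3 h4
    have e1 : 1 / (4 * ρ) = (1/ρ) / 4 := by field_simp
    have e2 : 1 / (2 * ρ) = (1/ρ) / 2 := by field_simp
    rw [e1] at h1 h2'
    rw [e2] at h3 h4
    have : k.succ = k + 1 := rfl
    rw [this]
    linarith [h3.1, h4.2]

lemma finset_ordConn (S : Finset ℕ) (h : ∀ i ∈ S, ∀ j ∈ S, ∀ k, i ≤ k → k ≤ j → k ∈ S) :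
    ∃ p q, p ≤ q ∧ S = Ico p q := by
  rcases S.eq_empty_or_nonempty with rfl | hS
  · exact ⟨0, 0, le_rfl, by simp⟩
  · refine ⟨S.min' hS, S.max' hS + 1, ?_, ?_⟩
    · have := S.min'_le _ (S.max'_mem hS); omega
    · ext k
      rw [mem_Ico]
      constructor
      · intro hk
        exact ⟨S.min'_le k hk, Nat.lt_succ_of_le (S.le_max' k hk)⟩
      · rintro ⟨h1, h2⟩
        exact h _ (S.min'_mem hS) _ (S.max'_mem hS) k h1 (by omega)

lemma sum_Ico_shift {β : Type*} [AddCommMonoid β] (g : ℕ → β) {p q : ℕ} (_ : p ≤ q) :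
    ∑ i ∈ Ico p q, g i = ∑ i ∈ range (q - p), g (p + i) := by
  rw [Finset.sum_Ico_eq_sum_range]

/-- discrete van der Corput second derivative test -/
lemma vdc (f : ℕ → ℝ) (m : ℕ) (l A : ℝ) (hl : 0 < l) (hA : 1 ≤ A)
    (h2 : ∀ i, i + 1 < m → l ≤ (f (i+2) - f (i+1)) - (f (i+1) - f i) ∧
      (f (i+2) - f (i+1)) - (f (i+1) - f i) ≤ A * l) :
    ‖∑ i ∈ range m, ee (f i)‖ ≤ 4 * A * m * √l + 8 / √l := by
  have hsl : 0 < √l := Real.sqrt_pos.mpr hl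
  have hss : √l * √l = l := Real.mul_self_sqrt hl.le
  rcases le_or_gt l (1/4) with hl4 | hl4
  swap
  · have h1 : ‖∑ i ∈ range m, ee (f i)‖ ≤ m := by
      refine (norm_sum_le _ _).trans ?_
      simp [norm_ee]
    have h3 : 1/2 ≤ √l := by
      apply Real.le_sqrt_of_sq_le; norm_num; linarith
    have : (m:ℝ) ≤ 4 * A * m * √l := by
      have : (m:ℝ) * 1 ≤ m * (4 * A * √l) := by
        apply mul_le_mul_of_nonneg_left _ (Nat.cast_nonneg m); nlinarith
      linarith
    have : 0 ≤ 8 / √l := by positivity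
    linarith
  have hρ : √l ≤ 1/2 := by
    rw [Real.sqrt_le_left (by norm_num)]; linarith
  set d : ℕ → ℝ := fun i => f (i+1) - f i with hd
  have grow : ∀ k i, i + k < m → l * k ≤ d (i+k) - d i ∧ d (i+k) - d i ≤ A * l * k := by
    intro k
    induction k with
    | zero => intro i _; simp
    | succ k ih =>
      intro i hi
      have a := ih i (by omega)
      have b := h2 (i+k) (by omega)
      have : d (i + (k+1)) = f (i+k+2) - f (i+k+1) := rfl
      rw [this]
      have : d (i+k) = f (i+k+1) - f (i+k) := rfl
      rw [this] at a
      push_cast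
      constructor <;> nlinarith [a.1, a.2, b.1, b.2]
  have mono : ∀ i j, i ≤ j → j < m → d i ≤ d j := by
    intro i j hij hj
    obtain ⟨k, rfl⟩ := Nat.exists_eq_add_of_le hij
    have := (grow k i hj).1
    have : 0 ≤ l * k := by positivity
    linarith
  have convx : ∀ (P : ℝ → Prop) [DecidablePred P], (∀ x y z, x ≤ y → y ≤ z → P x → P z → P y) →
      ∃ p q, p ≤ q ∧ (range m).filter (fun i => P (d i)) = Ico p q := by
    intro P _ hP
    apply finset_ordConn
    intro i hi j hj k hik hkj
    rw [mem_filter, mem_range] at *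
    exact ⟨by omega, hP _ _ _ (mono i k hik (by omega)) (mono k j hkj hj.1) hi.2 hj.2⟩
  have short : ∀ a : ℝ, ∀ (P : ℝ → Prop) [DecidablePred P], (∀ x y z, x ≤ y → y ≤ z → P x → P z → P y) →
      (∀ x, P x → a ≤ x ∧ x ≤ a + √l) →
      ‖∑ i ∈ (range m).filter (fun i => P (d i)), ee (f i)‖ ≤ 1 / √l + 1 := by
    intro a P _ hP hb
    refine (norm_sum_le _ _).trans ?_
    simp only [norm_ee, Finset.sum_const, nsmul_eq_mul, mul_one]
    obtain ⟨p, q, hpq, he⟩ := convx P hP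
    rw [he, Nat.card_Ico]
    rcases Nat.eq_or_lt_of_le hpq with rfl | hlt
    · simp; positivity
    have hp : p ∈ Ico p q := by simp; omega
    have hq : q - 1 ∈ Ico p q := by simp; omega
    rw [← he, mem_filter, mem_range] at hp hq
    have e : q - 1 = p + (q - 1 - p) := by omega
    have g := (grow (q - 1 - p) p (by omega)).1
    rw [← e] at g
    have b1 := hb _ hp.2
    have b2 := hb _ hq.2
    have e2 : ((q - p : ℕ) : ℝ) = ((q - 1 - p : ℕ) : ℝ) + 1 := by
      rw [show q - p = (q - 1 - p) + 1 by omega]; push_cast; ring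
    rw [e2]
    have : ((q - 1 - p : ℕ) : ℝ) ≤ 1 / √l := by
      rw [le_div_iff₀ hsl]
      have : l * ((q - 1 - p : ℕ) : ℝ) ≤ √l := by linarith
      nlinarith
    linarith
  have fiber : ∀ ν : ℤ, ‖∑ i ∈ (range m).filter (fun i => ⌊d i⌋ = ν), ee (f i)‖ ≤ 4 / √l := by
    intro ν
    have split : ∑ i ∈ (range m).filter (fun i => ⌊d i⌋ = ν), ee (f i) =
        ∑ i ∈ (range m).filter (fun i => (ν ≤ d i ∧ d i < ν + √l)), ee (f i) +
        ∑ i ∈ (range m).filter (fun i => (ν + √l ≤ d i ∧ d i ≤ ν + 1 - √l)), ee (f i) +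
        ∑ i ∈ (range m).filter (fun i => (ν + 1 - √l < d i ∧ d i < ν + 1)), ee (f i) := by
      simp only [Finset.sum_filter]
      rw [← Finset.sum_add_distrib, ← Finset.sum_add_distrib]
      apply Finset.sum_congr rfl
      intro i _
      by_cases h : ⌊d i⌋ = ν
      · rw [if_pos h]
        rw [Int.floor_eq_iff] at h
        rcases lt_or_ge (d i) (ν + √l) with h1 | h1
        · rw [if_pos ⟨h.1, h1⟩, if_neg (by rintro ⟨a, b⟩; linarith), if_neg (by rintro ⟨a, b⟩; linarith)]; simp
        · rw [if_neg (by rintro ⟨a, b⟩; linarith)]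
          rcases le_or_gt (d i) (ν + 1 - √l) with h3 | h3
          · rw [if_pos ⟨h1, h3⟩, if_neg (by rintro ⟨a, b⟩; linarith)]; simp
          · rw [if_neg (by rintro ⟨a, b⟩; linarith), if_pos ⟨h3, h.2⟩]; simp
      · rw [if_neg h, if_neg, if_neg, if_neg]
        · simp
        · rintro ⟨a, b⟩; exact h (Int.floor_eq_iff.mpr ⟨by linarith, b⟩)
        · rintro ⟨a, b⟩; exact h (Int.floor_eq_iff.mpr ⟨by linarith, by linarith⟩)
        · rintro ⟨a, b⟩; exact h (Int.floor_eq_iff.mpr ⟨a, by linarith⟩)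
    rw [split]
    have s1 := short ν (fun x => ν ≤ x ∧ x < ν + √l) (fun x y z a b h h' => ⟨by linarith [h.1], by linarith [h'.2]⟩)
      (fun x h => ⟨h.1, h.2.le⟩)
    have s3 := short (ν + 1 - √l) (fun x => ν + 1 - √l < x ∧ x < ν + 1) (fun x y z a b h h' => ⟨by linarith [h.1], by linarith [h'.2]⟩)
      (fun x h => ⟨h.1.le, by linarith [h.2]⟩)
    have s2 : ‖∑ i ∈ (range m).filter (fun i => (ν + √l ≤ d i ∧ d i ≤ ν + 1 - √l)), ee (f i)‖ ≤ 1 / √l := by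
      obtain ⟨p, q, hpq, he⟩ := convx (fun x => (ν + √l ≤ x ∧ x ≤ ν + 1 - √l))
        (fun x y z a b h h' => ⟨by linarith [h.1], by linarith [h'.2]⟩)
      rw [he, sum_Ico_shift _ hpq]
      have mem : ∀ i < q - p, p + i < m ∧ (ν + √l ≤ d (p+i) ∧ d (p+i) ≤ ν + 1 - √l) := by
        intro i hi
        have : p + i ∈ Ico p q := by simp; omega
        rw [← he, mem_filter, mem_range] at this
        exact this
      apply kusmin_landau (fun i => f (p + i)) (q - p) (√l) ν hsl
      · intro i hi
        have := (mem i hi).2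
        simp only [hd] at this
        constructor
        · have := this.1; simp only [← add_assoc]; linarith
        · have := this.2; simp only [← add_assoc]; linarith
      · intro i hi
        have := mono (p+i) (p+i+1) (by omega) (by have := (mem (i+1) hi).1; omega)
        simp only [hd] at this
        simpa [← add_assoc] using this
    have t := norm_add₃_le (a := ∑ i ∈ (range m).filter (fun i => (ν ≤ d i ∧ d i < ν + √l)), ee (f i))
      (b := ∑ i ∈ (range m).filter (fun i => (ν + √l ≤ d i ∧ d i ≤ ν + 1 - √l)), ee (f i))
      (c := ∑ i ∈ (range m).filter (fun i => (ν + 1 - √l < d i ∧ d i < ν + 1)), ee (f i))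
    have e4 : 4 / √l = 4 * (1 / √l) := by ring
    have : 2 ≤ 1 / √l := by rw [le_div_iff₀ hsl]; linarith
    rw [e4]
    linarith
  rcases Nat.eq_zero_or_pos m with rfl | hm
  · simp; positivity
  have hfl : ∀ i ∈ range m, ⌊d i⌋ ∈ Icc ⌊d 0⌋ ⌊d (m-1)⌋ := by
    intro i hi
    rw [mem_range] at hi
    rw [mem_Icc]
    exact ⟨Int.floor_le_floor (mono 0 i (by omega) hi), Int.floor_le_floor (mono i (m-1) (by omega) (by omega))⟩
  rw [← Finset.sum_fiberwise_of_maps_to hfl]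
  refine (norm_sum_le _ _).trans ?_
  refine (Finset.sum_le_sum (fun ν _ => fiber ν)).trans ?_
  rw [Finset.sum_const, nsmul_eq_mul, Int.card_Icc]
  have g := (grow (m-1) 0 (by omega)).2
  rw [zero_add] at g
  have hcard : (((⌊d (m-1)⌋ + 1 - ⌊d 0⌋).toNat : ℕ) : ℝ) ≤ A * l * m + 2 := by
    have h1 : ⌊d 0⌋ ≤ ⌊d (m-1)⌋ := Int.floor_le_floor (mono 0 (m-1) (by omega) (by omega))
    have h2 : (((⌊d (m-1)⌋ + 1 - ⌊d 0⌋).toNat : ℕ) : ℝ) = (⌊d (m-1)⌋ : ℝ) + 1 - ⌊d 0⌋ := by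
      have : (((⌊d (m-1)⌋ + 1 - ⌊d 0⌋).toNat : ℕ) : ℤ) = ⌊d (m-1)⌋ + 1 - ⌊d 0⌋ := Int.toNat_of_nonneg (by omega)
      exact_mod_cast this
    rw [h2]
    have h3 := Int.floor_le (d (m-1))
    have h4 := Int.lt_floor_add_one (d 0)
    have h5 : A * l * ((m-1 : ℕ):ℝ) ≤ A * l * m := by
      apply mul_le_mul_of_nonneg_left _ (by positivity)
      exact_mod_cast Nat.sub_le m 1
    linarith
  calc _ ≤ (A * l * m + 2) * (4 / √l) := mul_le_mul_of_nonneg_right hcard (by positivity)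
    _ = 4 * A * m * (l / √l) + 8 / √l := by ring
    _ = _ := by rw [Real.div_sqrt]

lemma rpow_mvt (s a b : ℝ) (ha : 0 < a) (hab : a < b) :
    ∃ ξ, a < ξ ∧ ξ < b ∧ b ^ s - a ^ s = s * ξ ^ (s - 1) * (b - a) := by
  obtain ⟨ξ, hξ, h⟩ := exists_hasDerivAt_eq_slope (fun t => t ^ s) (fun t => s * t ^ (s-1)) hab
    (by
      apply ContinuousOn.rpow_const continuousOn_id
      intro x hx; left; simp only [id]; linarith [hx.1])
    (by
      intro x hx
      exact Real.hasDerivAt_rpow_const (Or.inl (by linarith [hx.1])))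
  refine ⟨ξ, hξ.1, hξ.2, ?_⟩
  rw [h]
  have : b - a ≠ 0 := by linarith
  field_simp

lemma rpow_second_diff (c a : ℝ) (ha : 0 < a) :
    ∃ η, a < η ∧ η < a + 2 ∧ ((a+2)^c - (a+1)^c) - ((a+1)^c - a^c) = c * (c-1) * η^(c-2) := by
  obtain ⟨ξ, hξ, h⟩ := exists_hasDerivAt_eq_slope (fun t => (t+1) ^ c - t ^ c)
    (fun t => c * (t+1) ^ (c-1) - c * t ^ (c-1)) (by linarith : a < a + 1)
    (by
      apply ContinuousOn.sub
      · apply ContinuousOn.rpow_const (by fun_prop)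
        intro x hx; left; linarith [hx.1]
      · apply ContinuousOn.rpow_const continuousOn_id
        intro x hx; left; simp only [id]; linarith [hx.1])
    (by
      intro x hx
      have h1 : x ≠ 0 := by linarith [hx.1]
      have h2 : x + 1 ≠ 0 := by linarith [hx.1]
      have := ((Real.hasDerivAt_rpow_const (p := c) (Or.inl h2)).comp x ((hasDerivAt_id x).add_const 1))
      have h3 := this.sub (Real.hasDerivAt_rpow_const (p := c) (Or.inl h1))
      refine (h3.congr_deriv ?_)
      simp)
  obtain ⟨η, h1, h2, h3⟩ := rpow_mvt (c-1) ξ (ξ+1) (by linarith [hξ.1]) (by linarith)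
  refine ⟨η, by linarith [hξ.1], by linarith [hξ.2], ?_⟩
  have e : a + 1 + 1 = a + 2 := by ring
  simp only [e] at h
  have e2 : c - 1 - 1 = c - 2 := by ring
  rw [e2] at h3
  have h4 : a + 1 - a = 1 := by ring
  rw [h4, div_one] at h
  rw [← h]
  have : c * (ξ + 1) ^ (c - 1) - c * ξ ^ (c - 1) = c * ((ξ + 1) ^ (c - 1) - ξ ^ (c - 1)) := by ring
  rw [this, h3]; ring

lemma sum_ee_neg {ι : Type*} (s : Finset ι) (f : ι → ℝ) : ‖∑ i ∈ s, ee (-(f i))‖ = ‖∑ i ∈ s, ee (f i)‖ := by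
  simp only [ee_neg]
  rw [← map_sum, RCLike.norm_conj]

/-- second derivative test for `x n^c`. -/
lemma vdc_pow (c : ℝ) (hc1 : 1 < c) (hc2 : c < 2) (x M : ℝ) (hx : x ≠ 0) (hM : 1 ≤ M) (p q : ℕ)
    (hp : M ≤ p) (hq : (q:ℝ) ≤ 5 * M) :
    ‖∑ n ∈ Ico p q, ee (x * (n:ℝ)^c)‖ ≤
      (80 + 20 / √(c-1)) * (√(|x| * M^c) + M / √(|x| * M^c)) := by
  have hM0 : 0 < M := by linarith
  wlog hx0 : 0 < x with H
  · have hx1 : x < 0 := lt_of_le_of_ne (not_lt.mp hx0) hx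
    have := H c hc1 hc2 (-x) M (by linarith) hM p q hp hq hM0 (by linarith)
    rw [abs_neg] at this
    rw [← sum_ee_neg]
    simpa [neg_mul] using this
  rw [abs_of_pos hx0]
  rcases lt_or_ge q p with h | hpq
  · rw [Finset.Ico_eq_empty (by omega)]; simp; positivity
  rw [sum_Ico_shift _ hpq]
  set z := √(x * M^c) with hz
  have hz0 : 0 < z := Real.sqrt_pos.mpr (by positivity)
  have hzz : z * z = x * M^c := Real.mul_self_sqrt (by positivity)
  set l := x * (c * (c-1)) * M^(c-2) / 5 with hl
  have hc10 : 0 < c - 1 := by linarith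
  have hl0 : 0 < l := by positivity
  have key := vdc (fun i => x * ((p + i : ℕ) : ℝ)^c) (q - p) l 5 hl0 (by norm_num) (by
    intro i hi
    have hpi : M ≤ ((p+i : ℕ):ℝ) := by push_cast; have : (0:ℝ) ≤ i := Nat.cast_nonneg i; linarith
    obtain ⟨η, h1, h2, h3⟩ := rpow_second_diff c ((p+i : ℕ):ℝ) (by linarith)
    have e : (x * ((p + (i+2) : ℕ) : ℝ)^c - x * ((p + (i+1) : ℕ) : ℝ)^c) - (x * ((p + (i+1) : ℕ) : ℝ)^c - x * ((p + i : ℕ) : ℝ)^c)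
      = x * (c * (c-1) * η^(c-2)) := by
      rw [← h3]; push_cast; ring_nf
    have hη : M < η := by linarith
    have hη2 : η ≤ 5 * M := by
      have : ((p+i : ℕ):ℝ) + 2 ≤ q := by exact_mod_cast (by omega : p + i + 2 ≤ q)
      linarith
    have b1 : η^(c-2) ≤ M^(c-2) := rpow_le_rpow_of_nonpos hM0 hη.le (by linarith)
    have b2 : (5 * M)^(c-2) ≤ η^(c-2) := rpow_le_rpow_of_nonpos (by linarith) hη2 (by linarith)
    have b3 : M^(c-2) / 5 ≤ (5*M)^(c-2) := by
      rw [mul_rpow (by norm_num) hM0.le]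
      have : (5:ℝ)^(-1:ℝ) ≤ 5^(c-2) := rpow_le_rpow_of_exponent_le (by norm_num) (by linarith)
      rw [rpow_neg_one] at this
      have hp : 0 < M^(c-2) := by positivity
      nlinarith
    show l ≤ (x * ((p + (i+2) : ℕ) : ℝ)^c - x * ((p + (i+1) : ℕ) : ℝ)^c) - (x * ((p + (i+1) : ℕ) : ℝ)^c - x * ((p + i : ℕ) : ℝ)^c) ∧
      (x * ((p + (i+2) : ℕ) : ℝ)^c - x * ((p + (i+1) : ℕ) : ℝ)^c) - (x * ((p + (i+1) : ℕ) : ℝ)^c - x * ((p + i : ℕ) : ℝ)^c) ≤ 5 * l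
    rw [e, hl]
    have hxc : 0 < x * (c * (c-1)) := by positivity
    constructor
    · have := mul_le_mul_of_nonneg_left (b3.trans b2) hxc.le
      linarith
    · have := mul_le_mul_of_nonneg_left b1 hxc.le
      linarith)
  refine key.trans ?_
  have hMc : M^(c-2) = M^c / M^2 := by
    rw [rpow_sub hM0]; norm_num
  have hsl : √l = √(c*(c-1)/5) * (z / M) := by
    have : l = (c*(c-1)/5) * (z/M)^2 := by
      rw [hl, hMc, div_pow, pow_two z, hzz]; ring
    rw [this, Real.sqrt_mul (by positivity), Real.sqrt_sq (by positivity)]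
  have hs1 : √(c*(c-1)/5) ≤ 1 := by
    rw [Real.sqrt_le_left (by norm_num)]; nlinarith
  have hs2 : √(c-1) / √5 ≤ √(c*(c-1)/5) := by
    rw [← Real.sqrt_div' _ (by norm_num)]
    apply Real.sqrt_le_sqrt; nlinarith
  have h5 : √5 ≤ 2.5 := by rw [Real.sqrt_le_left (by norm_num)]; norm_num
  have hsc : 0 < √(c-1) := Real.sqrt_pos.mpr hc10
  have h50 : 0 < √5 := by positivity
  have hs3 : 1 / √(c*(c-1)/5) ≤ 2.5 / √(c-1) := by
    calc 1 / √(c*(c-1)/5) ≤ 1 / (√(c-1) / √5) := one_div_le_one_div_of_le (by positivity) hs2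
      _ = √5 / √(c-1) := by field_simp
      _ ≤ _ := by gcongr
  have hm : ((q - p : ℕ):ℝ) ≤ 4 * M := by
    rw [Nat.cast_sub hpq]; linarith
  have t1 : 4 * 5 * ((q-p : ℕ):ℝ) * √l ≤ 80 * z := by
    rw [hsl]
    calc 4 * 5 * ((q-p : ℕ):ℝ) * (√(c*(c-1)/5) * (z / M)) ≤ 4 * 5 * (4 * M) * (1 * (z / M)) := by gcongr
      _ = 80 * z := by field_simp; ring
  have t2 : 8 / √l ≤ 20 / √(c-1) * (M / z) := by
    rw [hsl]
    calc 8 / (√(c*(c-1)/5) * (z / M)) = 8 * (1 / √(c*(c-1)/5)) * (M / z) := by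
          field_simp
      _ ≤ 8 * (2.5 / √(c-1)) * (M/z) := by gcongr
      _ = _ := by ring
  have t3 : 0 ≤ 20 / √(c-1) * z := by positivity
  have t4 : 0 ≤ 80 * (M / z) := by positivity
  nlinarith

/-- Kusmin-Landau for `x n^c` -/
lemma kl_pow (c : ℝ) (hc1 : 1 < c) (x M : ℝ) (hx : x ≠ 0) (hM : 1 ≤ M) (p q : ℕ)
    (hp : M ≤ p) (hq : (q:ℝ) ≤ 5 * M) (hs : |x| * c * (5*M)^(c-1) ≤ 1/2) :
    ‖∑ n ∈ Ico p q, ee (x * (n:ℝ)^c)‖ ≤ 1 / (|x| * M^(c-1)) := by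
  have hM0 : 0 < M := by linarith
  wlog hx0 : 0 < x with H
  · have hx1 : x < 0 := lt_of_le_of_ne (not_lt.mp hx0) hx
    have := H c hc1 (-x) M (by linarith) hM p q hp hq (by rwa [abs_neg]) hM0 (by linarith)
    rw [abs_neg] at this
    rw [← sum_ee_neg]
    simpa [neg_mul] using this
  rw [abs_of_pos hx0] at *
  rcases lt_or_ge q p with h | hpq
  · rw [Finset.Ico_eq_empty (by omega)]; simp; positivity
  rw [sum_Ico_shift _ hpq]
  have hmono : M^(c-1) ≤ (5*M)^(c-1) := rpow_le_rpow hM0.le (by linarith) (by linarith)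
  have hMp : 0 < M^(c-1) := by positivity
  have hd : ∀ i, i < q - p → ∃ ξ : ℝ, M ≤ ξ ∧ ξ ≤ 5 * M ∧
      x * ((p + (i+1) : ℕ) : ℝ)^c - x * ((p + i : ℕ) : ℝ)^c = x * (c * ξ^(c-1)) := by
    intro i hi
    have hpi : M ≤ ((p+i : ℕ):ℝ) := by push_cast; have : (0:ℝ) ≤ i := Nat.cast_nonneg i; linarith
    obtain ⟨ξ, h1, h2, h3⟩ := rpow_mvt c ((p+i : ℕ):ℝ) ((p+(i+1) : ℕ):ℝ) (by linarith) (by push_cast; linarith)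
    refine ⟨ξ, by linarith, ?_, ?_⟩
    · have : ((p+(i+1) : ℕ):ℝ) ≤ q := by exact_mod_cast (by omega : p + (i + 1) ≤ q)
      linarith
    · rw [← mul_sub, h3]; push_cast; ring
  apply kusmin_landau (fun i => x * ((p + i : ℕ) : ℝ)^c) (q - p) (x * M^(c-1)) 0 (by positivity)
  · intro i hi
    obtain ⟨ξ, h1, h2, h3⟩ := hd i hi
    simp only [Int.cast_zero, sub_zero]
    rw [h3]
    have a1 : M^(c-1) ≤ ξ^(c-1) := rpow_le_rpow hM0.le h1 (by linarith)
    have a2 : ξ^(c-1) ≤ (5*M)^(c-1) := rpow_le_rpow (by linarith) h2 (by linarith)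
    have a3 : x * (c * ξ^(c-1)) ≤ 1/2 := by
      calc _ ≤ x * (c * (5*M)^(c-1)) := by gcongr
        _ ≤ _ := by linarith
    have a4 : x * M^(c-1) ≤ x * (c * M^(c-1)) := by
      apply mul_le_mul_of_nonneg_left _ hx0.le; nlinarith
    have a5 : x * (c * M^(c-1)) ≤ x * (c * ξ^(c-1)) := by gcongr
    have a6 : x * (c * M^(c-1)) ≤ 1/2 := a5.trans a3
    constructor <;> linarith
  · intro i hi
    have hpi : M ≤ ((p+i : ℕ):ℝ) := by push_cast; have : (0:ℝ) ≤ i := Nat.cast_nonneg i; linarith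
    obtain ⟨η, h1, h2, h3⟩ := rpow_second_diff c ((p+i : ℕ):ℝ) (by linarith)
    have e : (x * ((p + (i+2) : ℕ) : ℝ)^c - x * ((p + (i+1) : ℕ) : ℝ)^c) - (x * ((p + (i+1) : ℕ) : ℝ)^c - x * ((p + i : ℕ) : ℝ)^c)
      = x * (c * (c-1) * η^(c-2)) := by
      rw [← h3]; push_cast; ring_nf
    have : 0 ≤ x * (c * (c-1) * η^(c-2)) := by
      have : 0 < η := by linarith
      have : 0 < c - 1 := by linarith
      positivity
    show x * ((p + (i+1) : ℕ) : ℝ)^c - x * ((p + i : ℕ) : ℝ)^c ≤ x * ((p + (i+2) : ℕ) : ℝ)^c - x * ((p + (i+1) : ℕ) : ℝ)^c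
    linarith

/-- bilinear sum over a box with the side condition `x1 < mk ≤ x2` -/
noncomputable def bil (c θ : ℝ) (a b : ℕ → ℂ) (M K x1 x2 : ℕ) : ℂ :=
  ∑ m ∈ Ioc M (4*M), ∑ k ∈ Ioc K (4*K),
    if x1 < m * k ∧ m * k ≤ x2 then a m * b k * ee (θ * ((m:ℝ)^c * (k:ℝ)^c)) else 0

noncomputable def bilI (c θ : ℝ) (b : ℕ → ℂ) (K Q x1 x2 : ℕ) (m v : ℕ) : ℂ :=
  ∑ k ∈ (Ioc K (4*K)).filter (fun k => k / Q = v),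
    if x1 < m * k ∧ m * k ≤ x2 then b k * ee (θ * ((m:ℝ)^c * (k:ℝ)^c)) else 0

lemma norm_sq_sum {ι : Type*} (s : Finset ι) (z : ι → ℂ) :
    ((‖∑ k ∈ s, z k‖^2 : ℝ) : ℂ) = ∑ k ∈ s, ∑ k' ∈ s, z k * (starRingEnd ℂ) (z k') := by
  push_cast
  rw [← Complex.mul_conj', map_sum, Finset.sum_mul_sum]

lemma cauchy_schwarz_norm {ι : Type*} (s : Finset ι) (f g : ι → ℂ) :
    ‖∑ i ∈ s, f i * g i‖^2 ≤ (∑ i ∈ s, ‖f i‖^2) * ∑ i ∈ s, ‖g i‖^2 := by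
  calc ‖∑ i ∈ s, f i * g i‖^2 ≤ (∑ i ∈ s, ‖f i‖ * ‖g i‖)^2 := by
        apply pow_le_pow_left₀ (norm_nonneg _)
        refine (norm_sum_le _ _).trans ?_
        simp
    _ ≤ _ := Finset.sum_mul_sq_le_sq_mul_sq _ _ _

lemma block_cauchy (c θ : ℝ) (a b : ℕ → ℂ) (M K Q x1 x2 : ℕ) :
    ‖bil c θ a b M K x1 x2‖^2 ≤ (∑ m ∈ Ioc M (4*M), ‖a m‖^2) * ((4*K/Q : ℕ) + 1) *
      ∑ v ∈ range (4*K/Q+1), ∑ m ∈ Ioc M (4*M), ‖bilI c θ b K Q x1 x2 m v‖^2 := by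
  have e : bil c θ a b M K x1 x2 = ∑ mv ∈ Ioc M (4*M) ×ˢ range (4*K/Q+1),
      a mv.1 * bilI c θ b K Q x1 x2 mv.1 mv.2 := by
    rw [Finset.sum_product]
    unfold bil bilI
    apply Finset.sum_congr rfl
    intro m _
    have hfl : ∀ k ∈ Ioc K (4*K), k / Q ∈ range (4*K/Q+1) := by
      intro k hk
      rw [mem_Ioc] at hk
      rw [mem_range]
      exact Nat.lt_succ_of_le (Nat.div_le_div_right hk.2)
    rw [← Finset.sum_fiberwise_of_maps_to hfl]
    apply Finset.sum_congr rfl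
    intro v _
    rw [Finset.mul_sum]
    apply Finset.sum_congr rfl
    intro k _
    split_ifs
    · ring
    · simp
  rw [e]
  refine (cauchy_schwarz_norm _ _ _).trans (le_of_eq ?_)
  rw [Finset.sum_product, Finset.sum_product, Finset.sum_comm (s := range _)]
  simp only [Finset.sum_const, Finset.card_range, nsmul_eq_mul]
  rw [← Finset.mul_sum]
  push_cast
  ring

lemma bilI_sq (c θ : ℝ) (b : ℕ → ℂ) (M K Q x1 x2 v : ℕ) :
    ((∑ m ∈ Ioc M (4*M), ‖bilI c θ b K Q x1 x2 m v‖^2 : ℝ) : ℂ) =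
    ∑ k ∈ (Ioc K (4*K)).filter (fun k => k / Q = v), ∑ k' ∈ (Ioc K (4*K)).filter (fun k => k / Q = v),
      b k * (starRingEnd ℂ) (b k') * ∑ m ∈ (Ioc M (4*M)).filter
        (fun m => (x1 < m * k ∧ m * k ≤ x2) ∧ (x1 < m * k' ∧ m * k' ≤ x2)), ee (θ * ((k:ℝ)^c - (k':ℝ)^c) * (m:ℝ)^c) := by
  rw [Complex.ofReal_sum]
  unfold bilI
  simp_rw [norm_sq_sum]
  rw [Finset.sum_comm]
  apply Finset.sum_congr rfl
  intro k _
  rw [Finset.sum_comm]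
  apply Finset.sum_congr rfl
  intro k' _
  rw [Finset.sum_filter, Finset.mul_sum]
  apply Finset.sum_congr rfl
  intro m _
  by_cases h1 : x1 < m * k ∧ m * k ≤ x2
  · by_cases h2 : x1 < m * k' ∧ m * k' ≤ x2
    · rw [if_pos h1, if_pos h2, if_pos ⟨h1, h2⟩]
      have : θ * ((k:ℝ)^c - (k':ℝ)^c) * (m:ℝ)^c = θ * ((m:ℝ)^c * (k:ℝ)^c) - θ * ((m:ℝ)^c * (k':ℝ)^c) := by ring
      rw [this, ee_sub, map_mul]
      ring
    · rw [if_neg h2, if_pos h1, if_neg (fun h => h2 h.2)]; simp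
  · rw [if_neg h1, zero_mul, if_neg (fun h => h1 h.1), mul_zero]

lemma bil_set_Ico (M k k' x1 x2 : ℕ) (_ : 1 ≤ M) : ∃ p q : ℕ, (M:ℝ) ≤ p ∧ (q:ℝ) ≤ 5 * M ∧
    (Ioc M (4*M)).filter
        (fun m => (x1 < m * k ∧ m * k ≤ x2) ∧ (x1 < m * k' ∧ m * k' ≤ x2)) = Ico p q := by
  obtain ⟨p, q, hpq, he⟩ := finset_ordConn ((Ioc M (4*M)).filter
        (fun m => (x1 < m * k ∧ m * k ≤ x2) ∧ (x1 < m * k' ∧ m * k' ≤ x2))) (by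
    intro i hi j hj l hil hlj
    simp only [mem_filter, mem_Ioc] at *
    have a1 := Nat.mul_le_mul_right k hil
    have a2 := Nat.mul_le_mul_right k hlj
    have a3 := Nat.mul_le_mul_right k' hil
    have a4 := Nat.mul_le_mul_right k' hlj
    omega)
  rcases Nat.eq_or_lt_of_le hpq with rfl | hlt
  · refine ⟨M, M, le_rfl, ?_, ?_⟩
    · have : (0:ℝ) ≤ M := Nat.cast_nonneg M
      linarith
    · rw [he]; simp
  · refine ⟨p, q, ?_, ?_, he⟩
    · have : p ∈ Ico p q := by simp; omega
      rw [← he, mem_filter, mem_Ioc] at this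
      exact_mod_cast (by omega : M ≤ p)
    · have : q - 1 ∈ Ico p q := by simp; omega
      rw [← he, mem_filter, mem_Ioc] at this
      exact_mod_cast (by omega : q ≤ 5 * M)

/-- symmetric Schur-type bound -/
lemma schur (s : Finset ℕ) (b : ℕ → ℂ) (w : ℕ → ℕ → ℝ) (W : ℝ) (hw : ∀ k k', 0 ≤ w k k') (hsym : ∀ k k', w k k' = w k' k)
    (hW : ∀ k ∈ s, ∑ k' ∈ s, w k k' ≤ W) :
    ∑ k ∈ s, ∑ k' ∈ s, ‖b k‖ * ‖b k'‖ * w k k' ≤ W * ∑ k ∈ s, ‖b k‖^2 := by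
  have h1 : ∑ k ∈ s, ∑ k' ∈ s, ‖b k‖ * ‖b k'‖ * w k k' ≤
      ∑ k ∈ s, ∑ k' ∈ s, (‖b k‖^2 * w k k' / 2 + ‖b k'‖^2 * w k' k / 2) := by
    apply Finset.sum_le_sum; intro k _
    apply Finset.sum_le_sum; intro k' _
    rw [hsym k' k]
    nlinarith [sq_nonneg (‖b k‖ - ‖b k'‖), hw k k', mul_nonneg (sq_nonneg (‖b k‖ - ‖b k'‖)) (hw k k')]
  have h2 : ∑ k ∈ s, ∑ k' ∈ s, (‖b k‖^2 * w k k' / 2 + ‖b k'‖^2 * w k' k / 2) = ∑ k ∈ s, ‖b k‖^2 * ∑ k' ∈ s, w k k' := by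
    simp_rw [Finset.sum_add_distrib]
    rw [Finset.sum_comm (f := fun k k' => ‖b k'‖^2 * w k' k / 2), ← Finset.sum_add_distrib]
    apply Finset.sum_congr rfl; intro k _
    rw [← Finset.sum_add_distrib, Finset.mul_sum]
    apply Finset.sum_congr rfl; intro k' _; ring
  rw [h2] at h1
  refine h1.trans ?_
  rw [Finset.mul_sum]
  apply Finset.sum_le_sum; intro k hk
  rw [mul_comm W]
  exact mul_le_mul_of_nonneg_left (hW k hk) (sq_nonneg _)

lemma sum_inv_sqrt (Q : ℕ) : ∑ q ∈ Ico 1 (Q+1), 1 / √(q:ℝ) ≤ 2 * √(Q:ℝ) := by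
  induction Q with
  | zero => simp
  | succ n ih =>
    rw [Finset.sum_Ico_succ_top (by omega)]
    refine (add_le_add_left ih _).trans ?_
    have hn0 : (0:ℝ) ≤ n := Nat.cast_nonneg n
    set s := √(n:ℝ)
    have hs : 0 ≤ s := Real.sqrt_nonneg _
    have hs2 : s * s = n := Real.mul_self_sqrt hn0
    set t := √((n+1 : ℕ):ℝ) with ht
    have ht0 : 0 < t := Real.sqrt_pos.mpr (by positivity)
    have ht2 : t * t = n + 1 := by rw [ht, Real.mul_self_sqrt (by positivity)]; push_cast; ring
    have hst : s ≤ t := Real.sqrt_le_sqrt (by push_cast; linarith)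
    have : 1 / t ≤ 2 * (t - s) := by
      rw [div_le_iff₀ ht0]; nlinarith
    linarith

lemma row_sum (s : Finset ℕ) (k Q : ℕ) (hs : ∀ k' ∈ s, k' < k + Q ∧ k < k' + Q) (w : ℕ → ℝ) (hw : ∀ q, 0 ≤ w q) :
    ∑ k' ∈ s, w (Nat.dist k k') ≤ w 0 + 2 * ∑ q ∈ Ico 1 Q, w q := by
  rw [← Finset.sum_filter_add_sum_filter_not s (fun k' => k' ≤ k)]
  have h1 : ∑ k' ∈ s.filter (fun k' => k' ≤ k), w (Nat.dist k k') ≤ ∑ q ∈ range (Q), w q := by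
    rw [← Finset.sum_image (s := s.filter (fun k' => k' ≤ k)) (g := fun k' => Nat.dist k k') (f := w)]
    · apply Finset.sum_le_sum_of_subset_of_nonneg
      · intro q hq
        simp only [Finset.mem_image, mem_filter, mem_range] at *
        obtain ⟨k', ⟨h, h'⟩, rfl⟩ := hq
        have := hs k' h
        unfold Nat.dist; omega
      · intro q _ _; exact hw q
    · intro x hx y hy h
      simp only [Finset.coe_filter, Set.mem_ofPred_eq] at hx hy
      simp only [Nat.dist] at h; omega
  have h2 : ∑ k' ∈ s.filter (fun k' => ¬ k' ≤ k), w (Nat.dist k k') ≤ ∑ q ∈ Ico 1 Q, w q := by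
    rw [← Finset.sum_image (s := s.filter (fun k' => ¬ k' ≤ k)) (g := fun k' => Nat.dist k k') (f := w)]
    · apply Finset.sum_le_sum_of_subset_of_nonneg
      · intro q hq
        simp only [Finset.mem_image, mem_filter, mem_Ico] at *
        obtain ⟨k', ⟨h, h'⟩, rfl⟩ := hq
        have := hs k' h
        unfold Nat.dist; omega
      · intro q _ _; exact hw q
    · intro x hx y hy h
      simp only [Finset.coe_filter, Set.mem_ofPred_eq] at hx hy
      simp only [Nat.dist] at h; omega
  have h3 : ∑ q ∈ range Q, w q ≤ w 0 + ∑ q ∈ Ico 1 Q, w q := by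
    rcases Nat.eq_zero_or_pos Q with rfl | hQ
    · simp; exact hw 0
    · rw [Finset.range_eq_Ico, Finset.sum_eq_sum_Ico_succ_bot hQ]
  linarith

lemma pow_diff_bounds (c : ℝ) (hc1 : 1 < c) (hc2 : c < 2) (K k k' : ℕ) (hK : 1 ≤ K) (h1 : K < k') (h2 : k ≤ 4 * K) (h : k' < k) :
    (K:ℝ)^c / K * ((k - k' : ℕ):ℝ) ≤ (k:ℝ)^c - (k':ℝ)^c ∧ (k:ℝ)^c - (k':ℝ)^c ≤ 8 * ((K:ℝ)^c / K) * ((k - k' : ℕ):ℝ) := by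
  have hK0 : (0:ℝ) < K := by exact_mod_cast hK
  have hk' : (K:ℝ) < k' := by exact_mod_cast h1
  have hk : (k:ℝ) ≤ 4 * K := by exact_mod_cast h2
  obtain ⟨ξ, a1, a2, a3⟩ := rpow_mvt c k' k (by linarith) (by exact_mod_cast h)
  rw [a3, Nat.cast_sub h.le]
  have hq : (0:ℝ) ≤ (k:ℝ) - k' := by rw [sub_nonneg]; exact_mod_cast h.le
  have e : (K:ℝ)^c / K = (K:ℝ)^(c-1) := by rw [rpow_sub_one hK0.ne']
  rw [e]
  have b1 : (K:ℝ)^(c-1) ≤ ξ^(c-1) := rpow_le_rpow hK0.le (by linarith) (by linarith)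
  have b2 : ξ^(c-1) ≤ (4*K:ℝ)^(c-1) := rpow_le_rpow (by linarith) (by linarith) (by linarith)
  have b3 : (4*K:ℝ)^(c-1) ≤ 4 * (K:ℝ)^(c-1) := by
    rw [mul_rpow (by norm_num) hK0.le]
    have : (4:ℝ)^(c-1) ≤ 4^(1:ℝ) := rpow_le_rpow_of_exponent_le (by norm_num) (by linarith)
    rw [rpow_one] at this
    gcongr
  have hp : 0 < (K:ℝ)^(c-1) := by positivity
  constructor
  · apply mul_le_mul_of_nonneg_right _ hq; nlinarith
  · apply mul_le_mul_of_nonneg_right _ hq; nlinarith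

/-- Method 1 -/
lemma method1 (c : ℝ) (hc1 : 1 < c) (hc2 : c < 2) (θ : ℝ) (hθ : θ ≠ 0) (a b : ℕ → ℂ) (M K Q x1 x2 : ℕ)
    (hM : 1 ≤ M) (hQ : 1 ≤ Q) (hQK : Q ≤ K) (Z : ℝ) (hZ : Z = √(|θ| * ((M:ℝ)^c * (K:ℝ)^c) / K)) :
    ‖bil c θ a b M K x1 x2‖^2 ≤ (∑ m ∈ Ioc M (4*M), ‖a m‖^2) * (∑ k ∈ Ioc K (4*K), ‖b k‖^2) *
      ((20 + 30 * (80 + 20 / √(c-1))) * (K * M / Q + K * Z * √Q + K * M / (Z * √Q))) := by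
  set C := 80 + 20 / √(c-1) with hC
  have hC0 : 0 < C := by positivity
  have hK0 : (0:ℝ) < K := by exact_mod_cast (by omega : 0 < K)
  have hM0 : (0:ℝ) < M := by exact_mod_cast (by omega : 0 < M)
  have hQ0 : (0:ℝ) < Q := by exact_mod_cast (by omega : 0 < Q)
  have hθ0 : 0 < |θ| := abs_pos.mpr hθ
  have hZ0 : 0 < Z := by rw [hZ]; apply Real.sqrt_pos.mpr; positivity
  have hZZ : Z * Z = |θ| * ((M:ℝ)^c * (K:ℝ)^c) / K := by rw [hZ]; exact Real.mul_self_sqrt (by positivity)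
  set w : ℕ → ℝ := fun q => if q = 0 then 4 * M else C * (3 * Z * √Q + M / Z * (1 / √q)) with hw
  have hwn : ∀ q, 0 ≤ w q := by intro q; simp only [hw]; split_ifs <;> positivity
  have mb : ∀ k k' : ℕ, k ∈ Ioc K (4*K) → k' ∈ Ioc K (4*K) → k / Q = k' / Q →
      ‖∑ m ∈ (Ioc M (4*M)).filter
        (fun m => (x1 < m * k ∧ m * k ≤ x2) ∧ (x1 < m * k' ∧ m * k' ≤ x2)), ee (θ * ((k:ℝ)^c - (k':ℝ)^c) * (m:ℝ)^c)‖ ≤ w (Nat.dist k k') := by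
    intro k k' hk hk' hkk
    rw [mem_Ioc] at hk hk'
    rcases eq_or_ne k k' with rfl | hne
    · rw [Nat.dist_self]; simp only [hw, if_true]
      refine (norm_sum_le _ _).trans ?_
      simp only [norm_ee, Finset.sum_const, nsmul_eq_mul, mul_one]
      have := Finset.card_filter_le (Ioc M (4*M)) (fun m => (x1 < m * k ∧ m * k ≤ x2) ∧ (x1 < m * k ∧ m * k ≤ x2))
      rw [Nat.card_Ioc] at this
      exact_mod_cast this.trans (by omega)
    · have hd : Nat.dist k k' ≠ 0 := by unfold Nat.dist; omega
      have hdQ : Nat.dist k k' ≤ Q := by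
        have a1 := Nat.div_add_mod k Q
        have a2 := Nat.div_add_mod k' Q
        have a3 := Nat.mod_lt k (by omega : 0 < Q)
        have a4 := Nat.mod_lt k' (by omega : 0 < Q)
        rw [hkk] at a1
        unfold Nat.dist; omega
      simp only [hw, if_neg hd]
      have hb : (K:ℝ)^c / K * (Nat.dist k k' : ℕ) ≤ |(k:ℝ)^c - (k':ℝ)^c| ∧ |(k:ℝ)^c - (k':ℝ)^c| ≤ 8 * ((K:ℝ)^c / K) * (Nat.dist k k' : ℕ) := by
        rcases lt_or_gt_of_ne hne with h | h
        · have := pow_diff_bounds c hc1 hc2 K k' k (by omega) hk.1 hk'.2 h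
          have hp : 0 ≤ (K:ℝ)^c / K * ((k' - k : ℕ):ℝ) := by positivity
          rw [abs_sub_comm, abs_of_nonneg (by linarith [this.1]), Nat.dist_eq_sub_of_le h.le]
          exact this
        · have := pow_diff_bounds c hc1 hc2 K k k' (by omega) hk'.1 hk.2 h
          have hp : 0 ≤ (K:ℝ)^c / K * ((k - k' : ℕ):ℝ) := by positivity
          rw [abs_of_nonneg (by linarith [this.1]), Nat.dist_eq_sub_of_le_right h.le]
          exact this
      set q := Nat.dist k k' with hq
      have hq0 : (0:ℝ) < q := by exact_mod_cast Nat.pos_of_ne_zero hd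
      have hqQ : (q:ℝ) ≤ Q := by exact_mod_cast hdQ
      set dd := (k:ℝ)^c - (k':ℝ)^c with hdd
      have hp : 0 < (K:ℝ)^c / K * q := by positivity
      have hddp : 0 < |dd| := by linarith [hb.1]
      obtain ⟨p, r, hp1, hr1, he⟩ := bil_set_Ico M k k' x1 x2 hM
      rw [he]
      have := vdc_pow c hc1 hc2 (θ * dd) M (mul_ne_zero hθ (abs_pos.mp hddp)) (by exact_mod_cast hM) p r hp1 hr1
      refine this.trans ?_
      rw [← hC]
      apply mul_le_mul_of_nonneg_left _ hC0.le
      rw [abs_mul]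
      have l1 : Z * Z * q ≤ |θ| * |dd| * (M:ℝ)^c := by
        rw [hZZ]
        calc _ = |θ| * ((K:ℝ)^c / K * q) * (M:ℝ)^c := by ring
          _ ≤ _ := by gcongr; exact hb.1
      have l2 : |θ| * |dd| * (M:ℝ)^c ≤ 8 * (Z * Z * q) := by
        rw [hZZ]
        calc _ ≤ |θ| * (8 * ((K:ℝ)^c / K) * q) * (M:ℝ)^c := by gcongr; exact hb.2
          _ = _ := by ring
      have s1 : √(|θ| * |dd| * (M:ℝ)^c) ≤ 3 * Z * √Q := by
        rw [Real.sqrt_le_left (by positivity), mul_pow, Real.sq_sqrt hQ0.le]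
        calc _ ≤ 8 * (Z * Z * q) := l2
          _ ≤ 9 * (Z * Z * Q) := by
            have : Z * Z * q ≤ Z * Z * Q := by gcongr
            nlinarith [mul_pos (mul_pos hZ0 hZ0) hq0]
          _ = _ := by ring
      have s2 : Z * √q ≤ √(|θ| * |dd| * (M:ℝ)^c) := by
        apply Real.le_sqrt_of_sq_le
        rw [mul_pow, Real.sq_sqrt hq0.le, pow_two]; exact l1
      have hsq : 0 < √(q:ℝ) := Real.sqrt_pos.mpr hq0
      have s3 : (M:ℝ) / √(|θ| * |dd| * (M:ℝ)^c) ≤ M / Z * (1 / √q) := by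
        calc _ ≤ (M:ℝ) / (Z * √q) := by gcongr
          _ = _ := by field_simp
      exact add_le_add s1 s3
  set W := 4 * M + 2 * (C * (3 * Z * √Q * Q + M / Z * (2 * √Q))) with hWdef
  have row : ∀ v, ∀ k ∈ (Ioc K (4*K)).filter (fun k => k / Q = v),
      ∑ k' ∈ (Ioc K (4*K)).filter (fun k => k / Q = v), w (Nat.dist k k') ≤ W := by
    intro v k hk
    refine (row_sum _ k Q ?_ w hwn).trans ?_
    · intro k' hk'
      rw [mem_filter] at hk hk'
      have a1 := Nat.div_add_mod k Q
      have a2 := Nat.div_add_mod k' Q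
      have a3 := Nat.mod_lt k (by omega : 0 < Q)
      have a4 := Nat.mod_lt k' (by omega : 0 < Q)
      rw [hk.2] at a1
      rw [hk'.2] at a2
      omega
    · have h0 : w 0 = 4 * M := by simp [hw]
      have h1 : ∑ q ∈ Ico 1 Q, w q = ∑ q ∈ Ico 1 Q, C * (3 * Z * √Q + M / Z * (1 / √q)) := by
        apply Finset.sum_congr rfl
        intro q hq
        rw [mem_Ico] at hq
        simp only [hw]; rw [if_neg (by omega)]
      have h4 : ∑ q ∈ Ico 1 Q, C * (3 * Z * √Q + M / Z * (1 / √q)) =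
          C * (∑ q ∈ Ico 1 Q, 3 * Z * √(Q:ℝ) + M / Z * ∑ q ∈ Ico 1 Q, 1 / √(q:ℝ)) := by
        rw [Finset.mul_sum _ (fun q : ℕ => 1 / √(q:ℝ)) (M/Z), ← Finset.sum_add_distrib, Finset.mul_sum]
      rw [h0, h1, hWdef, h4]
      have h2 : ∑ q ∈ Ico 1 Q, 1 / √(q:ℝ) ≤ 2 * √Q := by
        refine le_trans ?_ (sum_inv_sqrt Q)
        apply Finset.sum_le_sum_of_subset_of_nonneg
        · intro x; simp only [mem_Ico]; omega
        · intros; positivity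
      have h3 : ∑ q ∈ Ico 1 Q, 3 * Z * √(Q:ℝ) ≤ 3 * Z * √Q * Q := by
        rw [Finset.sum_const, nsmul_eq_mul, Nat.card_Ico, mul_comm]
        gcongr; exact Nat.sub_le _ _
      gcongr
  have hE : ∑ v ∈ range (4*K/Q+1), ∑ m ∈ Ioc M (4*M), ‖bilI c θ b K Q x1 x2 m v‖^2 ≤
      W * ∑ k ∈ Ioc K (4*K), ‖b k‖^2 := by
    have hv : ∀ v, ∑ m ∈ Ioc M (4*M), ‖bilI c θ b K Q x1 x2 m v‖^2 ≤
        W * ∑ k ∈ (Ioc K (4*K)).filter (fun k => k / Q = v), ‖b k‖^2 := by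
      intro v
      refine le_trans ?_ (schur ((Ioc K (4*K)).filter (fun k => k / Q = v)) b (fun k k' => w (Nat.dist k k')) W
        (fun k k' => hwn _) (fun k k' => by rw [Nat.dist_comm]) (row v))
      have h1 : ∑ m ∈ Ioc M (4*M), ‖bilI c θ b K Q x1 x2 m v‖^2 =
          ‖((∑ m ∈ Ioc M (4*M), ‖bilI c θ b K Q x1 x2 m v‖^2 : ℝ) : ℂ)‖ := by
        rw [Complex.norm_real, Real.norm_of_nonneg (by positivity)]
      rw [h1, bilI_sq]
      refine (norm_sum_le _ _).trans (Finset.sum_le_sum ?_)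
      intro k hk
      refine (norm_sum_le _ _).trans (Finset.sum_le_sum ?_)
      intro k' hk'
      rw [norm_mul, norm_mul, RCLike.norm_conj]
      rw [mem_filter] at hk hk'
      apply mul_le_mul_of_nonneg_left _ (by positivity)
      exact mb k k' hk.1 hk'.1 (hk.2.trans hk'.2.symm)
    refine (Finset.sum_le_sum (fun v _ => hv v)).trans (le_of_eq ?_)
    rw [← Finset.mul_sum]
    congr 1
    apply Finset.sum_fiberwise_of_maps_to
    intro k hk
    rw [mem_Ioc] at hk
    rw [mem_range]
    exact Nat.lt_succ_of_le (Nat.div_le_div_right hk.2)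
  refine (block_cauchy c θ a b M K Q x1 x2).trans ?_
  have hcard : ((4*K/Q : ℕ):ℝ) + 1 ≤ 5 * K / Q := by
    have h1 : ((4*K/Q : ℕ):ℝ) ≤ ((4*K : ℕ):ℝ) / Q := Nat.cast_div_le
    push_cast at h1
    have h2 : (1:ℝ) ≤ K / Q := by rw [le_div_iff₀ hQ0, one_mul]; exact_mod_cast hQK
    calc _ ≤ 4 * (K:ℝ) / Q + K / Q := add_le_add h1 h2
      _ = _ := by ring
  have hsQ : √(Q:ℝ) * √Q = Q := Real.mul_self_sqrt hQ0.le
  have hsQ0 : 0 < √(Q:ℝ) := Real.sqrt_pos.mpr hQ0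
  have hW0 : 0 ≤ W := by positivity
  calc _ ≤ (∑ m ∈ Ioc M (4*M), ‖a m‖^2) * (5 * K / Q) * (W * ∑ k ∈ Ioc K (4*K), ‖b k‖^2) := by
        gcongr
    _ = (∑ m ∈ Ioc M (4*M), ‖a m‖^2) * (∑ k ∈ Ioc K (4*K), ‖b k‖^2) * (5 * K / Q * W) := by ring
    _ ≤ _ := by
      apply mul_le_mul_of_nonneg_left _ (by positivity)
      have e : 5 * K / Q * W = 20 * (K * M / Q) + 30 * C * (K * Z * √Q) + 20 * C * (K * M / (Z * √Q)) := by
        have : ∀ s q : ℝ, 0 < s → s * s = q → 5 * K / q * (4 * M + 2 * (C * (3 * Z * s * q + M / Z * (2 * s)))) =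
            20 * (K * M / q) + 30 * C * (K * Z * s) + 20 * C * (K * M / (Z * s)) := by
          rintro s q hs rfl
          field_simp
          ring
        exact this _ _ hsQ0 hsQ
      rw [e]
      have p1 : 0 ≤ (K:ℝ) * M / Q := by positivity
      have p2 : 0 ≤ K * Z * √Q := by positivity
      have p3 : 0 ≤ K * M / (Z * √Q) := by positivity
      nlinarith [mul_nonneg hC0.le p1, mul_nonneg hC0.le p2, mul_nonneg hC0.le p3]

/-- points separated by `1/R` in an interval of length `2δ` -/
lemma card_sep {ι : Type*} [DecidableEq ι] (B : Finset ι) (ψ : ι → ℝ) (R δ x : ℝ) (hR : 0 < R) (hδ : 0 ≤ δ)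
    (hsep : ∀ i ∈ B, ∀ j ∈ B, i ≠ j → 1 / R ≤ |ψ i - ψ j|) :
    (((B.filter (fun j => |x - ψ j| ≤ δ)).card : ℕ) : ℝ) ≤ 2 + 2 * δ * R := by
  have hinj : Set.InjOn (fun j => ⌊ψ j * R⌋) (B.filter (fun j => |x - ψ j| ≤ δ) : Set ι) := by
    intro i hi j hj h
    simp only [Finset.coe_filter, Set.mem_ofPred_eq] at hi hj
    by_contra hne
    have h1 := hsep i hi.1 j hj.1 hne
    have h2 := Int.abs_sub_lt_one_of_floor_eq_floor h
    rw [← sub_mul, abs_mul, abs_of_pos hR] at h2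
    rw [div_le_iff₀ hR] at h1
    linarith
  rw [← Finset.card_image_of_injOn hinj]
  have hsub : (B.filter (fun j => |x - ψ j| ≤ δ)).image (fun j => ⌊ψ j * R⌋) ⊆ Icc ⌊(x - δ) * R⌋ ⌊(x + δ) * R⌋ := by
    intro z hz
    simp only [Finset.mem_image, mem_filter] at hz
    obtain ⟨j, ⟨_, h⟩, rfl⟩ := hz
    rw [abs_le] at h
    rw [mem_Icc]
    constructor <;> apply Int.floor_le_floor <;> apply mul_le_mul_of_nonneg_right _ hR.le <;> linarith
  have h1 := Finset.card_le_card hsub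
  rw [Int.card_Icc] at h1
  have h3 : ⌊(x - δ) * R⌋ ≤ ⌊(x + δ) * R⌋ := Int.floor_le_floor (by nlinarith)
  have h2 : (((⌊(x + δ) * R⌋ + 1 - ⌊(x - δ) * R⌋).toNat : ℕ) : ℝ) = (⌊(x + δ) * R⌋ : ℝ) + 1 - ⌊(x - δ) * R⌋ := by
    have : (((⌊(x + δ) * R⌋ + 1 - ⌊(x - δ) * R⌋).toNat : ℕ) : ℤ) = ⌊(x + δ) * R⌋ + 1 - ⌊(x - δ) * R⌋ := Int.toNat_of_nonneg (by omega)
    exact_mod_cast this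
  have h4 := Int.floor_le ((x + δ) * R)
  have h5 := Int.lt_floor_add_one ((x - δ) * R)
  calc _ ≤ (((⌊(x + δ) * R⌋ + 1 - ⌊(x - δ) * R⌋).toNat : ℕ) : ℝ) := by exact_mod_cast h1
    _ ≤ _ := by rw [h2]; nlinarith

lemma two_sep {ι κ : Type*} [DecidableEq ι] [DecidableEq κ] (A : Finset ι) (B : Finset κ) (φ : ι → ℝ) (ψ : κ → ℝ)
    (P R δ : ℝ) (hP : 0 < P) (hR : 0 < R) (hδ : 0 ≤ δ)
    (hA : ∀ i ∈ A, ∀ j ∈ A, i ≠ j → 1 / P ≤ |φ i - φ j|)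
    (hB : ∀ i ∈ B, ∀ j ∈ B, i ≠ j → 1 / R ≤ |ψ i - ψ j|) (cA : (A.card : ℝ) ≤ P) (cB : (B.card : ℝ) ≤ R) :
    ((((A ×ˢ B).filter (fun ij => |φ ij.1 - ψ ij.2| ≤ δ)).card : ℕ) : ℝ) ≤ 2 * √(P * R) + 2 * δ * (P * R) := by
  rw [Finset.card_filter, Finset.sum_product]
  push_cast
  rcases le_total P R with h | h
  · have : ∀ i ∈ A, (∑ j ∈ B, if |φ i - ψ j| ≤ δ then (1:ℝ) else 0) ≤ 2 + 2 * δ * R := by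
      intro i _
      have := card_sep B ψ R δ (φ i) hR hδ hB
      rw [Finset.card_filter] at this; push_cast at this; exact this
    refine (Finset.sum_le_sum this).trans ?_
    rw [Finset.sum_const, nsmul_eq_mul]
    have h1 : P ≤ √(P * R) := Real.le_sqrt_of_sq_le (by nlinarith)
    have : 0 ≤ 2 + 2 * δ * R := by positivity
    nlinarith
  · rw [Finset.sum_comm]
    have : ∀ j ∈ B, (∑ i ∈ A, if |φ i - ψ j| ≤ δ then (1:ℝ) else 0) ≤ 2 + 2 * δ * P := by
      intro j _
      have := card_sep A φ P δ (ψ j) hP hδ hA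
      rw [Finset.card_filter] at this; push_cast at this
      simpa [abs_sub_comm] using this
    refine (Finset.sum_le_sum this).trans ?_
    rw [Finset.sum_const, nsmul_eq_mul]
    have h1 : R ≤ √(P * R) := Real.le_sqrt_of_sq_le (by nlinarith)
    have : 0 ≤ 2 + 2 * δ * P := by positivity
    nlinarith

lemma frac_sep (g H : ℕ) (hg : 1 ≤ g) (i j : ℕ × ℕ) (hi : Nat.gcd i.1 i.2 = g) (hj : Nat.gcd j.1 j.2 = g)
    (i0 : 0 < i.2) (j0 : 0 < j.2) (iH : i.2 ≤ H) (jH : j.2 ≤ H) (hne : i ≠ j) :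
    1 / ((H:ℝ) / g)^2 ≤ |(i.1:ℝ) / i.2 - (j.1:ℝ) / j.2| := by
  obtain ⟨a, b⟩ := i
  obtain ⟨p, q⟩ := j
  simp only at *
  obtain ⟨a', ha⟩ : g ∣ a := hi ▸ Nat.gcd_dvd_left a b
  obtain ⟨b', hb⟩ : g ∣ b := hi ▸ Nat.gcd_dvd_right a b
  obtain ⟨p', hp⟩ : g ∣ p := hj ▸ Nat.gcd_dvd_left p q
  obtain ⟨q', hq⟩ : g ∣ q := hj ▸ Nat.gcd_dvd_right p q
  have hc1 : Nat.Coprime a' b' := by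
    rw [ha, hb, Nat.gcd_mul_left] at hi
    exact Nat.eq_of_mul_eq_mul_left (by omega : 0 < g) (by omega)
  have hc2 : Nat.Coprime p' q' := by
    rw [hp, hq, Nat.gcd_mul_left] at hj
    exact Nat.eq_of_mul_eq_mul_left (by omega : 0 < g) (by omega)
  have hb0 : 0 < b' := Nat.pos_of_ne_zero (by rintro rfl; omega)
  have hq0 : 0 < q' := Nat.pos_of_ne_zero (by rintro rfl; omega)
  have hcross : (a':ℤ) * q' - p' * b' ≠ 0 := by
    intro h
    have h1 : a' * q' = p' * b' := by exact_mod_cast (by linarith : (a':ℤ) * q' = p' * b')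
    have d1 : a' ∣ p' := hc1.dvd_of_dvd_mul_right (h1 ▸ Dvd.intro _ rfl)
    have d2 : p' ∣ a' := hc2.dvd_of_dvd_mul_right (h1.symm ▸ Dvd.intro _ rfl)
    have e1 : a' = p' := Nat.dvd_antisymm d1 d2
    have e2 : b' = q' := by
      subst e1
      rcases Nat.eq_zero_or_pos a' with h0 | h0
      · subst h0
        rw [Nat.coprime_zero_left] at hc1 hc2
        omega
      · exact (Nat.eq_of_mul_eq_mul_left h0 h1).symm
    apply hne
    rw [ha, hb, hp, hq, e1, e2]
  have hg0 : (0:ℝ) < g := by exact_mod_cast (by omega : 0 < g)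
  have hb0' : (0:ℝ) < b' := by exact_mod_cast hb0
  have hq0' : (0:ℝ) < q' := by exact_mod_cast hq0
  have hbH : (g:ℝ) * b' ≤ H := by exact_mod_cast (hb ▸ iH)
  have hqH : (g:ℝ) * q' ≤ H := by exact_mod_cast (hq ▸ jH)
  have hcr : (1:ℝ) ≤ |(a':ℝ) * q' - p' * b'| := by
    have := Int.one_le_abs hcross
    exact_mod_cast this
  have e : (a:ℝ) / b - (p:ℝ) / q = ((a':ℝ) * q' - p' * b') / (b' * q') := by
    rw [ha, hb, hp, hq]; push_cast; field_simp
  rw [e, abs_div, abs_of_pos (by positivity : (0:ℝ) < b' * q')]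
  apply div_le_div₀ (abs_nonneg _) hcr (by positivity)
  have h1 : (b':ℝ) ≤ H / g := by rw [le_div_iff₀ hg0]; linarith
  have h2 : (q':ℝ) ≤ H / g := by rw [le_div_iff₀ hg0]; linarith
  rw [pow_two]
  gcongr

lemma gcd_card (H g : ℕ) (hg : 1 ≤ g) (S : Finset (ℕ × ℕ))
    (hS : ∀ i ∈ S, 1 ≤ i.1 ∧ i.1 ≤ H ∧ 1 ≤ i.2 ∧ i.2 ≤ H ∧ Nat.gcd i.1 i.2 = g) :
    (S.card : ℝ) ≤ ((H:ℝ) / g)^2 := by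
  have h1 : S.card ≤ (H / g) * (H / g) := by
    have : (Icc 1 (H/g) ×ˢ Icc 1 (H/g)).card = (H/g) * (H/g) := by simp
    rw [← this]
    apply Finset.card_le_card_of_injOn (fun i => (i.1 / g, i.2 / g))
    · intro i hi
      have h := hS i hi
      simp only [Finset.coe_product, Set.mem_prod, Finset.coe_Icc, Set.mem_Icc]
      have d1 : g ∣ i.1 := h.2.2.2.2 ▸ Nat.gcd_dvd_left _ _
      have d2 : g ∣ i.2 := h.2.2.2.2 ▸ Nat.gcd_dvd_right _ _
      refine ⟨⟨Nat.div_pos (Nat.le_of_dvd h.1 d1) hg, Nat.div_le_div_right h.2.1⟩,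
        ⟨Nat.div_pos (Nat.le_of_dvd h.2.2.1 d2) hg, Nat.div_le_div_right h.2.2.2.1⟩⟩
    · intro i hi j hj hij
      have h := hS i hi
      have h' := hS j hj
      simp only [Prod.mk.injEq] at hij
      have d1 : g ∣ i.1 := h.2.2.2.2 ▸ Nat.gcd_dvd_left _ _
      have d2 : g ∣ i.2 := h.2.2.2.2 ▸ Nat.gcd_dvd_right _ _
      have d1' : g ∣ j.1 := h'.2.2.2.2 ▸ Nat.gcd_dvd_left _ _
      have d2' : g ∣ j.2 := h'.2.2.2.2 ▸ Nat.gcd_dvd_right _ _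
      ext
      · rw [← Nat.div_mul_cancel d1, hij.1, Nat.div_mul_cancel d1']
      · rw [← Nat.div_mul_cancel d2, hij.2, Nat.div_mul_cancel d2']
  have h2 : ((H / g : ℕ):ℝ) ≤ (H:ℝ) / g := Nat.cast_div_le
  calc (S.card : ℝ) ≤ ((H/g : ℕ):ℝ) * ((H/g : ℕ):ℝ) := by exact_mod_cast h1
    _ ≤ _ := by rw [pow_two]; gcongr

lemma sum_inv_le (n : ℕ) : ∑ g ∈ Icc 1 n, 1 / (g:ℝ) ≤ 1 + log n := by
  have := harmonic_le_one_add_log n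
  rw [harmonic_eq_sum_Icc] at this
  push_cast at this
  simpa [one_div] using this

lemma sum_inv_sq_le (n : ℕ) : ∑ g ∈ Icc 1 n, 1 / (g:ℝ)^2 ≤ 2 := by
  suffices h : ∀ n : ℕ, 1 ≤ n → ∑ g ∈ Icc 1 n, 1 / (g:ℝ)^2 ≤ 2 - 1 / (n:ℝ) by
    rcases Nat.eq_zero_or_pos n with rfl | hn
    · simp
    · refine (h n hn).trans ?_
      have : (0:ℝ) ≤ 1 / n := by positivity
      linarith
  intro n hn
  induction n, hn using Nat.le_induction with
  | base => norm_num
  | succ n hn ih =>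
    rw [Finset.sum_Icc_succ_top (by omega)]
    have hn0 : (0:ℝ) < n := by exact_mod_cast hn
    have : 1 / ((n+1 : ℕ):ℝ)^2 ≤ 1 / n - 1 / ((n+1 : ℕ):ℝ) := by
      push_cast
      rw [div_sub_div _ _ (by positivity) (by positivity), div_le_div_iff₀ (by positivity) (by positivity)]
      nlinarith
    linarith

/-- Fouvry-Iwaniec type spacing count -/
lemma spacing_count (γ : ℝ) (hγ0 : 0 < γ) (hγ1 : γ ≤ 1) (H K : ℕ) (hK : 1 ≤ K) (δ : ℝ) (hδ : 0 ≤ δ) :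
    (((((Icc 1 H ×ˢ Icc 1 H) ×ˢ (Ioc (2*K) (8*K) ×ˢ Ioc (2*K) (8*K))).filter
      (fun z => |(z.1.1:ℝ) / z.1.2 - ((z.2.1:ℝ) / z.2.2)^γ| ≤ δ)).card : ℕ) : ℝ) ≤
    (4 / γ) * (16 * (H * K) * ((1 + log H) * (1 + log (8*K))) + 512 * δ * (H * K)^2) := by
  set Z := ((Icc 1 H ×ˢ Icc 1 H) ×ˢ (Ioc (2*K) (8*K) ×ˢ Ioc (2*K) (8*K))).filter
      (fun z => |(z.1.1:ℝ) / z.1.2 - ((z.2.1:ℝ) / z.2.2)^γ| ≤ δ) with hZ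
  have hmap : ∀ z ∈ Z, (Nat.gcd z.1.1 z.1.2, Nat.gcd z.2.1 z.2.2) ∈ Icc 1 H ×ˢ Icc 1 (8*K) := by
    intro z hz
    simp only [hZ, mem_filter, Finset.mem_product, mem_Icc, mem_Ioc] at hz
    simp only [Finset.mem_product, mem_Icc]
    refine ⟨⟨Nat.gcd_pos_of_pos_left _ (by omega), ?_⟩, ⟨Nat.gcd_pos_of_pos_left _ (by omega), ?_⟩⟩
    · exact (Nat.gcd_le_left _ (by omega)).trans (by omega)
    · exact (Nat.gcd_le_left _ (by omega)).trans (by omega)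
  rw [Finset.card_eq_sum_card_fiberwise hmap]
  push_cast
  rw [Finset.sum_product]
  have hK0 : (0:ℝ) < K := by exact_mod_cast hK
  have fib : ∀ g ∈ Icc 1 H, ∀ h ∈ Icc 1 (8*K),
      (((Z.filter (fun z => (Nat.gcd z.1.1 z.1.2, Nat.gcd z.2.1 z.2.2) = (g, h))).card : ℕ):ℝ) ≤
      (4/γ) * (16 * (H * K) * (1 / g * (1 / h)) + 128 * δ * (H * K)^2 * (1 / (g:ℝ)^2 * (1 / (h:ℝ)^2))) := by
    intro g hg h hh
    rw [mem_Icc] at hg hh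
    set A := (Icc 1 H ×ˢ Icc 1 H).filter (fun i => Nat.gcd i.1 i.2 = g) with hA
    set B := (Ioc (2*K) (8*K) ×ˢ Ioc (2*K) (8*K)).filter (fun i => Nat.gcd i.1 i.2 = h) with hB
    have hg0 : (0:ℝ) < g := by exact_mod_cast hg.1
    have hh0 : (0:ℝ) < h := by exact_mod_cast hh.1
    have hH0 : (0:ℝ) < H := by exact_mod_cast (by omega : 0 < H)
    set P := ((H:ℝ) / g)^2 with hP
    set R0 := (((8*K : ℕ):ℝ) / h)^2 with hR0
    have hP0 : 0 < P := by positivity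
    have hR00 : 0 < R0 := by rw [hR0]; push_cast; positivity
    have hsub : Z.filter (fun z => (Nat.gcd z.1.1 z.1.2, Nat.gcd z.2.1 z.2.2) = (g, h)) ⊆
        (A ×ˢ B).filter (fun ij => |(fun i : ℕ × ℕ => (i.1:ℝ) / i.2) ij.1 - (fun i : ℕ × ℕ => ((i.1:ℝ) / i.2)^γ) ij.2| ≤ δ) := by
      intro z hz
      simp only [hZ, hA, hB, mem_filter, Finset.mem_product, Prod.mk.injEq] at hz ⊢
      tauto
    have h1 : 4 / γ ≥ 4 := by
      rw [ge_iff_le, le_div_iff₀ hγ0]; nlinarith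
    have key := two_sep A B (fun i : ℕ × ℕ => (i.1:ℝ) / i.2) (fun i : ℕ × ℕ => ((i.1:ℝ) / i.2)^γ) P (4 / γ * R0) δ hP0 (by positivity) hδ
      (by
        intro i hi j hj hne
        simp only [hA, mem_filter, Finset.mem_product, mem_Icc] at hi hj
        exact frac_sep g H hg.1 i j hi.2 hj.2 (by omega) (by omega) (by omega) (by omega) hne)
      (by
        intro i hi j hj hne
        simp only [hB, mem_filter, Finset.mem_product, mem_Ioc] at hi hj
        have fs := frac_sep h (8*K) hh.1 i j hi.2 hj.2 (by omega) (by omega) (by omega) (by omega) hne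
        have rng : ∀ i : ℕ × ℕ, (2 * K < i.1 ∧ i.1 ≤ 8 * K) ∧ 2 * K < i.2 ∧ i.2 ≤ 8 * K → 0 < (i.1:ℝ) / i.2 ∧ (i.1:ℝ) / i.2 ≤ 4 := by
          intro i hi
          have a1 : (0:ℝ) < i.1 := by exact_mod_cast (by omega : 0 < i.1)
          have a2 : (0:ℝ) < i.2 := by exact_mod_cast (by omega : 0 < i.2)
          refine ⟨by positivity, ?_⟩
          rw [div_le_iff₀ a2]
          exact_mod_cast (by omega : i.1 ≤ 4 * i.2)
        have ri := rng i hi.1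
        have rj := rng j hj.1
        have gen : ∀ s t : ℝ, 0 < s → t ≤ 4 → s < t → (γ / 4) * (t - s) ≤ t^γ - s^γ := by
          intro s t hs ht hst
          obtain ⟨ξ, b1, b2, b3⟩ := rpow_mvt γ s t hs hst
          rw [b3]
          apply mul_le_mul_of_nonneg_right _ (by linarith)
          have : (4:ℝ)^(-1:ℝ) ≤ ξ^(γ-1) := by
            calc (4:ℝ)^(-1:ℝ) ≤ 4^(γ-1) := rpow_le_rpow_of_exponent_le (by norm_num) (by linarith)
              _ ≤ ξ^(γ-1) := rpow_le_rpow_of_nonpos (by linarith) (by linarith) (by linarith)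
          rw [rpow_neg_one] at this
          nlinarith
        have e : 1 / (4 / γ * R0) = γ / 4 * (1 / R0) := by field_simp
        rw [e]
        refine (mul_le_mul_of_nonneg_left fs (by positivity)).trans ?_
        rcases lt_trichotomy ((i.1:ℝ) / i.2) ((j.1:ℝ) / j.2) with hl | he | hl
        · have := gen _ _ ri.1 rj.2 hl
          rw [abs_sub_comm, abs_of_pos (by linarith), abs_sub_comm]
          exact this.trans (le_abs_self _)
        · rw [he]; simp
        · have := gen _ _ rj.1 ri.2 hl
          rw [abs_of_pos (by linarith)]
          exact this.trans (le_abs_self _))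
      (gcd_card H g hg.1 A (by
        intro i hi
        simp only [hA, mem_filter, Finset.mem_product, mem_Icc] at hi
        exact ⟨by omega, by omega, by omega, by omega, hi.2⟩))
      ((gcd_card (8*K) h hh.1 B (by
        intro i hi
        simp only [hB, mem_filter, Finset.mem_product, mem_Ioc] at hi
        exact ⟨by omega, by omega, by omega, by omega, hi.2⟩)).trans (by nlinarith))
    have hcard : (((Z.filter (fun z => (Nat.gcd z.1.1 z.1.2, Nat.gcd z.2.1 z.2.2) = (g, h))).card : ℕ):ℝ) ≤ _ :=
      (by exact_mod_cast Finset.card_le_card hsub : _ ≤ ((_ : ℕ) : ℝ)).trans key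
    refine hcard.trans ?_
    have s1 : √(P * (4 / γ * R0)) ≤ (4/γ) * (H / g * (((8*K : ℕ):ℝ) / h)) := by
      rw [Real.sqrt_le_left (by positivity), mul_pow, mul_pow, ← hP, ← hR0]
      have hPR : 0 < P * R0 := by positivity
      have hg4 : 1 ≤ 4 / γ := by rw [le_div_iff₀ hγ0]; linarith
      have hx : (4/γ)*(P*R0)*1 ≤ (4/γ)*(P*R0)*(4/γ) := by gcongr
      calc P * (4/γ*R0) = (4/γ)*(P*R0)*1 := by ring
        _ ≤ _ := hx
        _ = _ := by ring
    have e1 : (4/γ) * (16 * (H * K) * (1 / g * (1 / h)) + 128 * δ * (H * K)^2 * (1 / (g:ℝ)^2 * (1 / (h:ℝ)^2))) =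
       2 * ((4/γ) * (H / g * (((8*K : ℕ):ℝ) / h))) + 2 * δ * (P * (4 / γ * R0)) := by
      rw [hP, hR0]; push_cast; field_simp; ring
    rw [e1]
    linarith
  calc _ ≤ ∑ g ∈ Icc 1 H, ∑ h ∈ Icc 1 (8*K), (4/γ) * (16 * (H * K) * (1 / g * (1 / h)) + 128 * δ * (H * K)^2 * (1 / (g:ℝ)^2 * (1 / (h:ℝ)^2))) :=
        Finset.sum_le_sum (fun g hg => Finset.sum_le_sum (fun h hh => fib g hg h hh))
    _ = (4/γ) * (16 * (H * K) * ((∑ g ∈ Icc 1 H, 1 / (g:ℝ)) * (∑ h ∈ Icc 1 (8*K), 1 / (h:ℝ))) +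
        128 * δ * (H * K)^2 * ((∑ g ∈ Icc 1 H, 1 / (g:ℝ)^2) * (∑ h ∈ Icc 1 (8*K), 1 / (h:ℝ)^2))) := by
      simp_rw [← Finset.mul_sum, Finset.sum_add_distrib, ← Finset.mul_sum, Finset.sum_mul_sum]
      simp_rw [← Finset.mul_sum]
    _ ≤ (4/γ) * (16 * (H * K) * ((1 + log H) * (1 + log ((8*K : ℕ):ℝ))) + 128 * δ * (H * K)^2 * (2 * 2)) := by
      have l1 := sum_inv_le H
      have l2 := sum_inv_le (8*K)
      have l3 := sum_inv_sq_le H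
      have l4 := sum_inv_sq_le (8*K)
      have n1 : 0 ≤ ∑ g ∈ Icc 1 H, 1 / (g:ℝ) := by positivity
      have n3 : 0 ≤ 1 + log H := n1.trans l1
      gcongr
    _ = _ := by push_cast; ring

lemma continuous_ee : Continuous ee := by
  unfold ee; fun_prop

/-- average of `e(ty)` over `[-ε,ε]` -/
noncomputable def avg (ε y : ℝ) : ℂ := (1/(2*ε) : ℝ) • ∫ t in (-ε)..ε, ee (t*y)

lemma avg_re (ε y : ℝ) (hε : 0 < ε) (h : ε * |y| ≤ 1/6) : 1/2 ≤ ‖avg ε y‖ := by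
  refine le_trans ?_ ((le_abs_self _).trans (Complex.abs_re_le_norm _))
  have hi : IntervalIntegrable (fun t => ee (t*y)) volume (-ε) ε :=
    (continuous_ee.comp (by fun_prop)).intervalIntegrable _ _
  have e1 : (avg ε y).re = (1/(2*ε)) * ∫ t in (-ε)..ε, cos (2*π*(t*y)) := by
    unfold avg
    rw [Complex.smul_re, smul_eq_mul]
    congr 1
    have := (Complex.reCLM.intervalIntegral_comp_comm hi)
    rw [Complex.reCLM_apply] at this
    rw [← this]
    congr 1
    ext t
    rw [Complex.reCLM_apply, ee_eq, Complex.add_re, Complex.ofReal_re, Complex.re_ofReal_mul, Complex.I_re]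
    ring
  rw [e1]
  have e2 : ∫ t in (-ε)..ε, (1/2 : ℝ) ≤ ∫ t in (-ε)..ε, cos (2*π*(t*y)) := by
    apply intervalIntegral.integral_mono_on (by linarith)
    · simp
    · exact (Continuous.intervalIntegrable (by fun_prop) _ _)
    · intro t ht
      have ht' : |t| ≤ ε := abs_le.2 ht
      rw [← Real.cos_pi_div_three, ← Real.cos_abs (2*π*(t*y))]
      apply Real.cos_le_cos_of_nonneg_of_le_pi (abs_nonneg _) (by linarith [pi_pos])
      rw [abs_mul, abs_of_pos (by positivity : (0:ℝ) < 2*π), abs_mul]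
      have : |t| * |y| ≤ 1/6 := le_trans (by gcongr) h
      nlinarith [pi_pos]
  rw [intervalIntegral.integral_const, smul_eq_mul] at e2
  calc (1/2:ℝ) = 1/(2*ε) * ((ε - -ε) * (1/2)) := by field_simp; ring
    _ ≤ _ := by gcongr

lemma avg_shift (ε x y : ℝ) : (1/(2*ε) : ℝ) • ∫ t in (x-ε)..(x+ε), ee (t*y) = ee (x*y) * avg ε y := by
  unfold avg
  rw [mul_smul_comm]
  congr 1
  have : ∫ t in (x-ε)..(x+ε), ee (t*y) = ∫ t in (-ε)..ε, ee ((t+x)*y) := by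
    rw [intervalIntegral.integral_comp_add_right (fun t => ee (t*y))]
    congr 1 <;> ring
  rw [this, ← intervalIntegral.integral_const_mul]
  congr 1
  ext t
  rw [← ee_add]; congr 1; ring

/-- variance trick -/
lemma avg_sq (g : ℝ → ℂ) (hg : Continuous g) (a b : ℝ) (hab : a < b) (z : ℂ)
    (hz : z = (1/(b-a) : ℝ) • ∫ t in a..b, g t) : (b-a) * ‖z‖^2 ≤ ∫ t in a..b, ‖g t‖^2 := by
  have h0 : 0 ≤ ∫ t in a..b, ‖g t - z‖^2 :=
    intervalIntegral.integral_nonneg hab.le (fun t _ => by positivity)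
  have hba : (b - a) ≠ 0 := by linarith
  have hI : ∫ t in a..b, g t = ((b-a : ℝ):ℂ) * z := by
    have hba' : ((b-a:ℝ):ℂ) ≠ 0 := by exact_mod_cast hba
    rw [hz, Complex.real_smul]; push_cast at *; field_simp
  have e : ∫ t in a..b, ‖g t - z‖^2 = (∫ t in a..b, ‖g t‖^2) - (b-a) * ‖z‖^2 := by
    have e1 : ∀ t, ‖g t - z‖^2 = ‖g t‖^2 + (‖z‖^2 - 2 * (g t * (starRingEnd ℂ) z).re) := by
      intro t
      rw [← Complex.normSq_eq_norm_sq, Complex.normSq_sub, Complex.normSq_eq_norm_sq, Complex.normSq_eq_norm_sq]; ring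
    simp_rw [e1]
    have hc1 : IntervalIntegrable (fun t => ‖g t‖^2) volume a b := Continuous.intervalIntegrable (by fun_prop) _ _
    have hc2 : Continuous (fun t => (g t * (starRingEnd ℂ) z)) := by fun_prop
    have hc3 : Continuous (fun t => (g t * (starRingEnd ℂ) z).re) := Complex.continuous_re.comp hc2
    rw [intervalIntegral.integral_add hc1 (Continuous.intervalIntegrable (by fun_prop) _ _),
      intervalIntegral.integral_sub (by simp) (Continuous.intervalIntegrable (by fun_prop) _ _),
      intervalIntegral.integral_const_mul]
    have := (Complex.reCLM.intervalIntegral_comp_comm (hc2.intervalIntegrable (μ := volume) a b))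
    simp only [Complex.reCLM_apply] at this
    rw [this, intervalIntegral.integral_mul_const, hI, mul_assoc, Complex.mul_conj, ← Complex.ofReal_mul,
      Complex.ofReal_re, Complex.normSq_eq_norm_sq]
    simp; ring
  linarith

lemma gauss_ee_integrable (R η : ℝ) (hR : 0 < R) :
    Integrable (fun t : ℝ => ((rexp (-(π/R^2) * t^2) : ℝ):ℂ) * ee (t*η)) := by
  have := integrable_cexp_quadratic (b := ((π/R^2 : ℝ):ℂ)) (by rw [Complex.ofReal_re]; positivity) (2*π*η*Complex.I) 0
  refine this.congr (Filter.Eventually.of_forall fun t => ?_)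
  unfold ee
  simp only []
  rw [Complex.ofReal_exp, ← Complex.exp_add]
  congr 1; push_cast; ring

lemma gauss_ee (R η : ℝ) (hR : 0 < R) :
    ∫ t : ℝ, ((rexp (-(π/R^2) * t^2) : ℝ):ℂ) * ee (t*η) = ((R * rexp (-π*R^2*η^2) : ℝ):ℂ) := by
  have hp : 0 < π / R^2 := by positivity
  have := fourierIntegral_gaussian (b := ((π/R^2 : ℝ):ℂ)) (by rw [Complex.ofReal_re]; positivity) (2*π*η)
  rw [show (fun t : ℝ => ((rexp (-(π/R^2) * t^2) : ℝ):ℂ) * ee (t*η)) = fun t : ℝ => Complex.exp (Complex.I * (2*π*η) * t) *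
    Complex.exp (-((π/R^2:ℝ):ℂ) * t^2) from ?_, this]
  · have e1 : ((π:ℂ) / ((π/R^2:ℝ):ℂ)) = ((R^2 : ℝ):ℂ) := by
      have : (R:ℂ) ≠ 0 := by exact_mod_cast hR.ne'
      have : (π:ℂ) ≠ 0 := by exact_mod_cast pi_pos.ne'
      push_cast; field_simp
    rw [e1, show (1/2:ℂ) = ((1/2:ℝ):ℂ) by push_cast; rfl, ← Complex.ofReal_cpow (by positivity),
      ← Real.sqrt_eq_rpow, Real.sqrt_sq hR.le, Complex.ofReal_mul, Complex.ofReal_exp]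
    congr 2
    have : (R:ℂ) ≠ 0 := by exact_mod_cast hR.ne'
    have : (π:ℂ) ≠ 0 := by exact_mod_cast pi_pos.ne'
    push_cast; field_simp; ring
  · ext t
    unfold ee
    rw [Complex.ofReal_exp, mul_comm]
    congr 2
    · push_cast; ring
    · push_cast; ring

lemma gauss_mv {ι : Type*} (J : Finset ι) (β : ι → ℂ) (y : ι → ℝ) (B R : ℝ) (hB : ∀ j ∈ J, ‖β j‖ ≤ B) (hR : 0 < R) :
    Integrable (fun t : ℝ => rexp (-(π/R^2) * t^2) * ‖∑ j ∈ J, β j * ee (t * y j)‖^2) ∧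
    ∫ t : ℝ, rexp (-(π/R^2) * t^2) * ‖∑ j ∈ J, β j * ee (t * y j)‖^2 ≤
      B^2 * R * ∑ j ∈ J, ∑ j' ∈ J, rexp (-π*R^2*(y j - y j')^2) := by
  have key : ∀ t : ℝ, ((rexp (-(π/R^2) * t^2) * ‖∑ j ∈ J, β j * ee (t * y j)‖^2 : ℝ) : ℂ) =
      ∑ j ∈ J, ∑ j' ∈ J, β j * (starRingEnd ℂ) (β j') * (((rexp (-(π/R^2) * t^2) : ℝ):ℂ) * ee (t*(y j - y j'))) := by
    intro t
    rw [Complex.ofReal_mul, norm_sq_sum, Finset.mul_sum]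
    refine Finset.sum_congr rfl fun j _ => ?_
    rw [Finset.mul_sum]
    refine Finset.sum_congr rfl fun j' _ => ?_
    rw [map_mul, ← ee_neg, mul_sub, sub_eq_add_neg (t * y j), ee_add]; ring
  have hint : ∀ j ∈ J, ∀ j' ∈ J, Integrable (fun t : ℝ => β j * (starRingEnd ℂ) (β j') *
      (((rexp (-(π/R^2) * t^2) : ℝ):ℂ) * ee (t*(y j - y j')))) :=
    fun j _ j' _ => (gauss_ee_integrable R _ hR).const_mul _
  have hI : Integrable (fun t : ℝ => ((rexp (-(π/R^2) * t^2) * ‖∑ j ∈ J, β j * ee (t * y j)‖^2 : ℝ) : ℂ)) := by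
    simp_rw [key]
    exact integrable_finsetSum _ fun j hj => integrable_finsetSum _ fun j' hj' => hint j hj j' hj'
  refine ⟨hI.re, ?_⟩
  have e2 : ((∫ t : ℝ, rexp (-(π/R^2) * t^2) * ‖∑ j ∈ J, β j * ee (t * y j)‖^2 : ℝ):ℂ) =
      ∑ j ∈ J, ∑ j' ∈ J, β j * (starRingEnd ℂ) (β j') * ((R * rexp (-π*R^2*(y j - y j')^2) : ℝ):ℂ) := by
    rw [← integral_complex_ofReal]
    simp_rw [key]
    rw [integral_finsetSum _ fun j hj => integrable_finsetSum _ fun j' hj' => hint j hj j' hj']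
    refine Finset.sum_congr rfl fun j hj => ?_
    rw [integral_finsetSum _ fun j' hj' => hint j hj j' hj']
    refine Finset.sum_congr rfl fun j' hj' => ?_
    rw [integral_const_mul, gauss_ee _ _ hR]
  have e3 := congrArg norm e2
  rw [Complex.norm_real] at e3
  refine (le_abs_self _).trans (e3.le.trans ?_)
  rw [Finset.mul_sum]
  refine (norm_sum_le _ _).trans (Finset.sum_le_sum fun j hj => ?_)
  rw [Finset.mul_sum]
  refine (norm_sum_le _ _).trans (Finset.sum_le_sum fun j' hj' => ?_)
  rw [norm_mul, norm_mul, RCLike.norm_conj, Complex.norm_real, Real.norm_of_nonneg (by positivity)]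
  have := hB j hj
  have h2 := hB j' hj'
  have h3 : 0 ≤ B := (norm_nonneg _).trans this
  calc ‖β j‖ * ‖β j'‖ * (R * rexp (-π*R^2*(y j - y j')^2)) ≤ B * B * (R * rexp (-π*R^2*(y j - y j')^2)) := by gcongr
    _ = _ := by ring

lemma large_sieve {ι κ : Type*} (J : Finset ι) (β : ι → ℂ) (y : ι → ℝ) (B R ε : ℝ) (hB : ∀ j ∈ J, ‖β j‖ ≤ B) (hR : 0 < R)
    (hε : 0 < ε) (hεR : ε ≤ R) (hy : ∀ j ∈ J, ε * |y j| ≤ 1/6) (s : Finset κ) (x : κ → ℝ)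
    (hx : ∀ m ∈ s, |x m| ≤ R) (hsep : ∀ m ∈ s, ∀ m' ∈ s, m ≠ m' → 2*ε ≤ |x m - x m'|) :
    ∑ m ∈ s, ‖∑ j ∈ J, β j * ee (x m * y j)‖^2 ≤
      (2*rexp (4*π)) * (B^2 * R/ε) * ∑ j ∈ J, ∑ j' ∈ J, rexp (-π*R^2*(y j - y j')^2) := by
  set β' : ι → ℂ := fun j => β j / avg ε (y j) with hβ'
  have hav : ∀ j ∈ J, 1/2 ≤ ‖avg ε (y j)‖ := fun j hj => avg_re ε _ hε (hy j hj)
  have hB' : ∀ j ∈ J, ‖β' j‖ ≤ 2*B := by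
    intro j hj
    have h3 : 0 ≤ B := (norm_nonneg _).trans (hB j hj)
    have := hav j hj
    rw [hβ']; simp only []
    rw [norm_div, div_le_iff₀ (by linarith)]
    nlinarith [hB j hj]
  set g : ℝ → ℂ := fun t => ∑ j ∈ J, β' j * ee (t * y j) with hg
  have hgc : Continuous g := by
    rw [hg]
    refine continuous_finsetSum _ fun j _ => continuous_const.mul (continuous_ee.comp (by fun_prop))
  have h1 : ∀ m ∈ s, 2*ε*‖∑ j ∈ J, β j * ee (x m * y j)‖^2 ≤ ∫ t in (x m - ε)..(x m + ε), ‖g t‖^2 := by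
    intro m _
    have := avg_sq g hgc (x m - ε) (x m + ε) (by linarith) (∑ j ∈ J, β j * ee (x m * y j)) ?_
    · convert this using 2; ring
    · rw [hg, intervalIntegral.integral_finsetSum]
      · rw [Finset.smul_sum]
        refine Finset.sum_congr rfl fun j hj => ?_
        rw [intervalIntegral.integral_const_mul, show x m + ε - (x m - ε) = 2*ε by ring, ← mul_smul_comm, avg_shift]
        have : avg ε (y j) ≠ 0 := by
          intro h0; have := hav j hj; rw [h0] at this; norm_num at this
        rw [hβ']; simp only []; field_simp
      · intro j _
        exact (continuous_const.mul (continuous_ee.comp (by fun_prop))).intervalIntegrable _ _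
  have h2 := gauss_mv J β' y (2*B) R hB' hR
  have h3 : ∑ m ∈ s, ∫ t in (x m - ε)..(x m + ε), ‖g t‖^2 ≤
      rexp (4*π) * ∫ t : ℝ, rexp (-(π/R^2) * t^2) * ‖g t‖^2 := by
    have e1 : ∀ m ∈ s, ∫ t in (x m - ε)..(x m + ε), ‖g t‖^2 =
        ∫ t : ℝ, (Set.Ioc (x m - ε) (x m + ε)).indicator (fun t => ‖g t‖^2) t := by
      intro m _
      rw [intervalIntegral.integral_of_le (by linarith), integral_indicator measurableSet_Ioc]
    have hi : ∀ m ∈ s, Integrable (fun t => (Set.Ioc (x m - ε) (x m + ε)).indicator (fun t => ‖g t‖^2) t) := by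
      intro m _
      rw [integrable_indicator_iff measurableSet_Ioc]
      exact (Continuous.integrableOn_Icc (by fun_prop)).mono_set Set.Ioc_subset_Icc_self
    rw [Finset.sum_congr rfl e1, ← integral_finsetSum _ hi, ← integral_const_mul]
    apply integral_mono (integrable_finsetSum _ hi) (h2.1.const_mul _)
    intro t
    simp only []
    by_cases hex : ∃ m ∈ s, t ∈ Set.Ioc (x m - ε) (x m + ε)
    · obtain ⟨m, hm, htm⟩ := hex
      rw [Finset.sum_eq_single m, Set.indicator_of_mem htm]
      · have hxm := abs_le.1 (hx m hm)
        have ht2 : t^2 ≤ (2*R)^2 := by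
          apply sq_le_sq'
          · linarith [htm.1]
          · linarith [htm.2]
        have hge : 1 ≤ rexp (4*π) * rexp (-(π/R^2) * t^2) := by
          rw [← Real.exp_add]
          apply Real.one_le_exp
          have : π/R^2 * t^2 ≤ π/R^2 * (2*R)^2 := by gcongr
          have e : π/R^2 * (2*R)^2 = 4*π := by field_simp; ring
          linarith
        calc ‖g t‖^2 = 1 * ‖g t‖^2 := by ring
          _ ≤ (rexp (4*π) * rexp (-(π/R^2) * t^2)) * ‖g t‖^2 := by gcongr
          _ = _ := by ring
      · intro m' hm' hne
        rw [Set.indicator_of_notMem]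
        intro htm'
        have := hsep m' hm' m hm hne
        rw [Set.mem_Ioc] at htm htm'
        have h5 : |x m' - x m| < 2*ε := by
          rw [abs_lt]; constructor <;> linarith [htm.1, htm.2, htm'.1, htm'.2]
        linarith
      · intro h; exact absurd hm h
    · push Not at hex
      rw [Finset.sum_eq_zero]
      · positivity
      · intro m hm
        exact Set.indicator_of_notMem (hex m hm) _
  have h4 := Finset.sum_le_sum h1
  rw [← Finset.mul_sum] at h4
  have h5 : rexp (4*π) * (∫ t : ℝ, rexp (-(π/R^2) * t^2) * ‖g t‖^2) ≤ rexp (4*π) * _ :=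
    mul_le_mul_of_nonneg_left h2.2 (by positivity)
  have h6 := (h4.trans h3).trans h5
  rw [show (2*rexp (4*π)) * (B^2 * R/ε) * ∑ j ∈ J, ∑ j' ∈ J, rexp (-π*R^2*(y j - y j')^2) =
    (rexp (4*π) * ((2*B)^2 * R * ∑ j ∈ J, ∑ j' ∈ J, rexp (-π*R^2*(y j - y j')^2))) / (2*ε) by field_simp]
  rw [le_div_iff₀ (by linarith)]
  linarith

lemma sym_diff_bounds (c u t : ℝ) (hc1 : 1 < c) (hc2 : c < 2) (ht : 0 < t) (htu : t < u) :
    2*c*u^(c-1)*t*(1-(t/u)^2) ≤ (u+t)^c - (u-t)^c ∧ (u+t)^c - (u-t)^c ≤ 2*c*u^(c-1)*t := by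
  have hu : 0 < u := ht.trans htu
  have hd : ∀ τ ∈ Set.Ioo 0 t, HasDerivAt (fun τ : ℝ => (u+τ)^c - (u-τ)^c) (c*(u+τ)^(c-1) + c*(u-τ)^(c-1)) τ := by
    intro τ hτ
    have h1 : HasDerivAt (fun τ : ℝ => (u+τ)^c) (1 * c * (u+τ)^(c-1)) τ :=
      ((hasDerivAt_id τ).const_add u).rpow_const (Or.inl (by simp; linarith [hτ.1]))
    have h2 : HasDerivAt (fun τ : ℝ => (u-τ)^c) (-1 * c * (u-τ)^(c-1)) τ :=
      ((hasDerivAt_id τ).const_sub u).rpow_const (Or.inl (by simp; linarith [hτ.2]))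
    exact (h1.sub h2).congr_deriv (by ring)
  have hcont : ContinuousOn (fun τ : ℝ => (u+τ)^c - (u-τ)^c) (Set.Icc 0 t) := by
    apply ContinuousOn.sub
    · exact ContinuousOn.rpow_const (by fun_prop) (fun x hx => Or.inr (by linarith))
    · exact ContinuousOn.rpow_const (by fun_prop) (fun x hx => Or.inr (by linarith))
  obtain ⟨τ, hτ, he⟩ := exists_hasDerivAt_eq_slope _ _ ht hcont hd
  simp only [add_zero, sub_zero, sub_self] at he
  have he' : (u+t)^c - (u-t)^c = (c*(u+τ)^(c-1) + c*(u-τ)^(c-1)) * t := by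
    rw [he]; field_simp
  set s := τ/u with hs
  have hs0 : 0 < s := div_pos hτ.1 hu
  have hs1 : s < 1 := by rw [hs, div_lt_one hu]; linarith [hτ.2]
  have hst : s ≤ t/u := by rw [hs]; gcongr; exact hτ.2.le
  have e1 : (u+τ)^(c-1) = u^(c-1) * (1+s)^(c-1) := by
    rw [← mul_rpow hu.le (by linarith)]; congr 1; rw [hs]; field_simp
  have e2 : (u-τ)^(c-1) = u^(c-1) * (1-s)^(c-1) := by
    rw [← mul_rpow hu.le (by linarith)]; congr 1; rw [hs]; field_simp
  rw [he', e1, e2]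
  have hup : 0 < u^(c-1) := by positivity
  constructor
  · have am : 2*(1-(t/u)^2) ≤ (1+s)^(c-1) + (1-s)^(c-1) := by
      have p1 : 0 < (1+s)^(c-1) := by apply rpow_pos_of_pos; linarith
      have p2 : 0 < (1-s)^(c-1) := by apply rpow_pos_of_pos; linarith
      have p3 : (1+s)^(c-1) * (1-s)^(c-1) = (1-s^2)^(c-1) := by
        rw [← mul_rpow (by linarith) (by linarith)]; congr 1; ring
      have p4 : 1 - s^2 ≤ (1-s^2)^(c-1) := by
        calc 1 - s^2 = (1-s^2)^(1:ℝ) := by simp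
          _ ≤ _ := rpow_le_rpow_of_exponent_ge (by nlinarith) (by nlinarith) (by linarith)
      have p5 : 1-(t/u)^2 ≤ 1-s^2 := by gcongr
      have p6 : 0 < 1 - s^2 := by nlinarith
      have p7 : 1 - s^2 ≤ 1 := by nlinarith
      have p8 : (2*(1-s^2))^2 ≤ ((1+s)^(c-1) + (1-s)^(c-1))^2 := by
        nlinarith [sq_nonneg ((1+s)^(c-1) - (1-s)^(c-1))]
      have := (le_abs_self _).trans (abs_le_of_sq_le_sq p8 (by positivity))
      linarith
    have : c*u^(c-1)*t*(2*(1-(t/u)^2)) ≤ c*u^(c-1)*t*((1+s)^(c-1) + (1-s)^(c-1)) :=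
      mul_le_mul_of_nonneg_left am (by positivity)
    linarith
  · have b1 : (1+s)^(c-1) ≤ 1 + (c-1)*s := rpow_one_add_le_one_add_mul_self (by linarith) (by linarith) (by linarith)
    have b2 : (1-s)^(c-1) ≤ 1 + (c-1)*(-s) := by
      have := rpow_one_add_le_one_add_mul_self (s := -s) (by linarith) (p := c-1) (by linarith) (by linarith)
      rwa [← sub_eq_add_neg] at this
    have : c*u^(c-1)*t*((1+s)^(c-1) + (1-s)^(c-1)) ≤ c*u^(c-1)*t*2 :=
      mul_le_mul_of_nonneg_left (by linarith) (by positivity)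
    linarith

/-- key diophantine reduction -/
lemma pair_reduce (c : ℝ) (hc1 : 1 < c) (hc2 : c < 2) (K Q k k' l l' : ℕ) (Δ : ℝ) (hK : 1 ≤ K)
    (hk' : K < k') (hk : k' < k) (hk4 : k ≤ 4*K) (hkQ : k - k' ≤ Q) (hl' : K < l') (hl : l' < l) (hl4 : l ≤ 4*K) (hlQ : l - l' ≤ Q)
    (hle : k - k' ≤ l - l') (h : |((k:ℝ)^c - (k':ℝ)^c) - ((l:ℝ)^c - (l':ℝ)^c)| ≤ Δ) :
    |((k-k' : ℕ):ℝ)/((l-l':ℕ):ℝ) - (((l+l':ℕ):ℝ)/((k+k':ℕ):ℝ))^(c-1)| ≤ Δ/(((l-l':ℕ):ℝ)*(K:ℝ)^(c-1)) + 2*(Q:ℝ)^2/(K:ℝ)^2 := by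
  have hK0 : (1:ℝ) ≤ K := by exact_mod_cast hK
  have gen : ∀ a b : ℕ, K < b → b < a → a ≤ 4*K → a - b ≤ Q → ∃ ρ : ℝ, 0 ≤ ρ ∧ ρ ≤ Q^2/(4*K^2) ∧
      (a:ℝ)^c - (b:ℝ)^c = 2^(1-c)*c*(((a-b:ℕ):ℝ)*((a+b:ℕ):ℝ)^(c-1)*(1-ρ)) := by
    intro a b hb hab ha hQ
    have hab' : (b:ℝ) < a := by exact_mod_cast hab
    have hb' : (K:ℝ) < b := by exact_mod_cast hb
    have hq : ((a-b:ℕ):ℝ) = (a:ℝ) - b := by rw [Nat.cast_sub hab.le]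
    have hQ' : (a:ℝ) - b ≤ Q := by rw [← hq]; exact_mod_cast hQ
    have hu : ((a+b:ℕ):ℝ) = (a:ℝ) + b := by push_cast; ring
    have hb0 : (0:ℝ) < b := by linarith
    have ha0 : (0:ℝ) < a := by linarith
    obtain ⟨s1, s2⟩ := sym_diff_bounds c (a+b) (a-b) hc1 hc2 (by linarith) (by linarith)
    have e : ((a:ℝ)+b+(a-b))^c - ((a:ℝ)+b-(a-b))^c = 2^c*((a:ℝ)^c - (b:ℝ)^c) := by
      rw [show (a:ℝ)+b+(a-b) = 2*a by ring, show (a:ℝ)+b-(a-b) = 2*b by ring, mul_rpow (by norm_num) ha0.le,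
        mul_rpow (by norm_num) hb0.le]; ring
    rw [e] at s1 s2
    have h2c : (0:ℝ) < 2^c := by positivity
    have h2 : (2:ℝ)^(1-c) * 2^c = 2 := by rw [← rpow_add (by norm_num)]; norm_num
    set V := c*((a:ℝ)-b)*((a:ℝ)+b)^(c-1) with hV
    have hVpos : 0 < V := by
      have : (0:ℝ) < (a:ℝ) - b := by linarith
      have : (0:ℝ) < ((a:ℝ)+b)^(c-1) := by positivity
      positivity
    refine ⟨1 - 2^c*((a:ℝ)^c - (b:ℝ)^c)/(2*V), ?_, ?_, ?_⟩
    · rw [sub_nonneg, div_le_one (by positivity)]; linarith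
    · have : 1 - (((a:ℝ)-b)/(a+b))^2 ≤ 2^c*((a:ℝ)^c - (b:ℝ)^c)/(2*V) := by
        rw [le_div_iff₀ (by positivity)]; linarith
      have h3 : (((a:ℝ)-b)/(a+b))^2 ≤ Q^2/(4*K^2) := by
        rw [div_pow]
        have : (4*(K:ℝ)^2) = (K+K)^2 := by ring
        rw [this]
        have : (0:ℝ) ≤ (a:ℝ) - b := by linarith
        gcongr
        linarith
      linarith
    · rw [hq, hu, sub_sub_cancel]
      have : (2:ℝ)^(1-c) * c * (((a:ℝ) - b) * ((a:ℝ)+b)^(c-1) * (2^c*((a:ℝ)^c - (b:ℝ)^c)/(2*V))) =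
        (2^(1-c) * 2^c)*((a:ℝ)^c - (b:ℝ)^c)*(V/(2*V)) := by rw [hV]; ring
      rw [this, h2]; field_simp
  obtain ⟨ρ, r0, r1, er⟩ := gen k k' hk' hk hk4 hkQ
  obtain ⟨σ, t0, t1, et⟩ := gen l l' hl' hl hl4 hlQ
  rw [er, et] at h
  set q : ℝ := ((k-k' : ℕ):ℝ) with hq
  set q' : ℝ := ((l-l' : ℕ):ℝ) with hq'
  set u : ℝ := ((k+k' : ℕ):ℝ) with hu
  set u' : ℝ := ((l+l' : ℕ):ℝ) with hu'
  have q0 : 1 ≤ q := by rw [hq]; exact_mod_cast (by omega : 1 ≤ k - k')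
  have q1 : 1 ≤ q' := by rw [hq']; exact_mod_cast (by omega : 1 ≤ l - l')
  have q2 : q ≤ q' := by rw [hq, hq']; exact_mod_cast hle
  have u0 : 2*(K:ℝ) ≤ u := by rw [hu]; exact_mod_cast (by omega : 2*K ≤ k + k')
  have u1 : u' ≤ 8*(K:ℝ) := by rw [hu']; exact_mod_cast (by omega : l + l' ≤ 8*K)
  have up : 0 < u := by linarith
  have up' : 0 ≤ u' := by rw [hu']; positivity
  set U := u^(c-1) with hU
  set U' := u'^(c-1) with hU'
  have hUp : 0 < U := by positivity
  have hUp' : 0 ≤ U' := by positivity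
  have hdiv : (u'/u)^(c-1) = U'/U := by rw [div_rpow up' up.le]
  have hr4 : U'/U ≤ 4 := by
    rw [← hdiv]
    have h4 : u'/u ≤ 4 := by rw [div_le_iff₀ up]; linarith
    calc (u'/u)^(c-1) ≤ 4^(c-1) := by gcongr
      _ ≤ 4^(1:ℝ) := rpow_le_rpow_of_exponent_le (by norm_num) (by linarith)
      _ = 4 := by norm_num
  rw [hdiv]
  have hκ : (2:ℝ)^(1-c)*c*U ≥ (K:ℝ)^(c-1) := by
    have : (2*(K:ℝ))^(c-1) ≤ U := by rw [hU]; gcongr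
    rw [mul_rpow (by norm_num) (by linarith)] at this
    have h2 : (2:ℝ)^(1-c) * 2^(c-1) = 1 := by rw [← rpow_add (by norm_num)]; norm_num
    have hKp : 0 < (K:ℝ)^(c-1) := by positivity
    have h2p : (0:ℝ) < 2^(1-c) := by positivity
    calc (K:ℝ)^(c-1) = 1 * ((2:ℝ)^(1-c) * 2^(c-1)) * (K:ℝ)^(c-1) := by rw [h2]; ring
      _ ≤ c * ((2:ℝ)^(1-c) * 2^(c-1)) * (K:ℝ)^(c-1) := by gcongr
      _ = (2:ℝ)^(1-c)*c*(2^(c-1) * (K:ℝ)^(c-1)) := by ring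
      _ ≤ _ := by gcongr
  have hκp : 0 < (K:ℝ)^(c-1) := by positivity
  set κ := (2:ℝ)^(1-c)*c with hkap
  have hκ0 : 0 < κ := by positivity
  have e0 : q/q' - U'/U = (κ*(q*U*(1-ρ)) - κ*(q'*U'*(1-σ)))/(κ*U*q') + (ρ*(q/q') - σ*(U'/U)) := by
    field_simp; ring
  rw [e0]
  have hD0 : 0 ≤ Δ := (abs_nonneg _).trans h
  have a1 : |(κ*(q*U*(1-ρ)) - κ*(q'*U'*(1-σ)))/(κ*U*q')| ≤ Δ/(q'*(K:ℝ)^(c-1)) := by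
    rw [abs_div, abs_of_pos (by positivity : 0 < κ*U*q')]
    apply div_le_div₀ hD0 h (by positivity)
    rw [mul_comm q']; gcongr
  have hqq : q/q' ≤ 1 := by rw [div_le_one (by linarith)]; exact q2
  have hqq0 : 0 ≤ q/q' := by positivity
  have hUU0 : 0 ≤ U'/U := by positivity
  have a2 : |ρ*(q/q') - σ*(U'/U)| ≤ 2*(Q:ℝ)^2/(K:ℝ)^2 := by
    have e : 2*(Q:ℝ)^2/(K:ℝ)^2 = 8 * (Q^2/(4*K^2)) := by field_simp; ring
    rw [e]
    set E : ℝ := Q^2/(4*K^2)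
    have hE : 0 ≤ E := r0.trans r1
    have b1 : ρ*(q/q') ≤ E * 1 := by gcongr
    have b2 : σ*(U'/U) ≤ E * 4 := by gcongr
    have b3 : 0 ≤ ρ*(q/q') := by positivity
    have b4 : 0 ≤ σ*(U'/U) := by positivity
    rw [abs_le]; constructor <;> linarith
  exact (abs_add_le _ _).trans (add_le_add a1 a2)

/-- off-diagonal pairs in a common block -/
def blockPairs (K Q : ℕ) : Finset (ℕ × ℕ) :=
  ((Ioc K (4*K)) ×ˢ (Ioc K (4*K))).filter (fun p => p.2 < p.1 ∧ p.1 / Q = p.2 / Q)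

lemma mem_blockPairs (K Q : ℕ) (hQ : 1 ≤ Q) (p : ℕ × ℕ) (h : p ∈ blockPairs K Q) :
    K < p.2 ∧ p.2 < p.1 ∧ p.1 ≤ 4*K ∧ p.1 - p.2 ≤ Q := by
  simp only [blockPairs, mem_filter, Finset.mem_product, mem_Ioc] at h
  refine ⟨h.1.2.1, h.2.1, h.1.1.2, ?_⟩
  have h1 := Nat.div_add_mod p.1 Q
  have h2 := Nat.div_add_mod p.2 Q
  have h3 := Nat.mod_lt p.1 hQ
  rw [h.2.2] at h1
  omega

lemma card_blockPairs (K Q : ℕ) (hQ : 1 ≤ Q) : (blockPairs K Q).card ≤ 3 * K * Q := by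
  have : (blockPairs K Q).card ≤ (Ioc K (4*K) ×ˢ Icc 1 Q).card := by
    apply Finset.card_le_card_of_injOn (fun p => (p.1, p.1 - p.2))
    · intro p hp
      have hm := mem_blockPairs K Q hQ p hp
      simp only [Finset.coe_product, Set.mem_prod, Finset.mem_coe, mem_Ioc, mem_Icc]
      omega
    · intro p hp p' hp' he
      have hm := mem_blockPairs K Q hQ p hp
      have hm' := mem_blockPairs K Q hQ p' hp'
      simp only [Prod.mk.injEq] at he
      ext
      · exact he.1
      · omega
  refine this.trans ?_
  rw [Finset.card_product, Nat.card_Ioc, Nat.card_Icc]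
  have : 4*K - K = 3*K := by omega
  rw [this]; simp

noncomputable def yy (c : ℝ) (p : ℕ × ℕ) : ℝ := (p.1:ℝ)^c - (p.2:ℝ)^c

lemma count_pairs (c : ℝ) (hc1 : 1 < c) (hc2 : c < 2) (K Q : ℕ) (Δ : ℝ) (hK : 1 ≤ K) (hQ : 1 ≤ Q) (hΔ : 0 ≤ Δ) :
    ((((blockPairs K Q ×ˢ blockPairs K Q).filter (fun z => |yy c z.1 - yy c z.2| ≤ Δ)).card : ℕ):ℝ) ≤
    2 * ∑ i ∈ range (Nat.log 2 Q + 1), (4 / (c-1)) * (16 * (((2^(i+1):ℕ):ℝ) * K) *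
      ((1 + log ((2^(i+1):ℕ):ℝ)) * (1 + log (8*K))) +
      512 * (Δ/((2^i:ℕ)*(K:ℝ)^(c-1)) + 2*(Q:ℝ)^2/(K:ℝ)^2) * (((2^(i+1):ℕ):ℝ) * K)^2) := by
  have hK0 : (1:ℝ) ≤ K := by exact_mod_cast hK
  set Z := (blockPairs K Q ×ˢ blockPairs K Q).filter (fun z => |yy c z.1 - yy c z.2| ≤ Δ) with hZ
  set Z1 := Z.filter (fun z => z.1.1 - z.1.2 ≤ z.2.1 - z.2.2) with hZ1
  set Z2 := Z.filter (fun z => ¬ (z.1.1 - z.1.2 ≤ z.2.1 - z.2.2)) with hZ2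
  have hc : Z1.card + Z2.card = Z.card := Finset.card_filter_add_card_filter_not _
  have h21 : Z2.card ≤ Z1.card := by
    apply Finset.card_le_card_of_injOn Prod.swap
    · intro z hz
      simp only [hZ2, hZ1, hZ, Finset.coe_filter, mem_filter, Finset.mem_product, Set.mem_ofPred_eq, Prod.fst_swap, Prod.snd_swap] at hz ⊢
      refine ⟨⟨⟨hz.1.1.2, hz.1.1.1⟩, ?_⟩, by omega⟩
      rw [abs_sub_comm]; exact hz.1.2
    · exact Prod.swap_injective.injOn
  have h1 : (Z1.card : ℝ) ≤ ∑ i ∈ range (Nat.log 2 Q + 1), (4 / (c-1)) * (16 * (((2^(i+1):ℕ):ℝ) * K) *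
      ((1 + log ((2^(i+1):ℕ):ℝ)) * (1 + log (8*K))) +
      512 * (Δ/((2^i:ℕ)*(K:ℝ)^(c-1)) + 2*(Q:ℝ)^2/(K:ℝ)^2) * (((2^(i+1):ℕ):ℝ) * K)^2) := by
    have hmem : ∀ z ∈ Z1, (K < z.1.2 ∧ z.1.2 < z.1.1 ∧ z.1.1 ≤ 4*K ∧ z.1.1 - z.1.2 ≤ Q) ∧
        (K < z.2.2 ∧ z.2.2 < z.2.1 ∧ z.2.1 ≤ 4*K ∧ z.2.1 - z.2.2 ≤ Q) ∧ |yy c z.1 - yy c z.2| ≤ Δ ∧ z.1.1 - z.1.2 ≤ z.2.1 - z.2.2 := by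
      intro z hz
      simp only [hZ1, hZ, mem_filter, Finset.mem_product] at hz
      exact ⟨mem_blockPairs K Q hQ _ hz.1.1.1, mem_blockPairs K Q hQ _ hz.1.1.2, hz.1.2, hz.2⟩
    have hmaps : ∀ z ∈ Z1, Nat.log 2 (z.2.1 - z.2.2) ∈ range (Nat.log 2 Q + 1) := by
      intro z hz
      rw [mem_range, Nat.lt_succ_iff]
      exact Nat.log_mono_right (hmem z hz).2.1.2.2.2
    rw [Finset.card_eq_sum_card_fiberwise hmaps, Nat.cast_sum]
    apply Finset.sum_le_sum
    intro i _
    refine le_trans ?_ (spacing_count (c-1) (by linarith) (by linarith) (2^(i+1)) K hK _ (by positivity))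
    rw [Nat.cast_le]
    apply Finset.card_le_card_of_injOn (fun z => ((z.1.1 - z.1.2, z.2.1 - z.2.2), (z.2.1 + z.2.2, z.1.1 + z.1.2)))
    · intro z hz
      rw [Finset.mem_coe, mem_filter] at hz
      obtain ⟨a, b, d, e⟩ := hmem z hz.1
      have hne : z.2.1 - z.2.2 ≠ 0 := by omega
      have hlt : z.2.1 - z.2.2 < 2^(i+1) := by
        have := Nat.lt_pow_succ_log_self (b := 2) (by norm_num) (z.2.1 - z.2.2)
        rwa [hz.2] at this
      have hge : 2^i ≤ z.2.1 - z.2.2 := by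
        have := Nat.pow_log_le_self 2 hne
        rwa [hz.2] at this
      simp only [Finset.mem_coe, mem_filter, Finset.mem_product, mem_Icc, mem_Ioc]
      refine ⟨⟨⟨⟨by omega, by omega⟩, by omega, by omega⟩, ⟨by omega, by omega⟩, by omega, by omega⟩, ?_⟩
      refine (pair_reduce c hc1 hc2 K Q z.1.1 z.1.2 z.2.1 z.2.2 Δ hK a.1 a.2.1 a.2.2.1 a.2.2.2 b.1 b.2.1 b.2.2.1 b.2.2.2 e d).trans ?_
      have : ((2^i:ℕ):ℝ) ≤ ((z.2.1 - z.2.2 : ℕ):ℝ) := by exact_mod_cast hge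
      gcongr
    · intro z hz z' hz' he
      rw [Finset.mem_coe, mem_filter] at hz hz'
      obtain ⟨a, b, -, -⟩ := hmem z hz.1
      obtain ⟨a', b', -, -⟩ := hmem z' hz'.1
      simp only [Prod.mk.injEq] at he
      ext <;> omega
  have : (Z.card:ℝ) = Z1.card + Z2.card := by exact_mod_cast hc.symm
  have h21' : (Z2.card:ℝ) ≤ Z1.card := by exact_mod_cast h21
  rw [this]; linarith

lemma count_pairs2 (c : ℝ) (hc1 : 1 < c) (hc2 : c < 2) (K Q : ℕ) (Δ : ℝ) (hK : 1 ≤ K) (hQ : 1 ≤ Q) (hQK : Q ≤ K) (hΔ : 0 ≤ Δ) :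
    ((((blockPairs K Q ×ˢ blockPairs K Q).filter (fun z => |yy c z.1 - yy c z.2| ≤ Δ)).card : ℕ):ℝ) ≤
    (65536/(c-1)) * (1 + log (8*K))^3 * (Q*K + Δ*Q*(K:ℝ)^2/(K:ℝ)^(c-1) + (Q:ℝ)^4) := by
  refine (count_pairs c hc1 hc2 K Q Δ hK hQ hΔ).trans ?_
  have hK0 : (1:ℝ) ≤ K := by exact_mod_cast hK
  have hQ0 : (1:ℝ) ≤ Q := by exact_mod_cast hQ
  have hQK' : (Q:ℝ) ≤ K := by exact_mod_cast hQK
  set ℓ := 1 + log (8*K) with hℓ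
  have hℓ1 : 1 ≤ ℓ := by
    rw [hℓ]; have := log_nonneg (by linarith : (1:ℝ) ≤ 8*K); linarith
  have hcg : 0 < c - 1 := by linarith
  have hterm : ∀ i ∈ range (Nat.log 2 Q + 1), (4 / (c-1)) * (16 * (((2^(i+1):ℕ):ℝ) * K) *
      ((1 + log ((2^(i+1):ℕ):ℝ)) * ℓ) +
      512 * (Δ/((2^i:ℕ)*(K:ℝ)^(c-1)) + 2*(Q:ℝ)^2/(K:ℝ)^2) * (((2^(i+1):ℕ):ℝ) * K)^2) ≤
      (4/(c-1)) * (4096 * ℓ^2 * (Q*K + Δ*Q*(K:ℝ)^2/(K:ℝ)^(c-1) + (Q:ℝ)^4)) := by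
    intro i hi
    have hi' : 2^i ≤ Q := by
      apply Nat.pow_le_of_le_log (by omega)
      rw [mem_range] at hi; omega
    set G : ℝ := ((2^i:ℕ):ℝ) with hG
    have hGQ : G ≤ Q := by rw [hG]; exact_mod_cast hi'
    have hG1 : 1 ≤ G := by rw [hG]; exact_mod_cast Nat.one_le_two_pow
    have hG2 : ((2^(i+1):ℕ):ℝ) = 2*G := by rw [hG]; push_cast; ring
    rw [hG2]
    have hl : 1 + log (2*G) ≤ ℓ := by
      have := log_le_log (by linarith : 0 < 2*G) (by linarith : 2*G ≤ 8*(K:ℝ)); linarith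
    have hl0 : 0 ≤ log (2*G) := log_nonneg (by linarith)
    have hKp : 0 < (K:ℝ)^(c-1) := by positivity
    gcongr (4/(c-1)) * ?_
    have t1 : 16 * (2*G*K) * ((1 + log (2*G)) * ℓ) ≤ 32 * ℓ^2 * (Q*K) := by
      calc 16 * (2*G*K) * ((1 + log (2*G)) * ℓ) ≤ 16 * (2*Q*K) * (ℓ * ℓ) := by gcongr
        _ = _ := by ring
    have t2 : 512 * (Δ/(G*(K:ℝ)^(c-1)) + 2*(Q:ℝ)^2/(K:ℝ)^2) * (2*G*K)^2 = 2048 * (Δ*G*(K:ℝ)^2/(K:ℝ)^(c-1)) + 4096 * (Q^2*G^2) := by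
      field_simp; ring
    have t3 : Δ*G*(K:ℝ)^2/(K:ℝ)^(c-1) ≤ Δ*Q*(K:ℝ)^2/(K:ℝ)^(c-1) := by gcongr
    have t4 : (Q:ℝ)^2*G^2 ≤ (Q:ℝ)^4 := by
      calc (Q:ℝ)^2*G^2 ≤ (Q:ℝ)^2*(Q:ℝ)^2 := by gcongr
        _ = _ := by ring
    rw [t2]
    have hl2 : 1 ≤ ℓ^2 := one_le_pow₀ hℓ1
    set E1 := Δ*Q*(K:ℝ)^2/(K:ℝ)^(c-1) with hE1
    have hE0 : 0 ≤ E1 := by positivity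
    have hQ4 : 0 ≤ (Q:ℝ)^4 := by positivity
    have f1 : E1 ≤ ℓ^2 * E1 := le_mul_of_one_le_left hE0 hl2
    have f2 : (Q:ℝ)^4 ≤ ℓ^2 * (Q:ℝ)^4 := le_mul_of_one_le_left hQ4 hl2
    have f3 : 0 ≤ ℓ^2 * ((Q:ℝ)*K) := by positivity
    nlinarith
  have hlog : ((Nat.log 2 Q + 1 : ℕ):ℝ) ≤ 2*ℓ := by
    have h2 : ((2^(Nat.log 2 Q) : ℕ):ℝ) ≤ Q := by exact_mod_cast Nat.pow_log_le_self 2 (by omega)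
    have h3 := log_le_log (by positivity) (h2.trans (hQK'.trans (by linarith : (K:ℝ) ≤ 8*K)))
    push_cast at h3
    rw [log_pow] at h3
    have := log_two_gt_d9
    push_cast
    have hn : (0:ℝ) ≤ Nat.log 2 Q := by positivity
    nlinarith
  have := Finset.sum_le_sum hterm
  rw [Finset.sum_const, Finset.card_range, nsmul_eq_mul] at this
  set E := Q*K + Δ*Q*(K:ℝ)^2/(K:ℝ)^(c-1) + (Q:ℝ)^4 with hE
  have hE0 : 0 ≤ E := by positivity
  calc _ ≤ 2 * (((Nat.log 2 Q + 1 : ℕ):ℝ) * ((4/(c-1)) * (4096 * ℓ^2 * E))) := by gcongr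
    _ ≤ 2 * ((2*ℓ) * ((4/(c-1)) * (4096 * ℓ^2 * E))) := by gcongr
    _ = _ := by field_simp; ring

noncomputable def bilF (c θ : ℝ) (b : ℕ → ℂ) (K Q : ℕ) (m v : ℕ) : ℂ :=
  ∑ k ∈ (Ioc K (4*K)).filter (fun k => k / Q = v), b k * ee (θ * ((m:ℝ)^c * (k:ℝ)^c))

lemma card_block (K Q v : ℕ) (hQ : 1 ≤ Q) : ((Ioc K (4*K)).filter (fun k => k / Q = v)).card ≤ Q := by
  have : ((Ioc K (4*K)).filter (fun k => k / Q = v)) ⊆ Ico (v*Q) (v*Q+Q) := by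
    intro k hk
    rw [mem_filter] at hk
    rw [mem_Ico]
    have h1 := Nat.div_add_mod k Q
    have h3 := Nat.mod_lt k hQ
    rw [hk.2, mul_comm] at h1
    omega
  simpa using Finset.card_le_card this

lemma bilI_le (c θ : ℝ) (b : ℕ → ℂ) (A : ℝ) (K Q x1 x2 m v : ℕ) (hA : ∀ k ∈ Ioc K (4*K), ‖b k‖ ≤ A) (hA0 : 0 ≤ A) (hQ : 1 ≤ Q) :
    ‖bilI c θ b K Q x1 x2 m v‖ ≤ A * Q := by
  unfold bilI
  refine (norm_sum_le _ _).trans ?_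
  calc _ ≤ ∑ k ∈ (Ioc K (4*K)).filter (fun k => k / Q = v), A := by
        apply Finset.sum_le_sum
        intro k hk
        split_ifs
        · rw [norm_mul, norm_ee, mul_one]; exact hA k (mem_filter.1 hk).1
        · simpa using hA0
    _ ≤ _ := by
      rw [Finset.sum_const, nsmul_eq_mul, mul_comm]
      gcongr
      exact_mod_cast card_block K Q v hQ

lemma bilI_good_bad (c θ : ℝ) (b : ℕ → ℂ) (A : ℝ) (K Q x1 x2 m v : ℕ) (hA : ∀ k ∈ Ioc K (4*K), ‖b k‖ ≤ A) (hA0 : 0 ≤ A) (hQ : 1 ≤ Q)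
    (hm : 0 < m) :
    ‖bilI c θ b K Q x1 x2 m v‖^2 ≤ ‖bilF c θ b K Q m v‖^2 + ((if x1/m/Q = v then (A*Q)^2 else 0) + (if x2/m/Q = v then (A*Q)^2 else 0)) := by
  have h0 := bilI_le c θ b A K Q x1 x2 m v hA hA0 hQ
  have h1 : ‖bilI c θ b K Q x1 x2 m v‖^2 ≤ (A*Q)^2 := by gcongr
  have hn : 0 ≤ ‖bilF c θ b K Q m v‖^2 := by positivity
  have hp : 0 ≤ (A*Q)^2 := by positivity
  by_cases a1 : x1/m/Q = v
  · rw [if_pos a1]; split_ifs <;> linarith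
  by_cases a2 : x2/m/Q = v
  · rw [if_pos a2]; split_ifs <;> linarith
  rw [if_neg a1, if_neg a2, add_zero, add_zero]
  have hx : ∀ x k : ℕ, k / Q = v → x/m/Q ≠ v → (x < m*k ↔ x/m/Q < v) := by
    intro x k hk hne
    rw [mul_comm, ← Nat.div_lt_iff_lt_mul hm]
    constructor
    · intro h
      exact lt_of_le_of_ne (by rw [← hk]; exact Nat.div_le_div_right h.le) hne
    · intro h
      by_contra hcon
      push Not at hcon
      have := Nat.div_le_div_right (c := Q) hcon
      omega
  by_cases hg : x1/m/Q < v ∧ ¬ x2/m/Q < v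
  · have : bilI c θ b K Q x1 x2 m v = bilF c θ b K Q m v := by
      unfold bilI bilF
      apply Finset.sum_congr rfl
      intro k hk
      have hk2 := (mem_filter.1 hk).2
      rw [if_pos ⟨(hx x1 k hk2 a1).2 hg.1, not_lt.1 (fun h => hg.2 ((hx x2 k hk2 a2).1 h))⟩]
    rw [this]
  · have : bilI c θ b K Q x1 x2 m v = 0 := by
      unfold bilI
      apply Finset.sum_eq_zero
      intro k hk
      have hk2 := (mem_filter.1 hk).2
      rw [if_neg]
      rintro ⟨h1, h2⟩
      exact hg ⟨(hx x1 k hk2 a1).1 h1, fun h => absurd ((hx x2 k hk2 a2).2 h) (by omega)⟩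
    rw [this]; simp

lemma sq_sum_split (s : Finset ℕ) (z : ℕ → ℂ) :
    ‖∑ k ∈ s, z k‖^2 = ∑ k ∈ s, ‖z k‖^2 + 2 * (∑ p ∈ (s ×ˢ s).filter (fun p => p.2 < p.1), z p.1 * (starRingEnd ℂ) (z p.2)).re := by
  have h := norm_sq_sum s z
  rw [← Finset.sum_product' (f := fun k k' => z k * (starRingEnd ℂ) (z k'))] at h
  rw [← Finset.sum_filter_add_sum_filter_not (s ×ˢ s) (fun p => p.2 < p.1)] at h
  rw [← Finset.sum_filter_add_sum_filter_not ((s ×ˢ s).filter (fun p => ¬ p.2 < p.1)) (fun p => p.1 < p.2)] at h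
  rw [Finset.filter_filter, Finset.filter_filter] at h
  have e1 : ∑ p ∈ (s ×ˢ s).filter (fun p => ¬ p.2 < p.1 ∧ p.1 < p.2), z p.1 * (starRingEnd ℂ) (z p.2) =
      (starRingEnd ℂ) (∑ p ∈ (s ×ˢ s).filter (fun p => p.2 < p.1), z p.1 * (starRingEnd ℂ) (z p.2)) := by
    rw [map_sum]
    apply Finset.sum_nbij' Prod.swap Prod.swap
    · intro p hp
      simp only [mem_filter, Finset.mem_product, Prod.fst_swap, Prod.snd_swap] at hp ⊢
      exact ⟨⟨hp.1.2, hp.1.1⟩, hp.2.2⟩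
    · intro p hp
      simp only [mem_filter, Finset.mem_product, Prod.fst_swap, Prod.snd_swap] at hp ⊢
      exact ⟨⟨hp.1.2, hp.1.1⟩, by omega, hp.2⟩
    · intro p _; simp
    · intro p _; simp
    · intro p _; simp [mul_comm]
  have e2 : ∑ p ∈ (s ×ˢ s).filter (fun p => ¬ p.2 < p.1 ∧ ¬ p.1 < p.2), z p.1 * (starRingEnd ℂ) (z p.2) =
      ∑ k ∈ s, ((‖z k‖^2 : ℝ):ℂ) := by
    apply Finset.sum_nbij' Prod.fst (fun k => (k,k))
    · intro p hp
      simp only [mem_filter, Finset.mem_product] at hp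
      exact hp.1.1
    · intro k hk
      simp only [mem_filter, Finset.mem_product]
      exact ⟨⟨hk, hk⟩, by omega, by omega⟩
    · intro p hp
      simp only [mem_filter, Finset.mem_product] at hp
      ext
      · rfl
      · simp only []; omega
    · intro p _; rfl
    · intro p hp
      simp only [mem_filter, Finset.mem_product] at hp
      have : p.2 = p.1 := by omega
      rw [this, Complex.mul_conj']; push_cast; rfl
  rw [e1, e2] at h
  have h' := congrArg Complex.re h
  rw [Complex.ofReal_re, Complex.add_re, Complex.add_re, Complex.conj_re, ← Complex.ofReal_sum, Complex.ofReal_re] at h'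
  rw [h']; ring

lemma bilF_sum (c θ : ℝ) (b : ℕ → ℂ) (A : ℝ) (M K Q : ℕ) (hA : ∀ k ∈ Ioc K (4*K), ‖b k‖ ≤ A) (hA0 : 0 ≤ A) :
    ∑ v ∈ range (4*K/Q+1), ∑ m ∈ Ioc M (4*M), ‖bilF c θ b K Q m v‖^2 ≤
     9 * A^2 * (M * K) + 2 * ‖∑ m ∈ Ioc M (4*M), ∑ p ∈ blockPairs K Q, (b p.1 * (starRingEnd ℂ) (b p.2)) * ee ((θ * (m:ℝ)^c) * yy c p)‖ := by
  have hfl : ∀ k ∈ Ioc K (4*K), k / Q ∈ range (4*K/Q+1) := by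
    intro k hk
    rw [mem_Ioc] at hk
    rw [mem_range]
    exact Nat.lt_succ_of_le (Nat.div_le_div_right hk.2)
  have e1 : ∀ m v, ‖bilF c θ b K Q m v‖^2 = ∑ k ∈ (Ioc K (4*K)).filter (fun k => k / Q = v), ‖b k‖^2 +
     2 * (∑ p ∈ (blockPairs K Q).filter (fun p => p.1 / Q = v), (b p.1 * (starRingEnd ℂ) (b p.2)) * ee ((θ * (m:ℝ)^c) * yy c p)).re := by
    intro m v
    unfold bilF
    rw [sq_sum_split]
    congr 1
    · apply Finset.sum_congr rfl
      intro k _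
      rw [norm_mul, norm_ee, mul_one]
    · congr 2
      apply Finset.sum_congr
      · ext p
        simp only [blockPairs, mem_filter, Finset.mem_product]
        constructor
        · rintro ⟨⟨⟨a, b⟩, d, e⟩, f⟩; exact ⟨⟨⟨a, d⟩, f, by omega⟩, b⟩
        · rintro ⟨⟨⟨a, d⟩, f, g⟩, b⟩; exact ⟨⟨⟨a, b⟩, d, by omega⟩, f⟩
      · intro p _
        rw [map_mul, ← ee_neg, show (θ * (m:ℝ)^c) * yy c p = θ * ((m:ℝ)^c * (p.1:ℝ)^c) + -(θ * ((m:ℝ)^c * (p.2:ℝ)^c)) by unfold yy; ring, ee_add]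
        ring
  simp_rw [e1]
  rw [Finset.sum_comm]
  simp_rw [Finset.sum_add_distrib, ← Finset.mul_sum, ← Complex.re_sum]
  have hfl2 : ∀ p ∈ blockPairs K Q, p.1 / Q ∈ range (4*K/Q+1) := by
    intro p hp
    unfold blockPairs at hp
    exact hfl _ (Finset.mem_product.1 (mem_filter.1 hp).1).1
  simp_rw [Finset.sum_fiberwise_of_maps_to hfl2, Finset.sum_fiberwise_of_maps_to hfl]
  have d1 : ∑ m ∈ Ioc M (4*M), ∑ k ∈ Ioc K (4*K), ‖b k‖^2 ≤ 9 * A^2 * (M*K) := by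
    calc _ ≤ ∑ m ∈ Ioc M (4*M), ∑ k ∈ Ioc K (4*K), A^2 := by
          apply Finset.sum_le_sum; intro m _
          apply Finset.sum_le_sum; intro k hk
          have := hA k hk
          gcongr
      _ = _ := by
        simp only [Finset.sum_const, Nat.card_Ioc, nsmul_eq_mul]
        rw [show 4*M - M = 3*M by omega, show 4*K-K = 3*K by omega]; push_cast; ring
  have d2 := Complex.re_le_norm (∑ m ∈ Ioc M (4*M), ∑ p ∈ blockPairs K Q, (b p.1 * (starRingEnd ℂ) (b p.2)) * ee ((θ * (m:ℝ)^c) * yy c p))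
  linarith

lemma gauss_count {ι : Type*} (J : Finset ι) (y : ι → ℝ) (R Δ : ℝ) (hΔ : 0 ≤ Δ) :
    ∑ j ∈ J, ∑ j' ∈ J, rexp (-π*R^2*(y j - y j')^2) ≤
      (((J ×ˢ J).filter (fun z => |y z.1 - y z.2| ≤ Δ)).card : ℝ) + (J.card:ℝ)^2 * rexp (-π*R^2*Δ^2) := by
  rw [← Finset.sum_product' (f := fun j j' => rexp (-π*R^2*(y j - y j')^2))]
  calc _ ≤ ∑ z ∈ J ×ˢ J, ((if |y z.1 - y z.2| ≤ Δ then (1:ℝ) else 0) + rexp (-π*R^2*Δ^2)) := by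
        apply Finset.sum_le_sum
        intro z _
        split_ifs with h
        · have h1 : rexp (-π*R^2*(y z.1 - y z.2)^2) ≤ 1 := by
            apply Real.exp_le_one_iff.2
            have : 0 ≤ π*R^2*(y z.1 - y z.2)^2 := by positivity
            linarith
          have := Real.exp_pos (-π*R^2*Δ^2)
          linarith
        · rw [zero_add]
          apply Real.exp_le_exp.2
          push Not at h
          have h2 : Δ^2 ≤ (y z.1 - y z.2)^2 := by
            rw [← sq_abs (y z.1 - y z.2)]; gcongr
          have : π*R^2*Δ^2 ≤ π*R^2*(y z.1 - y z.2)^2 := by gcongr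
          linarith
    _ = _ := by
      rw [Finset.sum_add_distrib, Finset.sum_const, Finset.card_product, nsmul_eq_mul, Finset.sum_boole]
      push_cast; ring

set_option maxHeartbeats 1000000 in
lemma D_bound (c : ℝ) (hc1 : 1 < c) (hc2 : c < 2) (θ : ℝ) (hθ : θ ≠ 0) (β : ℕ × ℕ → ℂ) (B : ℝ) (M K Q : ℕ) (hM : 1 ≤ M) (hQ : 1 ≤ Q) (hQK : Q^2 ≤ K)
    (hB : ∀ p ∈ blockPairs K Q, ‖β p‖ ≤ B) (W : ℝ) (hW : W = |θ| * ((M:ℝ)^c * (K:ℝ)^c)) :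
    ‖∑ m ∈ Ioc M (4*M), ∑ p ∈ blockPairs K Q, β p * ee ((θ * (m:ℝ)^c) * yy c p)‖^2 ≤
     (4608 * rexp (4*π) * (65536/(c-1) + 9)) * B^2 * (M*(W*Q/K+M)*((1 + log (8*K))^4*(Q*K+Q*(K:ℝ)^3/W+(Q:ℝ)^4))) := by
  have hQKn : Q ≤ K := by nlinarith
  have hK : 1 ≤ K := by omega
  have hK0 : (1:ℝ) ≤ K := by exact_mod_cast hK
  have hM0 : (1:ℝ) ≤ M := by exact_mod_cast hM
  have hQ0 : (1:ℝ) ≤ Q := by exact_mod_cast hQ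
  have hQ2 : (Q:ℝ)^2 ≤ K := by exact_mod_cast hQK
  have hQK' : (Q:ℝ) ≤ K := by exact_mod_cast hQKn
  have hθp : 0 < |θ| := abs_pos.2 hθ
  have hγ : 0 < c - 1 := by linarith
  have hWp : 0 < W := by rw [hW]; positivity
  set R : ℝ := |θ| * (4*M)^c with hR
  have hRp : 0 < R := by positivity
  have hKc : 0 < (K:ℝ)^c := by positivity
  have hMc : 0 < (M:ℝ)^c := by positivity
  have h4c : (4:ℝ)^c ≤ 16 := by
    calc (4:ℝ)^c ≤ 4^(2:ℝ) := rpow_le_rpow_of_exponent_le (by norm_num) hc2.le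
      _ = 16 := by norm_num
  have h4c1 : (1:ℝ) ≤ (4:ℝ)^c := Real.one_le_rpow (by norm_num) (by linarith)
  have hR4 : R = |θ| * (M:ℝ)^c * 4^c := by
    rw [hR, mul_rpow (by norm_num) (by positivity)]; ring
  have hR16 : R ≤ 16 * (|θ| * (M:ℝ)^c) := by
    rw [hR4, mul_comm 16]; gcongr
  have hR1 : |θ| * (M:ℝ)^c ≤ R := by
    rw [hR4]; exact le_mul_of_one_le_right (by positivity) h4c1
  set e1 : ℝ := 1/(48*Q*((K:ℝ)^c/K)) with he1
  set e2 : ℝ := |θ| * ((M:ℝ)^c/M)/2 with he2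
  have he1p : 0 < e1 := by positivity
  have he2p : 0 < e2 := by positivity
  set ε := min e1 e2 with hε
  have hεp : 0 < ε := lt_min he1p he2p
  have hεR : ε ≤ R := by
    refine (min_le_right _ _).trans (le_trans ?_ hR1)
    have : (M:ℝ)^c/M ≤ (M:ℝ)^c := div_le_self hMc.le hM0
    rw [he2]
    have h3 : |θ| * ((M:ℝ)^c/M) ≤ |θ| * (M:ℝ)^c := by gcongr
    have h4 : 0 < |θ| * (M:ℝ)^c := by positivity
    linarith
  have hls := large_sieve (blockPairs K Q) β (yy c) B R ε hB hRp hεp hεR ?_ (Ioc M (4*M)) (fun m : ℕ => θ * (m:ℝ)^c) ?_ ?_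
  · have hcs := cauchy_schwarz_norm (Ioc M (4*M)) (fun _ => (1:ℂ)) (fun m : ℕ => ∑ p ∈ blockPairs K Q, β p * ee ((θ * (m:ℝ)^c) * yy c p))
    simp only [one_mul, norm_one, one_pow, Finset.sum_const, Nat.card_Ioc, nsmul_eq_mul, mul_one] at hcs
    rw [show 4*M - M = 3*M by omega] at hcs
    set ℓ := 1 + log (8*K) with hℓ
    have hℓ1 : 1 ≤ ℓ := by
      rw [hℓ]; have := log_nonneg (by linarith : (1:ℝ) ≤ 8*K); linarith
    set Δ := ℓ/R with hΔ
    have hΔ0 : 0 ≤ Δ := by positivity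
    have hgc := gauss_count (blockPairs K Q) (yy c) R Δ hΔ0
    have hcp := count_pairs2 c hc1 hc2 K Q Δ hK hQ hQKn hΔ0
    rw [← hℓ] at hcp
    set E := Q*K+Q*(K:ℝ)^3/W+(Q:ℝ)^4 with hE
    have hE0 : 0 ≤ E := by positivity
    have n1 : Δ*Q*(K:ℝ)^2/(K:ℝ)^(c-1) ≤ ℓ * (Q*(K:ℝ)^3/W) := by
      have : Δ ≤ ℓ * (K:ℝ)^c/W := by
        rw [hΔ, hW]
        rw [show ℓ * (K:ℝ)^c/(|θ| * ((M:ℝ)^c * (K:ℝ)^c)) = ℓ/(|θ| * (M:ℝ)^c) by field_simp]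
        gcongr
      calc Δ*Q*(K:ℝ)^2/(K:ℝ)^(c-1) ≤ (ℓ * (K:ℝ)^c/W)*Q*(K:ℝ)^2/(K:ℝ)^(c-1) := by gcongr
        _ = _ := by
          rw [rpow_sub (by linarith), rpow_one]; field_simp
    have n2 : ((blockPairs K Q).card:ℝ)^2 * rexp (-π*R^2*Δ^2) ≤ 9 * (Q*K) := by
      have c1 : ((blockPairs K Q).card:ℝ) ≤ 3*K*Q := by exact_mod_cast card_blockPairs K Q hQ
      have c2 : rexp (-π*R^2*Δ^2) ≤ 1/(K:ℝ)^3 := by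
        rw [one_div, ← Real.exp_log (by positivity : (0:ℝ) < ((K:ℝ)^3)⁻¹), log_inv, log_pow]
        apply Real.exp_le_exp.2
        have : R^2*Δ^2 = ℓ^2 := by rw [hΔ]; field_simp
        rw [mul_assoc, this]
        have hl : log K ≤ ℓ := by
          have := log_le_log (by linarith) (by linarith : (K:ℝ) ≤ 8*K); linarith
        have h3 := Real.pi_gt_three
        push_cast
        have q1 : ℓ ≤ ℓ^2 := by rw [sq]; exact le_mul_of_one_le_left (by linarith) hℓ1
        have q2 : 3 * ℓ^2 ≤ π * ℓ^2 := by gcongr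
        linarith
      calc ((blockPairs K Q).card:ℝ)^2 * rexp (-π*R^2*Δ^2) ≤ (3*K*Q)^2 * (1/(K:ℝ)^3) := by gcongr
        _ = 9 * ((Q:ℝ)^2/K) := by field_simp; ring
        _ ≤ 9 * (1:ℝ) := by gcongr; rw [div_le_one (by linarith)]; exact hQ2
        _ ≤ 9 * ((Q:ℝ)*K) := by gcongr; exact one_le_mul_of_one_le_of_one_le hQ0 hK0
    have n3 : ∑ j ∈ blockPairs K Q, ∑ j' ∈ blockPairs K Q, rexp (-π*R^2*(yy c j - yy c j')^2) ≤ (65536/(c-1) + 9) * (ℓ^4*E) := by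
      have h0 : 0 ≤ Q*(K:ℝ)^3/W := by positivity
      have h1 : Q*K + Δ*Q*(K:ℝ)^2/(K:ℝ)^(c-1) + (Q:ℝ)^4 ≤ ℓ * E := by
        rw [hE]
        have g1 : (Q*K:ℝ) ≤ ℓ * (Q*K) := le_mul_of_one_le_left (by positivity) hℓ1
        have g2 : (Q:ℝ)^4 ≤ ℓ * (Q:ℝ)^4 := le_mul_of_one_le_left (by positivity) hℓ1
        linarith
      have h2 : (65536/(c-1)) * ℓ^3 * (Q*K + Δ*Q*(K:ℝ)^2/(K:ℝ)^(c-1) + (Q:ℝ)^4) ≤ (65536/(c-1)) * ℓ^3 * (ℓ * E) := by gcongr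
      have h3 : (Q*K:ℝ) ≤ ℓ^4*E := by
        have g1 : (Q*K:ℝ) ≤ E := by
          rw [hE]; have : 0 ≤ (Q:ℝ)^4 := by positivity
          linarith
        exact g1.trans (le_mul_of_one_le_left hE0 (one_le_pow₀ hℓ1))
      linarith
    have n4 : R/ε ≤ 768 * (W*Q/K + M) := by
      have : 1/ε ≤ 1/e1 + 1/e2 := by
        rcases min_choice e1 e2 with h | h
        · rw [hε, h]; have : 0 < 1/e2 := by positivity
          linarith
        · rw [hε, h]; have : 0 < 1/e1 := by positivity
          linarith
      calc R/ε = R*(1/ε) := by ring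
        _ ≤ (16 * (|θ| * (M:ℝ)^c)) * (1/e1 + 1/e2) := by gcongr
        _ = 768 * (W*Q/K) + 32 * M := by rw [he1, he2, hW]; field_simp; ring
        _ ≤ _ := by linarith
    have n5 : ∑ m ∈ Ioc M (4*M), ‖∑ p ∈ blockPairs K Q, β p * ee ((θ * (m:ℝ)^c) * yy c p)‖^2 ≤
       (2*rexp (4*π)) * (B^2 * (768 * (W*Q/K + M))) * ((65536/(c-1) + 9) * (ℓ^4*E)) := by
      refine hls.trans ?_
      have hN0 : 0 ≤ ∑ j ∈ blockPairs K Q, ∑ j' ∈ blockPairs K Q, rexp (-π*R^2*(yy c j - yy c j')^2) := by positivity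
      rw [mul_div_assoc]
      gcongr
    calc _ ≤ _ := hcs
      _ ≤ ((3*M:ℕ):ℝ) * ((2*rexp (4*π)) * (B^2 * (768 * (W*Q/K + M))) * ((65536/(c-1) + 9) * (ℓ^4*E))) := by gcongr
      _ = _ := by push_cast; ring
  · intro p hp
    have hm := mem_blockPairs K Q hQ p hp
    have := pow_diff_bounds c hc1 hc2 K p.1 p.2 hK hm.1 hm.2.2.1 hm.2.1
    have hq : ((p.1 - p.2 : ℕ):ℝ) ≤ Q := by exact_mod_cast hm.2.2.2
    have hy0 : 0 ≤ yy c p := by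
      unfold yy
      refine le_trans ?_ this.1
      positivity
    rw [abs_of_nonneg hy0]
    calc ε * yy c p ≤ e1 * (8 * ((K:ℝ)^c/K) * Q) := by
          gcongr
          · exact min_le_left _ _
          · exact this.2.trans (by gcongr)
      _ = 1/6 := by rw [he1]; field_simp; norm_num
  · intro m hm
    rw [mem_Ioc] at hm
    have : (m:ℝ) ≤ 4*M := by exact_mod_cast hm.2
    rw [abs_mul, abs_of_nonneg (by positivity : (0:ℝ) ≤ (m:ℝ)^c)]
    rw [hR]; gcongr
  · have gen : ∀ m m' : ℕ, M < m' → m' < m → m ≤ 4*M → 2*ε ≤ |θ * (m:ℝ)^c - θ * (m':ℝ)^c| := by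
      intro m m' h1 h2 h3
      have := (pow_diff_bounds c hc1 hc2 M m m' hM h1 h3 h2).1
      have hq : (1:ℝ) ≤ ((m-m' : ℕ):ℝ) := by exact_mod_cast (by omega : 1 ≤ m - m')
      rw [← mul_sub, abs_mul]
      calc 2*ε ≤ 2*e2 := by gcongr; exact min_le_right _ _
        _ = |θ| * ((M:ℝ)^c/M*1) := by rw [he2]; ring
        _ ≤ |θ| * ((M:ℝ)^c/M*((m-m' : ℕ):ℝ)) := by gcongr
        _ ≤ |θ| * |(m:ℝ)^c - (m':ℝ)^c| := by gcongr; exact this.trans (le_abs_self _)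
    intro m hm m' hm' hne
    rw [mem_Ioc] at hm hm'
    rcases lt_or_gt_of_ne hne with h | h
    · rw [abs_sub_comm]; exact gen m' m hm.1 h hm'.2
    · exact gen m m' hm'.1 h hm.2

theorem method2 (c : ℝ) (hc1 : 1 < c) (hc2 : c < 2) : ∃ C : ℝ, 0 < C ∧ ∀ (θ : ℝ) (a b : ℕ → ℂ) (A : ℝ) (M K Q x1 x2 : ℕ),
    θ ≠ 0 → 0 ≤ A → 1 ≤ M → 1 ≤ Q → Q^2 ≤ K → (∀ k ∈ Ioc K (4*K), ‖b k‖ ≤ A) →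
    ∀ W : ℝ, W = |θ| * ((M:ℝ)^c * (K:ℝ)^c) →
    ‖bil c θ a b M K x1 x2‖^2 ≤ C * (∑ m ∈ Ioc M (4*M), ‖a m‖^2) * (K/Q) * A^2 *
      (M*K + √(M*(W*Q/K+M)*((1 + log (8*K))^4*(Q*K+Q*(K:ℝ)^3/W+(Q:ℝ)^4)))) := by
  set C1 := 4608 * rexp (4*π) * (65536/(c-1) + 9) with hC1
  have hγ : 0 < c - 1 := by linarith
  have hC1p : 0 < C1 := by positivity
  refine ⟨5*(15 + 2*√C1), by positivity, ?_⟩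
  intro θ a b A M K Q x1 x2 hθ hA0 hM hQ hQK hA W hW
  have hQKn : Q ≤ K := by nlinarith
  have hQ0 : (1:ℝ) ≤ Q := by exact_mod_cast hQ
  have hQ2 : (Q:ℝ)^2 ≤ K := by exact_mod_cast hQK
  have hQK' : (Q:ℝ) ≤ K := by exact_mod_cast hQKn
  have hD := D_bound c hc1 hc2 θ hθ (fun p => b p.1 * (starRingEnd ℂ) (b p.2)) (A^2) M K Q hM hQ hQK ?_ W hW
  · have h1 := bilF_sum c θ b A M K Q hA hA0
    set D := ∑ m ∈ Ioc M (4*M), ∑ p ∈ blockPairs K Q, (b p.1 * (starRingEnd ℂ) (b p.2)) * ee ((θ * (m:ℝ)^c) * yy c p) with hDd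
    set Y := M*(W*Q/K+M)*((1 + log (8*K))^4*(Q*K+Q*(K:ℝ)^3/W+(Q:ℝ)^4)) with hY
    have hD2 : ‖D‖ ≤ √C1 * A^2 * √Y := by
      have hWp : 0 ≤ W := by rw [hW]; positivity
      have hY0 : 0 ≤ Y := by positivity
      apply le_of_sq_le_sq _ (by positivity)
      rw [mul_pow, mul_pow, Real.sq_sqrt hC1p.le, Real.sq_sqrt hY0]
      exact hD
    have h2 : ∑ v ∈ range (4*K/Q+1), ∑ m ∈ Ioc M (4*M), ‖bilI c θ b K Q x1 x2 m v‖^2 ≤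
        ∑ v ∈ range (4*K/Q+1), ∑ m ∈ Ioc M (4*M), ‖bilF c θ b K Q m v‖^2 + 6 * M * (A*Q)^2 := by
      calc _ ≤ ∑ v ∈ range (4*K/Q+1), ∑ m ∈ Ioc M (4*M), (‖bilF c θ b K Q m v‖^2 + ((if x1/m/Q = v then (A*Q)^2 else 0) + (if x2/m/Q = v then (A*Q)^2 else 0))) := by
            apply Finset.sum_le_sum; intro v _
            apply Finset.sum_le_sum; intro m hm
            rw [mem_Ioc] at hm
            exact bilI_good_bad c θ b A K Q x1 x2 m v hA hA0 hQ (by omega)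
        _ = ∑ v ∈ range (4*K/Q+1), ∑ m ∈ Ioc M (4*M), ‖bilF c θ b K Q m v‖^2 +
            ∑ m ∈ Ioc M (4*M), ∑ v ∈ range (4*K/Q+1), ((if x1/m/Q = v then (A*Q)^2 else 0) + (if x2/m/Q = v then (A*Q)^2 else 0)) := by
            rw [Finset.sum_comm (s := Ioc M (4*M)), ← Finset.sum_add_distrib]
            apply Finset.sum_congr rfl; intro v _
            rw [Finset.sum_add_distrib]
        _ ≤ _ := by
          gcongr
          calc _ ≤ ∑ m ∈ Ioc M (4*M), 2*(A*Q)^2 := by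
                apply Finset.sum_le_sum; intro m _
                rw [Finset.sum_add_distrib, Finset.sum_ite_eq, Finset.sum_ite_eq]
                have : 0 ≤ (A*Q)^2 := by positivity
                split_ifs <;> linarith
            _ = _ := by
              rw [Finset.sum_const, Nat.card_Ioc, nsmul_eq_mul, show 4*M - M = 3*M by omega]; push_cast; ring
    have h3 : ∑ v ∈ range (4*K/Q+1), ∑ m ∈ Ioc M (4*M), ‖bilI c θ b K Q x1 x2 m v‖^2 ≤
        (15 + 2*√C1) * A^2 * (M*K + √Y) := by
      have g1 : 6 * M * (A*Q)^2 ≤ 6 * A^2 * (M*K) := by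
        calc 6 * M * (A*Q)^2 = 6 * A^2 * (M * Q^2) := by ring
          _ ≤ _ := by gcongr
      have g2 : 0 ≤ √C1 * A^2 * (M*K) := by positivity
      have g3 : 0 ≤ A^2 * √Y := by positivity
      nlinarith
    have h4 := block_cauchy c θ a b M K Q x1 x2
    have h5 : ((4*K/Q : ℕ):ℝ) + 1 ≤ 5 * (K/Q) := by
      have : ((4*K/Q : ℕ):ℝ) ≤ ((4*K:ℕ):ℝ)/Q := Nat.cast_div_le
      have h6 : 1 ≤ (K:ℝ)/Q := by rw [le_div_iff₀ (by linarith)]; linarith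
      push_cast at this
      rw [mul_div_assoc] at this
      linarith
    calc _ ≤ _ := h4
      _ ≤ (∑ m ∈ Ioc M (4*M), ‖a m‖^2) * (5 * (K/Q)) * ((15 + 2*√C1) * A^2 * (M*K + √Y)) := by gcongr
      _ = _ := by ring
  · intro p hp
    have hm := mem_blockPairs K Q hQ p hp
    rw [norm_mul, RCLike.norm_conj, sq]
    gcongr
    · exact hA _ (mem_Ioc.2 ⟨by omega, by omega⟩)
    · exact hA _ (mem_Ioc.2 ⟨by omega, by omega⟩)

lemma sum_inv_mult (N g : ℕ) (hg : 1 ≤ g) :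
    ∑ d ∈ (Icc 1 N).filter (fun d => g ∣ d), 1/(d:ℝ) ≤ (1/(g:ℝ)) * ∑ j ∈ Icc 1 N, 1/(j:ℝ) := by
  have e : ∑ d ∈ (Icc 1 N).filter (fun d => g ∣ d), 1/(d:ℝ) = ∑ j ∈ Icc 1 (N/g), 1/((g*j : ℕ):ℝ) := by
    symm
    apply Finset.sum_nbij' (fun j => g*j) (fun d => d/g)
    · intro j hj
      rw [mem_Icc] at hj
      rw [mem_filter, mem_Icc]
      refine ⟨⟨Nat.mul_pos hg hj.1, ?_⟩, Dvd.intro _ rfl⟩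
      have := (Nat.le_div_iff_mul_le hg).1 hj.2
      rwa [mul_comm]
    · intro d hd
      rw [mem_filter, mem_Icc] at hd
      rw [mem_Icc]
      exact ⟨Nat.div_pos (Nat.le_of_dvd hd.1.1 hd.2) hg, Nat.div_le_div_right hd.1.2⟩
    · intro j _; exact Nat.mul_div_cancel_left j hg
    · intro d hd
      rw [mem_filter] at hd
      exact Nat.mul_div_cancel' hd.2
    · intro j _; rfl
  rw [e, Finset.mul_sum]
  calc _ = ∑ j ∈ Icc 1 (N/g), 1/(g:ℝ) * (1/(j:ℝ)) := by
        apply Finset.sum_congr rfl; intro j _; push_cast; rw [div_mul_div_comm, one_mul]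
    _ ≤ _ := by
      apply Finset.sum_le_sum_of_subset_of_nonneg
      · apply Finset.Icc_subset_Icc_right; exact Nat.div_le_self _ _
      · intros; positivity

lemma sum_divisors_sq (N : ℕ) :
    ∑ k ∈ Icc 1 N, ((k.divisors.card:ℕ):ℝ)^2 ≤ N * (1 + log N)^3 := by
  set H := ∑ j ∈ Icc 1 N, 1/(j:ℝ) with hH
  have hH0 : 0 ≤ H := by positivity
  have h1 : ∀ k ∈ Icc 1 N, ((k.divisors.card:ℕ):ℝ)^2 =
      ∑ d ∈ Icc 1 N, ∑ e ∈ Icc 1 N, if Nat.lcm d e ∣ k then (1:ℝ) else 0 := by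
    intro k hk
    rw [mem_Icc] at hk
    have : ((k.divisors.card:ℕ):ℝ) = ∑ d ∈ Icc 1 N, if d ∣ k then (1:ℝ) else 0 := by
      rw [Finset.sum_boole]
      congr 2
      ext d
      simp only [Nat.mem_divisors, mem_filter, mem_Icc]
      constructor
      · rintro ⟨a, b⟩; exact ⟨⟨Nat.pos_of_dvd_of_pos a hk.1, (Nat.le_of_dvd hk.1 a).trans hk.2⟩, a⟩
      · rintro ⟨_, a⟩; exact ⟨a, by omega⟩
    rw [this, sq, Finset.sum_mul_sum]
    apply Finset.sum_congr rfl; intro d _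
    apply Finset.sum_congr rfl; intro e _
    by_cases hd : d ∣ k <;> by_cases he : e ∣ k <;> simp [hd, he, Nat.lcm_dvd_iff]
  rw [Finset.sum_congr rfl h1, Finset.sum_comm]
  have h2 : ∀ d ∈ Icc 1 N, ∀ e ∈ Icc 1 N, ∑ k ∈ Icc 1 N, (if Nat.lcm d e ∣ k then (1:ℝ) else 0) ≤
      N * ∑ g ∈ Icc 1 N, (g:ℝ) * ((if g ∣ d then 1/(d:ℝ) else 0) * (if g ∣ e then 1/(e:ℝ) else 0)) := by
    intro d hd e he
    rw [mem_Icc] at hd he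
    have hd0 : (0:ℝ) < d := by exact_mod_cast hd.1
    have he0 : (0:ℝ) < e := by exact_mod_cast he.1
    have a1 : ∑ k ∈ Icc 1 N, (if Nat.lcm d e ∣ k then (1:ℝ) else 0) = ((N / Nat.lcm d e : ℕ):ℝ) := by
      rw [Finset.sum_boole]
      congr 1
      have := Nat.Ioc_filter_dvd_card_eq_div N (Nat.lcm d e)
      rw [← this]; rfl
    rw [a1]
    refine Nat.cast_div_le.trans ?_
    rw [div_eq_mul_one_div]
    gcongr
    have hg : Nat.gcd d e ∈ Icc 1 N := by
      rw [mem_Icc]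
      exact ⟨Nat.gcd_pos_of_pos_left _ hd.1, (Nat.gcd_le_left _ hd.1).trans hd.2⟩
    refine le_trans ?_ (Finset.single_le_sum (f := fun g : ℕ => (g:ℝ) * ((if g ∣ d then 1/(d:ℝ) else 0) * (if g ∣ e then 1/(e:ℝ) else 0)))
      (fun g _ => by positivity) hg)
    rw [if_pos (Nat.gcd_dvd_left _ _), if_pos (Nat.gcd_dvd_right _ _)]
    have hl : (Nat.gcd d e : ℝ) * Nat.lcm d e = d * e := by exact_mod_cast Nat.gcd_mul_lcm d e
    have hl0 : (0:ℝ) < Nat.lcm d e := by exact_mod_cast Nat.lcm_pos hd.1 he.1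
    rw [div_le_iff₀ hl0]
    rw [show (Nat.gcd d e : ℝ) * (1/(d:ℝ) * (1/(e:ℝ))) * Nat.lcm d e = (Nat.gcd d e : ℝ) * Nat.lcm d e * (1/(d*e)) by field_simp, hl]
    rw [mul_one_div, div_self (by positivity)]
  calc _ = ∑ d ∈ Icc 1 N, ∑ e ∈ Icc 1 N, ∑ k ∈ Icc 1 N, (if Nat.lcm d e ∣ k then (1:ℝ) else 0) := by
        apply Finset.sum_congr rfl; intro d _; rw [Finset.sum_comm]
    _ ≤ ∑ d ∈ Icc 1 N, ∑ e ∈ Icc 1 N, N * ∑ g ∈ Icc 1 N, (g:ℝ) * ((if g ∣ d then 1/(d:ℝ) else 0) * (if g ∣ e then 1/(e:ℝ) else 0)) :=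
        Finset.sum_le_sum fun d hd => Finset.sum_le_sum fun e he => h2 d hd e he
    _ = N * ∑ g ∈ Icc 1 N, (g:ℝ) * ((∑ d ∈ (Icc 1 N).filter (fun d => g ∣ d), 1/(d:ℝ)) * (∑ d ∈ (Icc 1 N).filter (fun d => g ∣ d), 1/(d:ℝ))) := by
        simp_rw [← Finset.mul_sum]
        congr 1
        have : ∀ d, ∑ e ∈ Icc 1 N, ∑ g ∈ Icc 1 N, (g:ℝ) * ((if g ∣ d then 1/(d:ℝ) else 0) * (if g ∣ e then 1/(e:ℝ) else 0)) =
          ∑ g ∈ Icc 1 N, ∑ e ∈ Icc 1 N, (g:ℝ) * ((if g ∣ d then 1/(d:ℝ) else 0) * (if g ∣ e then 1/(e:ℝ) else 0)) := fun d => Finset.sum_comm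
        rw [Finset.sum_congr rfl fun d _ => this d, Finset.sum_comm]
        apply Finset.sum_congr rfl; intro g _
        rw [Finset.sum_filter, Finset.sum_mul_sum, Finset.mul_sum]
        apply Finset.sum_congr rfl; intro d _
        rw [Finset.mul_sum]
    _ ≤ N * ∑ g ∈ Icc 1 N, (1/(g:ℝ)) * H^2 := by
        apply mul_le_mul_of_nonneg_left _ (by positivity)
        apply Finset.sum_le_sum
        intro g hg
        rw [mem_Icc] at hg
        have hg0 : (0:ℝ) < g := by exact_mod_cast hg.1
        have := sum_inv_mult N g hg.1
        have h3 : (∑ d ∈ (Icc 1 N).filter (fun d => g ∣ d), 1/(d:ℝ)) * (∑ d ∈ (Icc 1 N).filter (fun d => g ∣ d), 1/(d:ℝ)) ≤ (1/(g:ℝ)*H) * (1/(g:ℝ)*H) :=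
          mul_le_mul this this (Finset.sum_nonneg fun _ _ => by positivity) (by positivity)
        calc _ ≤ (g:ℝ) * ((1/(g:ℝ)*H) * (1/(g:ℝ)*H)) := mul_le_mul_of_nonneg_left h3 hg0.le
          _ = _ := by field_simp
    _ = N * H^3 := by rw [← Finset.sum_mul, ← hH]; ring
    _ ≤ _ := by
      gcongr
      exact sum_inv_le N

lemma divisor_bound (ε : ℝ) (hε : 0 < ε) (hε1 : ε ≤ 1) : ∃ C : ℝ, 1 ≤ C ∧ ∀ n : ℕ, 1 ≤ n → ((n.divisors.card:ℕ):ℝ) ≤ C * (n:ℝ)^ε := by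
  obtain ⟨P, hP⟩ := exists_nat_ge ((2:ℝ)^(1/ε))
  set C' := 2/ε with hC'
  have hC1 : 1 ≤ C' := by rw [hC', le_div_iff₀ hε]; linarith
  refine ⟨C'^P, one_le_pow₀ hC1, ?_⟩
  intro n hn
  have hn0 : n ≠ 0 := by omega
  rw [Nat.card_divisors hn0]
  have e1 : (n:ℝ)^ε = ∏ p ∈ n.primeFactors, (((p:ℝ)^(n.factorization p)))^ε := by
    rw [Real.finsetProd_rpow]
    · congr 1
      have := Nat.prod_factorization_pow_eq_self hn0
      conv_lhs => rw [← this]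
      rw [Finsupp.prod]; push_cast; rfl
    · intros; positivity
  have key : ∀ p ∈ n.primeFactors, ((n.factorization p + 1 : ℕ):ℝ) ≤ (if p < P then C' else 1) * (((p:ℝ)^(n.factorization p)))^ε := by
    intro p hp
    set a := n.factorization p
    have hp2 : (2:ℝ) ≤ p := by exact_mod_cast (Nat.prime_of_mem_primeFactors hp).two_le
    have hsw : (((p:ℝ)^a))^ε = ((p:ℝ)^ε)^a := by
      rw [← rpow_natCast, ← rpow_natCast, ← rpow_mul (by linarith), ← rpow_mul (by linarith), mul_comm]
    rw [hsw]
    split_ifs with h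
    · have h2 : 1 + ε/2 ≤ (p:ℝ)^ε := by
        calc 1 + ε/2 ≤ 1 + ε * log 2 := by
              have := log_two_gt_d9; nlinarith
          _ ≤ rexp (ε * log 2) := by linarith [Real.add_one_le_exp (ε * log 2)]
          _ = 2^ε := by rw [rpow_def_of_pos (by norm_num), mul_comm]
          _ ≤ _ := by gcongr
      have h3 : 1 + (a:ℝ) * (ε/2) ≤ ((p:ℝ)^ε)^a :=
        (one_add_mul_le_pow (by linarith : (-2:ℝ) ≤ ε/2) a).trans (by gcongr)
      calc ((a+1:ℕ):ℝ) ≤ C' * (1 + (a:ℝ) * (ε/2)) := by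
            rw [hC']; push_cast
            have : 2/ε * (1 + (a:ℝ)*(ε/2)) = 2/ε + a := by field_simp
            rw [this]; linarith
        _ ≤ _ := by gcongr
    · push Not at h
      have hPp : (P:ℝ) ≤ p := by exact_mod_cast h
      have h2 : (2:ℝ) ≤ (p:ℝ)^ε := by
        calc (2:ℝ) = ((2:ℝ)^(1/ε))^ε := by rw [← rpow_mul (by norm_num), one_div, inv_mul_cancel₀ hε.ne', rpow_one]
          _ ≤ _ := by gcongr; linarith
      rw [one_mul]
      calc ((a+1:ℕ):ℝ) ≤ ((2^a:ℕ):ℝ) := by exact_mod_cast Nat.lt_two_pow_self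
        _ = (2:ℝ)^a := by push_cast; rfl
        _ ≤ _ := by gcongr
  rw [e1]
  push_cast
  calc _ ≤ ∏ p ∈ n.primeFactors, (if p < P then C' else 1) * (((p:ℝ)^(n.factorization p)))^ε := by
        apply Finset.prod_le_prod
        · intros; positivity
        · intro p hp; exact_mod_cast key p hp
    _ = (∏ p ∈ n.primeFactors, (if p < P then C' else 1)) * ∏ p ∈ n.primeFactors, (((p:ℝ)^(n.factorization p)))^ε := Finset.prod_mul_distrib
    _ ≤ _ := by
      gcongr
      rw [Finset.prod_ite, Finset.prod_const, Finset.prod_const_one, mul_one]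
      apply pow_le_pow_right₀ hC1
      calc _ ≤ (range P).card := by
            apply Finset.card_le_card
            intro p hp
            rw [mem_filter] at hp
            exact mem_range.2 hp.2
        _ = P := Finset.card_range P

lemma abel_mono (w : ℕ → ℝ) (z : ℕ → ℂ) (q : ℕ) (B : ℝ) (p : ℕ) (hpq : p ≤ q) (hw : ∀ k, p ≤ k → w k ≤ w (k+1)) (hw0 : 0 ≤ w p)
    (hB : ∀ p', p ≤ p' → p' ≤ q → ‖∑ k ∈ Ico p' q, z k‖ ≤ B) :
    ‖∑ k ∈ Ico p q, (w k : ℂ) * z k‖ ≤ w q * B := by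
  have key : ∀ n, ∀ p', p ≤ p' → p' + n = q → ‖∑ k ∈ Ico p' q, (w k : ℂ) * z k - (w p' : ℂ) * ∑ k ∈ Ico p' q, z k‖ ≤ (w q - w p') * B := by
    intro n
    induction n with
    | zero => intro p' _ h; have : p' = q := by omega
              subst this; simp
    | succ n ih =>
      intro p' hp' h
      have h1 := ih (p'+1) (by omega) (by omega)
      have h2 := hB (p'+1) (by omega) (by omega)
      rw [Finset.sum_eq_sum_Ico_succ_bot (by omega : p' < q), Finset.sum_eq_sum_Ico_succ_bot (by omega : p' < q)]
      have h3 := hw p' hp'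
      calc _ = ‖(∑ k ∈ Ico (p'+1) q, (w k : ℂ) * z k - (w (p'+1) : ℂ) * ∑ k ∈ Ico (p'+1) q, z k) + ((w (p'+1) - w p' : ℝ) : ℂ) * ∑ k ∈ Ico (p'+1) q, z k‖ := by
            congr 1; push_cast; ring
        _ ≤ (w q - w (p'+1)) * B + (w (p'+1) - w p') * B := by
            refine (norm_add_le _ _).trans (add_le_add h1 ?_)
            rw [norm_mul, Complex.norm_real, Real.norm_of_nonneg (by linarith)]
            exact mul_le_mul_of_nonneg_left h2 (by linarith)
        _ = _ := by ring
  have h1 := key (q-p) p le_rfl (by omega)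
  have h2 := hB p le_rfl hpq
  calc _ = ‖(∑ k ∈ Ico p q, (w k : ℂ) * z k - (w p : ℂ) * ∑ k ∈ Ico p q, z k) + (w p : ℂ) * ∑ k ∈ Ico p q, z k‖ := by congr 1; ring
    _ ≤ (w q - w p) * B + w p * B := by
      refine (norm_add_le _ _).trans (add_le_add h1 ?_)
      rw [norm_mul, Complex.norm_real, Real.norm_of_nonneg hw0]
      exact mul_le_mul_of_nonneg_left h2 hw0
    _ = _ := by ring

section
open ArithmeticFunction ArithmeticFunction.zeta ArithmeticFunction.Moebius

/-- truncation `≤ U` -/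
noncomputable def trunc (f : ArithmeticFunction ℝ) (U : ℕ) : ArithmeticFunction ℝ := ⟨fun n => if n ≤ U then f n else 0, by simp⟩

lemma trunc_apply (f : ArithmeticFunction ℝ) (U n : ℕ) : trunc f U n = if n ≤ U then f n else 0 := rfl

lemma af_sub_apply (f g : ArithmeticFunction ℝ) (n : ℕ) : (f - g) n = f n - g n := by
  rw [sub_eq_add_neg]
  show f n + (-g n) = _
  ring

noncomputable def vbf (V : ℕ) : ArithmeticFunction ℝ := (ζ : ArithmeticFunction ℝ) * ((μ : ArithmeticFunction ℝ) - trunc (μ : ArithmeticFunction ℝ) V)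

lemma vaughan_id (U V : ℕ) : (Λ - trunc Λ U) = trunc (μ : ArithmeticFunction ℝ) V * ArithmeticFunction.log
    - (trunc (μ : ArithmeticFunction ℝ) V * trunc Λ U) * (ζ : ArithmeticFunction ℝ) + (Λ - trunc Λ U) * vbf V := by
  have h1 : (Λ * (ζ : ArithmeticFunction ℝ)) = ArithmeticFunction.log := vonMangoldt_mul_zeta
  have h2 : (ζ : ArithmeticFunction ℝ) * (μ : ArithmeticFunction ℝ) = 1 := coe_zeta_mul_coe_moebius
  rw [← h1, vbf]
  have : (Λ - trunc Λ U) * ((ζ : ArithmeticFunction ℝ) * ((μ : ArithmeticFunction ℝ) - trunc (μ : ArithmeticFunction ℝ) V))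
     = (Λ - trunc Λ U) * (((ζ : ArithmeticFunction ℝ) * (μ : ArithmeticFunction ℝ)) - (ζ : ArithmeticFunction ℝ) * trunc (μ : ArithmeticFunction ℝ) V) := by ring
  rw [this, h2]; ring

lemma vbf_bound (V k : ℕ) : |vbf V k| ≤ (k.divisors.card : ℝ) := by
  rw [vbf, coe_zeta_mul_apply]
  refine (Finset.abs_sum_le_sum_abs _ _).trans ?_
  rw [Finset.card_eq_sum_ones]; push_cast
  apply Finset.sum_le_sum; intro d _
  have : |((μ d : ℤ):ℝ)| ≤ 1 := by exact_mod_cast abs_moebius_le_one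
  rw [af_sub_apply, trunc_apply]
  split_ifs
  · simp
  · simpa using this

lemma vbf_zero (V k : ℕ) (hk : k ≤ V) : vbf V k = 0 := by
  rw [vbf, coe_zeta_mul_apply]
  apply Finset.sum_eq_zero; intro d hd
  rw [af_sub_apply, trunc_apply, if_pos ((Nat.divisor_le hd).trans hk), sub_self]

lemma coefI_bound (U V k : ℕ) : |(trunc (μ : ArithmeticFunction ℝ) V * trunc Λ U) k| ≤ Real.log k := by
  rw [mul_apply]
  refine (Finset.abs_sum_le_sum_abs _ _).trans ?_
  have : Real.log k = (( (ζ : ArithmeticFunction ℝ)) * Λ) k := by rw [zeta_mul_vonMangoldt]; rfl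
  rw [this, mul_apply]
  apply Finset.sum_le_sum; intro d hd
  have hd1 : d.1 ≠ 0 := by
    have := (Nat.mem_divisorsAntidiagonal.1 hd)
    rintro h; rw [h] at this; simp at this; exact this.2 this.1.symm
  rw [abs_mul]
  have h1 : |((μ d.1 : ℤ):ℝ)| ≤ 1 := by exact_mod_cast abs_moebius_le_one
  have h2 : |trunc (μ : ArithmeticFunction ℝ) V d.1| ≤ 1 := by
    rw [trunc_apply]; split_ifs
    · simpa using h1
    · simp
  have h3 : |trunc Λ U d.2| ≤ Λ d.2 := by
    rw [trunc_apply]; split_ifs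
    · rw [abs_of_nonneg vonMangoldt_nonneg]
    · simpa using vonMangoldt_nonneg
  have h4 : ((ζ : ArithmeticFunction ℝ)) d.1 = 1 := by simp [natCoe_apply, zeta_apply, hd1]
  rw [h4]
  exact mul_le_mul h2 h3 (abs_nonneg _) zero_le_one

lemma coefI_zero (U V k : ℕ) (hk : U * V < k) : (trunc (μ : ArithmeticFunction ℝ) V * trunc Λ U) k = 0 := by
  rw [mul_apply]
  apply Finset.sum_eq_zero; intro d hd
  rw [trunc_apply, trunc_apply]
  have := (Nat.mem_divisorsAntidiagonal.1 hd).1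
  split_ifs with h1 h2
  · exfalso; have := Nat.mul_le_mul h1 h2; rw [mul_comm V U] at this; omega
  all_goals simp

end

lemma sum_conv (f h : ArithmeticFunction ℝ) (g : ℕ → ℂ) (x1 x2 : ℕ) :
    ∑ n ∈ Ioc x1 x2, (((f*h) n : ℝ) : ℂ) * g n =
    ∑ m ∈ Icc 1 x2, ∑ k ∈ Icc 1 x2, if x1 < m*k ∧ m*k ≤ x2 then ((f m : ℝ):ℂ) * ((h k : ℝ):ℂ) * g (m*k) else 0 := by
  have h1 : ∀ n ∈ Ioc x1 x2, (((f*h) n : ℝ) : ℂ) * g n = ∑ m ∈ Icc 1 x2, ∑ k ∈ Icc 1 x2, if m*k = n then ((f m : ℝ):ℂ) * ((h k : ℝ):ℂ) * g n else 0 := by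
    intro n hn
    rw [mem_Ioc] at hn
    rw [ArithmeticFunction.mul_apply, ← Finset.sum_product', ← Finset.sum_filter]
    push_cast
    rw [Finset.sum_mul]
    apply Finset.sum_congr _ (fun _ _ => rfl)
    ext ⟨a, b⟩
    simp only [Nat.mem_divisorsAntidiagonal, mem_filter, Finset.mem_product, mem_Icc]
    constructor
    · rintro ⟨e, h0⟩
      have ha : 0 < a := Nat.pos_of_ne_zero (by rintro rfl; simp at e; omega)
      have hb : 0 < b := Nat.pos_of_ne_zero (by rintro rfl; simp at e; omega)
      have := Nat.le_mul_of_pos_right a hb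
      have := Nat.le_mul_of_pos_left b ha
      refine ⟨⟨⟨ha, by omega⟩, ⟨hb, by omega⟩⟩, e⟩
    · rintro ⟨_, e⟩; exact ⟨e, by omega⟩
  rw [Finset.sum_congr rfl h1, Finset.sum_comm]
  apply Finset.sum_congr rfl; intro m _
  rw [Finset.sum_comm]
  apply Finset.sum_congr rfl; intro k _
  rw [Finset.sum_ite, Finset.sum_const_zero, add_zero]
  split_ifs with hh
  · rw [Finset.sum_eq_single (m*k)]
    · intro b hb hne; simp only [mem_filter] at hb; exact absurd hb.2.symm hne
    · intro hb; simp only [mem_filter, mem_Ioc] at hb; exact absurd (And.intro hh trivial) (by simpa using hb)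
  · apply Finset.sum_eq_zero
    intro b hb
    simp only [mem_filter, mem_Ioc] at hb
    rw [← hb.2] at hb; exact absurd hb.1 hh

lemma sum_typeI (f h : ArithmeticFunction ℝ) (g : ℕ → ℂ) (x1 x2 D : ℕ) (hD : D ≤ x2) (hf : ∀ m, D < m → f m = 0) :
    ∑ n ∈ Ioc x1 x2, (((f*h) n : ℝ) : ℂ) * g n =
    ∑ m ∈ Icc 1 D, ((f m : ℝ):ℂ) * ∑ k ∈ Ico (x1/m+1) (x2/m+1), ((h k : ℝ):ℂ) * g (m*k) := by
  rw [sum_conv]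
  symm
  rw [← Finset.sum_subset (Finset.Icc_subset_Icc_right hD)]
  · apply Finset.sum_congr rfl
    intro m hm
    rw [mem_Icc] at hm
    rw [Finset.mul_sum, ← Finset.sum_filter]
    apply Finset.sum_congr
    · ext k
      simp only [mem_filter, mem_Icc, mem_Ico, Nat.succ_le_iff, Nat.lt_succ_iff]
      have e1 : x1 / m < k ↔ x1 < m * k := by rw [Nat.div_lt_iff_lt_mul hm.1, mul_comm]
      have e2 : k ≤ x2 / m ↔ m * k ≤ x2 := by rw [Nat.le_div_iff_mul_le hm.1, mul_comm]
      rw [e1, e2]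
      constructor
      · rintro ⟨a, b⟩
        have hk : 0 < k := Nat.pos_of_ne_zero (by rintro rfl; simp at a)
        exact ⟨⟨hk, (Nat.le_mul_of_pos_left k hm.1).trans b⟩, a, b⟩
      · rintro ⟨_, a⟩; exact a
    · intro k _; ring
  · intro m _ hm
    rw [mem_Icc] at *
    rw [hf m (by omega)]
    simp

lemma sum_boxes {α : Type*} [AddCommMonoid α] (f : ℕ → α) (U J : ℕ) :
    ∑ m ∈ Ioc U (U*4^J), f m = ∑ i ∈ range J, ∑ m ∈ Ioc (U*4^i) (4*(U*4^i)), f m := by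
  induction J with
  | zero => simp
  | succ n ih =>
    rw [Finset.sum_range_succ, ← ih]
    have : U * 4^(n+1) = 4*(U*4^n) := by ring
    rw [this]
    have h1 : U ≤ U * 4^n := Nat.le_mul_of_pos_right _ (by positivity)
    rw [← Finset.Ioc_union_Ioc_eq_Ioc h1 (by omega : U*4^n ≤ 4*(U*4^n)), Finset.sum_union]
    rw [Finset.disjoint_left]; intro a; simp only [mem_Ioc]; omega

lemma sum_typeII (c θ : ℝ) (f h : ArithmeticFunction ℝ) (f' : ℕ → ℂ) (U V J x1 x2 : ℕ) (hU : 1 ≤ U) (hV : 1 ≤ V) (hJ : x2 < 4^J)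
    (hf : ∀ m, m ≤ U → f m = 0) (hf' : ∀ m, U < m → ((f m : ℝ):ℂ) = f' m) (hh : ∀ k, k ≤ V → h k = 0) :
    ∑ n ∈ Ioc x1 x2, (((f*h) n : ℝ) : ℂ) * ee (θ * (n:ℝ)^c) =
    ∑ i ∈ range J, ∑ j ∈ range J, bil c θ f' (fun k => ((h k : ℝ):ℂ)) (U*4^i) (V*4^j) x1 x2 := by
  rw [sum_conv]
  set t : ℕ → ℕ → ℂ := fun m k => if x1 < m*k ∧ m*k ≤ x2 then ((f m : ℝ):ℂ) * ((h k : ℝ):ℂ) * ee (θ * ((m*k:ℕ):ℝ)^c) else 0 with ht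
  have inner : ∀ m, 1 ≤ m → ∑ k ∈ Icc 1 x2, t m k = ∑ k ∈ Ioc V (V*4^J), t m k := by
    intro m hm
    have hVJ : x2 < V*4^J := lt_of_lt_of_le hJ (Nat.le_mul_of_pos_left _ hV)
    trans ∑ k ∈ Icc 1 (V*4^J), t m k
    · apply Finset.sum_subset (Finset.Icc_subset_Icc_right hVJ.le)
      intro k _ hk
      rw [mem_Icc] at *
      have := Nat.le_mul_of_pos_left k hm
      simp only [ht]; rw [if_neg (by omega)]
    · symm
      apply Finset.sum_subset
      · intro k; simp only [mem_Ioc, mem_Icc]; omega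
      · intro k hk hk'
        simp only [mem_Ioc, mem_Icc] at hk hk'
        simp only [ht]; rw [hh k (by omega)]; simp
  have outer : ∑ m ∈ Icc 1 x2, ∑ k ∈ Icc 1 x2, t m k = ∑ m ∈ Ioc U (U*4^J), ∑ k ∈ Ioc V (V*4^J), t m k := by
    rw [Finset.sum_congr rfl (fun m hm => inner m (mem_Icc.1 hm).1)]
    have hVJ : x2 < U*4^J := lt_of_lt_of_le hJ (Nat.le_mul_of_pos_left _ hU)
    trans ∑ m ∈ Icc 1 (U*4^J), ∑ k ∈ Ioc V (V*4^J), t m k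
    · apply Finset.sum_subset (Finset.Icc_subset_Icc_right hVJ.le)
      intro m hm hk
      apply Finset.sum_eq_zero; intro k hk2
      rw [mem_Icc] at *
      rw [mem_Ioc] at *
      have := Nat.le_mul_of_pos_right m (by omega : 0 < k)
      simp only [ht]; rw [if_neg (by omega)]
    · symm
      apply Finset.sum_subset
      · intro k; simp only [mem_Ioc, mem_Icc]; omega
      · intro k hk hk'
        simp only [mem_Ioc, mem_Icc] at hk hk'
        apply Finset.sum_eq_zero; intro k hk2
        simp only [ht]; rw [hf _ (by omega)]; simp
  rw [show (∑ m ∈ Icc 1 x2, ∑ k ∈ Icc 1 x2, if x1 < m*k ∧ m*k ≤ x2 then ((f m : ℝ):ℂ) * ((h k : ℝ):ℂ) * ee (θ * ((m*k:ℕ):ℝ)^c) else 0) = ∑ m ∈ Icc 1 x2, ∑ k ∈ Icc 1 x2, t m k from rfl, outer, sum_boxes]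
  apply Finset.sum_congr rfl; intro i _
  rw [Finset.sum_congr rfl (fun m _ => sum_boxes (t m) V J), Finset.sum_comm]
  apply Finset.sum_congr rfl; intro j _
  rw [bil]
  apply Finset.sum_congr rfl; intro m hm
  apply Finset.sum_congr rfl; intro k _
  rw [mem_Ioc] at hm
  have h1 : U ≤ U * 4^i := Nat.le_mul_of_pos_right _ (by positivity)
  simp only [ht]
  rw [hf' m (by omega)]
  push_cast
  rw [mul_rpow (by positivity) (by positivity)]

lemma typeI_inner (c θ : ℝ) (hc1 : 1 < c) (hc2 : c < 2) (hθ : θ ≠ 0) (x1 x2 m : ℕ) (hm : 1 ≤ m) (hmx : m ≤ x1) (hx : x2 ≤ 2*x1)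
    (p' : ℕ) (hp : x1/m+1 ≤ p') :
    ‖∑ k ∈ Ico p' (x2/m+1), ee (θ * ((m*k:ℕ):ℝ)^c)‖ ≤
      (80+20/√(c-1)) * (√(|θ| * (x1:ℝ)^c) + (x1/m:ℝ)/√(|θ| * (x1:ℝ)^c)) := by
  have hm0 : (0:ℝ) < m := by exact_mod_cast hm
  have hmx' : (m:ℝ) ≤ x1 := by exact_mod_cast hmx
  have e1 : ∀ k : ℕ, θ * ((m*k:ℕ):ℝ)^c = (θ * (m:ℝ)^c) * (k:ℝ)^c := by
    intro k; push_cast; rw [mul_rpow (by positivity) (by positivity)]; ring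
  simp_rw [e1]
  have hM : (1:ℝ) ≤ (x1:ℝ)/m := by rw [le_div_iff₀ hm0]; linarith
  have h := vdc_pow c hc1 hc2 (θ * (m:ℝ)^c) ((x1:ℝ)/m) (by positivity) hM p' (x2/m+1) ?_ ?_
  · have e2 : |θ * (m:ℝ)^c| * ((x1:ℝ)/m)^c = |θ| * (x1:ℝ)^c := by
      rw [abs_mul, abs_of_pos (by positivity : 0 < (m:ℝ)^c), div_rpow (by positivity) (by positivity)]
      field_simp
    rwa [e2] at h
  · have : (x1:ℝ)/m < ((x1/m+1 : ℕ):ℝ) := by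
      rw [div_lt_iff₀ hm0]
      exact_mod_cast Nat.lt_mul_of_div_lt (Nat.lt_succ_self _) hm
    exact this.le.trans (by exact_mod_cast hp)
  · push_cast
    have h1 : ((x2/m:ℕ):ℝ) ≤ (x2:ℝ)/m := Nat.cast_div_le
    have h2 : (x2:ℝ)/m ≤ 2*((x1:ℝ)/m) := by
      rw [← mul_div_assoc]; gcongr; exact_mod_cast hx
    linarith

open ArithmeticFunction ArithmeticFunction.zeta ArithmeticFunction.Moebius in
lemma typeI_bound (c θ : ℝ) (hc1 : 1 < c) (hc2 : c < 2) (hθ : θ ≠ 0) (x1 x2 D : ℕ) (hx1 : x1 ≤ x2) (hx : x2 ≤ 2*x1) (hD : D ≤ x1)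
    (f h : ArithmeticFunction ℝ) (hf0 : ∀ m, D < m → f m = 0) (hf : ∀ m, 1 ≤ m → |f m| ≤ 1 + Real.log m)
    (hh0 : ∀ k, 1 ≤ k → 0 ≤ h k) (hh : ∀ k, 1 ≤ k → h k ≤ 1 + Real.log k) (hhm : ∀ k, 1 ≤ k → h k ≤ h (k+1)) :
    ‖∑ n ∈ Ioc x1 x2, (((f*h) n : ℝ) : ℂ) * ee (θ * (n:ℝ)^c)‖ ≤
     ((80+20/√(c-1)) * (2 * (1 + Real.log x2)^3)) * (D * √(|θ| * (x1:ℝ)^c) + x1/√(|θ| * (x1:ℝ)^c)) := by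
  rcases Nat.eq_zero_or_pos D with hD0 | hD0
  · rw [sum_typeI f h (fun n => ee (θ * (n:ℝ)^c)) x1 x2 D (hD.trans hx1) hf0, hD0]
    simp
    have : 0 ≤ Real.log x2 := Real.log_natCast_nonneg _
    positivity
  have hx2 : (1:ℝ) ≤ x2 := by exact_mod_cast (by omega : 1 ≤ x2)
  have hx10 : (0:ℝ) < x1 := by exact_mod_cast (by omega : 0 < x1)
  set T := √(|θ| * (x1:ℝ)^c) with hT
  have hT0 : 0 < T := Real.sqrt_pos.2 (by positivity)
  set C0 := (80+20/√(c-1)) with hC0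
  have hC00 : 0 < C0 := by
    have : 0 < √(c-1) := Real.sqrt_pos.2 (by linarith)
    positivity
  set L := 1 + Real.log x2 with hL
  have hL1 : 1 ≤ L := by have := Real.log_nonneg hx2; linarith
  rw [sum_typeI f h (fun n => ee (θ * (n:ℝ)^c)) x1 x2 D (hD.trans hx1) hf0]
  have inner : ∀ m ∈ Icc 1 D, ‖((f m : ℝ):ℂ) * ∑ k ∈ Ico (x1/m+1) (x2/m+1), ((h k : ℝ):ℂ) * ee (θ * ((m*k:ℕ):ℝ)^c)‖ ≤
      L * (2 * L * (C0 * (T + (x1/m:ℝ)/T))) := by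
    intro m hm
    rw [mem_Icc] at hm
    have hm0 : (0:ℝ) < m := by exact_mod_cast hm.1
    rw [norm_mul, Complex.norm_real, Real.norm_eq_abs]
    have hfm : |f m| ≤ L := by
      refine (hf m hm.1).trans ?_
      have : Real.log m ≤ Real.log x2 := Real.log_le_log hm0 (by exact_mod_cast (by omega : m ≤ x2))
      linarith
    have ha := abel_mono (fun k => h k) (fun k => ee (θ * ((m*k:ℕ):ℝ)^c)) (x2/m+1) (C0 * (T + (x1/m:ℝ)/T)) (x1/m+1)
      (by have := Nat.div_le_div_right (c := m) hx1; omega) (fun k hk => hhm k ((Nat.succ_le_succ (Nat.zero_le _)).trans hk)) (hh0 _ (Nat.succ_le_succ (Nat.zero_le _)))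
      (fun p' hp' _ => typeI_inner c θ hc1 hc2 hθ x1 x2 m hm.1 (hm.2.trans hD) hx p' hp')
    have hq : h (x2/m+1) ≤ 2 * L := by
      refine (hh _ (Nat.succ_le_succ (Nat.zero_le _))).trans ?_
      have h1 : ((x2/m+1:ℕ):ℝ) ≤ 2 * x2 := by
        have : x2/m ≤ x2 := Nat.div_le_self _ _
        exact_mod_cast (by omega : x2/m+1 ≤ 2*x2)
      have h2 : Real.log ((x2/m+1:ℕ):ℝ) ≤ Real.log 2 + Real.log x2 := by
        rw [← Real.log_mul (by norm_num) (by positivity)]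
        exact Real.log_le_log (by positivity) h1
      have := Real.log_two_lt_d9
      linarith
    have hB : 0 ≤ C0 * (T + (x1/m:ℝ)/T) := by positivity
    exact mul_le_mul hfm (ha.trans (mul_le_mul_of_nonneg_right hq hB)) (norm_nonneg _) (by linarith)
  refine (norm_sum_le _ _).trans ((Finset.sum_le_sum inner).trans ?_)
  have e : ∑ m ∈ Icc 1 D, L * (2 * L * (C0 * (T + (x1/m:ℝ)/T))) = 2 * L^2 * C0 * (D * T + (x1/T) * ∑ m ∈ Icc 1 D, 1/(m:ℝ)) := by
    rw [mul_add (2 * L^2 * C0), Finset.mul_sum, Finset.mul_sum]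
    have : (D:ℝ) * T = ∑ m ∈ Icc 1 D, T := by simp
    rw [this, Finset.mul_sum, ← Finset.sum_add_distrib]
    apply Finset.sum_congr rfl; intro m _; ring
  rw [e]
  have hs : ∑ m ∈ Icc 1 D, 1/(m:ℝ) ≤ L := by
    refine (sum_inv_le D).trans ?_
    have : Real.log D ≤ Real.log x2 := Real.log_le_log (by exact_mod_cast hD0) (by exact_mod_cast hD.trans hx1)
    linarith
  calc _ ≤ 2 * L^2 * C0 * (L * (D * T) + (x1/T) * L) := by
        have h1 : (D:ℝ)*T ≤ L * (D*T) := le_mul_of_one_le_left (by positivity) hL1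
        gcongr
    _ = _ := by ring

open ArithmeticFunction ArithmeticFunction.zeta ArithmeticFunction.Moebius in
lemma vaughan_bound (c : ℝ) (hc1 : 1 < c) (hc2 : c < 2) : ∃ C : ℝ, 0 < C ∧ ∀ (θ : ℝ) (U V x1 x2 J : ℕ), θ ≠ 0 → 1 ≤ U → 1 ≤ V → U*V ≤ x1 →
    x1 ≤ x2 → x2 ≤ 2*x1 → x2 < 4^J →
    ‖∑ n ∈ Ioc x1 x2, ((Λ n : ℝ) : ℂ) * ee (θ * (n:ℝ)^c)‖ ≤
     C * (1 + Real.log x2)^3 * (U*V * √(|θ| * (x1:ℝ)^c) + x1/√(|θ| * (x1:ℝ)^c)) +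
     ∑ i ∈ range J, ∑ j ∈ range J, ‖bil c θ (fun m => ((Λ m : ℝ):ℂ)) (fun k => ((vbf V k : ℝ):ℂ)) (U*4^i) (V*4^j) x1 x2‖ := by
  have hs : 0 < √(c-1) := Real.sqrt_pos.2 (by linarith)
  refine ⟨2 * ((80+20/√(c-1)) * 2), by positivity, ?_⟩
  intro θ U V x1 x2 J hθ hU hV hUV hx12 hx2 hJ
  have hUx : U ≤ x1 := (Nat.le_mul_of_pos_right U hV).trans hUV
  have hVx : V ≤ U*V := Nat.le_mul_of_pos_left V hU
  have e : ∑ n ∈ Ioc x1 x2, ((Λ n : ℝ) : ℂ) * ee (θ * (n:ℝ)^c) =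
      ∑ n ∈ Ioc x1 x2, (((trunc (μ : ArithmeticFunction ℝ) V * ArithmeticFunction.log) n : ℝ) : ℂ) * ee (θ * (n:ℝ)^c)
      - ∑ n ∈ Ioc x1 x2, ((((trunc (μ : ArithmeticFunction ℝ) V * trunc Λ U) * (ζ : ArithmeticFunction ℝ)) n : ℝ) : ℂ) * ee (θ * (n:ℝ)^c)
      + ∑ n ∈ Ioc x1 x2, ((((Λ - trunc Λ U) * vbf V) n : ℝ) : ℂ) * ee (θ * (n:ℝ)^c) := by
    rw [← Finset.sum_sub_distrib, ← Finset.sum_add_distrib]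
    apply Finset.sum_congr rfl
    intro n hn
    rw [mem_Ioc] at hn
    have h1 : (Λ - trunc Λ U) n = Λ n := by
      rw [af_sub_apply, trunc_apply, if_neg (by omega), sub_zero]
    rw [← h1, vaughan_id U V, ArithmeticFunction.add_apply, af_sub_apply, ← vaughan_id U V]
    push_cast; ring
  rw [e, sum_typeII c θ (Λ - trunc Λ U) (vbf V) (fun m => ((Λ m : ℝ):ℂ)) U V J x1 x2 hU hV hJ
    (fun m hm => by rw [af_sub_apply, trunc_apply, if_pos hm, sub_self])
    (fun m hm => by rw [af_sub_apply, trunc_apply, if_neg (by omega), sub_zero]) (vbf_zero V)]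
  have hμ : ∀ m, |trunc (μ : ArithmeticFunction ℝ) V m| ≤ 1 := by
    intro m
    have h1 : |((μ m : ℤ):ℝ)| ≤ 1 := by exact_mod_cast abs_moebius_le_one
    rw [trunc_apply]; split_ifs
    · simpa using h1
    · simp
  have b1 := typeI_bound c θ hc1 hc2 hθ x1 x2 (U*V) hx12 hx2 hUV (trunc (μ : ArithmeticFunction ℝ) V) ArithmeticFunction.log
    (fun m hm => by rw [trunc_apply, if_neg (by omega)])
    (fun m hm => (hμ m).trans (by have := Real.log_natCast_nonneg m; linarith))
    (fun k hk => Real.log_natCast_nonneg k) (fun k hk => by rw [log_apply]; linarith)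
    (fun k hk => by
      rw [log_apply, log_apply]
      exact Real.log_le_log (by exact_mod_cast hk) (by push_cast; linarith))
  have hz : ∀ k, 1 ≤ k → (ζ : ArithmeticFunction ℝ) k = 1 := by
    intro k hk; have : k ≠ 0 := (by omega); simp [natCoe_apply, zeta_apply, this]
  have b2 := typeI_bound c θ hc1 hc2 hθ x1 x2 (U*V) hx12 hx2 hUV (trunc (μ : ArithmeticFunction ℝ) V * trunc Λ U) (ζ : ArithmeticFunction ℝ)
    (fun m hm => coefI_zero U V m hm)
    (fun m hm => (coefI_bound U V m).trans (by linarith))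
    (fun k hk => by rw [hz k hk]; norm_num) (fun k hk => by rw [hz k hk]; have := Real.log_natCast_nonneg k; linarith)
    (fun k hk => by rw [hz k hk, hz (k+1) (by omega)])
  refine (norm_add_le _ _).trans (add_le_add ((norm_sub_le _ _).trans ?_) ?_)
  · refine (add_le_add b1 b2).trans (le_of_eq ?_)
    push_cast; ring
  · exact (norm_sum_le _ _).trans (Finset.sum_le_sum fun i _ => norm_sum_le _ _)

lemma ev_log (C : ℝ) (k : ℕ) (δ : ℝ) (hδ : 0 < δ) : ∀ᶠ X : ℝ in Filter.atTop, C * (log X)^k ≤ X^δ := by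
  have h := isLittleO_log_rpow_rpow_atTop (k:ℝ) hδ
  have h2 := h.bound (by positivity : (0:ℝ) < 1/(|C|+1))
  filter_upwards [h2, Filter.eventually_ge_atTop (1:ℝ)] with X hX hX1
  have hl : 0 ≤ log X := log_nonneg hX1
  have hp : 0 < X^δ := by positivity
  rw [rpow_natCast, Real.norm_of_nonneg (by positivity), Real.norm_of_nonneg hp.le] at hX
  calc C * (log X)^k ≤ (|C|+1) * (log X)^k := by
        gcongr; linarith [le_abs_self C]
    _ ≤ (|C|+1) * (1/(|C|+1) * X^δ) := by gcongr
    _ = X^δ := by field_simp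

lemma bil_swap (c θ : ℝ) (a b : ℕ → ℂ) (M K x1 x2 : ℕ) : bil c θ a b M K x1 x2 = bil c θ b a K M x1 x2 := by
  rw [bil, bil, Finset.sum_comm]
  apply Finset.sum_congr rfl; intro k _
  apply Finset.sum_congr rfl; intro m _
  rw [mul_comm m k, mul_comm (a m), mul_comm ((m:ℝ)^c)]

lemma bil_nonempty (c θ : ℝ) (a b : ℕ → ℂ) (M K x1 x2 : ℕ) (h : bil c θ a b M K x1 x2 ≠ 0) : M*K ≤ x2 ∧ x1 ≤ 16*(M*K) := by
  rw [bil] at h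
  obtain ⟨m, hm, h⟩ := Finset.exists_ne_zero_of_sum_ne_zero h
  obtain ⟨k, hk, h⟩ := Finset.exists_ne_zero_of_sum_ne_zero h
  rw [mem_Ioc] at hm hk
  have hh : x1 < m*k ∧ m*k ≤ x2 := by
    by_contra hc; rw [if_neg hc] at h; exact h rfl
  have h1 : M*K ≤ m*k := Nat.mul_le_mul hm.1.le hk.1.le
  have h2 : m*k ≤ (4*M)*(4*K) := Nat.mul_le_mul hm.2 hk.2
  constructor
  · omega
  · have : (4*M)*(4*K) = 16*(M*K) := by ring
    omega

lemma W_bounds (c θ X : ℝ) (hc1 : 1 < c) (hc2 : c < 2) (M K : ℕ) (hX : 0 < X) (h1 : (M:ℝ)*K ≤ X) (h2 : X ≤ 128*(M*K)) :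
    |θ| * ((M:ℝ)^c*(K:ℝ)^c) ≤ |θ| * X^c ∧ |θ| * X^c ≤ 128^2 * (|θ| * ((M:ℝ)^c*(K:ℝ)^c)) := by
  rw [← mul_rpow (by positivity) (by positivity)]
  constructor
  · gcongr
  · have : X^c ≤ 128^2 * ((M:ℝ)*K)^c := by
      calc X^c ≤ (128*((M:ℝ)*K))^c := by gcongr
        _ = 128^c * ((M:ℝ)*K)^c := mul_rpow (by norm_num) (by positivity)
        _ ≤ _ := by
          gcongr
          rw [← rpow_natCast]
          exact rpow_le_rpow_of_exponent_le (by norm_num) (by push_cast; linarith)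
    calc _ ≤ |θ| * (128^2 * ((M:ℝ)*K)^c) := by gcongr
      _ = _ := by ring

/-- range (i) box estimate, K ≤ M -/
lemma boxI_aux (c : ℝ) (hc1 : 1 < c) (hc2 : c < 2) : ∃ C : ℝ, 0 < C ∧ ∀ (X θ G : ℝ) (a b : ℕ → ℂ) (M K x1 x2 : ℕ),
    1 ≤ X → θ ≠ 0 → 0 ≤ G → 1 ≤ M → 1 ≤ K → K ≤ M → X^(0.155:ℝ) ≤ K → (M:ℝ)*K ≤ X → X ≤ 128*(M*K) →
    |θ| * X^c ≤ X^(0.9:ℝ) →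
    (∑ m ∈ Ioc M (4*M), ‖a m‖^2) ≤ G*M → (∑ k ∈ Ioc K (4*K), ‖b k‖^2) ≤ G*K →
    ‖bil c θ a b M K x1 x2‖^2 ≤ C * (G^2 * X^2 * (X^(-0.05:ℝ) + 1/√(|θ| * X^c))) := by
  have hs : 0 < √(c-1) := Real.sqrt_pos.2 (by linarith)
  refine ⟨(20+30*(80+20/√(c-1))) * 128, by positivity, ?_⟩
  intro X θ G a b M K x1 x2 hX hθ hG hM hK hKM hKX hMK1 hMK2 hT ha hb
  have hX0 : 0 < X := by linarith
  have hM0 : (0:ℝ) < M := by exact_mod_cast hM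
  have hK0 : (0:ℝ) < K := by exact_mod_cast hK
  set W := |θ| * ((M:ℝ)^c*(K:ℝ)^c) with hW
  have hW0 : 0 < W := by positivity
  obtain ⟨hW1, hW2⟩ := W_bounds c θ X hc1 hc2 M K hX0 hMK1 hMK2
  rw [← hW] at hW1 hW2
  have h := method1 c hc1 hc2 θ hθ a b M K K x1 x2 hM hK le_rfl _ rfl
  rw [← hW] at h
  refine h.trans ?_
  have e1 : √(W/K) * √K = √W := by rw [← Real.sqrt_mul (by positivity)]; congr 1; field_simp
  rw [mul_assoc (K:ℝ) (√(W/K)), e1]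
  set C1 := (20+30*(80+20/√(c-1)))
  have hC1 : 0 < C1 := by positivity
  have hsW : 0 < √W := Real.sqrt_pos.2 hW0
  have hsT : 0 < √(|θ| * X^c) := Real.sqrt_pos.2 (by positivity)
  have b1 : (K:ℝ)*M/K ≤ X * X^(-0.05:ℝ) := by
    have : (M:ℝ) * X^(0.155:ℝ) ≤ X := (mul_le_mul_of_nonneg_left hKX hM0.le).trans hMK1
    have h2 : X * X^(-0.05:ℝ) = X^(0.95:ℝ) := by
      nth_rewrite 1 [← rpow_one X]; rw [← rpow_add hX0]; norm_num
    have h3 : X = X^(0.845:ℝ) * X^(0.155:ℝ) := by rw [← rpow_add hX0]; norm_num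
    have h4 : (M:ℝ) ≤ X^(0.845:ℝ) := by
      rw [h3] at this
      have h5 : 0 < X^(0.155:ℝ) := by positivity
      rw [← h3] at this
      nlinarith
    rw [mul_div_right_comm, div_self hK0.ne', one_mul, h2]
    exact h4.trans (rpow_le_rpow_of_exponent_le hX (by norm_num))
  have hKX' : (K:ℝ) ≤ X^(0.5:ℝ) := by
    have : (K:ℝ)^2 ≤ (X^(0.5:ℝ))^2 := by
      rw [← rpow_mul_natCast hX0.le]; norm_num
      have : (K:ℝ) ≤ M := by exact_mod_cast hKM
      nlinarith
    exact le_of_sq_le_sq this (by positivity)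
  have b2 : (K:ℝ)*√W ≤ X * X^(-0.05:ℝ) := by
    have h3 : √W ≤ X^(0.45:ℝ) := by
      rw [Real.sqrt_le_left (by positivity), ← rpow_mul_natCast hX0.le]
      norm_num
      norm_num at hT
      exact hW1.trans hT
    calc (K:ℝ)*√W ≤ X^(0.5:ℝ) * X^(0.45:ℝ) := by gcongr
      _ = X^(1:ℝ) * X^(-0.05:ℝ) := by rw [← rpow_add hX0, ← rpow_add hX0]; norm_num
      _ = _ := by rw [rpow_one]
  have b3 : (K:ℝ)*M/√W ≤ 128 * (X * (1/√(|θ| * X^c))) := by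
    have h3 : √(|θ| * X^c) ≤ 128 * √W := by
      rw [Real.sqrt_le_left (by positivity), mul_pow, Real.sq_sqrt hW0.le]; exact hW2
    rw [mul_one_div, ← mul_div_assoc, div_le_div_iff₀ hsW hsT]
    calc (K:ℝ)*M*√(|θ| * X^c) ≤ X * (128*√W) := by
          gcongr; linarith
      _ = _ := by ring
  have hXp : 0 < X^(-0.05:ℝ) := by positivity
  calc (∑ m ∈ Ioc M (4*M), ‖a m‖^2) * (∑ k ∈ Ioc K (4*K), ‖b k‖^2) * (C1 * ((K:ℝ)*M/K + K*√W + K*M/√W))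
      ≤ (G*M) * (G*K) * (C1 * (X * X^(-0.05:ℝ) + X * X^(-0.05:ℝ) + 128 * (X * (1/√(|θ| * X^c))))) := by gcongr
    _ = (M*K) * G^2 * (C1 * X) * (2*X^(-0.05:ℝ) + 128 * (1/√(|θ| * X^c))) := by ring
    _ ≤ X * G^2 * (C1 * X) * (128*X^(-0.05:ℝ) + 128 * (1/√(|θ| * X^c))) := by
        gcongr; norm_num
    _ = _ := by ring

lemma boxI (c : ℝ) (hc1 : 1 < c) (hc2 : c < 2) : ∃ C : ℝ, 0 < C ∧ ∀ (X θ G : ℝ) (a b : ℕ → ℂ) (M K x1 x2 : ℕ),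
    1 ≤ X → θ ≠ 0 → 0 ≤ G → 1 ≤ M → 1 ≤ K → X^(0.155:ℝ) ≤ M → X^(0.155:ℝ) ≤ K → (M:ℝ)*K ≤ X → X ≤ 128*(M*K) →
    |θ| * X^c ≤ X^(0.9:ℝ) →
    (∑ m ∈ Ioc M (4*M), ‖a m‖^2) ≤ G*M → (∑ k ∈ Ioc K (4*K), ‖b k‖^2) ≤ G*K →
    ‖bil c θ a b M K x1 x2‖^2 ≤ C * (G^2 * X^2 * (X^(-0.05:ℝ) + 1/√(|θ| * X^c))) := by
  obtain ⟨C, hC, h⟩ := boxI_aux c hc1 hc2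
  refine ⟨C, hC, ?_⟩
  intro X θ G a b M K x1 x2 hX hθ hG hM hK hMX hKX hMK1 hMK2 hT ha hb
  rcases le_total K M with hh | hh
  · exact h X θ G a b M K x1 x2 hX hθ hG hM hK hh hKX hMK1 hMK2 hT ha hb
  · rw [bil_swap]
    exact h X θ G b a K M x1 x2 hX hθ hG hK hM hh hMX (by linarith) (by linarith) hT hb ha

lemma sum_sq_le (a : ℕ → ℂ) (M : ℕ) (A : ℝ) (h : ∀ m ∈ Ioc M (4*M), ‖a m‖ ≤ A) :
    ∑ m ∈ Ioc M (4*M), ‖a m‖^2 ≤ 3*M*A^2 := by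
  calc _ ≤ ∑ m ∈ Ioc M (4*M), A^2 := Finset.sum_le_sum fun m hm => pow_le_pow_left₀ (norm_nonneg _) (h m hm) 2
    _ = _ := by
      rw [Finset.sum_const, Nat.card_Ioc, nsmul_eq_mul, show 4*M - M = 3*M by omega]; push_cast; ring

lemma boxII_m1 (c : ℝ) (hc1 : 1 < c) (hc2 : c < 2) : ∃ C : ℝ, 0 < C ∧ ∀ (X θ A : ℝ) (a b : ℕ → ℂ) (M K Q x1 x2 : ℕ),
    1 ≤ X → θ ≠ 0 → 0 ≤ A → 1 ≤ M → 1 ≤ K → 1 ≤ Q → Q ≤ K → X^(0.155:ℝ) ≤ Q → Q ≤ 2*X^(0.155:ℝ) → K ≤ X^(0.35:ℝ) →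
    (M:ℝ)*K ≤ X → X ≤ 128*(M*K) →
    X^(0.9:ℝ) ≤ |θ| * X^c → |θ| * X^c ≤ X^(1.173:ℝ) →
    (∀ m ∈ Ioc M (4*M), ‖a m‖ ≤ A) → (∀ k ∈ Ioc K (4*K), ‖b k‖ ≤ A) →
    ‖bil c θ a b M K x1 x2‖^2 ≤ C * (A^4 * X^(1.845:ℝ)) := by
  have hs : 0 < √(c-1) := Real.sqrt_pos.2 (by linarith)
  refine ⟨9 * ((20+30*(80+20/√(c-1))) * 131), by positivity, ?_⟩
  intro X θ A a b M K Q x1 x2 hX hθ hA hM hK hQ hQK hQ1 hQ2 hK35 hMK1 hMK2 hT1 hT2 ha hb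
  have hX0 : 0 < X := by linarith
  have hM0 : (0:ℝ) < M := by exact_mod_cast hM
  have hK0 : (0:ℝ) < K := by exact_mod_cast hK
  have hQ0 : (0:ℝ) < Q := by exact_mod_cast hQ
  set W := |θ| * ((M:ℝ)^c*(K:ℝ)^c) with hW
  have hW0 : 0 < W := by positivity
  obtain ⟨hW1, hW2⟩ := W_bounds c θ X hc1 hc2 M K hX0 hMK1 hMK2
  rw [← hW] at hW1 hW2
  have h := method1 c hc1 hc2 θ hθ a b M K Q x1 x2 hM hQ hQK _ rfl
  rw [← hW] at h
  refine h.trans ?_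
  have e1 : √(W/K) * √Q = √(W*Q/K) := by rw [← Real.sqrt_mul (by positivity)]; congr 1; ring
  rw [mul_assoc (K:ℝ) (√(W/K)), e1]
  set C1 := (20+30*(80+20/√(c-1)))
  have hC1 : 0 < C1 := by positivity
  have hsW : 0 < √(W*Q/K) := Real.sqrt_pos.2 (by positivity)
  have b1 : (K:ℝ)*M/Q ≤ X^(0.845:ℝ) := by
    rw [div_le_iff₀ hQ0]
    calc (K:ℝ)*M ≤ X := by linarith
      _ = X^(0.845:ℝ) * X^(0.155:ℝ) := by rw [← rpow_add hX0]; norm_num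
      _ ≤ _ := by gcongr
  have b2 : (K:ℝ)*√(W*Q/K) ≤ 2*X^(0.845:ℝ) := by
    refine le_of_sq_le_sq ?_ (by positivity)
    rw [mul_pow, Real.sq_sqrt (by positivity)]
    calc (K:ℝ)^2 * (W*Q/K) = W * Q * K := by field_simp
      _ ≤ X^(1.173:ℝ) * (2*X^(0.155:ℝ)) * X^(0.35:ℝ) := by
          have := hW1.trans hT2; gcongr
      _ = 2 * (X^(1.173:ℝ) * X^(0.155:ℝ) * X^(0.35:ℝ)) := by ring
      _ = 2 * X^(1.678:ℝ) := by rw [← rpow_add hX0, ← rpow_add hX0]; norm_num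
      _ ≤ 4 * X^(1.69:ℝ) := by
          have : X^(1.678:ℝ) ≤ X^(1.69:ℝ) := rpow_le_rpow_of_exponent_le hX (by norm_num)
          have : 0 < X^(1.69:ℝ) := by positivity
          linarith
      _ = (2*X^(0.845:ℝ))^2 := by rw [mul_pow, ← rpow_mul_natCast hX0.le]; norm_num
  have b3 : (K:ℝ)*M/√(W*Q/K) ≤ 128 * X^(0.845:ℝ) := by
    rw [div_le_iff₀ hsW]
    have hlow : X^(0.155:ℝ) ≤ 128 * √(W*Q/K) := by
      refine le_of_sq_le_sq ?_ (by positivity)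
      rw [mul_pow, Real.sq_sqrt (by positivity), ← rpow_mul_natCast hX0.le, ← mul_div_assoc, le_div_iff₀ hK0]
      calc X^((0.155:ℝ)*(2:ℕ)) * K ≤ X^(0.31:ℝ) * X^(0.35:ℝ) := by norm_num; gcongr; norm_num at hK35; exact hK35
        _ = X^(0.66:ℝ) := by rw [← rpow_add hX0]; norm_num
        _ ≤ X^(1.055:ℝ) := rpow_le_rpow_of_exponent_le hX (by norm_num)
        _ = X^(0.9:ℝ) * X^(0.155:ℝ) := by rw [← rpow_add hX0]; norm_num
        _ ≤ (128^2*W) * Q := by have := hT1.trans hW2; gcongr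
        _ = _ := by ring
    calc (K:ℝ)*M ≤ X := by linarith
      _ = X^(0.845:ℝ) * X^(0.155:ℝ) := by rw [← rpow_add hX0]; norm_num
      _ ≤ X^(0.845:ℝ) * (128 * √(W*Q/K)) := by gcongr
      _ = _ := by ring
  have s1 := sum_sq_le a M A ha
  have s2 := sum_sq_le b K A hb
  calc (∑ m ∈ Ioc M (4*M), ‖a m‖^2) * (∑ k ∈ Ioc K (4*K), ‖b k‖^2) * (C1 * ((K:ℝ)*M/Q + K*√(W*Q/K) + K*M/√(W*Q/K)))
      ≤ (3*M*A^2) * (3*K*A^2) * (C1 * (X^(0.845:ℝ) + 2 * X^(0.845:ℝ) + 128 * X^(0.845:ℝ))) := by gcongr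
    _ = 9 * (M*K) * A^4 * (C1 * 131 * X^(0.845:ℝ)) := by ring
    _ ≤ 9 * X * A^4 * (C1 * 131 * X^(0.845:ℝ)) := by gcongr
    _ = 9 * (C1 * 131) * (A^4 * (X^(1:ℝ) * X^(0.845:ℝ))) := by rw [rpow_one]; ring
    _ = _ := by rw [← rpow_add hX0]; norm_num

lemma boxII_m2 (c : ℝ) (hc1 : 1 < c) (hc2 : c < 2) : ∃ C : ℝ, 0 < C ∧ ∀ᶠ X : ℝ in Filter.atTop, ∀ (θ A : ℝ) (a b : ℕ → ℂ) (M K Q x1 x2 : ℕ),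
    θ ≠ 0 → 0 ≤ A → 1 ≤ M → 1 ≤ K → 1 ≤ Q → X^(0.155:ℝ) ≤ Q → Q ≤ 2*X^(0.155:ℝ) → M ≤ K → X^(0.35:ℝ) ≤ M →
    (M:ℝ)*K ≤ X → X ≤ 128*(M*K) →
    X^(0.9:ℝ) ≤ |θ| * X^c → |θ| * X^c ≤ X^(1.173:ℝ) →
    (∀ m ∈ Ioc M (4*M), ‖a m‖ ≤ A) → (∀ k ∈ Ioc K (4*K), ‖b k‖ ≤ A) →
    ‖bil c θ a b M K x1 x2‖^2 ≤ C * (A^4 * X^(1.845:ℝ)) := by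
  obtain ⟨C0, hC0, hm2⟩ := method2 c hc1 hc2
  set E : ℝ := 2^30 with hE
  refine ⟨C0 * 3 * (1 + E), by positivity, ?_⟩
  filter_upwards [ev_log (2^4) 4 (1/1000) (by norm_num), Filter.eventually_ge_atTop (4^25 + 8*rexp 2:ℝ)] with X hXlog hXbig
  intro θ A a b M K Q x1 x2 hθ hA hM hK hQ hQ1 hQ2 hMK hM35 hMK1 hMK2 hT1 hT2 ha hb
  have hXe : 8*rexp 2 ≤ X := by have : (0:ℝ) ≤ 4^25 := by positivity
                                linarith
  have hX4 : (4:ℝ)^25 ≤ X := by have := Real.exp_pos 2; linarith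
  have hX : 1 ≤ X := le_trans (by norm_num) hX4
  have hX0 : 0 < X := by linarith
  have hM0 : (0:ℝ) < M := by exact_mod_cast hM
  have hK0 : (0:ℝ) < K := by exact_mod_cast hK
  have hQ0 : (0:ℝ) < Q := by exact_mod_cast hQ
  have hMK' : (M:ℝ) ≤ K := by exact_mod_cast hMK
  set W := |θ| * ((M:ℝ)^c*(K:ℝ)^c) with hW
  have hW0 : 0 < W := by positivity
  obtain ⟨hW1, hW2⟩ := W_bounds c θ X hc1 hc2 M K hX0 hMK1 hMK2
  rw [← hW] at hW1 hW2
  have hWu : W ≤ X^(1.173:ℝ) := hW1.trans hT2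
  have hWl : X^(0.9:ℝ) ≤ 128^2 * W := hT1.trans hW2
  have hQQ : (Q:ℝ)^2 ≤ K := by
    calc (Q:ℝ)^2 ≤ (2*X^(0.155:ℝ))^2 := by gcongr
      _ = 4 * X^(0.31:ℝ) := by rw [mul_pow, ← rpow_mul_natCast hX0.le]; norm_num
      _ = (4^25:ℝ)^((0.04:ℝ)) * X^(0.31:ℝ) := by
          congr 1
          rw [← rpow_natCast, ← rpow_mul (by norm_num)]; norm_num
      _ ≤ X^(0.04:ℝ) * X^(0.31:ℝ) := by gcongr
      _ = X^(0.35:ℝ) := by rw [← rpow_add hX0]; norm_num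
      _ ≤ _ := hM35.trans hMK'
  have hK65 : (K:ℝ) ≤ X^(0.65:ℝ) := by
    have h1 : X^(0.35:ℝ) * K ≤ X := (mul_le_mul_of_nonneg_right hM35 hK0.le).trans hMK1
    have h3 : X = X^(0.35:ℝ) * X^(0.65:ℝ) := by rw [← rpow_add hX0]; norm_num
    rw [h3] at h1
    nth_rewrite 1 [← h3] at h1
    exact le_of_mul_le_mul_left h1 (by positivity)
  have hM5 : (M:ℝ) ≤ X^(0.5:ℝ) := by
    have : (M:ℝ)^2 ≤ (X^(0.5:ℝ))^2 := by
      rw [← rpow_mul_natCast hX0.le]; norm_num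
      nlinarith
    exact le_of_sq_le_sq this (by positivity)
  have hlog : (1+log (8*K))^4 ≤ X^(0.001:ℝ) := by
    have h1 : log (8*K) ≤ 2*log X - 1 := by
      have hK' : (K:ℝ) ≤ X := hK65.trans (by nth_rewrite 2 [← rpow_one X]; exact rpow_le_rpow_of_exponent_le hX (by norm_num))
      have h2 : log (8*K) ≤ log (8*X) := log_le_log (by positivity) (by linarith)
      rw [log_mul (by norm_num) hX0.ne'] at h2
      have h3 : log (8*rexp 2) ≤ log X := log_le_log (by positivity) hXe
      rw [log_mul (by norm_num) (Real.exp_ne_zero _), log_exp] at h3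
      linarith
    have h0 : 0 ≤ log (8*K) := log_nonneg (by
      have : (1:ℝ) ≤ K := by exact_mod_cast hK
      linarith)
    calc (1+log (8*K))^4 ≤ (2*log X)^4 := by gcongr; linarith
      _ = 2^4 * (log X)^4 := by ring
      _ ≤ _ := by convert hXlog using 2; norm_num
  have h := hm2 θ a b A M K Q x1 x2 hθ hA hM hQ (by exact_mod_cast hQQ) hb W rfl
  refine h.trans ?_
  have hD : √(M*(W*Q/K+M)*((1+log (8*K))^4*(Q*K+Q*(K:ℝ)^3/W+(Q:ℝ)^4))) ≤ E * X := by
    refine Real.sqrt_le_iff.2 ⟨by positivity, ?_⟩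
    have m1 : (M:ℝ)*W*Q^2 ≤ 4*X^(1.99:ℝ) := by
      calc (M:ℝ)*W*Q^2 ≤ X^(0.5:ℝ) * X^(1.173:ℝ) * (2*X^(0.155:ℝ))^2 := by gcongr
        _ = 4 * (X^(0.5:ℝ) * X^(1.173:ℝ) * (X^(0.155:ℝ))^2) := by ring
        _ = 4 * X^(1.983:ℝ) := by
          rw [← rpow_mul_natCast hX0.le, ← rpow_add hX0, ← rpow_add hX0]; norm_num
        _ ≤ _ := by gcongr <;> norm_num
    have m2 : (M:ℝ)*Q^2*K^2 ≤ 4*X^(1.99:ℝ) := by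
      calc (M:ℝ)*Q^2*K^2 = (M*K)*K*Q^2 := by ring
        _ ≤ X * X^(0.65:ℝ) * (2*X^(0.155:ℝ))^2 := by gcongr
        _ = 4 * (X^(1:ℝ) * X^(0.65:ℝ) * (X^(0.155:ℝ))^2) := by rw [rpow_one]; ring
        _ = 4 * X^(1.96:ℝ) := by
          rw [← rpow_mul_natCast hX0.le, ← rpow_add hX0, ← rpow_add hX0]; norm_num
        _ ≤ _ := by gcongr <;> norm_num
    have m3 : (M:ℝ)*W*Q^5/K ≤ 32*X^(1.99:ℝ) := by
      calc (M:ℝ)*W*Q^5/K = (M/K)*(W*Q^5) := by ring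
        _ ≤ 1 * (X^(1.173:ℝ) * (2*X^(0.155:ℝ))^5) := by
            gcongr; rw [div_le_one hK0]; exact hMK'
        _ = 32 * (X^(1.173:ℝ) * (X^(0.155:ℝ))^5) := by ring
        _ = 32 * X^(1.948:ℝ) := by
          rw [← rpow_mul_natCast hX0.le, ← rpow_add hX0]; norm_num
        _ ≤ _ := by gcongr <;> norm_num
    have m4 : (M:ℝ)^2*Q*K ≤ 2*X^(1.99:ℝ) := by
      calc (M:ℝ)^2*Q*K = (M*K)*M*Q := by ring
        _ ≤ X * X^(0.5:ℝ) * (2*X^(0.155:ℝ)) := by gcongr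
        _ = 2 * (X^(1:ℝ) * X^(0.5:ℝ) * (X^(0.155:ℝ))) := by rw [rpow_one]; ring
        _ = 2 * X^(1.655:ℝ) := by
          rw [← rpow_add hX0, ← rpow_add hX0]; norm_num
        _ ≤ _ := by gcongr <;> norm_num
    have m5 : (M:ℝ)^2*Q*K^3/W ≤ 2^15*X^(1.99:ℝ) := by
      rw [div_le_iff₀ hW0]
      calc (M:ℝ)^2*Q*K^3 = (M*K)^2*K*Q := by ring
        _ ≤ X^2 * X^(0.65:ℝ) * (2*X^(0.155:ℝ)) := by gcongr
        _ = 2 * (X^(2:ℝ) * X^(0.65:ℝ) * (X^(0.155:ℝ))) := by rw [rpow_ofNat]; ring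
        _ = 2 * X^(2.805:ℝ) := by
          rw [← rpow_add hX0, ← rpow_add hX0]; norm_num
        _ ≤ 2 * X^(2.89:ℝ) := by gcongr <;> norm_num
        _ = 2 * (X^(1.99:ℝ) * X^(0.9:ℝ)) := by rw [← rpow_add hX0]; norm_num
        _ ≤ 2 * (X^(1.99:ℝ) * (128^2*W)) := by gcongr
        _ = _ := by ring
    have m6 : (M:ℝ)^2*Q^4 ≤ 16*X^(1.99:ℝ) := by
      calc (M:ℝ)^2*Q^4 ≤ (X^(0.5:ℝ))^2 * (2*X^(0.155:ℝ))^4 := by gcongr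
        _ = 16 * ((X^(0.5:ℝ))^2 * (X^(0.155:ℝ))^4) := by ring
        _ = 16 * X^(1.62:ℝ) := by
          rw [← rpow_mul_natCast hX0.le, ← rpow_mul_natCast hX0.le, ← rpow_add hX0]; norm_num
        _ ≤ _ := by gcongr <;> norm_num
    have e : M*(W*Q/K+M)*((1+log (8*K))^4*(Q*K+Q*(K:ℝ)^3/W+(Q:ℝ)^4)) =
      (1+log (8*K))^4 * ((M:ℝ)*W*Q^2 + (M:ℝ)*Q^2*K^2 + (M:ℝ)*W*Q^5/K + (M:ℝ)^2*Q*K + (M:ℝ)^2*Q*K^3/W + (M:ℝ)^2*Q^4) := by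
      field_simp; ring
    rw [e]
    have hl0 : 0 ≤ log (8*K) := log_nonneg (by
      have : (1:ℝ) ≤ K := by exact_mod_cast hK
      linarith)
    calc _ ≤ X^(0.001:ℝ) * (2^16*X^(1.99:ℝ)) := by
          apply mul_le_mul hlog _ (by positivity) (by positivity)
          have : 0 < X^(1.99:ℝ) := by positivity
          linarith
      _ = 2^16 * (X^(0.001:ℝ) * X^(1.99:ℝ)) := by ring
      _ = 2^16 * X^(1.991:ℝ) := by rw [← rpow_add hX0]; norm_num
      _ ≤ E^2 * X^(2:ℝ) := by
          have : X^(1.991:ℝ) ≤ X^(2:ℝ) := rpow_le_rpow_of_exponent_le hX (by norm_num)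
          gcongr
          rw [hE]; norm_num
      _ = _ := by rw [rpow_ofNat]; ring
  have s1 := sum_sq_le a M A ha
  have hq : X/Q ≤ X^(0.845:ℝ) := by
    rw [div_le_iff₀ hQ0]
    calc X = X^(0.845:ℝ) * X^(0.155:ℝ) := by rw [← rpow_add hX0]; norm_num
      _ ≤ _ := by gcongr
  calc _ ≤ C0 * (3*M*A^2) * (K/Q) * A^2 * (X + E * X) := by gcongr
    _ = C0 * 3 * (1+E) * (A^4 * ((M*K)/Q * X)) := by ring
    _ ≤ C0 * 3 * (1+E) * (A^4 * (X/Q * X)) := by gcongr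
    _ ≤ C0 * 3 * (1+E) * (A^4 * (X^(0.845:ℝ) * X^(1:ℝ))) := by rw [rpow_one]; gcongr
    _ = _ := by rw [← rpow_add hX0]; norm_num

lemma boxII (c : ℝ) (hc1 : 1 < c) (hc2 : c < 2) : ∃ C : ℝ, 0 < C ∧ ∀ᶠ X : ℝ in Filter.atTop, ∀ (θ A : ℝ) (a b : ℕ → ℂ) (M K Q x1 x2 : ℕ),
    θ ≠ 0 → 0 ≤ A → 1 ≤ Q → Q ≤ M → Q ≤ K → X^(0.155:ℝ) ≤ Q → Q ≤ 2*X^(0.155:ℝ) →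
    (M:ℝ)*K ≤ X → X ≤ 128*(M*K) →
    X^(0.9:ℝ) ≤ |θ| * X^c → |θ| * X^c ≤ X^(1.173:ℝ) →
    (∀ m ∈ Ioc M (4*M), ‖a m‖ ≤ A) → (∀ k ∈ Ioc K (4*K), ‖b k‖ ≤ A) →
    ‖bil c θ a b M K x1 x2‖^2 ≤ C * (A^4 * X^(1.845:ℝ)) := by
  obtain ⟨C1, hC1, h1⟩ := boxII_m1 c hc1 hc2
  obtain ⟨C2, hC2, h2⟩ := boxII_m2 c hc1 hc2
  refine ⟨max C1 C2, by positivity, ?_⟩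
  filter_upwards [h2, Filter.eventually_ge_atTop (1:ℝ)] with X h2 hX
  intro θ A a b M K Q x1 x2 hθ hA hQ hQM hQK hQ1 hQ2 hMK1 hMK2 hT1 hT2 ha hb
  have hm : 1 ≤ M := hQ.trans hQM
  have hk : 1 ≤ K := hQ.trans hQK
  have hp : 0 ≤ A^4 * X^(1.845:ℝ) := by have : 0 < X := by linarith
                                        positivity
  have r1 := mul_le_mul_of_nonneg_right (le_max_left C1 C2) hp
  have r2 := mul_le_mul_of_nonneg_right (le_max_right C1 C2) hp
  have hMK1' : (K:ℝ)*M ≤ X := by linarith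
  have hMK2' : X ≤ 128*((K:ℝ)*M) := by linarith
  by_cases hK : (K:ℝ) ≤ X^(0.35:ℝ)
  · exact (h1 X θ A a b M K Q x1 x2 hX hθ hA hm hk hQ hQK hQ1 hQ2 hK hMK1 hMK2 hT1 hT2 ha hb).trans r1
  by_cases hM : (M:ℝ) ≤ X^(0.35:ℝ)
  · rw [bil_swap]
    exact (h1 X θ A b a K M Q x1 x2 hX hθ hA hk hm hQ hQM hQ1 hQ2 hM hMK1' hMK2' hT1 hT2 hb ha).trans r1
  push Not at hK hM
  rcases le_total M K with hh | hh
  · exact (h2 θ A a b M K Q x1 x2 hθ hA hm hk hQ hQ1 hQ2 hh hM.le hMK1 hMK2 hT1 hT2 ha hb).trans r2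
  · rw [bil_swap]
    exact (h2 θ A b a K M Q x1 x2 hθ hA hk hm hQ hQ1 hQ2 hh hK.le hMK1' hMK2' hT1 hT2 hb ha).trans r2

noncomputable def SL (c θ : ℝ) (x1 x2 : ℕ) : ℂ := ∑ n ∈ Ioc x1 x2, ((vonMangoldt n : ℝ) : ℂ) * ee (θ * (n:ℝ)^c)

noncomputable def UX (X : ℝ) : ℕ := ⌈X^(0.155:ℝ)⌉₊

lemma UX_bounds (X : ℝ) (hX : 1 ≤ X) : 1 ≤ UX X ∧ X^(0.155:ℝ) ≤ UX X ∧ (UX X : ℝ) ≤ 2*X^(0.155:ℝ) := by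
  have h1 : 1 ≤ X^(0.155:ℝ) := Real.one_le_rpow hX (by norm_num)
  have h2 := Nat.le_ceil (X^(0.155:ℝ))
  have h3 := Nat.ceil_lt_add_one (by linarith : 0 ≤ X^(0.155:ℝ))
  refine ⟨?_, h2, ?_⟩
  · have : (1:ℝ) ≤ UX X := h1.trans h2
    exact_mod_cast this
  · unfold UX; linarith

lemma S_bound (c : ℝ) (hc1 : 1 < c) (hc2 : c < 2) : ∃ C : ℝ, 0 < C ∧ ∀ᶠ X : ℝ in Filter.atTop, ∀ (θ E : ℝ) (x1 x2 : ℕ), θ ≠ 0 →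
    X/8 ≤ x1 → x1 ≤ x2 → x2 ≤ 2*x1 → (x2:ℝ) ≤ X → 0 ≤ E →
    (∀ M K : ℕ, UX X ≤ M → UX X ≤ K → (M:ℝ)*K ≤ X → X ≤ 128*(M*K) →
      ‖bil c θ (fun m => ((vonMangoldt m : ℝ):ℂ)) (fun k => ((vbf (UX X) k : ℝ):ℂ)) M K x1 x2‖ ≤ E) →
    ‖SL c θ x1 x2‖ ≤ C * (log X)^3 * (X^(0.31:ℝ) * √(|θ| * X^c) + X/√(|θ| * X^c)) + 4*(log X)^2 * E := by
  obtain ⟨C0, hC0, hv⟩ := vaughan_bound c hc1 hc2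
  refine ⟨C0 * 8 * 8, by positivity, ?_⟩
  filter_upwards [ev_log 32 0 0.69 (by norm_num), Filter.eventually_ge_atTop (rexp 1)] with X hX32 hXe
  intro θ E x1 x2 hθ hx1 hx12 hx2 hx2X hE hbox
  have hL1 : 1 ≤ log X := by
    have := log_le_log (Real.exp_pos 1) hXe
    rwa [log_exp] at this
  have hX : 1 ≤ X := le_trans (by have := Real.add_one_le_exp (1:ℝ); linarith) hXe
  have hX0 : 0 < X := by linarith
  obtain ⟨hU1, hU2, hU3⟩ := UX_bounds X hX
  set U := UX X with hU
  have hUU : (U:ℝ)*U ≤ 4 * X^(0.31:ℝ) := by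
    calc (U:ℝ)*U ≤ (2*X^(0.155:ℝ)) * (2*X^(0.155:ℝ)) := by gcongr
      _ = 4 * (X^(0.155:ℝ) * X^(0.155:ℝ)) := by ring
      _ = _ := by rw [← rpow_add hX0]; norm_num
  have hx10 : (0:ℝ) < x1 := by linarith
  have hUUx : U*U ≤ x1 := by
    have : (U:ℝ)*U ≤ x1 := by
      refine hUU.trans (le_trans ?_ hx1)
      have h3 : X = X^(0.69:ℝ) * X^(0.31:ℝ) := by rw [← rpow_add hX0]; norm_num
      have h5 : 0 < X^(0.31:ℝ) := by positivity
      rw [pow_zero, mul_one] at hX32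
      have := mul_le_mul_of_nonneg_right hX32 h5.le
      linarith
    exact_mod_cast this
  have hx20 : (0:ℝ) < x2 := lt_of_lt_of_le hx10 (by exact_mod_cast hx12)
  have hx1n : 1 ≤ x2 := by have : 0 < x2 := by exact_mod_cast hx20
                           omega
  set J := Nat.log 4 x2 + 1 with hJ
  have hJ4 : x2 < 4^J := Nat.lt_pow_succ_log_self (by norm_num) x2
  have hJL : (J:ℝ) ≤ 2 * log X := by
    have h1 : (4:ℝ)^(Nat.log 4 x2) ≤ x2 := by exact_mod_cast Nat.pow_log_le_self 4 (by omega)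
    have h2 := log_le_log (by positivity) (h1.trans hx2X)
    rw [log_pow] at h2
    have h4 : 1 ≤ log 4 := by
      rw [show (4:ℝ) = 2^2 by norm_num, log_pow]; have := log_two_gt_d9; push_cast; linarith
    have h5 : (Nat.log 4 x2 : ℝ) ≤ Nat.log 4 x2 * log 4 := le_mul_of_one_le_right (by positivity) h4
    rw [hJ]; push_cast; linarith
  have h := hv θ U U x1 x2 J hθ hU1 hU1 hUUx hx12 hx2 hJ4
  unfold SL
  refine h.trans (add_le_add ?_ ?_)
  · have hlx : log x2 ≤ log X := log_le_log hx20 hx2X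
    have hlx0 : 0 ≤ log x2 := log_natCast_nonneg _
    have hT1 : √(|θ| * (x1:ℝ)^c) ≤ √(|θ| * X^c) := by
      apply Real.sqrt_le_sqrt
      have : (x1:ℝ) ≤ X := le_trans (by exact_mod_cast hx12) hx2X
      gcongr
    have hT0 : 0 < √(|θ| * X^c) := Real.sqrt_pos.2 (by positivity)
    have hT10 : 0 < √(|θ| * (x1:ℝ)^c) := Real.sqrt_pos.2 (by positivity)
    have hT2 : √(|θ| * X^c) ≤ 8 * √(|θ| * (x1:ℝ)^c) := by
      rw [Real.sqrt_le_left (by positivity), mul_pow, Real.sq_sqrt (by positivity)]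
      have h8 : X^c ≤ 8^2 * (x1:ℝ)^c := by
        calc X^c ≤ (8*(x1:ℝ))^c := by gcongr; linarith
          _ = 8^c * (x1:ℝ)^c := mul_rpow (by norm_num) (by positivity)
          _ ≤ _ := by
            gcongr
            rw [← rpow_natCast]
            exact rpow_le_rpow_of_exponent_le (by norm_num) (by push_cast; linarith)
      calc |θ| * X^c ≤ |θ| * (8^2 * (x1:ℝ)^c) := by gcongr
        _ = _ := by ring
    have q1 : (x1:ℝ)/√(|θ| * (x1:ℝ)^c) ≤ 8 * (X/√(|θ| * X^c)) := by
      rw [← mul_div_assoc, div_le_div_iff₀ hT10 hT0]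
      have : (x1:ℝ) ≤ X := le_trans (by exact_mod_cast hx12) hx2X
      calc (x1:ℝ)*√(|θ| * X^c) ≤ X * (8 * √(|θ| * (x1:ℝ)^c)) := by gcongr
        _ = _ := by ring
    calc _ ≤ C0 * (2*log X)^3 * ((4*X^(0.31:ℝ)) * √(|θ| * X^c) + 8 * (X/√(|θ| * X^c))) := by
          gcongr; linarith
      _ ≤ C0 * (2*log X)^3 * ((8*X^(0.31:ℝ)) * √(|θ| * X^c) + 8 * (X/√(|θ| * X^c))) := by
          gcongr; norm_num
      _ = _ := by ring
  · calc _ ≤ ∑ i ∈ range J, ∑ j ∈ range J, E := by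
          apply Finset.sum_le_sum; intro i _; apply Finset.sum_le_sum; intro j _
          by_cases hne : bil c θ (fun m => ((vonMangoldt m : ℝ):ℂ)) (fun k => ((vbf U k : ℝ):ℂ)) (U*4^i) (U*4^j) x1 x2 = 0
          · rw [hne]; simpa using hE
          · obtain ⟨g1, g2⟩ := bil_nonempty _ _ _ _ _ _ _ _ hne
            have g1' : (((U*4^i:ℕ):ℝ))*((U*4^j:ℕ):ℝ) ≤ x2 := by exact_mod_cast g1
            have g2' : (x1:ℝ) ≤ 16*((((U*4^i:ℕ):ℝ))*((U*4^j:ℕ):ℝ)) := by exact_mod_cast g2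
            exact hbox _ _ (Nat.le_mul_of_pos_right _ (by positivity)) (Nat.le_mul_of_pos_right _ (by positivity)) (g1'.trans hx2X) (by linarith)
      _ = (J:ℝ)^2 * E := by simp; ring
      _ ≤ (2*log X)^2 * E := by gcongr
      _ = _ := by ring

set_option maxHeartbeats 1000000 in
lemma expsum_i (c : ℝ) (hc1 : 1 < c) (hc2 : c < 2) : ∃ C : ℝ, 0 < C ∧ ∀ᶠ X : ℝ in Filter.atTop, ∀ (θ : ℝ) (x1 x2 : ℕ),
    X/8 ≤ x1 → x1 ≤ x2 → x2 ≤ 2*x1 → (x2:ℝ) ≤ X → 1 ≤ |θ| * X^c → |θ| * X^c ≤ X^(0.9:ℝ) →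
    ‖SL c θ x1 x2‖ ≤ C * (log X)^5 * X * ((|θ| * X^c)^(-(1/4):ℝ) + X^(-0.025:ℝ)) := by
  obtain ⟨C1, hC1, hS⟩ := S_bound c hc1 hc2
  obtain ⟨C2, hC2, hB⟩ := boxI c hc1 hc2
  refine ⟨C1 + 128*√C2, by positivity, ?_⟩
  filter_upwards [hS, Filter.eventually_ge_atTop (4*rexp 1)] with X hS hXe
  intro θ x1 x2 hx1 hx12 hx2 hx2X hT1 hT2
  have hL2 : log 4 + 1 ≤ log X := by
    have := log_le_log (by positivity) hXe
    rwa [log_mul (by norm_num) (Real.exp_ne_zero _), log_exp] at this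
  have hl4 : 0 ≤ log 4 := log_nonneg (by norm_num)
  have hL1 : 1 ≤ log X := by linarith
  have hX : 1 ≤ X := le_trans (by have := Real.add_one_le_exp (1:ℝ); linarith) hXe
  have hX0 : 0 < X := by linarith
  obtain ⟨hU1, hU2, hU3⟩ := UX_bounds X hX
  have hθ : θ ≠ 0 := by rintro rfl; simp at hT1; linarith
  set T := |θ| * X^c with hT
  have hT0 : 0 < T := by linarith
  set L := log X with hL
  set Y := T^(-(1/4):ℝ) + X^(-0.025:ℝ) with hY
  have hY0 : 0 < Y := by positivity
  have hTq : 1/√T = (T^(-(1/4):ℝ))^2 := by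
    rw [← rpow_mul_natCast hT0.le, Real.sqrt_eq_rpow, one_div, ← rpow_neg hT0.le]; norm_num
  have hXq : X^(-0.05:ℝ) = (X^(-0.025:ℝ))^2 := by
    rw [← rpow_mul_natCast hX0.le]; norm_num
  have hp1 : 0 < T^(-(1/4):ℝ) := by positivity
  have hp2 : 0 < X^(-0.025:ℝ) := by positivity
  have hlog : ∀ N : ℕ, 1 ≤ N → (N:ℝ) ≤ X → 1 + log ((4*N:ℕ):ℝ) ≤ 2*L := by
    intro N hN1 hN
    have hN0 : (0:ℝ) < N := by exact_mod_cast hN1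
    push_cast
    rw [log_mul (by norm_num) hN0.ne']
    have := log_le_log hN0 hN
    linarith
  have hbox : ∀ M K : ℕ, UX X ≤ M → UX X ≤ K → (M:ℝ)*K ≤ X → X ≤ 128*(M*K) →
      ‖bil c θ (fun m => ((vonMangoldt m : ℝ):ℂ)) (fun k => ((vbf (UX X) k : ℝ):ℂ)) M K x1 x2‖ ≤ √C2 * (32 * L^3 * X * Y) := by
    intro M K hM hK hMK1 hMK2
    have hM1 : (1:ℝ) ≤ M := by exact_mod_cast hU1.trans hM
    have hK1 : (1:ℝ) ≤ K := by exact_mod_cast hU1.trans hK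
    have hMX : (M:ℝ) ≤ X := by nlinarith
    have hKX : (K:ℝ) ≤ X := by nlinarith
    have hG := hB X θ (32*L^3) (fun m => ((vonMangoldt m : ℝ):ℂ)) (fun k => ((vbf (UX X) k : ℝ):ℂ)) M K x1 x2 hX hθ (by positivity)
      (hU1.trans hM) (hU1.trans hK) (hU2.trans (by exact_mod_cast hM)) (hU2.trans (by exact_mod_cast hK)) hMK1 hMK2 hT2 ?_ ?_
    · rw [← hT, hTq, hXq] at hG
      refine le_of_sq_le_sq ?_ (by positivity)
      refine hG.trans ?_
      rw [mul_pow (√C2), Real.sq_sqrt hC2.le]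
      have : (X^(-0.025:ℝ))^2 + (T^(-(1/4):ℝ))^2 ≤ Y^2 := by rw [hY]; nlinarith
      calc _ ≤ C2 * ((32*L^3)^2 * X^2 * Y^2) := by gcongr
        _ = _ := by ring
    · refine (sum_sq_le _ M (2*L) ?_).trans ?_
      · intro m hm
        rw [mem_Ioc] at hm
        rw [Complex.norm_real, Real.norm_of_nonneg ArithmeticFunction.vonMangoldt_nonneg]
        refine ArithmeticFunction.vonMangoldt_le_log.trans ?_
        have h1 := hlog M (hU1.trans hM) hMX
        have : log m ≤ log ((4*M:ℕ):ℝ) := log_le_log (by exact_mod_cast (by omega : 0 < m)) (by exact_mod_cast hm.2)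
        linarith
      · have : L^2 ≤ L^3 := pow_le_pow_right₀ hL1 (by norm_num)
        nlinarith
    · calc ∑ k ∈ Ioc K (4*K), ‖((vbf (UX X) k : ℝ):ℂ)‖^2 ≤ ∑ k ∈ Ioc K (4*K), ((k.divisors.card:ℕ):ℝ)^2 := by
            apply Finset.sum_le_sum; intro k _
            rw [Complex.norm_real, Real.norm_eq_abs]
            exact pow_le_pow_left₀ (abs_nonneg _) (vbf_bound _ _) 2
        _ ≤ ∑ k ∈ Icc 1 (4*K), ((k.divisors.card:ℕ):ℝ)^2 := by
            apply Finset.sum_le_sum_of_subset_of_nonneg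
            · intro k; simp only [mem_Ioc, mem_Icc]; omega
            · intros; positivity
        _ ≤ _ := sum_divisors_sq _
        _ ≤ ((4*K:ℕ):ℝ) * (2*L)^3 := by
            have := log_natCast_nonneg (4*K)
            exact mul_le_mul_of_nonneg_left (pow_le_pow_left₀ (by linarith) (hlog K (hU1.trans hK) hKX) 3) (by positivity)
        _ = _ := by push_cast; ring
  refine (hS θ _ x1 x2 hθ hx1 hx12 hx2 hx2X (by positivity) hbox).trans ?_
  have hsT : √T ≤ X^(0.45:ℝ) := by
    rw [Real.sqrt_le_left (by positivity), ← rpow_mul_natCast hX0.le]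
    norm_num
    norm_num at hT2
    exact hT2
  have i1 : X^(0.31:ℝ) * √T ≤ X * X^(-0.025:ℝ) := by
    calc X^(0.31:ℝ) * √T ≤ X^(0.31:ℝ) * X^(0.45:ℝ) := by gcongr
      _ = X^(0.76:ℝ) := by rw [← rpow_add hX0]; norm_num
      _ ≤ X^(0.975:ℝ) := rpow_le_rpow_of_exponent_le hX (by norm_num)
      _ = X^(1:ℝ) * X^(-0.025:ℝ) := by rw [← rpow_add hX0]; norm_num
      _ = _ := by rw [rpow_one]
  have i2 : X/√T ≤ X * T^(-(1/4):ℝ) := by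
    rw [div_eq_mul_one_div, hTq]
    gcongr
    have : T^(-(1/4):ℝ) ≤ 1 := rpow_le_one_of_one_le_of_nonpos hT1 (by norm_num)
    nlinarith
  calc _ ≤ C1 * L^3 * (X * X^(-0.025:ℝ) + X * T^(-(1/4):ℝ)) + 4*L^2*(√C2 * (32 * L^3 * X * Y)) := by gcongr
    _ = C1 * L^3 * (X*Y) + 128*√C2 * L^5 * (X * Y) := by rw [hY]; ring
    _ ≤ C1 * L^5 * (X*Y) + 128*√C2 * L^5 * (X * Y) := by
        have : L^3 ≤ L^5 := pow_le_pow_right₀ hL1 (by norm_num)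
        gcongr
    _ = _ := by ring

set_option maxHeartbeats 1000000 in
lemma expsum_ii (c : ℝ) (hc1 : 1 < c) (hc2 : c < 2) : ∀ᶠ X : ℝ in Filter.atTop, ∀ (θ : ℝ) (x1 x2 : ℕ),
    X/8 ≤ x1 → x1 ≤ x2 → x2 ≤ 2*x1 → (x2:ℝ) ≤ X → X^(0.9:ℝ) ≤ |θ| * X^c → |θ| * X^c ≤ X^(1.173:ℝ) →
    ‖SL c θ x1 x2‖ ≤ X^(0.9233:ℝ) := by
  obtain ⟨C1, hC1, hS⟩ := S_bound c hc1 hc2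
  obtain ⟨C2, hC2, hB⟩ := boxII c hc1 hc2
  obtain ⟨C3, hC3, hd⟩ := divisor_bound 0.00005 (by norm_num) (by norm_num)
  filter_upwards [hS, hB, Filter.eventually_ge_atTop (4*rexp 1), ev_log (C1*2) 3 0.001 (by norm_num), ev_log (4*√C2) 2 0.0003 (by norm_num),
    ev_log 2 0 0.0003 (by norm_num), ev_log 2 1 0.0001 (by norm_num), ev_log (C3*4) 0 0.00005 (by norm_num)] with X hS hB hXe v1 v2 v3 v4 v5
  intro θ x1 x2 hx1 hx12 hx2 hx2X hT1 hT2
  have hL2 : log 4 + 1 ≤ log X := by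
    have := log_le_log (by positivity) hXe
    rwa [log_mul (by norm_num) (Real.exp_ne_zero _), log_exp] at this
  have hl4 : 0 ≤ log 4 := log_nonneg (by norm_num)
  have hL1 : 1 ≤ log X := by linarith
  have hX : 1 ≤ X := le_trans (by have := Real.add_one_le_exp (1:ℝ); linarith) hXe
  have hX0 : 0 < X := by linarith
  obtain ⟨hU1, hU2, hU3⟩ := UX_bounds X hX
  have hθ : θ ≠ 0 := by
    rintro rfl; simp at hT1
    have : 0 < X^(0.9:ℝ) := by positivity
    linarith
  set T := |θ| * X^c with hT
  have hT0 : 0 < T := lt_of_lt_of_le (by positivity) hT1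
  set L := log X with hL
  set A := X^(0.0001:ℝ) with hA
  rw [pow_zero, mul_one] at v3 v5
  rw [pow_one] at v4
  have hbox : ∀ M K : ℕ, UX X ≤ M → UX X ≤ K → (M:ℝ)*K ≤ X → X ≤ 128*(M*K) →
      ‖bil c θ (fun m => ((vonMangoldt m : ℝ):ℂ)) (fun k => ((vbf (UX X) k : ℝ):ℂ)) M K x1 x2‖ ≤ √C2 * X^(0.9227:ℝ) := by
    intro M K hM hK hMK1 hMK2
    have hM1 : (1:ℝ) ≤ M := by exact_mod_cast hU1.trans hM
    have hK1 : (1:ℝ) ≤ K := by exact_mod_cast hU1.trans hK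
    have hMX : (M:ℝ) ≤ X := by nlinarith
    have hKX : (K:ℝ) ≤ X := by nlinarith
    have hG := hB θ A (fun m => ((vonMangoldt m : ℝ):ℂ)) (fun k => ((vbf (UX X) k : ℝ):ℂ)) M K (UX X) x1 x2 hθ (by positivity)
      hU1 hM hK hU2 hU3 hMK1 hMK2 hT1 hT2 ?_ ?_
    · refine le_of_sq_le_sq (hG.trans (le_of_eq ?_)) (by positivity)
      rw [mul_pow, Real.sq_sqrt hC2.le, hA, ← rpow_mul_natCast hX0.le, ← rpow_mul_natCast hX0.le, ← rpow_add hX0]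
      norm_num
    · intro m hm
      rw [mem_Ioc] at hm
      rw [Complex.norm_real, Real.norm_of_nonneg ArithmeticFunction.vonMangoldt_nonneg]
      refine ArithmeticFunction.vonMangoldt_le_log.trans (le_trans ?_ v4)
      have h1 : (m:ℝ) ≤ 4*X := by
        have : (m:ℝ) ≤ 4*M := by exact_mod_cast hm.2
        linarith
      have : log m ≤ log (4*X) := log_le_log (by exact_mod_cast (by omega : 0 < m)) h1
      rw [log_mul (by norm_num) hX0.ne'] at this
      linarith
    · intro k hk
      rw [mem_Ioc] at hk
      rw [Complex.norm_real, Real.norm_eq_abs]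
      refine (vbf_bound _ _).trans ((hd k (by omega)).trans ?_)
      have h1 : (k:ℝ) ≤ 4*X := by
        have : (k:ℝ) ≤ 4*K := by exact_mod_cast hk.2
        linarith
      calc C3 * (k:ℝ)^(0.00005:ℝ) ≤ C3 * (4*X)^(0.00005:ℝ) := by gcongr
        _ = C3 * (4^(0.00005:ℝ) * X^(0.00005:ℝ)) := by rw [mul_rpow (by norm_num) hX0.le]
        _ ≤ C3 * (4 * X^(0.00005:ℝ)) := by
            have : (4:ℝ)^(0.00005:ℝ) ≤ 4^(1:ℝ) := rpow_le_rpow_of_exponent_le (by norm_num) (by norm_num)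
            rw [rpow_one] at this
            gcongr
        _ = (C3*4) * X^(0.00005:ℝ) := by ring
        _ ≤ X^(0.00005:ℝ) * X^(0.00005:ℝ) := by gcongr
        _ = A := by rw [← rpow_add hX0, hA]; norm_num
  refine (hS θ _ x1 x2 hθ hx1 hx12 hx2 hx2X (by positivity) hbox).trans ?_
  have hsT : √T ≤ X^(0.5865:ℝ) := by
    rw [Real.sqrt_le_left (by positivity), ← rpow_mul_natCast hX0.le]
    norm_num
    norm_num at hT2
    exact hT2
  have hsT0 : 0 < √T := Real.sqrt_pos.2 hT0
  have hsT' : X^(0.45:ℝ) ≤ √T := by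
    apply Real.le_sqrt_of_sq_le
    rw [← rpow_mul_natCast hX0.le]
    norm_num
    norm_num at hT1
    exact hT1
  have i1 : X^(0.31:ℝ) * √T ≤ X^(0.9:ℝ) := by
    calc X^(0.31:ℝ) * √T ≤ X^(0.31:ℝ) * X^(0.5865:ℝ) := by gcongr
      _ = X^(0.8965:ℝ) := by rw [← rpow_add hX0]; norm_num
      _ ≤ X^(0.9:ℝ) := rpow_le_rpow_of_exponent_le hX (by norm_num)
  have i2 : X/√T ≤ X^(0.9:ℝ) := by
    rw [div_le_iff₀ hsT0]
    calc X = X^(1:ℝ) := by rw [rpow_one]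
      _ ≤ X^(1.35:ℝ) := rpow_le_rpow_of_exponent_le hX (by norm_num)
      _ = X^(0.9:ℝ) * X^(0.45:ℝ) := by rw [← rpow_add hX0]; norm_num
      _ ≤ _ := by gcongr
  calc _ ≤ C1 * L^3 * (X^(0.9:ℝ) + X^(0.9:ℝ)) + 4*L^2*(√C2 * X^(0.9227:ℝ)) := by gcongr
    _ = (C1 * 2 * L^3) * X^(0.9:ℝ) + (4*√C2*L^2) * X^(0.9227:ℝ) := by ring
    _ ≤ X^(0.001:ℝ) * X^(0.9:ℝ) + X^(0.0003:ℝ) * X^(0.9227:ℝ) := by gcongr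
    _ = X^(0.901:ℝ) + X^(0.923:ℝ) := by rw [← rpow_add hX0, ← rpow_add hX0]; norm_num
    _ ≤ X^(0.923:ℝ) + X^(0.923:ℝ) := by gcongr <;> norm_num
    _ = 2 * X^(0.923:ℝ) := by ring
    _ ≤ X^(0.0003:ℝ) * X^(0.923:ℝ) := by gcongr
    _ = _ := by rw [← rpow_add hX0]; norm_num

/-- the smoothing weight -/
noncomputable def wt (y : ℝ) : ℝ := (Real.sin (π * y)) ^ 4

noncomputable def CC (ξ : ℝ) : ℂ := ∫ t in (0:ℝ)..1, ((wt t : ℝ) : ℂ) * ee (-(ξ * t))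

lemma wt_nonneg (y : ℝ) : 0 ≤ wt y := by unfold wt; positivity

lemma wt_le_one (y : ℝ) : wt y ≤ 1 := by
  unfold wt
  have h := Real.sin_sq_le_one (π * y)
  have h0 := sq_nonneg (Real.sin (π * y))
  nlinarith

lemma wt_cos (y : ℝ) : wt y = 3/8 - 1/2 * Real.cos (2*π*y) + 1/8 * Real.cos (2*π*(2*y)) := by
  unfold wt
  have h1 : Real.cos (2*π*y) = 1 - 2 * Real.sin (π*y)^2 := by
    rw [show 2*π*y = 2*(π*y) by ring, Real.cos_two_mul, Real.cos_sq']; ring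
  have h2 : Real.cos (2*π*(2*y)) = 2 * Real.cos (2*π*y)^2 - 1 := by
    rw [show 2*π*(2*y) = 2*(2*π*y) by ring, Real.cos_two_mul]
  rw [h2, h1]; ring

lemma cos_ee (x : ℝ) : ((Real.cos (2*π*x) : ℝ) : ℂ) = (ee x + ee (-x)) / 2 := by
  unfold ee
  push_cast
  rw [Complex.cos]
  congr 2
  congr 1
  ring_nf

lemma wt_ee (y : ℝ) : ((wt y : ℝ) : ℂ) = 3/8 - 1/4 * (ee y + ee (-y)) + 1/16 * (ee (2*y) + ee (-(2*y))) := by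
  rw [wt_cos]
  push_cast
  have h1 := cos_ee y
  have h2 := cos_ee (2*y)
  push_cast at h1 h2
  rw [h1, h2]; ring

lemma continuous_wt : Continuous wt := by unfold wt; fun_prop

lemma wt_add_int (y : ℝ) (m : ℤ) : wt (y + m) = wt y := by
  rw [wt_cos, wt_cos]
  congr 2
  · congr 1
    rw [show 2*π*(y+m) = 2*π*y + m*(2*π) by ring, Real.cos_add_int_mul_two_pi]
  · rw [show 2*π*(2*(y+m)) = 2*π*(2*y) + ((2*m:ℤ):ℝ)*(2*π) by push_cast; ring, Real.cos_add_int_mul_two_pi]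

lemma int_ee (ξ : ℝ) (hξ : ξ ≠ 0) : ∫ t in (0:ℝ)..1, ee (-(ξ*t)) = (1 - ee (-ξ)) / (2*π*Complex.I*ξ) := by
  have h : ∀ t:ℝ, ee (-(ξ*t)) = Complex.exp ((-(2*π*Complex.I*ξ)) * t) := by
    intro t; unfold ee; congr 1; push_cast; ring
  simp_rw [h]
  have hne : (2*π*Complex.I*ξ : ℂ) ≠ 0 := by
    simp [hξ, Real.pi_ne_zero]
  rw [integral_exp_mul_complex (by simpa using hne)]
  have h1 : ee (-ξ) = Complex.exp (-(2*π*Complex.I*ξ) * (1:ℝ)) := by rw [← h]; simp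
  rw [h1]
  simp only [Complex.ofReal_zero, mul_zero, Complex.exp_zero]
  rw [div_neg, ← neg_div]
  congr 1; ring

set_option maxHeartbeats 1000000 in
lemma CC_formula (ξ : ℝ) (h0 : 4 ≤ |ξ|) :
    CC ξ = (1 - ee (-ξ)) / (2*π*Complex.I) * ((1.5 / (ξ * (ξ^2-1) * (ξ^2-4)) : ℝ) : ℂ) := by
  have hne : ∀ k : ℤ, |k| ≤ 2 → ξ - k ≠ 0 := by
    intro k hk h
    have : ξ = k := by linarith
    rw [this] at h0
    have : (4:ℤ) ≤ |k| := by exact_mod_cast h0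
    omega
  have hi : ∀ k : ℤ, |k| ≤ 2 → ∫ t in (0:ℝ)..1, ee (-((ξ-k)*t)) = (1 - ee (-ξ)) / (2*π*Complex.I) * ((1/(ξ-k):ℝ):ℂ) := by
    intro k hk
    rw [int_ee _ (hne k hk), show -(ξ - k) = -ξ + k by ring, ee_add, ee_int, mul_one]
    push_cast
    have := hne k hk
    field_simp
  have hint : ∀ k : ℤ, IntervalIntegrable (fun t:ℝ => ee (-((ξ-k)*t))) volume 0 1 := by
    intro k
    apply Continuous.intervalIntegrable
    have := continuous_ee
    fun_prop
  have e0 := hi 0 (by norm_num)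
  have e1 := hi 1 (by norm_num)
  have e2 := hi (-1) (by norm_num)
  have e3 := hi 2 (by norm_num)
  have e4 := hi (-2) (by norm_num)
  have hexp : ∀ t : ℝ, ((wt t : ℝ):ℂ) * ee (-(ξ*t)) = 3/8 * ee (-((ξ-(0:ℤ))*t)) - 1/4 * ee (-((ξ-(1:ℤ))*t))
      - 1/4 * ee (-((ξ-(-1:ℤ))*t)) + 1/16 * ee (-((ξ-(2:ℤ))*t)) + 1/16 * ee (-((ξ-(-2:ℤ))*t)) := by
    intro t
    rw [wt_ee]
    have a1 : ee (-((ξ-(1:ℤ))*t)) = ee t * ee (-(ξ*t)) := by rw [← ee_add]; congr 1; push_cast; ring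
    have a2 : ee (-((ξ-(-1:ℤ))*t)) = ee (-t) * ee (-(ξ*t)) := by rw [← ee_add]; congr 1; push_cast; ring
    have a3 : ee (-((ξ-(2:ℤ))*t)) = ee (2*t) * ee (-(ξ*t)) := by rw [← ee_add]; congr 1; push_cast; ring
    have a4 : ee (-((ξ-(-2:ℤ))*t)) = ee (-(2*t)) * ee (-(ξ*t)) := by rw [← ee_add]; congr 1; push_cast; ring
    have a0 : ee (-((ξ-(0:ℤ))*t)) = ee (-(ξ*t)) := by congr 1; push_cast; ring
    rw [a0, a1, a2, a3, a4]; ring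
  unfold CC
  simp_rw [hexp]
  rw [intervalIntegral.integral_add, intervalIntegral.integral_add, intervalIntegral.integral_sub, intervalIntegral.integral_sub]
  · simp only [intervalIntegral.integral_const_mul]
    rw [e0, e1, e2, e3, e4]
    have n0 := hne 0 (by norm_num)
    have n1 := hne 1 (by norm_num)
    have n2 := hne (-1) (by norm_num)
    have n3 := hne 2 (by norm_num)
    have n4 := hne (-2) (by norm_num)
    have key : (1.5 / (ξ * (ξ^2-1) * (ξ^2-4)) : ℝ) = 3/8 * (1/(ξ-(0:ℤ))) - 1/4 * (1/(ξ-(1:ℤ))) - 1/4*(1/(ξ-(-1:ℤ)))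
       + 1/16*(1/(ξ-(2:ℤ))) + 1/16*(1/(ξ-(-2:ℤ))) := by
      have f1 : ξ^2-1 = (ξ-(1:ℤ))*(ξ-(-1:ℤ)) := by push_cast; ring
      have f2 : ξ^2-4 = (ξ-(2:ℤ))*(ξ-(-2:ℤ)) := by push_cast; ring
      rw [f1, f2]
      have f3 : ξ = ξ - (0:ℤ) := by simp
      have n0' : ξ ≠ 0 := by rw [f3]; exact n0
      rw [← f3]
      field_simp
      push_cast
      ring
    rw [key]
    push_cast
    ring
  all_goals first
    | exact (hint _).const_mul _
    | exact ((hint _).const_mul _).sub ((hint _).const_mul _)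
    | exact (((hint _).const_mul _).sub ((hint _).const_mul _)).sub ((hint _).const_mul _)
    | exact ((((hint _).const_mul _).sub ((hint _).const_mul _)).sub ((hint _).const_mul _)).add ((hint _).const_mul _)

lemma CC_le_one (ξ : ℝ) : ‖CC ξ‖ ≤ 1 := by
  unfold CC
  have := intervalIntegral.norm_integral_le_of_norm_le_const (a := (0:ℝ)) (b := 1) (C := 1)
    (f := fun t => ((wt t : ℝ):ℂ) * ee (-(ξ*t))) (by
      intro t _
      rw [norm_mul, norm_ee, mul_one, Complex.norm_real, Real.norm_of_nonneg (wt_nonneg t)]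
      exact wt_le_one t)
  simpa using this

lemma CC_decay (ξ : ℝ) (h0 : 4 ≤ |ξ|) : ‖CC ξ‖ ≤ 1 / |ξ|^5 := by
  rw [CC_formula ξ h0, norm_mul, norm_div, Complex.norm_real]
  have h1 : ‖1 - ee (-ξ)‖ ≤ 2 := by
    refine (norm_sub_le _ _).trans ?_
    rw [norm_ee]; norm_num
  have h2 : ‖(2*π*Complex.I : ℂ)‖ = 2*π := by
    simp [abs_of_pos Real.pi_pos]
  have hsq : 16 ≤ |ξ|^2 := by nlinarith
  have h3 : ‖(1.5 / (ξ * (ξ^2-1) * (ξ^2-4)) : ℝ)‖ = 1.5 / (|ξ| * (|ξ|^2-1) * (|ξ|^2-4)) := by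
    rw [Real.norm_eq_abs, abs_div, abs_mul, abs_mul, abs_of_nonneg (by norm_num : (0:ℝ) ≤ 1.5), ← sq_abs ξ,
      abs_of_nonneg (by linarith : (0:ℝ) ≤ |ξ|^2-1), abs_of_nonneg (by linarith : (0:ℝ) ≤ |ξ|^2-4)]
  rw [h2, h3]
  have hpi := Real.pi_gt_three
  have hd : 0 < |ξ| * (|ξ|^2-1) * (|ξ|^2-4) := by
    apply mul_pos (mul_pos _ _) <;> linarith
  calc ‖1 - ee (-ξ)‖ / (2*π) * (1.5 / (|ξ| * (|ξ|^2-1) * (|ξ|^2-4)))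
      ≤ 2/(2*3) * (1.5 / (|ξ| * (|ξ|^2-1) * (|ξ|^2-4))) := by gcongr
    _ ≤ _ := by
        rw [div_mul_div_comm, div_le_div_iff₀ (by positivity) (by positivity)]
        set z := |ξ|
        have : z^5 = z * (z^2*z^2) := by ring
        rw [this]
        have : 0 ≤ (z^2-16)*(z^2-1) := by apply mul_nonneg <;> linarith
        have h5 : z^2*z^2*(1/2) ≤ (z^2-1)*(z^2-4) := by nlinarith
        have := mul_le_mul_of_nonneg_left h5 (by linarith : 0 ≤ z)
        nlinarith

lemma CC_bound (α : ℝ) (hα : |α| ≤ 1/2) (h : ℤ) : ‖CC (α + h)‖ ≤ 9^5 / (1 + |(h:ℝ)|)^5 := by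
  have h1 : |(h:ℝ)| ≤ |α + h| + 1/2 := by
    have := abs_sub_abs_le_abs_sub (h:ℝ) (-α)
    rw [abs_neg, sub_neg_eq_add, add_comm (h:ℝ) α] at this
    linarith
  have hp : 0 < 1 + |(h:ℝ)| := by positivity
  rcases le_total 4 |α+h| with h4 | h4
  · refine (CC_decay _ h4).trans ?_
    have h5 : 0 < |α+h| := by linarith
    rw [div_le_div_iff₀ (by positivity) (by positivity), one_mul, ← mul_pow]
    apply pow_le_pow_left₀ hp.le
    linarith
  · refine (CC_le_one _).trans ?_
    rw [le_div_iff₀ (by positivity), one_mul]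
    apply pow_le_pow_left₀ hp.le
    linarith

lemma summable_fifth : Summable (fun h:ℤ => 1 / (1 + |(h:ℝ)|)^5) := by
  have h := Real.summable_abs_int_rpow (b := 2) (by norm_num)
  have h2 : Summable (fun n:ℤ => |(n:ℝ)|^(-2:ℝ) + (if n = 0 then (1:ℝ) else 0)) := by
    apply h.add
    apply summable_of_finite_support
    apply (Set.finite_singleton (0:ℤ)).subset
    intro n hn
    simp at hn
    simpa using hn
  refine h2.of_nonneg_of_le (fun n => by positivity) (fun n => ?_)
  split_ifs with hn
  · subst hn; simp
  · have : (1:ℝ) ≤ |(n:ℝ)| := by exact_mod_cast Int.one_le_abs hn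
    rw [add_zero, rpow_neg (abs_nonneg _), one_div]
    apply inv_anti₀ (by positivity)
    rw [rpow_ofNat]
    calc |(n:ℝ)|^2 ≤ (1+|(n:ℝ)|)^2 := by gcongr; linarith
      _ ≤ (1+|(n:ℝ)|)^5 := by apply pow_le_pow_right₀ <;> [linarith; norm_num]

lemma CC_summable (α : ℝ) (hα : |α| ≤ 1/2) : Summable (fun h:ℤ => ‖CC (α + h)‖) := by
  refine (summable_fifth.mul_left (9^5)).of_nonneg_of_le (fun _ => norm_nonneg _) (fun h => ?_)
  rw [mul_one_div]
  exact CC_bound α hα h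

/-- Fourier expansion -/
lemma floor_expand (α : ℝ) (hα : |α| ≤ 1/2) (y : ℝ) :
    HasSum (fun h:ℤ => CC (α + h) * ee ((α+h)*y)) (((wt y:ℝ):ℂ) * ee (α * ⌊y⌋)) := by
  let f : ℝ → ℂ := fun t => ((wt t:ℝ):ℂ) * ee (-(α*t))
  have hfc : Continuous f := by
    have := continuous_ee
    have := continuous_wt
    simp only [f]
    fun_prop
  have hf01 : f 0 = f 1 := by
    simp [f, wt]
  haveI : Fact ((0:ℝ) < 1) := ⟨one_pos⟩
  let g : C(AddCircle (1:ℝ), ℂ) := ⟨AddCircle.liftIco 1 0 f, AddCircle.liftIco_zero_continuous hf01 hfc.continuousOn⟩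
  have hco : ∀ h:ℤ, fourierCoeff g h = CC (α + h) := by
    intro h
    change fourierCoeff (AddCircle.liftIco 1 0 f) h = _
    rw [fourierCoeff_liftIco_eq, fourierCoeffOn_eq_integral]
    unfold CC
    simp only [add_zero, zero_add, sub_zero, div_one, one_smul]
    apply intervalIntegral.integral_congr
    intro t _
    simp only [f, smul_eq_mul]
    have h7 : ∀ T : ℝ, T = 1 → (fourier (-h) ((t:ℝ) : AddCircle T) : ℂ) = ee (-(h*t)) := by
      intro T hT
      subst hT
      rw [fourier_coe_apply]
      unfold ee
      congr 1
      push_cast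
      ring
    rw [h7 _ (by norm_num), show -((α+h)*t) = -(h*t) + -(α*t) by ring, ee_add]
    ring
  have hs : Summable (fourierCoeff g) := by
    apply Summable.of_norm
    simp_rw [hco]
    exact CC_summable α hα
  have := has_pointwise_sum_fourier_series_of_summable hs ((Int.fract y : ℝ) : AddCircle (1:ℝ))
  have hg : g ((Int.fract y:ℝ) : AddCircle (1:ℝ)) = f (Int.fract y) := by
    change AddCircle.liftIco 1 0 f _ = _
    rw [AddCircle.liftIco_zero_coe_apply]
    exact ⟨Int.fract_nonneg y, Int.fract_lt_one y⟩
  rw [hg] at this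
  have h2 := this.mul_right (ee (α*y))
  have hfun : (fun h:ℤ => CC (α + h) * ee ((α+h)*y)) = fun h:ℤ => fourierCoeff g h • fourier h ((Int.fract y:ℝ) : AddCircle (1:ℝ)) * ee (α*y) := by
    funext h
    rw [hco, smul_eq_mul, fourier_coe_apply, mul_assoc]
    congr 1
    have : ee ((α+h)*y) = ee (h * Int.fract y) * ee (α*y) := by
      have h3 : ee ((h * ⌊y⌋ : ℤ)) = 1 := ee_int _
      rw [show (α+h)*y = h * Int.fract y + α*y + ((h*⌊y⌋:ℤ):ℝ) by
        push_cast; unfold Int.fract; ring, ee_add, h3, mul_one, ee_add]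
    rw [this]
    congr 1
    unfold ee
    congr 1
    push_cast
    ring
  have hval : ((wt y:ℝ):ℂ) * ee (α * ⌊y⌋) = f (Int.fract y) * ee (α*y) := by
    simp only [f]
    have hw : wt (Int.fract y) = wt y := by
      conv_rhs => rw [← Int.fract_add_floor y, wt_add_int]
    rw [hw, mul_assoc, ← ee_add]
    congr 2
    unfold Int.fract; ring
  rw [hfun, hval]
  exact h2

noncomputable def K1 : ℝ := ∑' h:ℤ, (1 + |(h:ℝ)|)^(-(1.1:ℝ))

lemma summable_K1 : Summable (fun h:ℤ => (1 + |(h:ℝ)|)^(-(1.1:ℝ))) := by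
  have h := Real.summable_abs_int_rpow (b := 1.1) (by norm_num)
  have h2 : Summable (fun n:ℤ => |(n:ℝ)|^(-1.1:ℝ) + (if n = 0 then (1:ℝ) else 0)) := by
    apply h.add
    apply summable_of_hasFiniteSupport
    apply (Set.finite_singleton (0:ℤ)).subset
    intro n hn
    simp at hn
    simpa using hn
  refine h2.of_nonneg_of_le (fun n => by positivity) (fun n => ?_)
  split_ifs with hn
  · subst hn; simp; positivity
  · have : (1:ℝ) ≤ |(n:ℝ)| := by exact_mod_cast Int.one_le_abs hn
    rw [add_zero]
    apply rpow_le_rpow_of_nonpos <;> linarith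

lemma K1_pos : 0 < K1 := by
  unfold K1
  refine summable_K1.tsum_pos (fun h => by positivity) 0 (by simp)

lemma F_tsum_bound (s : Finset ℕ) (b : ℕ → ℂ) (y : ℕ → ℝ) (α : ℝ) (hα : |α| ≤ 1/2) (G : ℝ)
    (hG : ∀ h:ℤ, ‖∑ n ∈ s, b n * ee ((α+h) * y n)‖ ≤ G * (1+|(h:ℝ)|)^(3.9:ℝ)) :
    ‖∑ n ∈ s, b n * (((wt (y n):ℝ):ℂ) * ee (α * ⌊y n⌋))‖ ≤ 9^5*K1*G := by
  have hs : HasSum (fun h:ℤ => CC (α+h) * ∑ n ∈ s, b n * ee ((α+h) * y n)) (∑ n ∈ s, b n * (((wt (y n):ℝ):ℂ) * ee (α * ⌊y n⌋))) := by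
    have := hasSum_sum (s := s) (fun n _ => (floor_expand α hα (y n)).mul_left (b n))
    refine this.congr_fun ?_
    intro h
    rw [Finset.mul_sum]
    apply Finset.sum_congr rfl
    intro n _
    ring
  have hb : ∀ h:ℤ, ‖CC (α+h) * ∑ n ∈ s, b n * ee ((α+h) * y n)‖ ≤ 9^5*G*(1+|(h:ℝ)|)^(-(1.1:ℝ)) := by
    intro h
    have hp : 0 < 1 + |(h:ℝ)| := by positivity
    rw [norm_mul]
    calc _ ≤ (9^5 / (1+|(h:ℝ)|)^5) * (G * (1+|(h:ℝ)|)^(3.9:ℝ)) := by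
            have := CC_bound α hα h
            have := hG h
            gcongr
      _ = _ := by
            have : (1+|(h:ℝ)|)^(-(1.1:ℝ)) = (1+|(h:ℝ)|)^(3.9:ℝ) / (1+|(h:ℝ)|)^5 := by
              rw [← rpow_natCast, ← rpow_sub hp]; norm_num
            rw [this]; ring
  have hsum := (summable_K1.mul_left (9^5*G))
  calc _ ≤ ∑' h:ℤ, 9^5*G*(1+|(h:ℝ)|)^(-(1.1:ℝ)) := by
        rw [← hs.tsum_eq]
        exact tsum_of_norm_bounded hsum.hasSum hb
    _ = _ := by rw [tsum_mul_left]; unfold K1; ring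

lemma F_cut_bound (s : Finset ℕ) (b : ℕ → ℂ) (y : ℕ → ℝ) (α : ℝ) (hα : |α| ≤ 1/2) (B E H : ℝ) (hH : 0 < H) (hE : 0 ≤ E) (hB0 : 0 ≤ B)
    (hB : ∀ h:ℤ, |α+h| ≤ H → ‖∑ n ∈ s, b n * ee ((α+h) * y n)‖ ≤ B)
    (hE2 : ∀ h:ℤ, ‖∑ n ∈ s, b n * ee ((α+h) * y n)‖ ≤ E) :
    ‖∑ n ∈ s, b n * (((wt (y n):ℝ):ℂ) * ee (α * ⌊y n⌋))‖ ≤ 9^5*K1*(B + E * H^(-(3.9:ℝ))) := by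
  apply F_tsum_bound s b y α hα
  intro h
  have h1 : (1:ℝ) ≤ (1+|(h:ℝ)|)^(3.9:ℝ) := Real.one_le_rpow (by linarith [abs_nonneg (h:ℝ)]) (by norm_num)
  have hEH : 0 ≤ E * H^(-(3.9:ℝ)) := by positivity
  rcases le_or_gt |α+h| H with h2 | h2
  · have := hB h h2
    calc _ ≤ B := this
      _ ≤ (B + E * H^(-(3.9:ℝ))) * 1 := by linarith
      _ ≤ _ := by gcongr
  · refine (hE2 h).trans ?_
    have h3 : H ≤ 1 + |(h:ℝ)| := by
      have := abs_add_le α (h:ℝ)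
      linarith
    calc E = E * (H^(-(3.9:ℝ)) * H^(3.9:ℝ)) := by
            rw [← rpow_add hH]; norm_num
      _ ≤ E * (H^(-(3.9:ℝ)) * (1+|(h:ℝ)|)^(3.9:ℝ)) := by gcongr
      _ = E * H^(-(3.9:ℝ)) * (1+|(h:ℝ)|)^(3.9:ℝ) := by ring
      _ ≤ _ := by gcongr; linarith

/-- log weight on primes -/
noncomputable def thw (n : ℕ) : ℝ := if n.Prime then log n else 0

lemma thw_nonneg (n : ℕ) : 0 ≤ thw n := by
  unfold thw; split_ifs
  · exact log_natCast_nonneg n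
  · rfl

lemma thw_le_Lam (n : ℕ) : thw n ≤ vonMangoldt n := by
  unfold thw; split_ifs with h
  · rw [ArithmeticFunction.vonMangoldt_apply_prime h]
  · exact ArithmeticFunction.vonMangoldt_nonneg

lemma sum_Lam_sub_thw (x1 x2 : ℕ) (hx : 1 ≤ x2) : ∑ n ∈ Ioc x1 x2, (vonMangoldt n - thw n) ≤ 2 * √(x2:ℝ) * log x2 := by
  have h := Chebyshev.abs_psi_sub_theta_le_sqrt_mul_log (x := (x2:ℝ)) (by exact_mod_cast hx)
  refine le_trans ?_ h
  refine le_trans ?_ (le_abs_self _)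
  unfold Chebyshev.psi Chebyshev.theta
  rw [Nat.floor_natCast, Finset.sum_filter, ← Finset.sum_sub_distrib]
  apply Finset.sum_le_sum_of_subset_of_nonneg
  · exact Finset.Ioc_subset_Ioc_left (Nat.zero_le _)
  · intro n _ _
    exact sub_nonneg.mpr (thw_le_Lam n)

noncomputable def Fp (c : ℝ) (x1 x2 : ℕ) (α : ℝ) : ℂ :=
  ∑ n ∈ Ioc x1 x2, ((thw n:ℝ):ℂ) * (((wt ((n:ℝ)^c):ℝ):ℂ) * ee (α * ⌊(n:ℝ)^c⌋))

lemma Lam_sum_le (x1 x2 : ℕ) (X : ℝ) (hX : (x2:ℝ) ≤ X) (hX1 : 1 ≤ X) : ∑ n ∈ Ioc x1 x2, vonMangoldt n ≤ X * log X := by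
  calc _ ≤ ∑ n ∈ Ioc x1 x2, log X := by
        apply Finset.sum_le_sum
        intro n hn
        rw [mem_Ioc] at hn
        refine ArithmeticFunction.vonMangoldt_le_log.trans ?_
        apply log_le_log (by exact_mod_cast (by omega : 0 < n))
        refine le_trans ?_ hX
        exact_mod_cast hn.2
    _ ≤ _ := by
        rw [Finset.sum_const, nsmul_eq_mul, Nat.card_Ioc]
        have := log_nonneg hX1
        gcongr
        refine le_trans ?_ hX
        exact_mod_cast Nat.sub_le _ _

lemma Fp_trivial (c : ℝ) (x1 x2 : ℕ) (X α : ℝ) (hX : (x2:ℝ) ≤ X) (hX1 : 1 ≤ X) : ‖Fp c x1 x2 α‖ ≤ X * log X := by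
  refine le_trans ?_ (Lam_sum_le x1 x2 X hX hX1)
  unfold Fp
  refine norm_sum_le_of_le _ ?_
  intro n _
  rw [norm_mul, norm_mul, norm_ee, mul_one, Complex.norm_real, Complex.norm_real, Real.norm_of_nonneg (wt_nonneg _),
    Real.norm_of_nonneg (thw_nonneg _)]
  calc thw n * wt _ ≤ thw n * 1 := by
        have := thw_nonneg n
        gcongr
        exact wt_le_one _
    _ ≤ _ := by rw [mul_one]; exact thw_le_Lam n

lemma Fp_sub (c : ℝ) (x1 x2 : ℕ) (hx : 1 ≤ x2) (α : ℝ) :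
    ‖Fp c x1 x2 α‖ ≤ ‖∑ n ∈ Ioc x1 x2, ((vonMangoldt n:ℝ):ℂ) * (((wt ((n:ℝ)^c):ℝ):ℂ) * ee (α * ⌊(n:ℝ)^c⌋))‖
      + 2 * √(x2:ℝ) * log x2 := by
  have h1 : Fp c x1 x2 α = (∑ n ∈ Ioc x1 x2, ((vonMangoldt n:ℝ):ℂ) * (((wt ((n:ℝ)^c):ℝ):ℂ) * ee (α * ⌊(n:ℝ)^c⌋)))
     - ∑ n ∈ Ioc x1 x2, ((vonMangoldt n - thw n:ℝ):ℂ) * (((wt ((n:ℝ)^c):ℝ):ℂ) * ee (α * ⌊(n:ℝ)^c⌋)) := by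
    unfold Fp
    rw [← Finset.sum_sub_distrib]
    apply Finset.sum_congr rfl
    intro n _
    push_cast; ring
  rw [h1]
  refine (norm_sub_le _ _).trans ?_
  gcongr
  refine le_trans ?_ (sum_Lam_sub_thw x1 x2 hx)
  refine norm_sum_le_of_le _ ?_
  intro n _
  have h0 := sub_nonneg.mpr (thw_le_Lam n)
  rw [norm_mul, norm_mul, norm_ee, mul_one, Complex.norm_real, Complex.norm_real, Real.norm_of_nonneg (wt_nonneg _),
    Real.norm_of_nonneg h0]
  calc _ ≤ (vonMangoldt n - thw n) * 1 := by
        gcongr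
        exact wt_le_one _
    _ ≤ _ := by rw [mul_one]

lemma abs_add_int_ge (α : ℝ) (hα : |α| ≤ 1/2) (h : ℤ) : |α| ≤ |α + h| := by
  by_cases h0 : h = 0
  · subst h0; simp
  · have h1 : (1:ℝ) ≤ |(h:ℝ)| := by exact_mod_cast Int.one_le_abs h0
    have := abs_sub_abs_le_abs_sub (h:ℝ) (-α)
    rw [abs_neg, sub_neg_eq_add, add_comm (h:ℝ) α] at this
    linarith

lemma SL_triv (c θ : ℝ) (x1 x2 : ℕ) (X : ℝ) (hX : (x2:ℝ) ≤ X) (hX1 : 1 ≤ X) : ‖SL c θ x1 x2‖ ≤ X * log X := by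
  refine le_trans ?_ (Lam_sum_le x1 x2 X hX hX1)
  unfold SL
  refine norm_sum_le_of_le _ ?_
  intro n _
  rw [norm_mul, norm_ee, mul_one, Complex.norm_real, Real.norm_of_nonneg ArithmeticFunction.vonMangoldt_nonneg]

lemma Fp_bound (c : ℝ) (hc1 : 1 < c) (hc2 : c < 1.153) : ∃ C : ℝ, 0 < C ∧ ∀ᶠ X : ℝ in Filter.atTop, ∀ (α : ℝ) (x1 x2 : ℕ),
    X/8 ≤ x1 → x1 ≤ x2 → x2 ≤ 2*x1 → (x2:ℝ) ≤ X → |α| ≤ 1/2 → 1 ≤ |α| * X^c →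
    (X^(0.9:ℝ) ≤ |α| * X^c → ‖Fp c x1 x2 α‖ ≤ X^(0.9234:ℝ)) ∧
     ‖Fp c x1 x2 α‖ ≤ C * (log X)^5 * X * ((|α| * X^c)^(-(1/4):ℝ) + X^(-0.025:ℝ)) := by
  obtain ⟨C1, hC1, hi⟩ := expsum_i c hc1 (by linarith)
  have hii := expsum_ii c hc1 (by linarith)
  have hK := K1_pos
  set KK := 9^5*K1 with hKK
  have hKK0 : 0 < KK := by positivity
  refine ⟨KK*C1 + 1, by positivity, ?_⟩
  filter_upwards [hi, hii, Filter.eventually_ge_atTop (8*rexp 1), ev_log (3*KK) 0 0.0001 (by norm_num), ev_log (3*KK) 1 0.001 (by norm_num),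
    ev_log 6 1 0.1 (by norm_num)] with X hi hii hXe v1 v2 v3
  intro α x1 x2 hx1 hx12 hx2 hx2X hα hT
  have hXe' : rexp 1 ≤ X := by linarith [Real.exp_pos 1]
  have hL : 1 ≤ log X := by
    rw [Real.le_log_iff_exp_le (by linarith [Real.exp_pos 1])]; exact hXe'
  have hX8 : 8 ≤ X := by linarith [Real.add_one_le_exp (1:ℝ)]
  have hX1 : 1 ≤ X := by linarith
  have hX0 : 0 < X := by linarith
  have hx21 : 1 ≤ x2 := by
    have : (1:ℝ) ≤ x1 := by linarith
    have : 1 ≤ x1 := by exact_mod_cast this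
    omega
  have hXc : 0 < X^c := by positivity
  have hsub := Fp_sub c x1 x2 hx21 α
  have hsq : 2 * √(x2:ℝ) * log x2 ≤ 1/3 * X^(0.9234:ℝ) := by
    calc 2 * √(x2:ℝ) * log x2 ≤ 2 * √X * log X := by
          gcongr
      _ = 1/3*(X^(1/2:ℝ) * (6 * log X ^ 1)) := by rw [Real.sqrt_eq_rpow]; ring
      _ ≤ 1/3*(X^(1/2:ℝ) * X^(0.1:ℝ)) := by gcongr
      _ = 1/3*X^(0.6:ℝ) := by rw [← rpow_add hX0]; norm_num
      _ ≤ _ := by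
        have := rpow_le_rpow_of_exponent_le hX1 (by norm_num : (0.6:ℝ) ≤ 0.9234)
        linarith
  have htail : KK * (X * log X * (X^(0.02:ℝ))^(-(3.9:ℝ))) ≤ 1/3 * X^(0.9234:ℝ) := by
    calc _ = 1/3*((3*KK*log X^1) * (X^(1:ℝ) * X^(-0.078:ℝ))) := by
            rw [← rpow_mul hX0.le, rpow_one]; norm_num; ring
      _ ≤ 1/3*(X^(0.001:ℝ) * (X^(1:ℝ) * X^(-0.078:ℝ))) := by gcongr
      _ = 1/3*X^(0.923:ℝ) := by rw [← rpow_add hX0, ← rpow_add hX0]; norm_num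
      _ ≤ _ := by
        have := rpow_le_rpow_of_exponent_le hX1 (by norm_num : (0.923:ℝ) ≤ 0.9234)
        linarith
  have hmid : KK * X^(0.9233:ℝ) ≤ 1/3 * X^(0.9234:ℝ) := by
    calc _ = 1/3*((3*KK*log X^0) * X^(0.9233:ℝ)) := by ring
      _ ≤ 1/3*(X^(0.0001:ℝ) * X^(0.9233:ℝ)) := by gcongr
      _ = _ := by rw [← rpow_add hX0]; norm_num
  have hup : ∀ h:ℤ, |α+h| ≤ X^(0.02:ℝ) → |α+h| * X^c ≤ X^(1.173:ℝ) := by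
    intro h hh
    calc _ ≤ X^(0.02:ℝ) * X^c := by gcongr
      _ = X^(0.02+c) := by rw [← rpow_add hX0]
      _ ≤ _ := rpow_le_rpow_of_exponent_le hX1 (by linarith)
  have hlow : ∀ h:ℤ, |α| * X^c ≤ |α+h| * X^c := by
    intro h
    have := abs_add_int_ge α hα h
    gcongr
  have hE : ∀ h:ℤ, ‖SL c (α+h) x1 x2‖ ≤ X * log X := fun h => SL_triv c _ x1 x2 X hx2X hX1
  constructor
  · intro hT9
    have hF := F_cut_bound (Ioc x1 x2) (fun n => ((vonMangoldt n:ℝ):ℂ)) (fun n => (n:ℝ)^c) α hα (X^(0.9233:ℝ))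
      (X * log X) (X^(0.02:ℝ)) (by positivity) (by positivity) (by positivity)
      (fun h hh => hii (α+h) x1 x2 hx1 hx12 hx2 hx2X (hT9.trans (hlow h)) (hup h hh)) hE
    rw [← hKK, mul_add] at hF
    linarith
  · set B := C1 * (log X)^5 * X * ((|α| * X^c)^(-(1/4):ℝ) + X^(-0.025:ℝ)) with hB
    have hB0 : 0 ≤ B := by positivity
    have hF := F_cut_bound (Ioc x1 x2) (fun n => ((vonMangoldt n:ℝ):ℂ)) (fun n => (n:ℝ)^c) α hα (B + X^(0.9233:ℝ))
      (X * log X) (X^(0.02:ℝ)) (by positivity) (by positivity) (by positivity)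
      (fun h hh => by
        rcases le_total (|α+h| * X^c) (X^(0.9:ℝ)) with h9 | h9
        · have := hi (α+h) x1 x2 hx1 hx12 hx2 hx2X (hT.trans (hlow h)) h9
          have h2 : (|α+h| * X^c)^(-(1/4):ℝ) ≤ (|α| * X^c)^(-(1/4):ℝ) :=
            rpow_le_rpow_of_nonpos (by linarith) (hlow h) (by norm_num)
          have h3 : C1 * (log X)^5 * X * ((|α+h| * X^c)^(-(1/4):ℝ) + X^(-0.025:ℝ)) ≤ B := by
            rw [hB]; gcongr
          have h4 : 0 ≤ X^(0.9233:ℝ) := by positivity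
          exact (this.trans h3).trans (by linarith)
        · have := hii (α+h) x1 x2 hx1 hx12 hx2 hx2X h9 (hup h hh)
          exact this.trans (by linarith)) hE
    rw [← hKK, mul_add, mul_add] at hF
    have h5 : X^(0.9234:ℝ) ≤ 1 * (log X)^5 * X * ((|α| * X^c)^(-(1/4):ℝ) + X^(-0.025:ℝ)) := by
      calc X^(0.9234:ℝ) ≤ X^(0.975:ℝ) := rpow_le_rpow_of_exponent_le hX1 (by norm_num)
        _ = 1 * 1^5 * X * (0 + X^(-0.025:ℝ)) := by
          nth_rewrite 2 [← rpow_one X]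
          rw [zero_add, one_pow, mul_one, one_mul, ← rpow_add hX0]; norm_num
        _ ≤ _ := by gcongr; positivity
    have h6 : (KK*C1+1) * (log X)^5 * X * ((|α| * X^c)^(-(1/4):ℝ) + X^(-0.025:ℝ)) = KK * B + 1 * (log X)^5 * X * ((|α| * X^c)^(-(1/4):ℝ) + X^(-0.025:ℝ)) := by
      rw [hB]; ring
    rw [h6]
    linarith

noncomputable def Gk (c : ℝ) (x1 x2 : ℕ) (β : ℝ) : ℂ :=
  ∑ n ∈ Ioc x1 x2, (((wt ((n:ℝ)^c):ℝ):ℂ) * ee (β * ⌊(n:ℝ)^c⌋))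

lemma Ioc_eq_Ico_succ (x1 x2 : ℕ) : Ioc x1 x2 = Ico (x1+1) (x2+1) := by
  ext n; simp only [mem_Ioc, mem_Ico]; omega

lemma Gk_trivial (c : ℝ) (x1 x2 : ℕ) (X β : ℝ) (hX : (x2:ℝ) ≤ X) : ‖Gk c x1 x2 β‖ ≤ X := by
  unfold Gk
  calc _ ≤ ∑ n ∈ Ioc x1 x2, (1:ℝ) := by
        refine norm_sum_le_of_le _ ?_
        intro n _
        rw [norm_mul, norm_ee, mul_one, Complex.norm_real, Real.norm_of_nonneg (wt_nonneg _)]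
        exact wt_le_one _
    _ ≤ _ := by
        rw [Finset.sum_const, nsmul_eq_mul, Nat.card_Ioc, mul_one]
        refine le_trans ?_ hX
        exact_mod_cast Nat.sub_le _ _

set_option maxHeartbeats 1000000 in
lemma Gk_bound (c : ℝ) (hc1 : 1 < c) (hc2 : c < 2) : ∃ C : ℝ, 0 < C ∧ ∀ (X β : ℝ) (x1 x2 : ℕ), 8 ≤ X →
    X/8 ≤ x1 → x1 ≤ x2 → x2 ≤ 2*x1 → (x2:ℝ) ≤ X → |β| ≤ 1/2 → β ≠ 0 →
    ‖Gk c x1 x2 β‖ ≤ C * (X^(1-c) / |β| + X^(c/2)) := by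
  set K : ℝ := 80+20/√(c-1) with hK
  have hK0 : 0 < K := by positivity
  have hK1 := K1_pos
  refine ⟨9^5*K1*(8 + 6*K), by positivity, ?_⟩
  intro X β x1 x2 hX8 hx1 hx12 hx2 hx2X hβ hβ0
  have hX1 : 1 ≤ X := by linarith
  have hX0 : 0 < X := by linarith
  set M : ℝ := (x1:ℝ) with hM
  have hM1 : 1 ≤ M := by linarith
  have hM0 : 0 < M := by linarith
  have hMX : M ≤ X := le_trans (by rw [hM]; exact_mod_cast hx12) hx2X
  have hβp : 0 < |β| := abs_pos.mpr hβ0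
  have hXc2 : X^(c/2) * X^(c/2) = X^c := by rw [← rpow_add hX0]; congr 1; ring
  have hXcp : 0 < X^(c/2) := by positivity
  have hxc : X^(1/2:ℝ) ≤ X^(c/2) := rpow_le_rpow_of_exponent_le hX1 (by linarith)
  have hp : M ≤ ((x1+1:ℕ):ℝ) := by rw [hM]; push_cast; linarith
  have hq : ((x2+1:ℕ):ℝ) ≤ 5*M := by
    have : (x2:ℝ) ≤ 2*M := by rw [hM]; exact_mod_cast hx2
    push_cast; linarith
  have hup : ∀ θ : ℝ, √(|θ| * M^c) ≤ √|θ| * X^(c/2) := by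
    intro θ
    have : √(|θ| * M^c) ≤ √(|θ| * (X^(c/2) * X^(c/2))) := by
      apply Real.sqrt_le_sqrt
      rw [hXc2]
      gcongr
    refine this.trans (le_of_eq ?_)
    rw [Real.sqrt_mul (abs_nonneg _), Real.sqrt_mul_self hXcp.le]
  -- lower bound gives M / sqrt
  have hdn : ∀ θ κ : ℝ, 0 < κ → M ≤ κ * (|θ| * M^c) → M / √(|θ| * M^c) ≤ √κ * X^(c/2) := by
    intro θ κ hκ h
    have hpos : 0 < |θ| * M^c := by
      by_contra hn
      push Not at hn
      nlinarith
    rw [div_le_iff₀ (by positivity)]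
    calc M = √M * √M := (Real.mul_self_sqrt hM0.le).symm
      _ ≤ √M * √(κ * (|θ| * M^c)) := by gcongr
      _ = √κ * √M * √(|θ| * M^c) := by rw [Real.sqrt_mul hκ.le]; ring
      _ ≤ √κ * X^(c/2) * √(|θ| * M^c) := by
        gcongr
        refine le_trans ?_ hxc
        rw [← Real.sqrt_eq_rpow]
        gcongr
  have hMc : M^c = M * M^(c-1) := by
    nth_rewrite 2 [← rpow_one M]
    rw [← rpow_add hM0]; congr 1; ring
  have hMc1 : 1 ≤ M^(c-1) := Real.one_le_rpow hM1 (by linarith)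
  have key := F_tsum_bound (Ioc x1 x2) (fun _ => 1) (fun n => (n:ℝ)^c) β hβ (8*(X^(1-c)/|β|) + 6*K*X^(c/2)) ?_
  · simp only [one_mul] at key
    unfold Gk
    refine key.trans ?_
    rw [mul_assoc (9^5*K1)]
    have : 0 ≤ X^(1-c)/|β| := by positivity
    have h2 : 8*(X^(1-c)/|β|) + 6*K*X^(c/2) ≤ (8+6*K) * (X^(1-c)/|β| + X^(c/2)) := by
      nlinarith [mul_nonneg hK0.le this]
    gcongr
  · intro h
    simp only [one_mul]
    rw [Ioc_eq_Ico_succ]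
    have h1 : (1:ℝ) ≤ (1+|(h:ℝ)|)^(3.9:ℝ) := Real.one_le_rpow (by linarith [abs_nonneg (h:ℝ)]) (by norm_num)
    have hA : 0 ≤ X^(1-c)/|β| := by positivity
    by_cases h0 : h = 0
    · subst h0
      simp only [Int.cast_zero, add_zero, abs_zero, Real.one_rpow, mul_one]
      by_cases hs : |β| * c * (5*M)^(c-1) ≤ 1/2
      · have := kl_pow c hc1 β M hβ0 hM1 (x1+1) (x2+1) hp hq hs
        refine this.trans ?_
        have h8 : X^(c-1) ≤ 8 * M^(c-1) := by
          calc X^(c-1) ≤ (8*M)^(c-1) := by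
                apply rpow_le_rpow hX0.le (by linarith) (by linarith)
            _ = 8^(c-1) * M^(c-1) := mul_rpow (by norm_num) hM0.le
            _ ≤ 8^(1:ℝ) * M^(c-1) := by
                gcongr
                · norm_num
                · linarith
            _ = _ := by norm_num
        have h9 : X^(1-c) = 1 / X^(c-1) := by
          rw [← neg_sub, rpow_neg hX0.le, one_div]
        have h10 : 1/(|β| * M^(c-1)) ≤ 8*(X^(1-c)/|β|) := by
          rw [h9, div_div, mul_one_div, div_le_div_iff₀ (by positivity) (by positivity)]
          calc 1 * (X^(c-1) * |β|) ≤ 1 * ((8 * M^(c-1)) * |β|) := by gcongr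
            _ = _ := by ring
        have : 0 ≤ 6*K*X^(c/2) := by positivity
        linarith
      · push Not at hs
        have h5 : (5*M)^(c-1) ≤ 5 * M^(c-1) := by
          rw [mul_rpow (by norm_num) hM0.le]
          gcongr
          calc (5:ℝ)^(c-1) ≤ 5^(1:ℝ) := by
                apply rpow_le_rpow_of_exponent_le (by norm_num); linarith
            _ = 5 := by norm_num
        have h6 : M ≤ 25 * (|β| * M^c) := by
          have : 1/2 < |β| * 2 * (5 * M^(c-1)) := by
            refine hs.trans_le ?_
            gcongr
          rw [hMc]
          nlinarith
        have := vdc_pow c hc1 hc2 β M hβ0 hM1 (x1+1) (x2+1) hp hq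
        refine this.trans ?_
        have e1 := hup β
        have e2 := hdn β 25 (by norm_num) h6
        have e3 : √|β| ≤ 1 := by rw [Real.sqrt_le_one]; linarith
        have e4 : √(25:ℝ) = 5 := by rw [show (25:ℝ) = 5^2 by norm_num]; exact Real.sqrt_sq (by norm_num)
        rw [e4] at e2
        rw [← hK]
        have e5 : √|β| * X^(c/2) ≤ 1 * X^(c/2) := by gcongr
        have e6 : K * (√(|β| * M^c) + M / √(|β| * M^c)) ≤ K * (6 * X^(c/2)) := by
          gcongr; linarith
        linarith
    · have hh1 : (1:ℝ) ≤ |(h:ℝ)| := by exact_mod_cast Int.one_le_abs h0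
      have hlow : 1/2 ≤ |β + h| := by
        have := abs_sub_abs_le_abs_sub (h:ℝ) (-β)
        rw [abs_neg, sub_neg_eq_add, add_comm (h:ℝ) β] at this
        linarith
      have hhigh : |β + h| ≤ 1 + |(h:ℝ)| := by
        have := abs_add_le β (h:ℝ)
        linarith
      have hne : β + h ≠ 0 := by
        intro h; rw [h] at hlow; norm_num at hlow
      have := vdc_pow c hc1 hc2 (β+h) M hne hM1 (x1+1) (x2+1) hp hq
      refine this.trans ?_
      have e1 := hup (β+h)
      have e2 := hdn (β+h) 4 (by norm_num) (by
        rw [hMc]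
        have : 1/2*1 ≤ |β+h| * M^(c-1) := by gcongr
        nlinarith)
      have e4 : √(4:ℝ) = 2 := by rw [show (4:ℝ) = 2^2 by norm_num]; exact Real.sqrt_sq (by norm_num)
      rw [e4] at e2
      have e3 : √|β+h| ≤ (1+|(h:ℝ)|)^(3.9:ℝ) := by
        calc √|β+h| ≤ √(1+|(h:ℝ)|) := Real.sqrt_le_sqrt hhigh
          _ = (1+|(h:ℝ)|)^(1/2:ℝ) := Real.sqrt_eq_rpow _
          _ ≤ _ := rpow_le_rpow_of_exponent_le (by linarith) (by norm_num)
      rw [← hK]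
      set W := (1+|(h:ℝ)|)^(3.9:ℝ)
      have e5 : √|β+h| * X^(c/2) ≤ W * X^(c/2) := by gcongr
      have e7 : 1 * X^(c/2) ≤ W * X^(c/2) := by gcongr
      calc K * (√(|β+h| * M^c) + M / √(|β+h| * M^c)) ≤ K * (6 * (W * X^(c/2))) := by
            gcongr
            have : 0 ≤ W * X^(c/2) := by positivity
            linarith
        _ = (0 + 6*K*X^(c/2)) * W := by ring
        _ ≤ _ := by gcongr; positivity

noncomputable def FF (J : Finset ℕ) (f : ℕ → ℝ) (v : ℕ → ℤ) (N : ℕ) (a : ℤ) : ℂ :=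
  ∑ n ∈ J, ((f n:ℝ):ℂ) * ee ((a:ℝ)/N * v n)

noncomputable def AA (r : ℕ) : Finset ℤ := Ico (-(2*r:ℤ)) (2*r)

lemma ee_nsmul (x : ℝ) (j : ℕ) : ee (j * x) = ee x ^ j := by
  unfold ee
  rw [← Complex.exp_nat_mul]
  congr 1; push_cast; ring

lemma ee_eq_one (x : ℝ) (h : ee x = 1) : ∃ n : ℤ, x = n := by
  unfold ee at h
  rw [Complex.exp_eq_one_iff] at h
  obtain ⟨n, hn⟩ := h
  refine ⟨n, ?_⟩
  have h2 : (2*π*Complex.I : ℂ) ≠ 0 := by simp [Real.pi_ne_zero]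
  have : (x:ℂ) * (2*π*Complex.I) = n * (2*π*Complex.I) := by rw [← hn]; ring
  exact_mod_cast mul_right_cancel₀ h2 this

lemma sum_AA {β : Type*} [AddCommMonoid β] (r : ℕ) (g : ℤ → β) : ∑ a ∈ AA r, g a = ∑ j ∈ range (4*r), g (-(2*r:ℤ) + j) := by
  unfold AA
  refine (Finset.sum_bij (fun (j:ℕ) _ => (-(2*r:ℤ) + j)) ?_ ?_ ?_ ?_).symm
  · intro j hj; rw [mem_range] at hj; rw [mem_Ico]; constructor <;> omega
  · intro j _ j' _ h; omega
  · intro a ha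
    rw [mem_Ico] at ha
    refine ⟨(a + 2*r).toNat, ?_, ?_⟩
    · rw [mem_range]; omega
    · omega
  · intro j _; rfl

lemma orth (r : ℕ) (hr : 0 < r) (k : ℤ) (hk : |k| < 4*r) :
    ∑ a ∈ AA r, ee ((a:ℝ)/(4*r:ℕ) * k) = if k = 0 then ((4*r:ℕ):ℂ) else 0 := by
  split_ifs with h0
  · subst h0
    rw [sum_AA]
    simp [ee_zero]
  · rw [sum_AA]
    have hN : ((4*r:ℕ):ℝ) ≠ 0 := by positivity
    set z := ee ((k:ℝ)/(4*r:ℕ)) with hz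
    have h1 : ∀ j:ℕ, ee (((-(2*r:ℤ) + j:ℤ):ℝ)/(4*r:ℕ) * k) = ee (-(2*r:ℝ)/(4*r:ℕ) * k) * z^j := by
      intro j
      rw [hz, ← ee_nsmul, ← ee_add]
      congr 1
      push_cast
      ring
    simp_rw [h1]
    rw [← Finset.mul_sum]
    have hz1 : z ≠ 1 := by
      intro h
      obtain ⟨n, hn⟩ := ee_eq_one _ h
      rw [div_eq_iff hN] at hn
      have : k = n * (4*r:ℕ) := by exact_mod_cast hn
      have hn0 : n ≠ 0 := by rintro rfl; simp at this; exact h0 this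
      have := Int.one_le_abs hn0
      have h3 : |k| = |n| * (4*r) := by
        rw [‹k = _›, abs_mul]; push_cast
        rw [abs_of_nonneg (by positivity : (0:ℤ) ≤ 4*r)]
      nlinarith
    have hzN : z^(4*r) = 1 := by
      rw [hz, ← ee_nsmul, mul_div_cancel₀ _ hN, ee_int]
    have := geom_sum_eq hz1 (4*r)
    rw [this, hzN, sub_self, zero_div, mul_zero]

/-- triples -/
noncomputable def TT (J : Finset ℕ) : Finset (ℕ × ℕ × ℕ) := J ×ˢ J ×ˢ J

noncomputable def kk (v : ℕ → ℤ) (r : ℕ) (t : ℕ × ℕ × ℕ) : ℤ := v t.1 + v t.2.1 + v t.2.2 - r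

noncomputable def fff (f : ℕ → ℝ) (t : ℕ × ℕ × ℕ) : ℝ := f t.1 * f t.2.1 * f t.2.2

lemma cube_expand (J : Finset ℕ) (f : ℕ → ℝ) (v : ℕ → ℤ) (N r : ℕ) (a : ℤ) :
    FF J f v N a ^ 3 * ee (-((a:ℝ)/N * r)) = ∑ t ∈ TT J, ((fff f t:ℝ):ℂ) * ee ((a:ℝ)/N * kk v r t) := by
  unfold TT
  rw [Finset.sum_product]
  simp_rw [Finset.sum_product]
  unfold FF
  rw [pow_succ, pow_two, Finset.sum_mul_sum, Finset.sum_mul, Finset.sum_mul]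
  apply Finset.sum_congr rfl; intro n1 _
  rw [Finset.sum_mul, Finset.sum_mul]
  apply Finset.sum_congr rfl; intro n2 _
  rw [Finset.mul_sum, Finset.sum_mul]
  apply Finset.sum_congr rfl; intro n3 _
  have : ee ((a:ℝ)/N * kk v r (n1,n2,n3)) = ee ((a:ℝ)/N * v n1) * ee ((a:ℝ)/N * v n2) * ee ((a:ℝ)/N * v n3) * ee (-((a:ℝ)/N * r)) := by
    rw [← ee_add, ← ee_add, ← ee_add]
    congr 1
    unfold kk; push_cast; ring
  rw [this]
  unfold fff
  push_cast
  ring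

lemma count_identity (J : Finset ℕ) (f : ℕ → ℝ) (v : ℕ → ℤ) (r : ℕ) (hr : 0 < r) (hv : ∀ n ∈ J, 0 ≤ v n ∧ v n ≤ r) :
    ∑ a ∈ AA r, FF J f v (4*r) a ^ 3 * ee (-((a:ℝ)/(4*r:ℕ) * r)) = (((4*r:ℕ) * ∑ t ∈ (TT J).filter (fun t => kk v r t = 0), fff f t : ℝ) : ℂ) := by
  simp_rw [cube_expand]
  rw [Finset.sum_comm]
  simp_rw [← Finset.mul_sum]
  rw [Finset.sum_filter]
  push_cast
  rw [Finset.mul_sum]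
  apply Finset.sum_congr rfl
  intro t ht
  have hk : |kk v r t| < 4*r := by
    unfold TT at ht
    simp only [Finset.mem_product] at ht
    obtain ⟨a1, a2, a3⟩ := ht
    have := hv _ a1
    have := hv _ a2
    have := hv _ a3
    unfold kk
    rw [abs_lt]
    constructor <;> omega
  have := orth r hr (kk v r t) hk
  push_cast at this
  rw [this]
  split_ifs with h
  · push_cast; ring
  · simp

/-- Fejer counts -/
noncomputable def cnt (R : ℕ) (a : ℤ) : ℕ := ((range R ×ˢ range R).filter (fun b => (b.1:ℤ) - b.2 = a)).card

lemma cnt_le (R : ℕ) (a : ℤ) : cnt R a ≤ R := by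
  unfold cnt
  calc _ ≤ (range R).card := by
        apply Finset.card_le_card_of_injOn (fun b => b.1)
        · intro b hb
          simp only [Finset.coe_filter, Finset.mem_product, Set.mem_ofPred_eq] at hb
          simpa using hb.1.1
        · intro b hb b' hb' h
          simp only [Finset.coe_filter, Finset.mem_product, Set.mem_ofPred_eq] at hb hb'
          ext
          · exact h
          · simp only at h
            have := hb.2; have := hb'.2; omega
    _ = R := Finset.card_range R

lemma cnt_zero (R : ℕ) (a : ℤ) (h : (R:ℤ) ≤ |a|) : cnt R a = 0 := by
  unfold cnt
  rw [Finset.card_eq_zero, Finset.filter_eq_empty_iff]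
  intro b hb hba
  simp only [Finset.mem_product, mem_range] at hb
  rcases abs_cases a with ⟨h1, _⟩ | ⟨h1, _⟩ <;> omega

lemma cnt_ge (R : ℕ) (a : ℤ) : (R:ℤ) - |a| ≤ cnt R a := by
  have h1 : R - a.natAbs ≤ cnt R a := by
    unfold cnt
    calc R - a.natAbs = (range (R - a.natAbs)).card := (Finset.card_range _).symm
      _ ≤ _ := by
        apply Finset.card_le_card_of_injOn (fun j => ((j + a.toNat : ℕ), (j + (-a).toNat : ℕ)))
        · intro j hj
          simp only [Finset.coe_range, Set.mem_Iio] at hj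
          simp only [Finset.coe_filter, Finset.mem_product, Set.mem_ofPred_eq, mem_range]
          refine ⟨⟨?_, ?_⟩, ?_⟩ <;> omega
        · intro j _ j' _ h
          simp only [Prod.mk.injEq] at h
          omega
  rw [Int.abs_eq_natAbs]
  omega

lemma sum_cnt (R r : ℕ) (hR : R ≤ 2*r) (g : ℤ → ℂ) : ∑ a ∈ AA r, (cnt R a:ℂ) * g a = ∑ b ∈ range R, ∑ b' ∈ range R, g ((b:ℤ) - b') := by
  rw [← Finset.sum_product' (f := fun (b b':ℕ) => g ((b:ℤ) - b'))]
  rw [← Finset.sum_fiberwise_of_maps_to (s := range R ×ˢ range R) (t := AA r) (g := fun b => (b.1:ℤ) - b.2)]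
  · apply Finset.sum_congr rfl
    intro a _
    unfold cnt
    rw [Finset.sum_congr rfl (g := fun _ => g a)]
    · rw [Finset.sum_const, nsmul_eq_mul]
    · intro b hb
      rw [mem_filter] at hb
      rw [hb.2]
  · intro b hb
    simp only [Finset.mem_product, mem_range] at hb
    unfold AA
    rw [mem_Ico]
    constructor <;> omega

lemma fejer_sq (R N : ℕ) (k : ℤ) : ∑ b ∈ range R, ∑ b' ∈ range R, ee ((((b:ℤ) - b':ℤ):ℝ)/N * k) = ((‖∑ b ∈ range R, ee ((b:ℝ)/N * k)‖^2 : ℝ):ℂ) := by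
  rw [norm_sq_sum]
  apply Finset.sum_congr rfl; intro b _
  apply Finset.sum_congr rfl; intro b' _
  rw [← ee_sub]
  congr 1; push_cast; ring

lemma fejer_lower (R N : ℕ) (k : ℤ) (hN : 0 < N) (hk : 8 * R * |(k:ℝ)| ≤ N) : (R:ℝ)^2/4 ≤ ‖∑ b ∈ range R, ee ((b:ℝ)/N * k)‖^2 := by
  have h1 : (R:ℝ) * (1/2) ≤ ‖∑ b ∈ range R, ee ((b:ℝ)/N * k)‖ := by
    refine le_trans ?_ (Complex.re_le_norm _)
    rw [Complex.re_sum]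
    calc (R:ℝ) * (1/2) = ∑ b ∈ range R, (1/2:ℝ) := by rw [Finset.sum_const, Finset.card_range, nsmul_eq_mul]
      _ ≤ _ := by
        apply Finset.sum_le_sum
        intro b hb
        rw [mem_range] at hb
        have hre : (ee ((b:ℝ)/N * k)).re = Real.cos (2*π*((b:ℝ)/N*k)) := by
          rw [ee_eq]; simp [-Complex.ofReal_cos, -Complex.ofReal_sin]
        rw [hre, ← Real.cos_abs, ← Real.cos_pi_div_three]
        apply Real.cos_le_cos_of_nonneg_of_le_pi (abs_nonneg _)
        · linarith [Real.pi_pos]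
        · rw [abs_mul, abs_of_pos (by positivity : 0 < 2*π), abs_mul, abs_of_nonneg (by positivity : (0:ℝ) ≤ (b:ℝ)/N)]
          have hbR : (b:ℝ) ≤ R := by exact_mod_cast hb.le
          have hN' : (0:ℝ) < N := by exact_mod_cast hN
          have : (b:ℝ)/N * |(k:ℝ)| ≤ 1/8 := by
            rw [div_mul_eq_mul_div, div_le_iff₀ hN']
            have := mul_le_mul_of_nonneg_right hbR (abs_nonneg (k:ℝ))
            linarith
          nlinarith [Real.pi_pos]
  have := pow_le_pow_left₀ (by positivity) h1 2
  linarith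

lemma circle_main (J : Finset ℕ) (f : ℕ → ℝ) (hf : ∀ n, 0 ≤ f n) (v : ℕ → ℤ) (r R : ℕ) (hr : 0 < r) (hR0 : 0 < R) (hR : R ≤ 2*r) (hv : ∀ n ∈ J, 0 ≤ v n ∧ v n ≤ r) :
    (R:ℝ)/4 * ∑ t ∈ (TT J).filter (fun t => 8 * R * |(kk v r t:ℝ)| ≤ (4*r:ℕ)), fff f t
      - ‖∑ a ∈ AA r, (((1 - cnt R a / R : ℝ)):ℂ) * (FF J f v (4*r) a ^ 3 * ee (-((a:ℝ)/(4*r:ℕ) * r)))‖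
     ≤ (4*r:ℕ) * ∑ t ∈ (TT J).filter (fun t => kk v r t = 0), fff f t := by
  set W : ℤ → ℂ := fun a => FF J f v (4*r) a ^ 3 * ee (-((a:ℝ)/(4*r:ℕ) * r)) with hW
  have hR' : (0:ℝ) < R := by exact_mod_cast hR0
  have h1 : ∑ a ∈ AA r, (((1 - cnt R a / R : ℝ)):ℂ) * W a = ∑ a ∈ AA r, W a - (1/R) * ∑ a ∈ AA r, (cnt R a:ℂ) * W a := by
    rw [Finset.mul_sum, ← Finset.sum_sub_distrib]
    apply Finset.sum_congr rfl; intro a _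
    push_cast; ring
  have hfff : ∀ t, 0 ≤ fff f t := fun t => mul_nonneg (mul_nonneg (hf _) (hf _)) (hf _)
  have h2 : (1/R) * ∑ a ∈ AA r, (cnt R a:ℂ) * W a = ((∑ t ∈ TT J, fff f t * (1/R * ‖∑ b ∈ range R, ee ((b:ℝ)/(4*r:ℕ) * kk v r t)‖^2) : ℝ):ℂ) := by
    rw [sum_cnt R r hR]
    simp_rw [hW, cube_expand]
    have : ∀ b ∈ range R, ∑ b' ∈ range R, ∑ t ∈ TT J, ((fff f t:ℝ):ℂ) * ee ((((b:ℤ) - b':ℤ):ℝ)/(4*r:ℕ) * kk v r t) =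
       ∑ t ∈ TT J, ((fff f t:ℝ):ℂ) * ∑ b' ∈ range R, ee ((((b:ℤ) - b':ℤ):ℝ)/(4*r:ℕ) * kk v r t) := by
      intro b _
      rw [Finset.sum_comm]
      simp_rw [Finset.mul_sum]
    rw [Finset.sum_congr rfl this, Finset.sum_comm, Finset.mul_sum, Complex.ofReal_sum]
    apply Finset.sum_congr rfl; intro t _
    rw [← Finset.mul_sum, fejer_sq]
    push_cast; ring
  have h3 := count_identity J f v r hr hv
  change ∑ a ∈ AA r, W a = _ at h3
  rw [h2, h3, ← Complex.ofReal_sub] at h1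
  have h4 : ‖∑ a ∈ AA r, (((1 - cnt R a / R : ℝ)):ℂ) * W a‖ = _ := congrArg norm h1
  rw [Complex.norm_real] at h4
  have h5 := neg_abs_le (((4*r:ℕ):ℝ) * ∑ t ∈ (TT J).filter (fun t => kk v r t = 0), fff f t - ∑ t ∈ TT J, fff f t * (1/R * ‖∑ b ∈ range R, ee ((b:ℝ)/(4*r:ℕ) * kk v r t)‖^2))
  rw [← Real.norm_eq_abs, ← h4] at h5
  have h6 : (R:ℝ)/4 * ∑ t ∈ (TT J).filter (fun t => 8 * R * |(kk v r t:ℝ)| ≤ (4*r:ℕ)), fff f t ≤ ∑ t ∈ TT J, fff f t * (1/R * ‖∑ b ∈ range R, ee ((b:ℝ)/(4*r:ℕ) * kk v r t)‖^2) := by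
    rw [Finset.mul_sum, Finset.sum_filter]
    apply Finset.sum_le_sum
    intro t _
    have := hfff t
    split_ifs with h
    · have h7 := fejer_lower R (4*r) (kk v r t) (by omega) h
      rw [mul_comm]
      apply mul_le_mul_of_nonneg_left _ this
      calc (R:ℝ)/4 = 1/R * ((R:ℝ)^2/4) := by field_simp
        _ ≤ _ := by gcongr
    · positivity
  linarith

lemma parseval_AA (J : Finset ℕ) (f : ℕ → ℝ) (v : ℕ → ℤ) (r : ℕ) (hr : 0 < r) (hv : ∀ n ∈ J, 0 ≤ v n ∧ v n ≤ r)
    (hinj : Set.InjOn v J) : ∑ a ∈ AA r, ‖FF J f v (4*r) a‖^2 = (4*r:ℕ) * ∑ n ∈ J, f n ^ 2 := by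
  have h : ((∑ a ∈ AA r, ‖FF J f v (4*r) a‖^2 : ℝ):ℂ) = (((4*r:ℕ) * ∑ n ∈ J, f n ^ 2 : ℝ):ℂ) := by
    rw [Complex.ofReal_sum]
    have h1 : ∀ a ∈ AA r, ((‖FF J f v (4*r) a‖^2:ℝ):ℂ) = ∑ n ∈ J, ∑ n' ∈ J, ((f n * f n':ℝ):ℂ) * ee ((a:ℝ)/(4*r:ℕ) * (v n - v n' : ℤ)) := by
      intro a _
      unfold FF
      rw [norm_sq_sum]
      apply Finset.sum_congr rfl; intro n _
      apply Finset.sum_congr rfl; intro n' _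
      rw [map_mul, Complex.conj_ofReal]
      have : ee ((a:ℝ)/(4*r:ℕ) * (v n - v n' : ℤ)) = ee ((a:ℝ)/(4*r:ℕ) * v n) * (starRingEnd ℂ) (ee ((a:ℝ)/(4*r:ℕ) * v n')) := by
        rw [← ee_sub]; congr 1; push_cast; ring
      rw [this]; push_cast; ring
    rw [Finset.sum_congr rfl h1, Finset.sum_comm]
    push_cast
    rw [Finset.mul_sum]
    apply Finset.sum_congr rfl; intro n hn
    rw [Finset.sum_comm]
    rw [Finset.sum_eq_single n]
    · rw [← Finset.mul_sum]
      have := orth r hr (v n - v n) (by simp; omega)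
      push_cast at this
      rw [this]
      simp
      ring
    · intro n' hn' hne
      rw [← Finset.mul_sum]
      have hk : |v n - v n'| < 4*r := by
        have := hv n hn; have := hv n' hn'
        rw [abs_lt]; constructor <;> omega
      have h2 := orth r hr (v n - v n') hk
      have h3 : v n - v n' ≠ 0 := by
        intro h; exact hne (hinj hn' hn (by omega))
      rw [if_neg h3] at h2
      push_cast at h2
      rw [h2, mul_zero]
    · intro h; exact absurd hn h
  exact_mod_cast h

lemma cauchy_trick (J : Finset ℕ) (th w : ℕ → ℝ) (hw : ∀ n, 0 ≤ w n) (v : ℕ → ℤ) (N r : ℕ) (S : Finset ℤ) :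
    ‖∑ a ∈ S, FF J (fun n => th n * w n) v N a ^ 3 * ee (-((a:ℝ)/N * r))‖^2 ≤ (∑ n ∈ J, th n^2 * w n) *
      ∑ a ∈ S, ∑ a' ∈ S, ‖FF J (fun n => th n * w n) v N a‖^2 * ‖FF J (fun n => th n * w n) v N a'‖^2 * ‖FF J w v N (a - a')‖ := by
  set F := FF J (fun n => th n * w n) v N with hF
  set Y : ℤ → ℂ := fun a => F a ^ 2 * ee (-((a:ℝ)/N * r)) with hY
  have h1 : ∑ a ∈ S, F a ^ 3 * ee (-((a:ℝ)/N * r)) = ∑ n ∈ J, ((th n * √(w n):ℝ):ℂ) * (((√(w n):ℝ):ℂ) * ∑ a ∈ S, Y a * ee ((a:ℝ)/N * v n)) := by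
    have : ∀ a ∈ S, F a ^ 3 * ee (-((a:ℝ)/N * r)) = ∑ n ∈ J, ((th n * w n:ℝ):ℂ) * (Y a * ee ((a:ℝ)/N * v n)) := by
      intro a _
      calc F a ^ 3 * ee (-((a:ℝ)/N * r)) = F a * Y a := by rw [hY]; ring
        _ = (∑ n ∈ J, ((th n * w n:ℝ):ℂ) * ee ((a:ℝ)/N * v n)) * Y a := by rw [hF]; rfl
        _ = _ := by
          rw [Finset.sum_mul]
          apply Finset.sum_congr rfl; intro n _; ring
    rw [Finset.sum_congr rfl this, Finset.sum_comm]
    apply Finset.sum_congr rfl; intro n _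
    rw [← Finset.mul_sum, ← mul_assoc]
    congr 1
    rw [← Complex.ofReal_mul]
    congr 1
    rw [mul_assoc, Real.mul_self_sqrt (hw n)]
  rw [h1]
  refine (cauchy_schwarz_norm _ _ _).trans ?_
  have h2 : ∑ n ∈ J, ‖((th n * √(w n):ℝ):ℂ)‖^2 = ∑ n ∈ J, th n^2 * w n := by
    apply Finset.sum_congr rfl; intro n _
    rw [Complex.norm_real, Real.norm_eq_abs, sq_abs, mul_pow, Real.sq_sqrt (hw n)]
  rw [h2]
  have h0 : 0 ≤ ∑ n ∈ J, th n^2 * w n := Finset.sum_nonneg (fun n _ => mul_nonneg (sq_nonneg _) (hw n))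
  apply mul_le_mul_of_nonneg_left _ h0
  have h3 : ((∑ n ∈ J, ‖((√(w n):ℝ):ℂ) * ∑ a ∈ S, Y a * ee ((a:ℝ)/N * v n)‖^2 : ℝ):ℂ) = ∑ a ∈ S, ∑ a' ∈ S, Y a * (starRingEnd ℂ) (Y a') * FF J w v N (a-a') := by
    rw [Complex.ofReal_sum]
    have : ∀ n ∈ J, ((‖((√(w n):ℝ):ℂ) * ∑ a ∈ S, Y a * ee ((a:ℝ)/N * v n)‖^2:ℝ):ℂ) = ∑ a ∈ S, ∑ a' ∈ S, Y a * (starRingEnd ℂ) (Y a') * (((w n:ℝ):ℂ) * ee (((a-a':ℤ):ℝ)/N * v n)) := by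
      intro n _
      rw [norm_mul, mul_pow, Complex.norm_real, Real.norm_eq_abs, sq_abs, Real.sq_sqrt (hw n), Complex.ofReal_mul, norm_sq_sum, Finset.mul_sum]
      apply Finset.sum_congr rfl; intro a _
      rw [Finset.mul_sum]
      apply Finset.sum_congr rfl; intro a' _
      have : ee (((a-a':ℤ):ℝ)/N * v n) = ee ((a:ℝ)/N * v n) * (starRingEnd ℂ) (ee ((a':ℝ)/N * v n)) := by
        rw [← ee_sub]; congr 1; push_cast; ring
      rw [this, map_mul]; ring
    rw [Finset.sum_congr rfl this, Finset.sum_comm]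
    apply Finset.sum_congr rfl; intro a _
    rw [Finset.sum_comm]
    apply Finset.sum_congr rfl; intro a' _
    rw [← Finset.mul_sum]
    rfl
  have h4 : (∑ n ∈ J, ‖((√(w n):ℝ):ℂ) * ∑ a ∈ S, Y a * ee ((a:ℝ)/N * v n)‖^2) = ‖∑ a ∈ S, ∑ a' ∈ S, Y a * (starRingEnd ℂ) (Y a') * FF J w v N (a-a')‖ := by
    rw [← h3, Complex.norm_real, Real.norm_of_nonneg (Finset.sum_nonneg (fun n _ => by positivity))]
  rw [h4]
  refine norm_sum_le_of_le _ (fun a _ => norm_sum_le_of_le _ (fun a' _ => ?_))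
  have hYn : ∀ a, ‖Y a‖ = ‖F a‖^2 := by
    intro a; rw [hY]; simp only; rw [norm_mul, norm_ee, mul_one, norm_pow]
  rw [norm_mul, norm_mul, RCLike.norm_conj, hYn, hYn]

lemma bilinear_split (S A : Finset ℤ) (hSA : S ⊆ A) (F : ℤ → ℂ) (G : ℤ → ℂ) (g : ℤ → ℤ → ℝ) (hg : ∀ a a', 0 ≤ g a a') (D W Δ P : ℝ) (hD : 0 ≤ D) (hW0 : 0 ≤ W)
    (hΔ : ∀ a ∈ S, ‖F a‖ ≤ Δ) (hG : ∀ a ∈ A, ∀ a' ∈ A, ‖G (a-a')‖ ≤ D + g a a') (hW : ∀ a ∈ A, ∑ a' ∈ A, g a a' ≤ W) (hP : ∑ a ∈ A, ‖F a‖^2 ≤ P) :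
    ∑ a ∈ S, ∑ a' ∈ S, ‖F a‖^2 * ‖F a'‖^2 * ‖G (a - a')‖ ≤ D * P^2 + Δ^2 * W * P := by
  have hPS : ∑ a ∈ S, ‖F a‖^2 ≤ P := (Finset.sum_le_sum_of_subset_of_nonneg hSA (fun _ _ _ => by positivity)).trans hP
  have hP0 : 0 ≤ ∑ a ∈ S, ‖F a‖^2 := Finset.sum_nonneg (fun _ _ => by positivity)
  calc _ ≤ ∑ a ∈ S, (D * (‖F a‖^2 * P) + ‖F a‖^2 * (Δ^2 * W)) := by
        apply Finset.sum_le_sum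
        intro a ha
        calc ∑ a' ∈ S, ‖F a‖^2 * ‖F a'‖^2 * ‖G (a - a')‖ ≤ ∑ a' ∈ S, (D * (‖F a‖^2 * ‖F a'‖^2) + ‖F a‖^2 * (Δ^2 * g a a')) := by
              apply Finset.sum_le_sum
              intro a' ha'
              have h1 := hG a (hSA ha) a' (hSA ha')
              have h2 := pow_le_pow_left₀ (norm_nonneg _) (hΔ a' ha') 2
              calc _ ≤ ‖F a‖^2 * ‖F a'‖^2 * (D + g a a') := by gcongr
                _ = D * (‖F a‖^2 * ‖F a'‖^2) + ‖F a‖^2 * (‖F a'‖^2 * g a a') := by ring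
                _ ≤ _ := by
                  have := hg a a'
                  gcongr
          _ = D * (‖F a‖^2 * ∑ a' ∈ S, ‖F a'‖^2) + ‖F a‖^2 * (Δ^2 * ∑ a' ∈ S, g a a') := by
              rw [Finset.sum_add_distrib, ← Finset.mul_sum, ← Finset.mul_sum, ← Finset.mul_sum, ← Finset.mul_sum]
          _ ≤ _ := by
              have : ∑ a' ∈ S, g a a' ≤ W := (Finset.sum_le_sum_of_subset_of_nonneg hSA (fun _ _ _ => hg _ _)).trans (hW a (hSA ha))
              gcongr
    _ = D * P * ∑ a ∈ S, ‖F a‖^2 + Δ^2 * W * ∑ a ∈ S, ‖F a‖^2 := by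
        rw [Finset.mul_sum, Finset.mul_sum, ← Finset.sum_add_distrib]
        apply Finset.sum_congr rfl; intro a _; ring
    _ ≤ D * P * P + Δ^2 * W * P := by
        have hP' : 0 ≤ P := hP0.trans hPS
        gcongr
    _ = _ := by ring

noncomputable def uu (b : ℤ) : ℝ := if b = 0 then 1 else 1/|(b:ℝ)|

lemma uu_nonneg (b : ℤ) : 0 ≤ uu b := by unfold uu; split_ifs <;> positivity

lemma uu_neg (b : ℤ) : uu (-b) = uu b := by unfold uu; simp

lemma sum_uu (n : ℕ) : ∑ b ∈ Icc (-(n:ℤ)) n, uu b ≤ 1 + 2*(1 + log n) := by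
  have h1 : Icc (-(n:ℤ)) n ⊆ {0} ∪ ((Icc 1 n).image (fun j:ℕ => (j:ℤ)) ∪ (Icc 1 n).image (fun j:ℕ => -(j:ℤ))) := by
    intro b hb
    rw [mem_Icc] at hb
    simp only [Finset.mem_union, Finset.mem_singleton, Finset.mem_image, mem_Icc]
    rcases lt_trichotomy b 0 with h | h | h
    · right; right; exact ⟨(-b).toNat, by omega, by omega⟩
    · left; exact h
    · right; left; exact ⟨b.toNat, by omega, by omega⟩
  have hpos : ∀ (s : Finset ℤ), 0 ≤ ∑ b ∈ s, uu b := fun s => Finset.sum_nonneg (fun b _ => uu_nonneg b)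
  have hun : ∀ s t : Finset ℤ, ∑ b ∈ s ∪ t, uu b ≤ ∑ b ∈ s, uu b + ∑ b ∈ t, uu b := by
    intro s t
    rw [← Finset.sum_union_inter]
    linarith [hpos (s ∩ t)]
  have hj : ∑ j ∈ Icc 1 n, uu (j:ℤ) ≤ 1 + log n := by
    refine le_trans (le_of_eq ?_) (sum_inv_le n)
    apply Finset.sum_congr rfl
    intro j hj
    rw [mem_Icc] at hj
    unfold uu
    rw [if_neg (by omega)]
    simp
  calc _ ≤ _ := Finset.sum_le_sum_of_subset_of_nonneg h1 (fun b _ _ => uu_nonneg b)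
    _ ≤ _ := hun _ _
    _ ≤ 1 + (∑ j ∈ Icc 1 n, uu (j:ℤ) + ∑ j ∈ Icc 1 n, uu (j:ℤ)) := by
        have e0 : ∑ b ∈ ({0}:Finset ℤ), uu b = 1 := by simp [uu]
        rw [e0]
        refine add_le_add le_rfl ((hun _ _).trans ?_)
        rw [Finset.sum_image (by intro a _ b _ h; simp only at h; omega), Finset.sum_image (by intro a _ b _ h; simp only at h; omega)]
        simp_rw [uu_neg]
        exact le_rfl
    _ ≤ _ := by linarith

lemma sum_uu_shift (r : ℕ) (s : ℤ) (n : ℕ) (h : ∀ a' ∈ AA r, |s - a'| ≤ n) : ∑ a' ∈ AA r, uu (s - a') ≤ 1 + 2*(1 + log n) := by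
  refine le_trans ?_ (sum_uu n)
  rw [← Finset.sum_image (s := AA r) (g := fun a' => s - a') (f := uu) (by intro a _ b _ h; simp only at h; omega)]
  apply Finset.sum_le_sum_of_subset_of_nonneg
  · intro b hb
    rw [Finset.mem_image] at hb
    obtain ⟨a', ha', rfl⟩ := hb
    have := abs_le.mp (h a' ha')
    rw [mem_Icc]; exact this
  · intro b _ _; exact uu_nonneg b

noncomputable def vv (c : ℝ) (n : ℕ) : ℤ := ⌊(n:ℝ)^c⌋

noncomputable def ww (c : ℝ) (n : ℕ) : ℝ := wt ((n:ℝ)^c)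

noncomputable def fw (c : ℝ) (n : ℕ) : ℝ := thw n * ww c n

lemma ww_nonneg (c : ℝ) (n : ℕ) : 0 ≤ ww c n := wt_nonneg _

lemma ww_le_one (c : ℝ) (n : ℕ) : ww c n ≤ 1 := wt_le_one _

lemma fw_nonneg (c : ℝ) (n : ℕ) : 0 ≤ fw c n := mul_nonneg (thw_nonneg n) (ww_nonneg c n)

lemma thw_le_log (n : ℕ) (X : ℝ) (hX : 1 ≤ X) (h : (n:ℝ) ≤ X) : thw n ≤ log X := by
  unfold thw
  split_ifs with hp
  · exact log_le_log (by exact_mod_cast hp.pos) h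
  · exact log_nonneg hX

lemma fw_le_log (c : ℝ) (n : ℕ) (X : ℝ) (hX : 1 ≤ X) (h : (n:ℝ) ≤ X) : fw c n ≤ log X := by
  unfold fw
  calc thw n * ww c n ≤ thw n * 1 := mul_le_mul_of_nonneg_left (ww_le_one c n) (thw_nonneg n)
    _ ≤ _ := by rw [mul_one]; exact thw_le_log n X hX h

lemma FF_eq_Fp (c : ℝ) (x1 x2 N : ℕ) (a : ℤ) : FF (Ioc x1 x2) (fw c) (vv c) N a = Fp c x1 x2 ((a:ℝ)/N) := by
  unfold FF Fp fw vv ww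
  apply Finset.sum_congr rfl; intro n _
  push_cast; ring

lemma FF_eq_Gk (c : ℝ) (x1 x2 N : ℕ) (a : ℤ) : FF (Ioc x1 x2) (ww c) (vv c) N a = Gk c x1 x2 ((a:ℝ)/N) := by
  unfold FF Gk vv ww
  rfl

lemma FF_period (J : Finset ℕ) (f : ℕ → ℝ) (v : ℕ → ℤ) (N : ℕ) (hN : 0 < N) (a j : ℤ) : FF J f v N (a + j*N) = FF J f v N a := by
  unfold FF
  apply Finset.sum_congr rfl; intro n _
  congr 1
  have : (((a + j*N:ℤ):ℝ)/N * v n) = (a:ℝ)/N * v n + ((j * v n:ℤ):ℝ) := by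
    push_cast
    have : (N:ℝ) ≠ 0 := by positivity
    field_simp
  rw [this, ee_add, ee_int, mul_one]

lemma vv_gap (c X : ℝ) (hc1 : 1 < c) (hc2 : c < 2) (hX : 4 ≤ X) (hbig : 2 ≤ X^(c-1)/4) (n n' : ℕ) (hn : X/4 ≤ n) (h : n < n') :
    X^(c-1)/8 * ((n':ℝ) - n) ≤ (vv c n':ℝ) - vv c n := by
  have hnn : (n:ℝ) < n' := by exact_mod_cast h
  have hn1 : (n:ℝ) + 1 ≤ n' := by exact_mod_cast h
  have hn0 : (0:ℝ) < n := by linarith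
  obtain ⟨ξ, h1, h2, h3⟩ := rpow_mvt c (n:ℝ) n' hn0 hnn
  have h4 : X^(c-1)/4 ≤ ξ^(c-1) := by
    calc X^(c-1)/4 ≤ X^(c-1)/4^(c-1) := by
          apply div_le_div_of_nonneg_left (by positivity) (by positivity)
          calc (4:ℝ)^(c-1) ≤ 4^(1:ℝ) := rpow_le_rpow_of_exponent_le (by norm_num) (by linarith)
            _ = 4 := by norm_num
      _ = (X/4)^(c-1) := by rw [div_rpow (by linarith) (by norm_num)]
      _ ≤ ξ^(c-1) := rpow_le_rpow (by linarith) (by linarith) (by linarith)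
  have h5 : X^(c-1)/4 * ((n':ℝ)-n) ≤ (n':ℝ)^c - (n:ℝ)^c := by
    rw [h3]
    apply mul_le_mul_of_nonneg_right _ (by linarith)
    have : 0 ≤ ξ^(c-1) := rpow_nonneg (by linarith) _
    nlinarith
  have h6 := Int.floor_le ((n:ℝ)^c)
  have h7 := Int.lt_floor_add_one ((n':ℝ)^c)
  unfold vv
  nlinarith

lemma vv_inj (c X : ℝ) (hc1 : 1 < c) (hc2 : c < 2) (hX : 4 ≤ X) (hbig : 2 ≤ X^(c-1)/4) (x1 x2 : ℕ) (hx : X/4 ≤ x1) :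
    Set.InjOn (vv c) (Ioc x1 x2) := by
  have key : ∀ n n' : ℕ, x1 < n → n < n' → vv c n ≠ vv c n' := by
    intro n n' h1 h2 h
    have hn : X/4 ≤ n := hx.trans (by exact_mod_cast h1.le)
    have := vv_gap c X hc1 hc2 hX hbig n n' hn h2
    rw [h, sub_self] at this
    have h3 : (n:ℝ) < n' := by exact_mod_cast h2
    nlinarith
  intro n hn n' hn' h
  simp only [Finset.coe_Ioc, Set.mem_Ioc] at hn hn'
  rcases lt_trichotomy n n' with h1 | h1 | h1
  · exact absurd h (key n n' hn.1 h1)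
  · exact h1
  · exact absurd h.symm (key n' n hn'.1 h1)

lemma vv_range (c X : ℝ) (hc1 : 1 < c) (r : ℕ) (hr : (r:ℝ) = X^c) (n : ℕ) (hn : (n:ℝ) ≤ X) : 0 ≤ vv c n ∧ vv c n ≤ r := by
  unfold vv
  constructor
  · exact Int.floor_nonneg.mpr (by positivity)
  · have h : (n:ℝ)^c ≤ X^c := rpow_le_rpow (by positivity) hn (by linarith)
    have h2 := Int.floor_le ((n:ℝ)^c)
    rw [← hr] at h
    exact_mod_cast h2.trans h

lemma exp_uu (d : ℤ) : rexp (-π * ((d:ℝ)/32)^2) ≤ 1024 * uu d := by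
  unfold uu
  split_ifs with h
  · subst h; norm_num
  · have hd : (1:ℝ) ≤ |(d:ℝ)| := by exact_mod_cast Int.one_le_abs h
    have h1 : |(d:ℝ)|/1024 ≤ π * ((d:ℝ)/32)^2 := by
      rw [← sq_abs ((d:ℝ)/32), abs_div]
      norm_num
      have := Real.pi_gt_three
      rw [div_pow]
      nlinarith [sq_nonneg (|(d:ℝ)|)]
    have h2 := Real.add_one_le_exp (π * ((d:ℝ)/32)^2)
    rw [neg_mul, Real.exp_neg, mul_one_div, inv_le_comm₀ (by positivity) (by positivity), inv_div]
    linarith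

set_option maxHeartbeats 1000000 in
lemma mean_X (c : ℝ) (hc1 : 1 < c) (hc2 : c < 2) : ∃ C, 0 < C ∧ ∀ᶠ X in Filter.atTop, ∀ (r x1 x2 : ℕ), (r:ℝ) = X^c → X/4 ≤ x1 → (x2:ℝ) ≤ X/2 →
    ∀ s : Finset ℤ, (∀ a ∈ s, |(a:ℝ)| ≤ X) → ∑ a ∈ s, ‖FF (Ioc x1 x2) (fw c) (vv c) (4*r) a‖^2 ≤ C * X^2 * (log X)^3 := by
  refine ⟨(2*rexp (4*π)) * 2 * (1024 * 5), by positivity, ?_⟩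
  have e1 : ∀ᶠ X in Filter.atTop, (8:ℝ) ≤ X^(c-1) := (tendsto_rpow_atTop (by linarith)).eventually_ge_atTop 8
  have e2 : ∀ᶠ X in Filter.atTop, (1:ℝ) ≤ log X := Real.tendsto_log_atTop.eventually_ge_atTop 1
  filter_upwards [e1, e2, Filter.eventually_ge_atTop 4] with X h8 hL hX4
  intro r x1 x2 hr hx1 hx2 s hs
  have hX0 : 0 < X := by linarith
  have hr0 : (0:ℝ) < r := by rw [hr]; positivity
  have hmem : ∀ n ∈ Ioc x1 x2, X/4 ≤ (n:ℝ) ∧ (n:ℝ) ≤ X/2 := by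
    intro n hn
    rw [mem_Ioc] at hn
    exact ⟨hx1.trans (by exact_mod_cast hn.1.le), le_trans (by exact_mod_cast hn.2) hx2⟩
  have hls := large_sieve (Ioc x1 x2) (fun n => ((fw c n:ℝ):ℂ)) (fun n => (vv c n:ℝ)/(4*r:ℕ)) (log X) X (1/2)
    (by
      intro n hn
      rw [Complex.norm_real, Real.norm_of_nonneg (fw_nonneg c n)]
      exact fw_le_log c n X (by linarith) (by linarith [(hmem n hn).2]))
    hX0 (by norm_num) (by linarith)
    (by
      intro n hn
      have h := vv_range c X hc1 r hr n (by linarith [(hmem n hn).2])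
      have h1 : (0:ℝ) ≤ vv c n := by exact_mod_cast h.1
      have h2 : (vv c n:ℝ) ≤ r := by exact_mod_cast h.2
      rw [abs_of_nonneg (by positivity)]
      push_cast
      have : (vv c n:ℝ)/(4*r) ≤ 1/4 := by rw [div_le_div_iff₀ (by positivity) (by norm_num)]; linarith
      linarith)
    s (fun a => (a:ℝ)) hs
    (by
      intro m _ m' _ hne
      have : (1:ℝ) ≤ |((m - m':ℤ):ℝ)| := by exact_mod_cast Int.one_le_abs (sub_ne_zero.mpr hne)
      push_cast at this
      linarith)
  have hFF : ∀ a : ℤ, FF (Ioc x1 x2) (fw c) (vv c) (4*r) a = ∑ n ∈ Ioc x1 x2, ((fw c n:ℝ):ℂ) * ee ((a:ℝ) * ((vv c n:ℝ)/(4*r:ℕ))) := by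
    intro a
    unfold FF
    apply Finset.sum_congr rfl; intro n _
    congr 2; ring
  simp_rw [hFF]
  refine hls.trans ?_
  have hpair : ∀ n ∈ Ioc x1 x2, ∑ n' ∈ Ioc x1 x2, rexp (-π*X^2*((vv c n:ℝ)/(4*r:ℕ) - (vv c n':ℝ)/(4*r:ℕ))^2) ≤ 1024 * 5 * log X := by
    intro n hn
    have hg : ∀ n' ∈ Ioc x1 x2, |(n:ℝ) - n'|/32 ≤ X * |(vv c n:ℝ)/(4*r:ℕ) - (vv c n':ℝ)/(4*r:ℕ)| := by
      intro n' hn'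
      have hgap : X^(c-1)/8 * |(n:ℝ) - n'| ≤ |(vv c n:ℝ) - vv c n'| := by
        rcases lt_trichotomy n n' with h | h | h
        · have h1 := vv_gap c X hc1 hc2 hX4 (by linarith) n n' (hmem n hn).1 h
          have h2 : (n:ℝ) < n' := by exact_mod_cast h
          rw [abs_sub_comm, abs_of_pos (by linarith), abs_sub_comm]
          exact h1.trans (le_abs_self _)
        · subst h; simp
        · have h1 := vv_gap c X hc1 hc2 hX4 (by linarith) n' n (hmem n' hn').1 h
          have h2 : (n':ℝ) < n := by exact_mod_cast h
          rw [abs_of_pos (by linarith)]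
          exact h1.trans (le_abs_self _)
      rw [← sub_div, abs_div, abs_of_pos (show (0:ℝ) < (4*r:ℕ) by push_cast; positivity), ← mul_div_assoc, le_div_iff₀ (by push_cast; positivity)]
      push_cast
      rw [hr]
      have e : X^c = X^(c-1) * X := by
        rw [← rpow_add_one hX0.ne']; congr 1; ring
      rw [e]
      calc _ = X * (X^(c-1)/8 * |(n:ℝ) - n'|) := by ring
        _ ≤ _ := by gcongr
    calc _ ≤ ∑ n' ∈ Ioc x1 x2, 1024 * uu ((n:ℤ) - n') := by
          apply Finset.sum_le_sum
          intro n' hn'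
          refine le_trans ?_ (exp_uu _)
          apply Real.exp_le_exp.mpr
          have h1 := pow_le_pow_left₀ (by positivity) (hg n' hn') 2
          have h2 : (((((n:ℤ)-n':ℤ)):ℝ)/32)^2 = (|(n:ℝ) - n'|/32)^2 := by
            push_cast; rw [div_pow, div_pow, sq_abs]
          rw [h2]
          rw [mul_pow, sq_abs] at h1
          have := Real.pi_pos
          nlinarith
      _ = 1024 * ∑ n' ∈ Ioc x1 x2, uu ((n:ℤ) - n') := by rw [Finset.mul_sum]
      _ ≤ 1024 * (1 + 2*(1 + log x2)) := by
          apply mul_le_mul_of_nonneg_left _ (by norm_num)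
          refine le_trans ?_ (sum_uu x2)
          rw [← Finset.sum_image (s := Ioc x1 x2) (g := fun n':ℕ => (n:ℤ) - n') (f := uu) (by intro a _ b _ h; simp only at h; omega)]
          apply Finset.sum_le_sum_of_subset_of_nonneg
          · intro b hb
            rw [Finset.mem_image] at hb
            obtain ⟨a', ha', rfl⟩ := hb
            rw [mem_Ioc] at ha' hn
            rw [mem_Icc]; constructor <;> omega
          · intro b _ _; exact uu_nonneg b
      _ ≤ _ := by
          have : log x2 ≤ log X := by
            rw [mem_Ioc] at hn
            apply log_le_log
            · exact_mod_cast (by omega : 0 < x2)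
            · linarith
          linarith
  have hsum := Finset.sum_le_sum hpair
  rw [Finset.sum_const, nsmul_eq_mul] at hsum
  have hcard : ((Ioc x1 x2).card:ℝ) ≤ X := by
    rw [Nat.card_Ioc]
    calc ((x2 - x1:ℕ):ℝ) ≤ x2 := by exact_mod_cast Nat.sub_le _ _
      _ ≤ X := by linarith
  calc _ ≤ 2*rexp (4*π) * ((log X)^2 * X / (1/2)) * (X * (1024 * 5 * log X)) := by
        apply mul_le_mul_of_nonneg_left _ (by positivity)
        refine hsum.trans ?_
        gcongr
    _ = _ := by ring

lemma Gk_hG (c : ℝ) (hc1 : 1 < c) (hc2 : c < 2) : ∃ C, 0 < C ∧ ∀ (X : ℝ) (r x1 x2 : ℕ), 8 ≤ X → (r:ℝ) = X^c → X/4 ≤ x1 → x1 ≤ x2 → (x2:ℝ) ≤ X/2 →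
    ∀ a ∈ AA r, ∀ a' ∈ AA r, ‖FF (Ioc x1 x2) (ww c) (vv c) (4*r) (a-a')‖ ≤ C*X^(c/2) + C*X*(uu (a-a') + uu (a-4*r-a') + uu (a+4*r-a')) := by
  obtain ⟨C, hC, hG⟩ := Gk_bound c hc1 hc2
  refine ⟨4*C+1, by positivity, ?_⟩
  intro X r x1 x2 hX hr hx1 hx12 hx2 a ha a' ha'
  have hX0 : 0 < X := by linarith
  have hr0 : (0:ℝ) < r := by rw [hr]; positivity
  have hr0' : 0 < r := by exact_mod_cast hr0
  have hN : 0 < 4*r := by omega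
  have key : ∀ b : ℤ, |b| ≤ 2*r → ‖FF (Ioc x1 x2) (ww c) (vv c) (4*r) b‖ ≤ (4*C+1)*X^(c/2) + (4*C+1)*X*uu b := by
    intro b hb
    rw [FF_eq_Gk]
    by_cases h0 : b = 0
    · subst h0
      refine (Gk_trivial c x1 x2 X _ (by linarith)).trans ?_
      have : uu 0 = 1 := by simp [uu]
      rw [this]
      have : 0 ≤ X^(c/2) := by positivity
      nlinarith
    · have hb1 : (0:ℝ) < |(b:ℝ)| := by positivity
      have hbr : |(b:ℝ)| ≤ 2*r := by exact_mod_cast hb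
      have hx12' : (x2:ℝ) ≤ 2*x1 := by linarith
      have h := hG X ((b:ℝ)/(4*r:ℕ)) x1 x2 hX (by linarith) hx12 (by exact_mod_cast hx12') (by linarith)
        (by rw [abs_div, abs_of_pos (show (0:ℝ) < (4*r:ℕ) by push_cast; positivity), div_le_iff₀ (by push_cast; positivity)]; push_cast; linarith)
        (by
          have : ((4*r:ℕ):ℝ) ≠ 0 := by push_cast; positivity
          have : (b:ℝ) ≠ 0 := by exact_mod_cast h0
          positivity)
      refine h.trans ?_
      have hu : uu b = 1/|(b:ℝ)| := by unfold uu; rw [if_neg h0]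
      rw [hu, abs_div, abs_of_pos (show (0:ℝ) < (4*r:ℕ) by push_cast; positivity)]
      have e : X^(1-c)/(|(b:ℝ)|/(4*r:ℕ)) = 4*X*(1/|(b:ℝ)|) := by
        push_cast
        rw [hr]
        have : X = X^(1-c) * X^c := by rw [← rpow_add hX0]; norm_num
        field_simp
        linarith
      rw [e]
      have : 0 ≤ X^(c/2) := by positivity
      have : 0 ≤ X * (1/|(b:ℝ)|) := by positivity
      nlinarith
  unfold AA at ha ha'
  rw [mem_Ico] at ha ha'
  have u1 := uu_nonneg (a-a')
  have u2 := uu_nonneg (a-4*r-a')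
  have u3 := uu_nonneg (a+4*r-a')
  have hp : 0 ≤ (4*C+1)*X := by positivity
  by_cases h1 : a - a' < -(2*r)
  · have h := key (a+4*r-a') (by rw [abs_le]; constructor <;> omega)
    have e := FF_period (Ioc x1 x2) (ww c) (vv c) (4*r) hN (a-a') 1
    have e2 : a - a' + 1 * ((4*r:ℕ):ℤ) = a + 4*r - a' := by push_cast; ring
    rw [e2] at e
    rw [← e]
    nlinarith
  · by_cases h2 : 2*r < a - a'
    · have h := key (a-4*r-a') (by rw [abs_le]; constructor <;> omega)
      have e := FF_period (Ioc x1 x2) (ww c) (vv c) (4*r) hN (a-a') (-1)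
      have e2 : a - a' + (-1) * ((4*r:ℕ):ℤ) = a - 4*r - a' := by push_cast; ring
      rw [e2] at e
      rw [← e]
      nlinarith
    · have h := key (a-a') (by rw [abs_le]; constructor <;> omega)
      nlinarith

lemma log_8r (c X : ℝ) (hc2 : c < 2) (r : ℕ) (hr : (r:ℝ) = X^c) (hX : 8 ≤ X) : log ((8*r:ℕ):ℝ) ≤ 3 * log X := by
  have hX0 : 0 < X := by linarith
  have : ((8*r:ℕ):ℝ) ≤ X^3 := by
    push_cast
    rw [hr]
    calc 8 * X^c ≤ X * X^(2:ℝ) := by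
          apply mul_le_mul hX _ (by positivity) (by positivity)
          exact rpow_le_rpow_of_exponent_le (by linarith) (by linarith)
      _ = X^3 := by rw [rpow_two]; ring
  calc _ ≤ log (X^3) := by
        apply log_le_log _ this
        push_cast; rw [hr]; positivity
    _ = _ := by rw [log_pow]; norm_num

set_option maxHeartbeats 1000000 in
lemma err3 (c : ℝ) (hc1 : 1 < c) (hc2 : c < 1.153) : ∀ᶠ X in Filter.atTop, ∀ (r x1 x2 : ℕ), (r:ℝ) = X^c → X/4 ≤ x1 → x1 ≤ x2 → (x2:ℝ) ≤ X/2 →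
    ∀ S ⊆ AA r, (∀ a ∈ S, X < |(a:ℝ)|) →
      ‖∑ a ∈ S, FF (Ioc x1 x2) (fw c) (vv c) (4*r) a ^ 3 * ee (-((a:ℝ)/(4*r:ℕ)*r))‖ ≤ X^3/log X := by
  obtain ⟨C, hC, hG⟩ := Gk_hG c hc1 (by linarith)
  obtain ⟨C5, hC5, hF⟩ := Fp_bound c hc1 hc2
  have e1 : ∀ᶠ X in Filter.atTop, (8:ℝ) ≤ X^(c-1) := (tendsto_rpow_atTop (by linarith)).eventually_ge_atTop 8
  have e2 : ∀ᶠ X in Filter.atTop, (1:ℝ) ≤ log X := Real.tendsto_log_atTop.eventually_ge_atTop 1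
  have e3 : ∀ᶠ X in Filter.atTop, (4:ℝ) ≤ X^(0.1:ℝ) := (tendsto_rpow_atTop (by norm_num)).eventually_ge_atTop 4
  filter_upwards [hF, e1, e2, e3, ev_log (32*C) 8 0.1 (by norm_num), ev_log (72*C*2*2) 7 0.0001 (by norm_num), Filter.eventually_ge_atTop 8] with X hF h8 hL h4 hl1 hl2 hX8
  intro r x1 x2 hr hx1 hx12 hx2 S hS hSX
  set L := log X with hLdef
  have hX0 : 0 < X := by linarith
  have hX1 : 1 ≤ X := by linarith
  have hr0 : (0:ℝ) < r := by rw [hr]; positivity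
  have hr0' : 0 < r := by exact_mod_cast hr0
  set J := Ioc x1 x2 with hJ
  have hmem : ∀ n ∈ J, X/4 ≤ (n:ℝ) ∧ (n:ℝ) ≤ X/2 := by
    intro n hn
    rw [hJ, mem_Ioc] at hn
    exact ⟨hx1.trans (by exact_mod_cast hn.1.le), le_trans (by exact_mod_cast hn.2) hx2⟩
  have hcard : ((J).card:ℝ) ≤ X := by
    rw [hJ, Nat.card_Ioc]
    calc ((x2 - x1:ℕ):ℝ) ≤ x2 := by exact_mod_cast Nat.sub_le _ _
      _ ≤ X := by linarith
  have hth : ∑ n ∈ J, thw n^2 * ww c n ≤ X * L^2 := by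
    calc _ ≤ ∑ n ∈ J, L^2 := by
          apply Finset.sum_le_sum; intro n hn
          have h1 := thw_le_log n X hX1 (by linarith [(hmem n hn).2])
          have h2 := pow_le_pow_left₀ (thw_nonneg n) h1 2
          calc _ ≤ L^2 * 1 := mul_le_mul h2 (ww_le_one c n) (ww_nonneg c n) (by positivity)
            _ = _ := mul_one _
      _ ≤ _ := by rw [Finset.sum_const, nsmul_eq_mul]; gcongr
  have hff : ∑ n ∈ J, fw c n^2 ≤ X * L^2 := by
    calc _ ≤ ∑ n ∈ J, L^2 := by
          apply Finset.sum_le_sum; intro n hn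
          exact pow_le_pow_left₀ (fw_nonneg c n) (fw_le_log c n X hX1 (by linarith [(hmem n hn).2])) 2
      _ ≤ _ := by rw [Finset.sum_const, nsmul_eq_mul]; gcongr
  have hvr : ∀ n ∈ J, 0 ≤ vv c n ∧ vv c n ≤ r := fun n hn => vv_range c X hc1 r hr n (by linarith [(hmem n hn).2])
  have hP : ∑ a ∈ AA r, ‖FF J (fw c) (vv c) (4*r) a‖^2 ≤ 4*X^c*(X*L^2) := by
    rw [parseval_AA J (fw c) (vv c) r hr0' hvr (vv_inj c X hc1 (by linarith) (by linarith) (by linarith) x1 x2 hx1)]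
    push_cast
    rw [hr]
    gcongr
  have hct := cauchy_trick J thw (ww c) (ww_nonneg c) (vv c) (4*r) r S
  have hbs := bilinear_split S (AA r) hS (FF J (fw c) (vv c) (4*r)) (FF J (ww c) (vv c) (4*r))
    (fun a a' => C*X*(uu (a-a') + uu (a-4*r-a') + uu (a+4*r-a')))
    (fun a a' => by have := uu_nonneg (a-a'); have := uu_nonneg (a-4*r-a'); have := uu_nonneg (a+4*r-a'); positivity)
    (C*X^(c/2)) (C*X*(27*L)) (X^(0.9234:ℝ)) (4*X^c*(X*L^2)) (by positivity) (by positivity)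
    (by
      intro a ha
      rw [FF_eq_Fp]
      have haA := hS ha
      unfold AA at haA
      rw [mem_Ico] at haA
      have ha2 : |a| ≤ 2*r := by rw [abs_le]; constructor <;> omega
      have ha3 : |(a:ℝ)| ≤ 2*r := by exact_mod_cast ha2
      have hx12' : (x2:ℝ) ≤ 2*x1 := by linarith
      have hNpos : (0:ℝ) < (4*r:ℕ) := by push_cast; positivity
      have e : |(a:ℝ)/(4*r:ℕ)| * X^c = |(a:ℝ)|/4 := by
        rw [abs_div, abs_of_pos hNpos]
        push_cast
        rw [← hr]
        field_simp
      have h9 : X^(0.9:ℝ) ≤ |(a:ℝ)|/4 := by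
        have : X^(0.9:ℝ) * 4 ≤ X := by
          calc X^(0.9:ℝ) * 4 ≤ X^(0.9:ℝ) * X^(0.1:ℝ) := by gcongr
            _ = X := by rw [← rpow_add hX0]; norm_num
        have := hSX a ha
        linarith
      refine (hF ((a:ℝ)/(4*r:ℕ)) x1 x2 (by linarith) hx12 (by exact_mod_cast hx12') (by linarith) ?_ ?_).1 ?_
      · rw [abs_div, abs_of_pos hNpos, div_le_iff₀ hNpos]; push_cast; linarith
      · rw [e]; exact le_trans (Real.one_le_rpow hX1 (by norm_num)) h9
      · rw [e]; exact h9)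
    (fun a ha a' ha' => hG X r x1 x2 hX8 hr hx1 hx12 hx2 a ha a' ha')
    (by
      intro a ha
      rw [← Finset.mul_sum, Finset.sum_add_distrib, Finset.sum_add_distrib]
      apply mul_le_mul_of_nonneg_left _ (by positivity)
      have hl := log_8r c X (by linarith) r hr hX8
      have hh : ∀ s : ℤ, |s| ≤ 6*r → ∑ a' ∈ AA r, uu (s-a') ≤ 9*L := by
        intro s hs
        have := sum_uu_shift r s (8*r) (by
          intro a' ha'
          unfold AA at ha'
          rw [mem_Ico] at ha'
          rw [abs_le] at hs ⊢
          push_cast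
          constructor <;> omega)
        linarith
      unfold AA at ha
      rw [mem_Ico] at ha
      have := hh a (by rw [abs_le]; constructor <;> omega)
      have := hh (a-4*r) (by rw [abs_le]; constructor <;> omega)
      have := hh (a+4*r) (by rw [abs_le]; constructor <;> omega)
      linarith)
    hP
  have hfin : ‖∑ a ∈ S, FF J (fw c) (vv c) (4*r) a ^ 3 * ee (-((a:ℝ)/(4*r:ℕ)*r))‖^2 ≤ (X^3/L)^2 := by
    refine (le_trans hct (mul_le_mul hth hbs (by positivity) (by positivity))).trans ?_
    have t1 : 32*C*L^8 * X^(5*c/2) ≤ X^(3:ℝ) := by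
      calc _ ≤ X^(0.1:ℝ) * X^(5*c/2) := by gcongr
        _ = X^(0.1+5*c/2) := by rw [← rpow_add hX0]
        _ ≤ _ := rpow_le_rpow_of_exponent_le hX1 (by linarith)
    have t2 : 72*C*2*2*L^7 * X^(1.8468+c) ≤ X^(3:ℝ) := by
      calc _ ≤ X^(0.0001:ℝ) * X^(1.8468+c) := by gcongr
        _ = X^(0.0001+(1.8468+c)) := by rw [← rpow_add hX0]
        _ ≤ _ := rpow_le_rpow_of_exponent_le hX1 (by linarith)
    have a1 : X^(5*c/2) = X^(c/2) * (X^c)^2 := by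
      rw [← rpow_natCast, ← rpow_mul hX0.le, ← rpow_add hX0]; congr 1; push_cast; ring
    have a2 : X^(1.8468+c) = (X^(0.9234:ℝ))^2 * X^c := by
      rw [← rpow_natCast, ← rpow_mul hX0.le, ← rpow_add hX0]; congr 1; push_cast; ring
    have a3 : X^(3:ℝ) = X^3 := by norm_cast
    rw [a1, a3] at t1
    rw [a2, a3] at t2
    rw [div_pow, le_div_iff₀ (by positivity)]
    have hX3 : 0 < X^3 := by positivity
    calc _ = X^3 * (((32*C*L^8 * (X^(c/2) * (X^c)^2)) + 3/4*(72*C*2*2*L^7 * ((X^(0.9234:ℝ))^2 * X^c)))/2) := by ring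
      _ ≤ X^3 * X^3 := by
          apply mul_le_mul_of_nonneg_left _ hX3.le
          nlinarith
      _ = _ := by ring
  exact le_of_sq_le_sq hfin (by positivity)

set_option maxHeartbeats 1000000 in
lemma err_total (c : ℝ) (hc1 : 1 < c) (hc2 : c < 1.153) : ∃ C, 0 < C ∧ ∀ᶠ X in Filter.atTop, ∀ (r x1 x2 R : ℕ), (r:ℝ) = X^c → X/4 ≤ x1 → x1 ≤ x2 → (x2:ℝ) ≤ X/2 →
    R = ⌈(log X)^76⌉₊ →
      ‖∑ a ∈ AA r, (((1 - cnt R a/R:ℝ)):ℂ)*(FF (Ioc x1 x2) (fw c) (vv c) (4*r) a^3 * ee (-((a:ℝ)/(4*r:ℕ)*r)))‖ ≤ C * (X^3/log X) := by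
  obtain ⟨C5, hC5, hF⟩ := Fp_bound c hc1 hc2
  obtain ⟨C2, hC2, hM⟩ := mean_X c hc1 (by linarith)
  refine ⟨3 + (3*C5*C2) + 1, by positivity, ?_⟩
  have e2 : ∀ᶠ X in Filter.atTop, (4:ℝ) ≤ log X := Real.tendsto_log_atTop.eventually_ge_atTop 4
  filter_upwards [hF, hM, err3 c hc1 hc2, e2, ev_log 2 76 1 (by norm_num), ev_log 1 9 0.025 (by norm_num), Filter.eventually_ge_atTop 8] with X hF hM h3 hL hl1 hl2 hX8
  intro r x1 x2 R hr hx1 hx12 hx2 hR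
  rw [rpow_one] at hl1
  set L := log X with hLdef
  have hX0 : 0 < X := by linarith
  have hX1 : 1 ≤ X := by linarith
  have hL0 : 0 < L := by linarith
  have hr0 : (0:ℝ) < r := by rw [hr]; positivity
  have hr0' : 0 < r := by exact_mod_cast hr0
  have hNpos : (0:ℝ) < (4*r:ℕ) := by push_cast; positivity
  have hRL : L^76 ≤ R := by rw [hR]; exact Nat.le_ceil _
  have hR0 : (0:ℝ) < R := lt_of_lt_of_le (by positivity) hRL
  have hRX : (R:ℝ) ≤ X := by
    have : (R:ℝ) < L^76 + 1 := by rw [hR]; exact Nat.ceil_lt_add_one (by positivity)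
    have : 1 ≤ L^76 := one_le_pow₀ (by linarith)
    linarith
  set F := FF (Ioc x1 x2) (fw c) (vv c) (4*r) with hFdef
  set E : ℤ → ℂ := fun a => (((1 - cnt R a/R:ℝ)):ℂ)*(F a^3 * ee (-((a:ℝ)/(4*r:ℕ)*r))) with hE
  have hcnt : ∀ a, 0 ≤ 1 - (cnt R a:ℝ)/R ∧ 1 - (cnt R a:ℝ)/R ≤ 1 := by
    intro a
    have h1 : (cnt R a:ℝ) ≤ R := by exact_mod_cast cnt_le R a
    have : (cnt R a:ℝ)/R ≤ 1 := by rw [div_le_one hR0]; exact h1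
    have : 0 ≤ (cnt R a:ℝ)/R := by positivity
    constructor <;> linarith
  have hEn : ∀ a, ‖E a‖ = (1 - (cnt R a:ℝ)/R) * ‖F a‖^3 := by
    intro a
    rw [hE]; simp only
    rw [norm_mul, Complex.norm_real, Real.norm_of_nonneg (hcnt a).1, norm_mul, norm_ee, mul_one, norm_pow]
  have hx12' : (x2:ℝ) ≤ 2*x1 := by linarith
  have haa : ∀ a ∈ AA r, |(a:ℝ)/(4*r:ℕ)| ≤ 1/2 := by
    intro a ha
    unfold AA at ha
    rw [mem_Ico] at ha
    have ha2 : |a| ≤ 2*r := by rw [abs_le]; constructor <;> omega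
    have ha3 : |(a:ℝ)| ≤ 2*r := by exact_mod_cast ha2
    rw [abs_div, abs_of_pos hNpos, div_le_iff₀ hNpos]; push_cast; linarith
  have haX : ∀ a : ℤ, |(a:ℝ)/(4*r:ℕ)| * X^c = |(a:ℝ)|/4 := by
    intro a
    rw [abs_div, abs_of_pos hNpos]
    push_cast
    rw [← hr]
    field_simp
  set S1 := (AA r).filter (fun a : ℤ => |(a:ℝ)| ≤ L^36) with hS1
  set S2 := (AA r).filter (fun a : ℤ => ¬ |(a:ℝ)| ≤ L^36 ∧ |(a:ℝ)| ≤ X) with hS2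
  set S3 := (AA r).filter (fun a : ℤ => ¬ |(a:ℝ)| ≤ L^36 ∧ ¬ |(a:ℝ)| ≤ X) with hS3
  have hsplit : ∑ a ∈ AA r, E a = ∑ a ∈ S1, E a + (∑ a ∈ S2, E a + ∑ a ∈ S3, E a) := by
    rw [← Finset.sum_filter_add_sum_filter_not (AA r) (fun a : ℤ => |(a:ℝ)| ≤ L^36)]
    congr 1
    rw [← Finset.sum_filter_add_sum_filter_not ((AA r).filter (fun a : ℤ => ¬ |(a:ℝ)| ≤ L^36)) (fun a : ℤ => |(a:ℝ)| ≤ X), Finset.filter_filter, Finset.filter_filter]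
  have b1 : ‖∑ a ∈ S1, E a‖ ≤ 3 * (X^3/L) := by
    have hcard : (S1.card:ℝ) ≤ 3*L^36 := by
      have hsub : S1 ⊆ Icc (-⌊L^36⌋) ⌊L^36⌋ := by
        intro a ha
        rw [hS1, mem_filter, abs_le] at ha
        rw [mem_Icc]
        refine ⟨?_, Int.le_floor.mpr ha.2.2⟩
        have : -a ≤ ⌊L^36⌋ := Int.le_floor.mpr (by push_cast; linarith [ha.2.1])
        linarith
      have h1 := Finset.card_le_card hsub
      rw [Int.card_Icc] at h1
      have h0 : 0 ≤ ⌊L^36⌋ := Int.floor_nonneg.mpr (by positivity)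
      have h2 : (S1.card:ℤ) ≤ 2*⌊L^36⌋ + 1 := by omega
      have h3 : (S1.card:ℝ) ≤ 2*⌊L^36⌋ + 1 := by exact_mod_cast h2
      have h4 := Int.floor_le (L^36)
      have : 1 ≤ L^36 := one_le_pow₀ (by linarith)
      linarith
    calc _ ≤ ∑ a ∈ S1, L^36/L^76 * (X*L)^3 := by
          apply norm_sum_le_of_le
          intro a ha
          rw [hS1, mem_filter] at ha
          rw [hEn]
          have h1 : ‖F a‖ ≤ X*L := by
            rw [hFdef, FF_eq_Fp]; exact Fp_trivial c x1 x2 X _ (by linarith) hX1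
          have h2 : (R:ℝ) - |(a:ℝ)| ≤ cnt R a := by exact_mod_cast cnt_ge R a
          have h3 : 1 - (cnt R a:ℝ)/R ≤ L^36/L^76 := by
            calc 1 - (cnt R a:ℝ)/R ≤ |(a:ℝ)|/R := by
                  rw [sub_le_iff_le_add, ← add_div, le_div_iff₀ hR0]; linarith
              _ ≤ _ := div_le_div₀ (by positivity) ha.2 (by positivity) hRL
          exact mul_le_mul h3 (pow_le_pow_left₀ (norm_nonneg _) h1 3) (by positivity) (by positivity)
      _ = S1.card * (L^36/L^76 * (X*L)^3) := by rw [Finset.sum_const, nsmul_eq_mul]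
      _ ≤ 3*L^36 * (L^36/L^76 * (X*L)^3) := by gcongr
      _ = _ := by field_simp
  have b2 : ‖∑ a ∈ S2, E a‖ ≤ 3*C5*C2 * (X^3/L) := by
    have hMs := hM r x1 x2 hr hx1 hx2 S2 (by intro a ha; rw [hS2, mem_filter] at ha; exact ha.2.2)
    calc _ ≤ ∑ a ∈ S2, 3*C5*X/L^4 * ‖F a‖^2 := by
          apply norm_sum_le_of_le
          intro a ha
          rw [hS2, mem_filter] at ha
          push Not at ha
          obtain ⟨haA, haL, haX'⟩ := ha
          rw [hEn]
          have h36 : 4 ≤ L^36 := by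
            calc (4:ℝ) ≤ L^1 := by linarith
              _ ≤ L^36 := pow_le_pow_right₀ (by linarith) (by norm_num)
          have hb := (hF ((a:ℝ)/(4*r:ℕ)) x1 x2 (by linarith) hx12 (by exact_mod_cast hx12') (by linarith) (haa a haA)
            (by rw [haX]; linarith)).2
          rw [haX, ← FF_eq_Fp] at hb
          have hT : (|(a:ℝ)|/4)^(-(1/4):ℝ) ≤ 2 * (L^9)⁻¹ := by
            have h1 : (L^36/4) ≤ |(a:ℝ)|/4 := by linarith
            calc (|(a:ℝ)|/4)^(-(1/4):ℝ) ≤ (L^36/4)^(-(1/4):ℝ) := rpow_le_rpow_of_nonpos (by positivity) h1 (by norm_num)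
              _ = (L^36)^(-(1/4):ℝ) / 4^(-(1/4):ℝ) := div_rpow (by positivity) (by norm_num) _
              _ = (L^9)⁻¹ * 4^((1/4):ℝ) := by
                  rw [rpow_neg (by norm_num : (0:ℝ) ≤ 4), div_inv_eq_mul]
                  congr 1
                  rw [rpow_neg (by positivity)]
                  congr 1
                  rw [← rpow_natCast, ← rpow_mul hL0.le, ← rpow_natCast]; norm_num
              _ ≤ (L^9)⁻¹ * 2 := by
                  apply mul_le_mul_of_nonneg_left _ (by positivity)
                  calc (4:ℝ)^((1/4):ℝ) ≤ 4^((1/2):ℝ) := rpow_le_rpow_of_exponent_le (by norm_num) (by norm_num)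
                    _ = 2 := by rw [show (4:ℝ) = 2^(2:ℝ) by norm_num, ← rpow_mul (by norm_num)]; norm_num
              _ = _ := by ring
          have hX25 : X^(-0.025:ℝ) ≤ (L^9)⁻¹ := by
            rw [rpow_neg hX0.le]
            apply inv_anti₀ (by positivity)
            linarith
          have hb2 : ‖F a‖ ≤ 3*C5*X/L^4 := by
            refine hb.trans ?_
            calc _ ≤ C5*L^5*X*(2*(L^9)⁻¹ + (L^9)⁻¹) := by gcongr
              _ = _ := by field_simp; ring
          calc _ ≤ 1 * ‖F a‖^3 := by
                apply mul_le_mul_of_nonneg_right (hcnt a).2 (by positivity)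
            _ = ‖F a‖ * ‖F a‖^2 := by ring
            _ ≤ _ := by gcongr
      _ = 3*C5*X/L^4 * ∑ a ∈ S2, ‖F a‖^2 := by rw [Finset.mul_sum]
      _ ≤ 3*C5*X/L^4 * (C2 * X^2 * L^3) := by gcongr
      _ = _ := by field_simp
  have b3 : ‖∑ a ∈ S3, E a‖ ≤ X^3/L := by
    have := h3 r x1 x2 hr hx1 hx12 hx2 S3 (Finset.filter_subset _ _) (by intro a ha; rw [hS3, mem_filter] at ha; linarith [not_le.mp ha.2.2])
    refine le_trans (le_of_eq ?_) this
    congr 1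
    apply Finset.sum_congr rfl
    intro a ha
    rw [hS3, mem_filter] at ha
    have hXa := not_le.mp ha.2.2
    have : (R:ℤ) ≤ |a| := by
      have : (R:ℝ) ≤ |(a:ℝ)| := by linarith
      exact_mod_cast this
    rw [hE]; simp only
    rw [cnt_zero R a this, Nat.cast_zero, zero_div, sub_zero, Complex.ofReal_one, one_mul]
  rw [hsplit]
  calc _ ≤ _ := norm_add_le _ _
    _ ≤ ‖∑ a ∈ S1, E a‖ + (‖∑ a ∈ S2, E a‖ + ‖∑ a ∈ S3, E a‖) := by gcongr; exact norm_add_le _ _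
    _ ≤ 3*(X^3/L) + (3*C5*C2 * (X^3/L) + X^3/L) := by gcongr
    _ = _ := by ring

def PNTShort : Prop := ∀ B : ℕ, ∃ c1, 0 < c1 ∧ ∀ᶠ X : ℝ in Filter.atTop, ∀ y1 y2 : ℕ, X/8 ≤ y1 → (y2:ℝ) ≤ X → X/(log X)^B ≤ (y2:ℝ) - y1 →
  c1*((y2:ℝ) - y1) ≤ ∑ n ∈ Ioc y1 y2, vonMangoldt n

lemma re_SL (c θ : ℝ) (x1 x2 : ℕ) : (SL c θ x1 x2).re = ∑ n ∈ Ioc x1 x2, vonMangoldt n * Real.cos (2*π*(θ*(n:ℝ)^c)) := by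
  unfold SL
  rw [Complex.re_sum]
  apply Finset.sum_congr rfl; intro n _
  rw [Complex.re_ofReal_mul]
  congr 1
  unfold ee
  have : (2*π*((θ*(n:ℝ)^c:ℝ):ℂ)*Complex.I : ℂ) = ((2*π*(θ*(n:ℝ)^c):ℝ):ℂ) * Complex.I := by push_cast; ring
  rw [this, Complex.exp_ofReal_mul_I_re]

lemma short_w (hP : PNTShort) (c : ℝ) (hc1 : 1 < c) (hc2 : c < 1.153) : ∃ c1, 0 < c1 ∧ ∀ᶠ X : ℝ in Filter.atTop, ∀ y1 y2 : ℕ, X/4 ≤ y1 → (y2:ℝ) ≤ X/2 →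
    X/(log X)^77 ≤ (y2:ℝ) - y1 → c1*((y2:ℝ) - y1) ≤ ∑ n ∈ Ioc y1 y2, fw c n := by
  obtain ⟨c1, hc, hP⟩ := hP 77
  refine ⟨c1/4, by positivity, ?_⟩
  have e1 : ∀ᶠ X : ℝ in Filter.atTop, (2:ℝ) ≤ X^(0.01:ℝ) := (tendsto_rpow_atTop (by norm_num)).eventually_ge_atTop 2
  have e2 : ∀ᶠ X in Filter.atTop, (1:ℝ) ≤ log X := Real.tendsto_log_atTop.eventually_ge_atTop 1
  filter_upwards [hP, expsum_ii c hc1 (by linarith), e1, e2, ev_log (3*(8/c1)) 78 0.07 (by norm_num), Filter.eventually_ge_atTop 4] with X hP hS h2 hL hlog hX4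
  intro y1 y2 hy1 hy2 hlen
  have hX0 : 0 < X := by linarith
  have hX1 : 1 ≤ X := by linarith
  set L := log X with hLd
  have hpos : 0 < (y2:ℝ) - y1 := lt_of_lt_of_le (by positivity) hlen
  have hy12 : y1 ≤ y2 := by exact_mod_cast (by linarith : (y1:ℝ) ≤ y2)
  have hy2y : y2 ≤ 2*y1 := by exact_mod_cast (by linarith : (y2:ℝ) ≤ 2*y1)
  have h0 := hP y1 y2 (by linarith) (by linarith) hlen
  have hXc1 : X^(0.9:ℝ) ≤ X^c := rpow_le_rpow_of_exponent_le hX1 (by linarith)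
  have hXc2 : 2*X^c ≤ X^(1.173:ℝ) := by
    calc 2*X^c ≤ X^(0.01:ℝ) * X^c := by gcongr
      _ = X^(0.01+c) := by rw [← rpow_add hX0]
      _ ≤ _ := rpow_le_rpow_of_exponent_le hX1 (by linarith)
  have hXc0 : 0 ≤ X^c := by positivity
  have s1 := hS 1 y1 y2 (by linarith) hy12 hy2y (by linarith) (by norm_num; linarith) (by norm_num; linarith)
  have s2 := hS 2 y1 y2 (by linarith) hy12 hy2y (by linarith) (by norm_num; linarith) (by norm_num; linarith)
  have r1 := (le_abs_self _).trans ((Complex.abs_re_le_norm _).trans s1)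
  have r2 := (neg_le_abs _).trans ((Complex.abs_re_le_norm _).trans s2)
  have hw : ∑ n ∈ Ioc y1 y2, vonMangoldt n * ww c n = 3/8 * ∑ n ∈ Ioc y1 y2, vonMangoldt n
      - 1/2 * (SL c 1 y1 y2).re + 1/8 * (SL c 2 y1 y2).re := by
    rw [re_SL, re_SL, Finset.mul_sum, Finset.mul_sum, Finset.mul_sum, ← Finset.sum_sub_distrib, ← Finset.sum_add_distrib]
    apply Finset.sum_congr rfl; intro n _
    unfold ww
    rw [wt_cos, one_mul]; ring
  have hy2pos : 1 ≤ y2 := by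
    have : (0:ℝ) < y2 := by linarith [show (0:ℝ) ≤ y1 by positivity]
    exact_mod_cast this
  have hd := sum_Lam_sub_thw y1 y2 hy2pos
  have hd2 : ∑ n ∈ Ioc y1 y2, vonMangoldt n * ww c n - ∑ n ∈ Ioc y1 y2, fw c n ≤ ∑ n ∈ Ioc y1 y2, (vonMangoldt n - thw n) := by
    rw [← Finset.sum_sub_distrib]
    apply Finset.sum_le_sum; intro n _
    have := thw_le_Lam n
    unfold fw
    rw [← sub_mul]
    exact mul_le_of_le_one_right (by linarith) (ww_le_one c n)
  have hd3 : 2 * √(y2:ℝ) * log y2 ≤ 2 * X^(0.9233:ℝ) * L := by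
    have : √(y2:ℝ) ≤ X^(0.9233:ℝ) := by
      calc √(y2:ℝ) ≤ √X := Real.sqrt_le_sqrt (by linarith)
        _ = X^((1/2):ℝ) := Real.sqrt_eq_rpow X
        _ ≤ _ := rpow_le_rpow_of_exponent_le hX1 (by norm_num)
    have : log y2 ≤ L := log_le_log (by exact_mod_cast hy2pos) (by linarith)
    gcongr
  have hsm : 3 * X^(0.9233:ℝ) * L ≤ c1/8 * ((y2:ℝ) - y1) := by
    calc 3 * X^(0.9233:ℝ) * L = c1/8 * (X^(0.9233:ℝ) * (3*(8/c1)*L^78) / L^77) := by field_simp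
      _ ≤ c1/8 * (X^(0.9233:ℝ) * X^(0.07:ℝ) / L^77) := by gcongr
      _ ≤ c1/8 * (X / L^77) := by
          gcongr
          rw [← rpow_add hX0]
          calc X^((0.9233:ℝ)+0.07) ≤ X^(1:ℝ) := rpow_le_rpow_of_exponent_le hX1 (by norm_num)
            _ = X := rpow_one X
      _ ≤ _ := by gcongr
  have hq : 0 ≤ X^(0.9233:ℝ) := by positivity
  have hq2 : X^(0.9233:ℝ) ≤ X^(0.9233:ℝ) * L := le_mul_of_one_le_right hq hL
  nlinarith

lemma count_ge (c : ℝ) (hc1 : 1 < c) (X : ℝ) (hX : 8 ≤ X) (r x1 x2 : ℕ) (hr : (r:ℝ)^(1/c) = X) (hx1 : X/4 ≤ x1) (hx2 : (x2:ℝ) ≤ X/2) :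
    ∑ t ∈ (TT (Ioc x1 x2)).filter (fun t => kk (vv c) r t = 0), fff (fw c) t ≤ (log X)^3 * (countSolFloor c r 3 : ℝ) := by
  classical
  set J := Ioc x1 x2 with hJ
  set S := (TT J).filter (fun t => kk (vv c) r t = 0) with hS
  set S' := S.filter (fun t => t.1.Prime ∧ t.2.1.Prime ∧ t.2.2.Prime) with hS'
  have hL : 0 ≤ log X := log_nonneg (by linarith)
  have hm : ∀ n ∈ J, X/8 < (n:ℝ) ∧ (n:ℝ) ≤ X := by
    intro n hn
    rw [hJ, mem_Ioc] at hn
    have h1 : (x1:ℝ) ≤ n := by exact_mod_cast hn.1.le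
    have h2 : (n:ℝ) ≤ x2 := by exact_mod_cast hn.2
    constructor <;> linarith
  have h1 : ∑ t ∈ S, fff (fw c) t = ∑ t ∈ S', fff (fw c) t := by
    rw [hS']
    symm
    apply Finset.sum_filter_of_ne
    intro t _ hne
    have hz : ∀ n, ¬ n.Prime → fw c n = 0 := by
      intro n hn; unfold fw thw; rw [if_neg hn, zero_mul]
    unfold fff at hne
    refine ⟨?_, ?_, ?_⟩ <;> (by_contra h; apply hne; rw [hz _ h]; ring)
  have h2 : ∑ t ∈ S', fff (fw c) t ≤ S'.card * (log X)^3 := by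
    rw [← nsmul_eq_mul, ← Finset.sum_const]
    apply Finset.sum_le_sum
    intro t ht
    rw [hS', mem_filter, hS, mem_filter] at ht
    have ht2 := ht.1.1
    unfold TT at ht2
    rw [Finset.mem_product, Finset.mem_product] at ht2
    have b : ∀ n ∈ J, fw c n ≤ log X := fun n hn => fw_le_log c n X (by linarith) (hm n hn).2
    unfold fff
    calc _ ≤ log X * log X * log X := by
          apply mul_le_mul (mul_le_mul (b _ ht2.1) (b _ ht2.2.1) (fw_nonneg _ _) hL) (b _ ht2.2.2) (fw_nonneg _ _) (by positivity)
      _ = _ := by ring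
  have h3 : S'.card ≤ countSolFloor c r 3 := by
    unfold countSolFloor
    set A : Set (Fin 3 → ℕ) := {p | (∀ j, (p j).Prime ∧ (r:ℝ)^(1/c)/8 < (p j:ℝ) ∧ (p j:ℝ) ≤ (r:ℝ)^(1/c)) ∧ (∑ j, ⌊(p j:ℝ)^c⌋) = (r:ℤ)} with hA
    have hfin : A.Finite := by
      apply (Set.finite_Iic (fun _ : Fin 3 => ⌊X⌋₊)).subset
      intro p hp j
      rw [hA, Set.mem_ofPred_eq, hr] at hp
      exact Nat.le_floor (hp.1 j).2.2
    have hcard : (S'.image (fun t => ![t.1, t.2.1, t.2.2])).card = S'.card := by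
      apply Finset.card_image_of_injective
      intro t t' h
      have a0 := congrFun h 0
      have a1 := congrFun h 1
      have a2 := congrFun h 2
      simp at a0 a1 a2
      ext <;> assumption
    rw [← hcard, ← Set.ncard_coe_finset]
    change _ ≤ A.ncard
    apply Set.ncard_le_ncard _ hfin
    intro p hp
    rw [Finset.mem_coe, Finset.mem_image] at hp
    obtain ⟨t, ht, rfl⟩ := hp
    rw [hS', mem_filter, hS, mem_filter] at ht
    obtain ⟨⟨ht2, ht3⟩, ht4⟩ := ht
    unfold TT at ht2
    rw [Finset.mem_product, Finset.mem_product] at ht2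
    rw [hA, Set.mem_ofPred_eq, hr]
    refine ⟨?_, ?_⟩
    · intro j
      fin_cases j
      · exact ⟨ht4.1, hm _ ht2.1⟩
      · exact ⟨ht4.2.1, hm _ ht2.2.1⟩
      · exact ⟨ht4.2.2, hm _ ht2.2.2⟩
    · rw [Fin.sum_univ_three]
      unfold kk vv at ht3
      simp
      linarith
  rw [h1]
  refine h2.trans ?_
  rw [mul_comm]
  apply mul_le_mul_of_nonneg_left _ (by positivity)
  exact_mod_cast h3

set_option maxHeartbeats 1000000 in
lemma triple_near (c X : ℝ) (hc1 : 1 < c) (hc2 : c < 1.153) (hX : 8 ≤ X) (r R : ℕ) (hr : (r:ℝ) = X^c) (hR : 10 ≤ R) (hRX : 10 * (R:ℝ) ≤ r) (hRX2 : 100*(R:ℝ) ≤ X) (n1 n2 : ℕ)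
    (h1 : 0.32*r ≤ (n1:ℝ)^c ∧ (n1:ℝ)^c ≤ 0.34*r) (h2 : 0.32*r ≤ (n2:ℝ)^c ∧ (n2:ℝ)^c ≤ 0.34*r) :
    ∃ y1 y2 : ℕ, X/4 ≤ y1 ∧ (y2:ℝ) ≤ X/2 ∧ X/(200*R) ≤ (y2:ℝ) - y1 ∧ ∀ n3 ∈ Ioc y1 y2, 8*(R:ℝ)*|(kk (vv c) r (n1,n2,n3):ℝ)| ≤ (4*r:ℕ) := by
  have hX0 : 0 < X := by linarith
  have hc0 : 0 < c := by linarith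
  have hr0 : (0:ℝ) < r := by rw [hr]; positivity
  have hRr : (10:ℝ) ≤ R := by exact_mod_cast hR
  have hR0 : (0:ℝ) < R := by linarith
  set z : ℝ := r - (n1:ℝ)^c - (n2:ℝ)^c with hz
  have hz1 : 0.32*r ≤ z := by rw [hz]; linarith [h1.2, h2.2]
  have hz2 : z ≤ 0.36*r := by rw [hz]; linarith [h1.1, h2.1]
  have hz0 : 0 < z := lt_of_lt_of_le (by positivity) hz1
  set q := z^(1/c) with hq
  have hqc : q^c = z := by rw [hq, ← rpow_mul hz0.le, one_div_mul_cancel hc0.ne', rpow_one]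
  have hq0 : 0 < q := by positivity
  have hq1 : X/4 ≤ q := by
    rw [← rpow_le_rpow_iff (by positivity) hq0.le hc0, hqc, div_rpow hX0.le (by norm_num), ← hr]
    refine le_trans ?_ hz1
    rw [div_le_iff₀ (by positivity)]
    have : (4:ℝ)^(1:ℝ) ≤ 4^c := rpow_le_rpow_of_exponent_le (by norm_num) hc1.le
    rw [rpow_one] at this
    nlinarith
  have hq2 : q ≤ 0.49*X := by
    rw [← rpow_le_rpow_iff hq0.le (by positivity) hc0, hqc, mul_rpow (by norm_num) hX0.le, ← hr]
    refine hz2.trans ?_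
    apply mul_le_mul_of_nonneg_right _ hr0.le
    calc (0.36:ℝ) = (0.36^4)^(1/4:ℝ) := by
          rw [← rpow_natCast, ← rpow_mul (by norm_num)]; norm_num
      _ ≤ (0.49^5)^(1/4:ℝ) := rpow_le_rpow (by norm_num) (by norm_num) (by norm_num)
      _ = 0.49^(5/4:ℝ) := by rw [← rpow_natCast, ← rpow_mul (by norm_num)]; norm_num
      _ ≤ 0.49^c := rpow_le_rpow_of_exponent_ge (by norm_num) (by norm_num) (by linarith)
  set l := X/(100*R) with hl
  have hl1 : 1 ≤ l := by rw [hl, le_div_iff₀ (by positivity)]; linarith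
  have hl2 : l ≤ X/1000 := by
    rw [hl]; apply div_le_div_of_nonneg_left hX0.le (by norm_num); linarith
  have f1 := Nat.floor_le (show 0 ≤ l by linarith)
  have f2 := Nat.lt_floor_add_one l
  have f3 := Nat.le_ceil q
  have f4 := Nat.ceil_lt_add_one hq0.le
  have f5 : (1:ℝ) ≤ ⌊l⌋₊ := by exact_mod_cast Nat.floor_pos.mpr hl1
  refine ⟨⌈q⌉₊, ⌈q⌉₊ + ⌊l⌋₊, by linarith, ?_, ?_, ?_⟩
  · push_cast; linarith
  · push_cast
    have : X/(200*R) = l/2 := by rw [hl]; field_simp; norm_num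
    rw [this]; linarith
  · intro n3 hn3
    rw [mem_Ioc] at hn3
    have g1 : (⌈q⌉₊:ℝ) < n3 := by exact_mod_cast hn3.1
    have g2 : (n3:ℝ) ≤ ⌈q⌉₊ + ⌊l⌋₊ := by exact_mod_cast hn3.2
    obtain ⟨ξ, k1, k2, k3⟩ := rpow_mvt c q n3 hq0 (by linarith)
    have hξ : ξ^(c-1) ≤ X^(c-1) := rpow_le_rpow (by linarith) (by linarith) (by linarith)
    have hd0 : 0 ≤ (n3:ℝ)^c - z := by
      rw [← hqc, k3]
      have : 0 ≤ ξ^(c-1) := rpow_nonneg (by linarith) _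
      have : 0 ≤ (n3:ℝ) - q := by linarith
      positivity
    have hd1 : (n3:ℝ)^c - z ≤ r/(25*R) := by
      rw [← hqc, k3]
      have hnq : 0 ≤ (n3:ℝ) - q := by linarith
      calc c*ξ^(c-1)*((n3:ℝ)-q) ≤ 2*X^(c-1)*(2*l) := by
            have hξ0 : 0 ≤ ξ^(c-1) := rpow_nonneg (by linarith) _
            exact mul_le_mul (mul_le_mul (by linarith) hξ hξ0 (by norm_num)) (by linarith) hnq (by positivity)
        _ = _ := by
          have e : X^c = X^(c-1) * X := by
            rw [← rpow_add_one hX0.ne']; congr 1; ring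
          rw [hl, hr, e]; field_simp; norm_num
    have a1 := Int.floor_le ((n1:ℝ)^c)
    have a2 := Int.lt_floor_add_one ((n1:ℝ)^c)
    have b1 := Int.floor_le ((n2:ℝ)^c)
    have b2 := Int.lt_floor_add_one ((n2:ℝ)^c)
    have d1 := Int.floor_le ((n3:ℝ)^c)
    have d2 := Int.lt_floor_add_one ((n3:ℝ)^c)
    have hk : |(kk (vv c) r (n1,n2,n3):ℝ)| ≤ r/(25*R) + 3 := by
      unfold kk vv
      have : 0 ≤ (r:ℝ)/(25*R) := by positivity
      push_cast
      rw [abs_le]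
      constructor <;> linarith
    calc 8*(R:ℝ)*|(kk (vv c) r (n1,n2,n3):ℝ)| ≤ 8*R*(r/(25*R)+3) := by gcongr
      _ = 8/25*r + 24*R := by field_simp; ring
      _ ≤ _ := by push_cast; linarith

lemma ivl_I (c : ℝ) (hc1 : 1 < c) (hc2 : c < 1.153) : ∃ κ, 0 < κ ∧ ∀ᶠ X : ℝ in Filter.atTop, ∃ y1 y2 : ℕ, X/4 ≤ y1 ∧ (y2:ℝ) ≤ X/2 ∧ κ*X ≤ (y2:ℝ) - y1 ∧
    ∀ n ∈ Ioc y1 y2, 0.32*X^c ≤ (n:ℝ)^c ∧ (n:ℝ)^c ≤ 0.34*X^c := by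
  have hc0 : 0 < c := by linarith
  set a : ℝ := 0.32^(1/c) with ha
  set b : ℝ := 0.34^(1/c) with hb
  have hab : a < b := rpow_lt_rpow (by norm_num) (by norm_num) (by positivity)
  have ha0 : 0 < a := by positivity
  have hb0 : 0 < b := by positivity
  have hac : a^c = 0.32 := by rw [ha, ← rpow_mul (by norm_num), one_div_mul_cancel hc0.ne', rpow_one]
  have hbc : b^c = 0.34 := by rw [hb, ← rpow_mul (by norm_num), one_div_mul_cancel hc0.ne', rpow_one]
  have ha1 : 1/4 ≤ a := by
    rw [← rpow_le_rpow_iff (by positivity) ha0.le hc0, hac]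
    calc ((1/4:ℝ))^c ≤ (1/4)^(1:ℝ) := rpow_le_rpow_of_exponent_ge (by norm_num) (by norm_num) hc1.le
      _ ≤ _ := by norm_num
  have hb1 : b ≤ 1/2 := by
    rw [← rpow_le_rpow_iff hb0.le (by positivity) hc0, hbc]
    calc (0.34:ℝ) = (0.34^4)^(1/4:ℝ) := by
          rw [← rpow_natCast, ← rpow_mul (by norm_num)]; norm_num
      _ ≤ ((1/2)^5)^(1/4:ℝ) := rpow_le_rpow (by norm_num) (by norm_num) (by norm_num)
      _ = (1/2)^(5/4:ℝ) := by rw [← rpow_natCast, ← rpow_mul (by norm_num)]; norm_num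
      _ ≤ (1/2)^c := rpow_le_rpow_of_exponent_ge (by norm_num) (by norm_num) (by linarith)
  refine ⟨(b-a)/2, by linarith, ?_⟩
  have hev : ∀ᶠ X : ℝ in Filter.atTop, 2 ≤ (b-a)/2*X := (Filter.Tendsto.const_mul_atTop (by linarith) Filter.tendsto_id).eventually_ge_atTop 2
  filter_upwards [hev, Filter.eventually_ge_atTop 4] with X h2 hX4
  have hX0 : 0 < X := by linarith
  have f1 := Nat.floor_le (show 0 ≤ b*X by positivity)
  have f2 := Nat.lt_floor_add_one (b*X)
  have f3 := Nat.le_ceil (a*X)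
  have f4 := Nat.ceil_lt_add_one (show 0 ≤ a*X by positivity)
  refine ⟨⌈a*X⌉₊, ⌊b*X⌋₊, by nlinarith, by nlinarith, by nlinarith, ?_⟩
  intro n hn
  rw [mem_Ioc] at hn
  have g1 : (⌈a*X⌉₊:ℝ) < n := by exact_mod_cast hn.1
  have g2 : (n:ℝ) ≤ ⌊b*X⌋₊ := by exact_mod_cast hn.2
  rw [← hac, ← hbc, ← mul_rpow ha0.le hX0.le, ← mul_rpow hb0.le hX0.le]
  exact ⟨rpow_le_rpow (by positivity) (by linarith) hc0.le, rpow_le_rpow (by positivity) (by linarith) hc0.le⟩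

lemma triple_sum_ge (J I : Finset ℕ) (hI : I ⊆ J) (f : ℕ → ℝ) (hf : ∀ n, 0 ≤ f n) (p : ℕ × ℕ × ℕ → Prop) [DecidablePred p] (K : ℕ → ℕ → Finset ℕ) (m s : ℝ) (hs : 0 ≤ s) (hm : 0 ≤ m)
    (hKJ : ∀ n1 ∈ I, ∀ n2 ∈ I, K n1 n2 ⊆ J) (hKp : ∀ n1 ∈ I, ∀ n2 ∈ I, ∀ n3 ∈ K n1 n2, p (n1,n2,n3)) (hKm : ∀ n1 ∈ I, ∀ n2 ∈ I, m ≤ ∑ n ∈ K n1 n2, f n)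
    (hIs : s ≤ ∑ n ∈ I, f n) : s^2*m ≤ ∑ t ∈ (TT J).filter p, fff f t := by
  rw [Finset.sum_filter]
  unfold TT
  rw [Finset.sum_product]
  have hnn : ∀ t, 0 ≤ if p t then fff f t else 0 := by
    intro t; split_ifs
    · unfold fff; have := hf t.1; have := hf t.2.1; have := hf t.2.2; positivity
    · exact le_rfl
  have hI0 : 0 ≤ ∑ n ∈ I, f n := hs.trans hIs
  calc s^2*m ≤ (∑ n ∈ I, f n)^2*m := by gcongr
    _ = ∑ n1 ∈ I, ∑ n2 ∈ I, f n1 * f n2 * m := by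
        rw [sq, Finset.sum_mul_sum, Finset.sum_mul]
        apply Finset.sum_congr rfl; intro n1 _
        rw [Finset.sum_mul]
    _ ≤ ∑ n1 ∈ I, ∑ t ∈ J ×ˢ J, (if p (n1, t) then fff f (n1, t) else 0) := by
        apply Finset.sum_le_sum; intro n1 h1
        rw [Finset.sum_product]
        calc _ ≤ ∑ n2 ∈ I, ∑ n3 ∈ J, (if p (n1, n2, n3) then fff f (n1, n2, n3) else 0) := by
              apply Finset.sum_le_sum; intro n2 h2
              calc f n1 * f n2 * m ≤ f n1 * f n2 * ∑ n ∈ K n1 n2, f n :=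
                    mul_le_mul_of_nonneg_left (hKm n1 h1 n2 h2) (mul_nonneg (hf _) (hf _))
                _ = ∑ n3 ∈ K n1 n2, (if p (n1, n2, n3) then fff f (n1, n2, n3) else 0) := by
                    rw [Finset.mul_sum]
                    apply Finset.sum_congr rfl; intro n3 h3
                    rw [if_pos (hKp n1 h1 n2 h2 n3 h3)]; rfl
                _ ≤ _ := Finset.sum_le_sum_of_subset_of_nonneg (hKJ n1 h1 n2 h2) (fun _ _ _ => hnn _)
          _ ≤ _ := Finset.sum_le_sum_of_subset_of_nonneg hI (fun _ _ _ => Finset.sum_nonneg (fun _ _ => hnn _))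
    _ ≤ _ := Finset.sum_le_sum_of_subset_of_nonneg hI (fun _ _ _ => Finset.sum_nonneg (fun _ _ => hnn _))

set_option maxHeartbeats 1000000 in
lemma baker_X (hP : PNTShort) (c : ℝ) (hc1 : 1 < c) (hc2 : c < 1.153) : ∃ c₀, 0 < c₀ ∧ ∀ᶠ X : ℝ in Filter.atTop, ∀ r : ℕ, (r:ℝ)^(1/c) = X →
    c₀ * X^(3-c) / (log X)^3 ≤ (countSolFloor c r 3 : ℝ) := by
  obtain ⟨c1, hc1p, hw⟩ := short_w hP c hc1 hc2
  obtain ⟨κ, hκ, hI⟩ := ivl_I c hc1 hc2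
  obtain ⟨C, hC, hE⟩ := err_total c hc1 hc2
  set c2 := (c1*κ)^2*c1/800 with hc2d
  have hc2p : 0 < c2 := by positivity
  refine ⟨c2/8, by positivity, ?_⟩
  have e2 : ∀ᶠ X in Filter.atTop, max 402 (2*C/c2) ≤ log X := Real.tendsto_log_atTop.eventually_ge_atTop _
  have e3 : ∀ᶠ X in Filter.atTop, 1/κ ≤ log X := Real.tendsto_log_atTop.eventually_ge_atTop _
  filter_upwards [hw, hI, hE, e2, e3, ev_log 200 76 1 (by norm_num), Filter.eventually_ge_atTop 8] with X hw hI hE hL hLκ hl1 hX8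
  intro r hrX
  rw [rpow_one] at hl1
  set L := log X with hLd
  have hX0 : 0 < X := by linarith
  have hL402 : 402 ≤ L := (le_max_left _ _).trans hL
  have hLC : 2*C/c2 ≤ L := (le_max_right _ _).trans hL
  have hL0 : 0 < L := by linarith
  have hc0 : 0 < c := by linarith
  have hr : (r:ℝ) = X^c := by
    rw [← hrX, ← rpow_mul (by positivity), one_div_mul_cancel hc0.ne', rpow_one]
  have hr0 : (0:ℝ) < r := by rw [hr]; positivity
  have hr0' : 0 < r := by exact_mod_cast hr0
  have hXr : X ≤ r := by
    rw [hr]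
    calc X = X^(1:ℝ) := (rpow_one X).symm
      _ ≤ _ := rpow_le_rpow_of_exponent_le (by linarith) hc1.le
  set R := ⌈L^76⌉₊ with hR
  have hRL : L^76 ≤ R := Nat.le_ceil _
  have hL76 : 10 ≤ L^76 := by
    calc (10:ℝ) ≤ L^1 := by linarith
      _ ≤ L^76 := pow_le_pow_right₀ (by linarith) (by norm_num)
  have hR10 : 10 ≤ R := by exact_mod_cast hL76.trans hRL
  have hRu : (R:ℝ) ≤ 2*L^76 := by
    have : (R:ℝ) < L^76 + 1 := Nat.ceil_lt_add_one (by positivity)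
    linarith
  have hR0 : (0:ℝ) < R := by linarith
  have hRX2 : 100*(R:ℝ) ≤ X := by linarith
  obtain ⟨i1, i2, hi1, hi2, hi3, hi4⟩ := hI
  set x1 := ⌈X/4⌉₊ with hx1
  set x2 := ⌊X/2⌋₊ with hx2
  have hx1' : X/4 ≤ x1 := Nat.le_ceil _
  have hx2' : (x2:ℝ) ≤ X/2 := Nat.floor_le (by positivity)
  have hx12 : x1 ≤ x2 := by
    apply Nat.ceil_le.mpr
    have := Nat.lt_floor_add_one (X/2)
    linarith
  set J := Ioc x1 x2 with hJ
  have hsub : ∀ y1 y2 : ℕ, X/4 ≤ y1 → (y2:ℝ) ≤ X/2 → Ioc y1 y2 ⊆ J := by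
    intro y1 y2 h1 h2
    apply Finset.Ioc_subset_Ioc
    · exact Nat.ceil_le.mpr h1
    · exact Nat.le_floor h2
  have hvr : ∀ n ∈ J, 0 ≤ vv c n ∧ vv c n ≤ r := by
    intro n hn
    rw [hJ, mem_Ioc] at hn
    have : (n:ℝ) ≤ x2 := by exact_mod_cast hn.2
    exact vv_range c X hc1 r hr n (by linarith)
  have hcm := circle_main J (fw c) (fw_nonneg c) (vv c) r R hr0' (by omega) (by
    have : (R:ℝ) ≤ 2*r := by linarith
    exact_mod_cast this) hvr
  have hEE := hE r x1 x2 R hr hx1' hx12 hx2' rfl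
  have hct := count_ge c hc1 X hX8 r x1 x2 hrX hx1' hx2'
  have hIw : c1*(κ*X) ≤ ∑ n ∈ Ioc i1 i2, fw c n := by
    refine le_trans ?_ (hw i1 i2 hi1 hi2 ?_)
    · gcongr
    · refine le_trans ?_ hi3
      rw [div_le_iff₀ (by positivity)]
      have : 1 ≤ κ*L := by rw [div_le_iff₀ hκ] at hLκ; linarith
      have h76 : L ≤ L^77 := by
        calc L = L^1 := (pow_one L).symm
          _ ≤ _ := pow_le_pow_right₀ (by linarith) (by norm_num)
      nlinarith [mul_le_mul_of_nonneg_left h76 hκ.le]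
  have hT : ∀ n1 n2 : ℕ, ∃ y : ℕ × ℕ, n1 ∈ Ioc i1 i2 → n2 ∈ Ioc i1 i2 → X/4 ≤ y.1 ∧ (y.2:ℝ) ≤ X/2 ∧ X/(200*R) ≤ (y.2:ℝ) - y.1 ∧ ∀ n3 ∈ Ioc y.1 y.2, 8*(R:ℝ)*|(kk (vv c) r (n1,n2,n3):ℝ)| ≤ (4*r:ℕ) := by
    intro n1 n2
    by_cases h : n1 ∈ Ioc i1 i2 ∧ n2 ∈ Ioc i1 i2
    · have h1 := hi4 n1 h.1
      have h2 := hi4 n2 h.2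
      rw [← hr] at h1 h2
      obtain ⟨y1, y2, hy⟩ := triple_near c X hc1 hc2 hX8 r R hr hR10 (by linarith) hRX2 n1 n2 h1 h2
      exact ⟨(y1,y2), fun _ _ => hy⟩
    · exact ⟨(0,0), fun h1 h2 => absurd ⟨h1,h2⟩ h⟩
  choose y hy using hT
  have hts := triple_sum_ge J (Ioc i1 i2) (hsub i1 i2 hi1 hi2) (fw c) (fw_nonneg c) (fun t => 8*(R:ℝ)*|(kk (vv c) r t:ℝ)| ≤ (4*r:ℕ))
    (fun n1 n2 => Ioc (y n1 n2).1 (y n1 n2).2) (c1*(X/(200*R))) (c1*(κ*X)) (by positivity) (by positivity)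
    (fun n1 h1 n2 h2 => hsub _ _ (hy n1 n2 h1 h2).1 (hy n1 n2 h1 h2).2.1)
    (fun n1 h1 n2 h2 => (hy n1 n2 h1 h2).2.2.2)
    (fun n1 h1 n2 h2 => by
      obtain ⟨a1, a2, a3, _⟩ := hy n1 n2 h1 h2
      refine le_trans ?_ (hw _ _ a1 a2 ?_)
      · gcongr
      · refine le_trans ?_ a3
        apply div_le_div_of_nonneg_left hX0.le (by positivity)
        calc 200*(R:ℝ) ≤ 400*L^76 := by linarith
          _ ≤ L*L^76 := by gcongr; linarith
          _ = L^77 := by ring)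
    hIw
  have hmain : c2*X^3 ≤ (R:ℝ)/4 * ∑ t ∈ (TT J).filter (fun t => 8*(R:ℝ)*|(kk (vv c) r t:ℝ)| ≤ (4*r:ℕ)), fff (fw c) t := by
    calc c2*X^3 = (R:ℝ)/4 * ((c1*(κ*X))^2*(c1*(X/(200*R)))) := by rw [hc2d]; field_simp; norm_num
      _ ≤ _ := by gcongr
  have hCL : C*(X^3/L) ≤ c2/2*X^3 := by
    rw [← mul_div_assoc, div_le_iff₀ hL0]
    rw [div_le_iff₀ hc2p] at hLC
    have : 0 < X^3 := by positivity
    nlinarith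
  have hfin : c2/2*X^3 ≤ (4*X^c)*(L^3*(countSolFloor c r 3:ℝ)) := by
    have e : ((4*r:ℕ):ℝ) = 4*X^c := by push_cast; rw [hr]
    rw [e] at hcm
    have : (4*X^c) * ∑ t ∈ (TT J).filter (fun t => kk (vv c) r t = 0), fff (fw c) t ≤ (4*X^c)*(L^3*(countSolFloor c r 3:ℝ)) := by gcongr
    rw [e] at hmain hEE
    linarith
  rw [div_le_iff₀ (by positivity)]
  have e : X^(3-c) = X^3/X^c := by
    rw [rpow_sub hX0]; norm_cast
  rw [e, ← mul_div_assoc, div_le_iff₀ (by positivity)]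
  linarith

theorem baker_of_PNT (hP : PNTShort) (c : ℝ) (hc1 : 1 < c) (hc2 : c < 3581/3106) :
    ∃ c₀ > 0, ∃ r₀ : ℕ, ∀ r : ℕ, r₀ ≤ r → c₀ * (r:ℝ)^(3/c - 1) / (log r)^3 ≤ (countSolFloor c r 3 : ℝ) := by
  obtain ⟨c₀, hc0, h⟩ := baker_X hP c hc1 (by norm_num at hc2 ⊢; linarith)
  have hcp : 0 < c := by linarith
  have ht : Filter.Tendsto (fun r : ℕ => (r:ℝ)^(1/c)) Filter.atTop Filter.atTop :=
    (tendsto_rpow_atTop (by positivity)).comp tendsto_natCast_atTop_atTop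
  have h2 := ht.eventually h
  rw [Filter.eventually_atTop] at h2
  obtain ⟨r₀, h2⟩ := h2
  refine ⟨c₀, hc0, max r₀ 3, ?_⟩
  intro r hr
  have h3 := h2 r (le_trans (le_max_left _ _) hr) r rfl
  have hr3 : 3 ≤ r := le_trans (le_max_right _ _) hr
  have hr0 : (0:ℝ) < r := by exact_mod_cast (by omega : 0 < r)
  have hlog : 0 < log r := log_pos (by exact_mod_cast (by omega : 1 < r))
  refine le_trans ?_ h3
  have e1 : ((r:ℝ)^(1/c))^(3-c) = (r:ℝ)^(3/c - 1) := by
    rw [← rpow_mul hr0.le]; congr 1; field_simp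
  rw [e1, log_rpow hr0]
  apply div_le_div_of_nonneg_left (by positivity) (by positivity)
  apply pow_le_pow_left₀ (by positivity)
  have : 1/c ≤ 1 := by rw [div_le_one hcp]; exact hc1.le
  nlinarith

noncomputable def bb (n : ℕ) (s : ℂ) : ℂ := (s-1) * ((n+1:ℝ):ℂ)^(-s) + ((n+2:ℝ):ℂ)^(1-s) - ((n+1:ℝ):ℂ)^(1-s)

noncomputable def Zf (s : ℂ) : ℂ := 1 + ∑' n, bb n s

lemma deriv_cpow_real (w : ℂ) (x : ℝ) (hx : 0 < x) : HasDerivAt (fun y:ℝ => (y:ℂ)^w) (w * (x:ℂ)^(w-1)) x := by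
  have h := ((hasDerivAt_id' (x:ℂ)).cpow_const (c := w) (Or.inl (by simpa using hx))).comp_ofReal
  simpa using h

lemma cpow_diff (s : ℂ) (hs : 0 < s.re) (a x : ℝ) (ha : 0 < a) (hx : x ∈ Set.Icc a (a+1)) :
    ‖(x:ℂ)^(-s) - (a:ℂ)^(-s)‖ ≤ ‖s‖ * a^(-s.re-1) := by
  have h := norm_image_sub_le_of_norm_deriv_le_segment' (f := fun y:ℝ => (y:ℂ)^(-s)) (f' := fun y:ℝ => -s * (y:ℂ)^(-s-1)) (a := a) (b := a+1) (C := ‖s‖ * a^(-s.re-1))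
    (fun y hy => (deriv_cpow_real (-s) y (by linarith [hy.1])).hasDerivWithinAt)
    (fun y hy => by
      have hy0 : 0 < y := by linarith [hy.1]
      rw [norm_mul, norm_neg, Complex.norm_cpow_eq_rpow_re_of_pos hy0]
      apply mul_le_mul_of_nonneg_left _ (norm_nonneg _)
      simp only [Complex.sub_re, Complex.neg_re, Complex.one_re]
      exact rpow_le_rpow_of_nonpos ha hy.1 (by linarith)) x hx
  refine h.trans ?_
  have : 0 ≤ ‖s‖ * a^(-s.re-1) := by positivity
  nlinarith [hx.2]

lemma bb_bound (n : ℕ) (s : ℂ) (hs : 0 < s.re) : ‖bb n s‖ ≤ ‖s‖ * ‖s-1‖ * (n+1:ℝ)^(-s.re-1) := by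
  set a : ℝ := n+1 with ha
  have ha0 : 0 < a := by positivity
  have h := norm_image_sub_le_of_norm_deriv_le_segment' (f := fun y:ℝ => (y:ℂ)^(1-s) + (s-1)*(a:ℂ)^(-s)*(y:ℂ)) (f' := fun y:ℝ => (1-s) * (y:ℂ)^(-s) + (s-1)*(a:ℂ)^(-s)) (a := a) (b := a+1) (C := ‖s‖ * ‖s-1‖ * a^(-s.re-1))
    (fun y hy => by
      have h1 := deriv_cpow_real (1-s) y (by linarith [hy.1])
      have h2 : HasDerivAt (fun y:ℝ => (s-1)*(a:ℂ)^(-s)*(y:ℂ)) ((s-1)*(a:ℂ)^(-s)) y := by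
        simpa using (Complex.ofRealCLM.hasDerivAt (x := y)).const_mul ((s-1)*(a:ℂ)^(-s))
      have e : (1-s-1:ℂ) = -s := by ring
      rw [e] at h1
      exact (h1.add h2).hasDerivWithinAt)
    (fun y hy => by
      have e : (1-s) * (y:ℂ)^(-s) + (s-1)*(a:ℂ)^(-s) = -((s-1) * ((y:ℂ)^(-s) - (a:ℂ)^(-s))) := by ring
      rw [e, norm_neg, norm_mul, mul_comm ‖s‖, mul_assoc]
      exact mul_le_mul_of_nonneg_left (cpow_diff s hs a y ha0 ⟨hy.1, hy.2.le⟩) (norm_nonneg _)) (a+1) ⟨by linarith, le_rfl⟩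
  have e : bb n s = (((a+1:ℝ):ℂ)^(1-s) + (s-1)*(a:ℂ)^(-s)*((a+1:ℝ):ℂ)) - ((a:ℂ)^(1-s) + (s-1)*(a:ℂ)^(-s)*(a:ℂ)) := by
    unfold bb
    rw [ha]
    have : ((n:ℝ)+2) = n+1+1 := by ring
    rw [this]; push_cast; ring
  rw [e]
  refine h.trans (le_of_eq ?_)
  ring

lemma summable_pow1 (p : ℝ) (hp : 0 < p) : Summable (fun n:ℕ => (n+1:ℝ)^(-p-1)) := by
  have := (summable_nat_add_iff 1).mpr (Real.summable_nat_rpow.mpr (show -p-1 < -1 by linarith))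
  simpa using this

lemma bb_summable (s : ℂ) (hs : 0 < s.re) : Summable (fun n => bb n s) :=
  Summable.of_norm_bounded ((summable_pow1 s.re hs).mul_left (‖s‖*‖s-1‖)) (fun n => bb_bound n s hs)

lemma bb_diff (n : ℕ) : Differentiable ℂ (bb n) := by
  unfold bb
  have h1 : ((n+1:ℝ):ℂ) ≠ 0 := by norm_cast
  have h2 : ((n+2:ℝ):ℂ) ≠ 0 := by norm_cast
  intro s
  refine DifferentiableAt.sub (DifferentiableAt.add (DifferentiableAt.mul (by fun_prop) ?_) ?_) ?_
  · exact DifferentiableAt.const_cpow (by fun_prop) (Or.inl h1)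
  · exact DifferentiableAt.const_cpow (by fun_prop) (Or.inl h2)
  · exact DifferentiableAt.const_cpow (by fun_prop) (Or.inl h1)

lemma Zf_diff (s : ℂ) (hs : 0 < s.re) : DifferentiableAt ℂ Zf s := by
  set ε := s.re/2 with hε
  set U : Set ℂ := {z | ε < z.re} ∩ Metric.ball 0 (‖s‖+1) with hU
  have hUo : IsOpen U := (isOpen_lt continuous_const Complex.continuous_re).inter Metric.isOpen_ball
  have hsU : s ∈ U := ⟨by change ε < s.re; linarith, by simp⟩
  have hd : DifferentiableOn ℂ (fun z => ∑' n, bb n z) U := by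
    refine Complex.differentiableOn_tsum_of_summable_norm (u := fun n:ℕ => (‖s‖+1)*(‖s‖+2)*(n+1:ℝ)^(-ε-1)) ((summable_pow1 ε (by linarith)).mul_left _) (fun n => (bb_diff n).differentiableOn) hUo ?_
    intro n z hz
    have h1 : ε < z.re := hz.1
    have h2 : ‖z‖ < ‖s‖+1 := by simpa using hz.2
    refine (bb_bound n z (by linarith)).trans ?_
    have h3 : ‖z-1‖ ≤ ‖s‖+2 := (norm_sub_le _ _).trans (by rw [norm_one]; linarith)
    have h4 : (n+1:ℝ)^(-z.re-1) ≤ (n+1:ℝ)^(-ε-1) := rpow_le_rpow_of_exponent_le (by linarith [show (0:ℝ) ≤ n by positivity]) (by linarith)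
    gcongr
  exact ((hd.differentiableAt (hUo.mem_nhds hsU)).const_add 1)

lemma bb_range (N : ℕ) (s : ℂ) : ∑ n ∈ range N, bb n s = (s-1) * ∑ n ∈ range N, ((n+1:ℝ):ℂ)^(-s) + ((N+1:ℝ):ℂ)^(1-s) - 1 := by
  induction N with
  | zero => simp
  | succ N ih =>
    rw [Finset.sum_range_succ, Finset.sum_range_succ, ih]
    unfold bb
    have : ((N+1:ℕ):ℝ)+1 = N+2 := by push_cast; ring
    rw [this]; ring

lemma Zf_one : Zf 1 = 1 := by
  unfold Zf bb
  simp

lemma Zf_eq (s : ℂ) (hs : 1 < s.re) : Zf s = (s-1) * riemannZeta s := by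
  have h1 := (bb_summable s (by linarith)).hasSum.tendsto_sum_nat
  have hz : Summable (fun n:ℕ => ((n+1:ℝ):ℂ)^(-s)) := by
    have := (summable_nat_add_iff 1).mpr (Complex.summable_one_div_nat_cpow.mpr hs)
    refine this.congr (fun n => ?_)
    rw [Complex.cpow_neg, one_div]; push_cast; rfl
  have hzv : ∑' n:ℕ, ((n+1:ℝ):ℂ)^(-s) = riemannZeta s := by
    rw [zeta_eq_tsum_one_div_nat_add_one_cpow hs]
    apply tsum_congr; intro n
    rw [Complex.cpow_neg, one_div]; push_cast; rfl
  have h2 := hz.hasSum.tendsto_sum_nat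
  rw [hzv] at h2
  have h3 : Filter.Tendsto (fun N:ℕ => ((N+1:ℝ):ℂ)^(1-s)) Filter.atTop (nhds 0) := by
    rw [tendsto_zero_iff_norm_tendsto_zero]
    have : ∀ N:ℕ, ‖((N+1:ℝ):ℂ)^(1-s)‖ = (N+1:ℝ)^(-(s.re-1)) := by
      intro N
      rw [Complex.norm_cpow_eq_rpow_re_of_pos (by positivity)]
      congr 1; simp
    simp_rw [this]
    exact (tendsto_rpow_neg_atTop (by linarith)).comp (Filter.tendsto_atTop_add_const_right _ 1 tendsto_natCast_atTop_atTop)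
  simp_rw [bb_range] at h1
  have h4 := ((h2.const_mul (s-1)).add h3).sub_const 1
  have h5 := tendsto_nhds_unique h1 h4
  unfold Zf
  rw [h5]; ring

lemma sum_pow_le (η : ℝ) (hη : 0 < η) (hη1 : η ≤ 1/2) (N : ℕ) : ∑ n ∈ range N, (n+1:ℝ)^(η-1) ≤ (N:ℝ)^η/η := by
  induction N with
  | zero => simp [Real.zero_rpow hη.ne']
  | succ N ih =>
    rw [Finset.sum_range_succ]
    have : (N+1:ℝ)^(η-1) ≤ ((N+1:ℝ)^η - (N:ℝ)^η)/η := by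
      rw [le_div_iff₀ hη]
      rcases Nat.eq_zero_or_pos N with h | h
      · subst h; simp [Real.zero_rpow hη.ne']; linarith
      · obtain ⟨ξ, h1, h2, h3⟩ := rpow_mvt η N (N+1) (by exact_mod_cast h) (by linarith)
        rw [h3]
        have hN : (0:ℝ) < N := by exact_mod_cast h
        have := rpow_le_rpow_of_nonpos (by linarith) h2.le (show η-1 ≤ 0 by linarith)
        nlinarith
    rw [sub_div] at this
    push_cast
    linarith

lemma tail_pow_le (η : ℝ) (hη : 0 < η) (hη1 : η ≤ 1/2) (N : ℕ) (hN : 0 < N) : ∑' n:ℕ, ((n+N:ℕ)+1:ℝ)^(η-2) ≤ 2*(N:ℝ)^(η-1) := by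
  have hN0 : (0:ℝ) < N := by exact_mod_cast hN
  apply Real.tsum_le_of_sum_range_le (fun n => by positivity)
  intro M
  have h : ∑ n ∈ range M, ((n+N:ℕ)+1:ℝ)^(η-2) ≤ 2*((N:ℝ)^(η-1) - ((M+N:ℕ):ℝ)^(η-1)) := by
    induction M with
    | zero => simp
    | succ M ih =>
      rw [Finset.sum_range_succ]
      have hMN : (0:ℝ) < (M+N:ℕ) := by exact_mod_cast (by omega)
      obtain ⟨ξ, h1, h2, h3⟩ := rpow_mvt (η-1) (M+N:ℕ) ((M+N:ℕ)+1) hMN (by linarith)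
      have := rpow_le_rpow_of_nonpos (by linarith) h2.le (show η-1-1 ≤ 0 by linarith)
      have e : η-1-1 = η-2 := by ring
      rw [e] at this h3
      have e2 : ((M+1+N:ℕ):ℝ) = (M+N:ℕ)+1 := by push_cast; ring
      rw [e2]
      have h0 : 0 ≤ ((M+N:ℕ)+1:ℝ)^(η-2) := by positivity
      nlinarith
  have : 0 ≤ ((M+N:ℕ):ℝ)^(η-1) := by positivity
  linarith

lemma Zf_bound (η : ℝ) (hη : 0 < η) (hη1 : η ≤ 1/2) : ∃ C, 1 ≤ C ∧ ∀ s : ℂ, 1-η ≤ s.re → s.re ≤ 3 → ‖Zf s‖ ≤ C * (2+|s.im|)^(1+η) := by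
  refine ⟨4/η+3+16, by have : 0 < 4/η := by positivity
                       linarith, ?_⟩
  intro s hs1 hs2
  set T := 2+|s.im| with hT
  have hT2 : 2 ≤ T := by rw [hT]; linarith [abs_nonneg s.im]
  have hsn : ‖s‖ ≤ 2*T := by
    have := Complex.norm_le_abs_re_add_abs_im s
    rw [abs_of_nonneg (by linarith : 0 ≤ s.re)] at this
    linarith [abs_nonneg s.im]
  have hsn1 : ‖s-1‖ ≤ T := by
    have h := Complex.norm_le_abs_re_add_abs_im (s-1)
    have : |(s-1).re| ≤ 2 := by rw [abs_le]; simp; constructor <;> linarith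
    simp only [Complex.sub_im, Complex.one_im, sub_zero] at h
    linarith
  set N := ⌈T⌉₊ with hN
  have hN1 : T ≤ N := Nat.le_ceil T
  have hN2 : (N:ℝ) + 1 ≤ 2*T := by
    have := Nat.ceil_lt_add_one (show 0 ≤ T by linarith)
    have h3 : (N:ℝ) < T + 1 := this
    have h4 : (2:ℝ) ≤ T := hT2
    linarith
  have hN0 : 0 < N := by exact_mod_cast (by linarith : (0:ℝ) < N)
  have hσ : 0 < s.re := by linarith
  have hsum := bb_summable s hσ
  have e : Zf s = (s-1) * ∑ n ∈ range N, ((n+1:ℝ):ℂ)^(-s) + ((N+1:ℝ):ℂ)^(1-s) + ∑' n, bb (n+N) s := by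
    unfold Zf
    rw [← hsum.sum_add_tsum_nat_add N, bb_range]; ring
  have t1 : ‖∑ n ∈ range N, ((n+1:ℝ):ℂ)^(-s)‖ ≤ (2*T)^η/η := by
    calc _ ≤ ∑ n ∈ range N, (n+1:ℝ)^(η-1) := by
          apply norm_sum_le_of_le
          intro n _
          rw [Complex.norm_cpow_eq_rpow_re_of_pos (by positivity)]
          exact rpow_le_rpow_of_exponent_le (by linarith [show (0:ℝ) ≤ n by positivity]) (by simp; linarith)
      _ ≤ _ := sum_pow_le η hη hη1 N
      _ ≤ _ := by gcongr; linarith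
  have t2 : ‖((N+1:ℝ):ℂ)^(1-s)‖ ≤ (2*T)^η := by
    rw [Complex.norm_cpow_eq_rpow_re_of_pos (by positivity)]
    calc _ ≤ (N+1:ℝ)^η := rpow_le_rpow_of_exponent_le (by linarith [show (0:ℝ) ≤ N by positivity]) (by simp; linarith)
      _ ≤ _ := by gcongr
  have t3 : ‖∑' n, bb (n+N) s‖ ≤ 2*T*T*(2*T^(η-1)) := by
    have hle : ∀ n, ‖bb (n+N) s‖ ≤ 2*T*T*((n+N:ℕ)+1:ℝ)^(η-2) := by
      intro n
      refine (bb_bound (n+N) s hσ).trans ?_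
      have : (((n+N:ℕ):ℝ)+1)^(-s.re-1) ≤ ((n+N:ℕ)+1:ℝ)^(η-2) := rpow_le_rpow_of_exponent_le (by linarith [show (0:ℝ) ≤ (n+N:ℕ) by positivity]) (by linarith)
      gcongr
    have hsm : Summable (fun n:ℕ => ((n+N:ℕ)+1:ℝ)^(η-2)) := by
      have := (summable_nat_add_iff N).mpr (summable_pow1 (1-η) (by linarith))
      refine this.congr (fun n => ?_)
      congr 1; ring
    refine (tsum_of_norm_bounded (hsm.mul_left (2*T*T)).hasSum hle).trans ?_
    rw [tsum_mul_left]
    apply mul_le_mul_of_nonneg_left _ (by positivity)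
    refine (tail_pow_le η hη hη1 N hN0).trans ?_
    have := rpow_le_rpow_of_nonpos (by linarith) hN1 (show η-1 ≤ 0 by linarith)
    linarith
  have e1 : T^(1+η) = T * T^η := by rw [rpow_add (by linarith), rpow_one]
  have e2 : T*T^(η-1) = T^η := by
    have := rpow_add (show 0 < T by linarith) 1 (η-1)
    rw [rpow_one] at this; rw [← this]; congr 1; ring
  have e3 : (2*T)^η ≤ 2*T^η := by
    rw [mul_rpow (by norm_num) (by linarith)]
    gcongr
    calc (2:ℝ)^η ≤ 2^(1:ℝ) := rpow_le_rpow_of_exponent_le (by norm_num) (by linarith)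
      _ = 2 := by norm_num
  have hTη : 0 < T^η := by positivity
  rw [e, e1]
  calc _ ≤ ‖s-1‖*‖∑ n ∈ range N, ((n+1:ℝ):ℂ)^(-s)‖ + ‖((N+1:ℝ):ℂ)^(1-s)‖ + ‖∑' n, bb (n+N) s‖ := by
        refine (norm_add_le _ _).trans ?_
        gcongr
        refine (norm_add_le _ _).trans ?_
        rw [norm_mul]
    _ ≤ T*((2*T^η)/η) + 2*T^η + 2*T*T*(2*T^(η-1)) := by
        gcongr
        · exact t1.trans (by gcongr)
        · exact t2.trans e3
    _ = T*T^η*(2/η) + 2*T^η + 4*T*(T*T^(η-1)) := by ring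
    _ ≤ _ := by
        rw [e2]
        have : 0 < 2/η := by positivity
        have e4 : 4/η = 2*(2/η) := by ring
        rw [e4]
        have a1 : T^η ≤ T*T^η := by nlinarith
        have a2 : 0 ≤ T*T^η*(2/η) := by positivity
        nlinarith

lemma Zf_deriv_bound (η : ℝ) (hη : 0 < η) (hη1 : η ≤ 1/2) : ∃ C, 1 ≤ C ∧ ∀ s : ℂ, 1-η/2 ≤ s.re → s.re ≤ 2 → ‖deriv Zf s‖ ≤ C * (2+|s.im|)^(1+η) := by
  obtain ⟨C, hC, h⟩ := Zf_bound η hη hη1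
  refine ⟨max 1 (4*C/(η/2)), le_max_left _ _, ?_⟩
  intro s h1 h2
  have hR : 0 < η/2 := by linarith
  have hpt : ∀ w ∈ Metric.closedBall s (η/2), 1-η ≤ w.re ∧ w.re ≤ 3 ∧ |w.im| ≤ |s.im| + 1 := by
    intro w hw
    rw [Metric.mem_closedBall, dist_eq_norm] at hw
    have a1 := (Complex.abs_re_le_norm (w-s)).trans hw
    have a2 := (Complex.abs_im_le_norm (w-s)).trans hw
    rw [Complex.sub_re, abs_le] at a1
    rw [Complex.sub_im] at a2
    have := abs_sub_abs_le_abs_sub w.im s.im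
    refine ⟨by linarith, by linarith, by linarith⟩
  have hd : DiffContOnCl ℂ Zf (Metric.ball s (η/2)) := by
    apply DifferentiableOn.diffContOnCl
    rw [closure_ball _ hR.ne']
    intro w hw
    exact (Zf_diff w (by linarith [(hpt w hw).1])).differentiableWithinAt
  have hT : (0:ℝ) < 2+|s.im| := by linarith [abs_nonneg s.im]
  have := Complex.norm_deriv_le_of_forall_mem_sphere_norm_le (C := C*(4*(2+|s.im|)^(1+η))) hR hd (by
    intro w hw
    obtain ⟨b1, b2, b3⟩ := hpt w (Metric.sphere_subset_closedBall hw)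
    refine (h w b1 b2).trans ?_
    have : (2+|w.im|)^(1+η) ≤ (2*(2+|s.im|))^(1+η) := by
      apply rpow_le_rpow (by linarith [abs_nonneg w.im]) (by linarith [abs_nonneg s.im]) (by linarith)
    rw [mul_rpow (by norm_num) hT.le] at this
    have h4 : (2:ℝ)^(1+η) ≤ 2^(2:ℝ) := rpow_le_rpow_of_exponent_le (by norm_num) (by linarith)
    norm_num at h4
    gcongr
    refine this.trans ?_
    gcongr)
  refine this.trans ?_
  calc _ = (4*C/(η/2)) * (2+|s.im|)^(1+η) := by ring
    _ ≤ _ := by gcongr; exact le_max_right _ _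

lemma zeta_341 (x t : ℝ) (hx : 0 < x) : 1 ≤ ‖riemannZeta (1+x)‖^3 * ‖riemannZeta (1+x+Complex.I*t)‖^4 * ‖riemannZeta (1+x+2*Complex.I*t)‖ := by
  have := DirichletCharacter.norm_LFunction_product_ge_one (N := 1) 1 hx t
  simpa [DirichletCharacter.LFunctionTrivChar, DirichletCharacter.LFunction_modOne_eq] using this

lemma Zf_341 (η : ℝ) (hη : 0 < η) (hη1 : η ≤ 1/2) : ∃ c, 0 < c ∧ ∀ x t : ℝ, 0 < x → x ≤ 1 → 1 ≤ |t| → c*x^3*(2+|t|)^(4-η) ≤ ‖Zf (1+x+Complex.I*t)‖^4 := by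
  obtain ⟨C, hC, h⟩ := Zf_bound η hη hη1
  refine ⟨((C*4)^3)⁻¹*(1/81)*(1/6)/C, by positivity, ?_⟩
  intro x t hx hx1 ht
  set T := 2+|t| with hT
  have hT0 : 0 < T := by linarith [abs_nonneg t]
  have h341 := zeta_341 x t hx
  set A := riemannZeta (1+x) with hA
  set B := riemannZeta (1+x+Complex.I*t) with hB
  set D := riemannZeta (1+x+2*Complex.I*t) with hD
  have eA : Zf (1+x) = x * A := by rw [Zf_eq _ (by simp [hx])]; ring
  have eB : Zf (1+x+Complex.I*t) = (x+Complex.I*t) * B := by rw [Zf_eq _ (by simp [hx])]; ring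
  have eD : Zf (1+x+2*Complex.I*t) = (x+2*Complex.I*t) * D := by rw [Zf_eq _ (by simp [hx])]; ring
  have bA : x*‖A‖ ≤ C*4 := by
    have := h (1+x) (by simp; linarith) (by simp; linarith)
    rw [eA, norm_mul, Complex.norm_real, Real.norm_of_nonneg hx.le] at this
    refine this.trans ?_
    have h4 : (2:ℝ)^(1+η) ≤ 2^(2:ℝ) := rpow_le_rpow_of_exponent_le (by norm_num) (by linarith)
    norm_num at h4
    gcongr
    simpa using h4
  have bB : T/3*‖B‖ ≤ ‖Zf (1+x+Complex.I*t)‖ := by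
    rw [eB, norm_mul]
    gcongr
    have := Complex.abs_im_le_norm ((x:ℂ)+Complex.I*t)
    simp at this
    linarith
  have bD : (2*T/3)*‖D‖ ≤ C*(4*T^(1+η)) := by
    have := h (1+x+2*Complex.I*t) (by simp; linarith) (by simp; linarith)
    rw [eD, norm_mul] at this
    have h2 := Complex.abs_im_le_norm ((x:ℂ)+2*Complex.I*t)
    simp at h2
    have h3 : (2*T/3)*‖D‖ ≤ ‖(x:ℂ)+2*Complex.I*t‖*‖D‖ := by gcongr; linarith
    refine h3.trans (this.trans ?_)
    have h4 : (2:ℝ)^(1+η) ≤ 2^(2:ℝ) := rpow_le_rpow_of_exponent_le (by norm_num) (by linarith)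
    norm_num at h4
    gcongr
    have h5 : (2+|(1+(x:ℂ)+2*Complex.I*t).im|)^(1+η) ≤ (2*T)^(1+η) := by
      apply rpow_le_rpow (by positivity) _ (by linarith)
      simp
      linarith
    rw [mul_rpow (by norm_num) hT0.le] at h5
    refine h5.trans ?_
    gcongr
  set Z := ‖Zf (1+x+Complex.I*t)‖ with hZ
  have e1 : T^(4-η) * T^(1+η) = T^5 := by
    rw [← rpow_add hT0, ← rpow_natCast]; congr 1; push_cast; ring
  have hP : 0 < T^(1+η) := by positivity
  have k1 : (x*‖A‖)^3 ≤ (C*4)^3 := by gcongr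
  have k2 : (T/3*‖B‖)^4 ≤ Z^4 := by gcongr
  have hZ0 : 0 ≤ Z^4 := by positivity
  have k3 : x^3*T^5*(2/243) ≤ (C*4)^3 * Z^4 * (C*(4*T^(1+η))) := by
    calc x^3*T^5*(2/243) = x^3*T^5*(2/243)*1 := by ring
      _ ≤ x^3*T^5*(2/243)*(‖A‖^3 * ‖B‖^4 * ‖D‖) := by gcongr
      _ = (x*‖A‖)^3 * (T/3*‖B‖)^4 * ((2*T/3)*‖D‖) := by ring
      _ ≤ _ := by gcongr
  rw [← e1] at k3
  have k4 : x^3*T^(4-η)*(2/243) ≤ (C*4)^3 * Z^4 * (C*4) := by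
    have : (x^3*T^(4-η)*(2/243)) * T^(1+η) ≤ ((C*4)^3 * Z^4 * (C*4)) * T^(1+η) := by linarith
    exact le_of_mul_le_mul_right this hP
  have hC0 : 0 < C := by linarith
  have : ((C*4)^3)⁻¹*(1/81)*(1/6)/C*x^3*T^(4-η) = (x^3*T^(4-η)*(2/243)) / ((C*4)^3*(C*4)) := by
    field_simp; ring
  rw [this, div_le_iff₀ (by positivity)]
  linarith

lemma Zf_lower (η : ℝ) (hη : 0 < η) (hη1 : η ≤ 1/2) : ∃ c, 0 < c ∧ c ≤ η/2 ∧ ∀ s : ℂ, 1 ≤ |s.im| → 1 - c*(2+|s.im|)^(-(5*η)) ≤ s.re → s.re ≤ 2 → Zf s ≠ 0 ∧ ‖deriv Zf s / Zf s‖ ≤ (2+|s.im|)^(5*η)/c := by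
  obtain ⟨C, hC, hB⟩ := Zf_deriv_bound η hη hη1
  obtain ⟨c, hc, h3⟩ := Zf_341 η hη hη1
  set c' := min (η/2) (c/(4*C)^4) with hc'
  have hc0 : 0 < c' := lt_min (by linarith) (by positivity)
  have hc1 : c' ≤ η/2 := min_le_left _ _
  have hc2 : c' * (4*C)^4 ≤ c := (le_div_iff₀ (by positivity)).mp (min_le_right _ _)
  refine ⟨c', hc0, by linarith, ?_⟩
  intro s hs1 hs2 hs3
  set T := 2+|s.im| with hT
  have hT0 : 0 < T := by linarith [abs_nonneg s.im]
  have hT1 : 1 ≤ T := by linarith [abs_nonneg s.im]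
  set κ := c'*T^(-(5*η)) with hκ
  have hκ0 : 0 < κ := by positivity
  have hκ1 : κ ≤ c' := by
    have : T^(-(5*η)) ≤ 1 := rpow_le_one_of_one_le_of_nonpos hT1 (by linarith)
    nlinarith
  have key : ∀ x : ℝ, κ ≤ x → x ≤ 1 → 4*C*κ*T^(1+η) ≤ ‖Zf (1+x+Complex.I*s.im)‖ := by
    intro x hx1 hx2
    have h := h3 x s.im (by linarith) hx2 hs1
    rw [← hT] at h
    refine le_of_pow_le_pow_left₀ (n := 4) (by norm_num) (by positivity) (le_trans ?_ h)
    have e1 : (T^(1+η))^4 = T^(5*η) * T^(4-η) := by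
      rw [← rpow_add hT0, ← rpow_natCast, ← rpow_mul hT0.le]; congr 1; push_cast; ring
    have e2 : κ * T^(5*η) = c' := by
      rw [hκ, mul_assoc, ← rpow_add hT0]; simp
    calc (4*C*κ*T^(1+η))^4 = (4*C)^4*κ^3*(κ*T^(5*η))*T^(4-η) := by rw [mul_pow _ (T^(1+η)), e1]; ring
      _ = (c'*(4*C)^4)*κ^3*T^(4-η) := by rw [e2]; ring
      _ ≤ c*x^3*T^(4-η) := by gcongr
  have lower : 2*C*κ*T^(1+η) ≤ ‖Zf s‖ := by
    have hpos : 0 < C*κ*T^(1+η) := by positivity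
    by_cases hb : 1+κ ≤ s.re
    · have := key (s.re-1) (by linarith) (by linarith)
      have e : (1:ℂ)+(s.re-1:ℝ)+Complex.I*s.im = s := by
        apply Complex.ext <;> simp
      rw [e] at this
      nlinarith
    · push Not at hb
      have h0 := key κ le_rfl (by linarith)
      set w : ℂ := 1+κ+Complex.I*s.im with hw
      have hwre : w.re = 1+κ := by simp [hw]
      have hwim : w.im = s.im := by simp [hw]
      have hconv : Convex ℝ ((Set.Icc (1-η/2) 2) ×ℂ {s.im}) :=
        ((convex_Icc (1-η/2) 2).linear_preimage Complex.reLm).inter ((convex_singleton s.im).linear_preimage Complex.imLm)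
      have hmv := hconv.norm_image_sub_le_of_norm_deriv_le (f := Zf) (C := C*T^(1+η)) (x := s) (y := w)
        (fun z hz => Zf_diff z (by have := hz.1.1; linarith))
        (fun z hz => by
          have h1 := hz.1
          have h2 : z.im = s.im := hz.2
          have := hB z h1.1 h1.2
          rwa [h2] at this)
        ⟨⟨by linarith, hs3⟩, rfl⟩ ⟨⟨by rw [hwre]; linarith, by rw [hwre]; linarith⟩, hwim⟩
      have hn : ‖w-s‖ ≤ 2*κ := by
        have := Complex.norm_le_abs_re_add_abs_im (w-s)
        rw [Complex.sub_re, Complex.sub_im, hwim, hwre, sub_self, abs_zero, abs_of_nonneg (by linarith)] at this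
        linarith
      have h5 : ‖Zf w - Zf s‖ ≤ C*T^(1+η)*(2*κ) := hmv.trans (by gcongr)
      have h6 := norm_sub_norm_le (Zf w) (Zf s)
      nlinarith
  have hpos : 0 < 2*C*κ*T^(1+η) := by positivity
  refine ⟨norm_pos_iff.mp (by linarith), ?_⟩
  rw [norm_div, div_le_iff₀ (by linarith)]
  have e2 : T^(5*η)/c' = 1/κ := by
    rw [hκ, rpow_neg hT0.le]; field_simp
  rw [e2]
  calc _ ≤ C*T^(1+η) := hB s (by linarith) hs3
    _ ≤ 1/κ*(2*C*κ*T^(1+η)) := by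
      field_simp; norm_num
    _ ≤ _ := by gcongr

lemma Zf_ne (s : ℂ) (hs : 1 ≤ s.re) : Zf s ≠ 0 := by
  by_cases h1 : s = 1
  · rw [h1, Zf_one]; exact one_ne_zero
  have hz := riemannZeta_ne_zero_of_one_le_re hs
  have e : Zf s = (s-1)*riemannZeta s := by
    have hp : Filter.Tendsto (fun x : ℝ => s + (x:ℂ)) (nhdsWithin 0 (Set.Ioi 0)) (nhds s) := by
      have : ContinuousAt (fun x : ℝ => s + (x:ℂ)) 0 := by fun_prop
      have h := this.tendsto
      simp only [Complex.ofReal_zero, add_zero] at h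
      exact h.mono_left nhdsWithin_le_nhds
    have t1 := (Zf_diff s (by linarith)).continuousAt.tendsto.comp hp
    have c2 : ContinuousAt (fun z => (z-1)*riemannZeta z) s :=
      (continuousAt_id.sub continuousAt_const).mul (differentiableAt_riemannZeta h1).continuousAt
    have t2 := c2.tendsto.comp hp
    refine tendsto_nhds_unique (t1.congr' ?_) t2
    filter_upwards [self_mem_nhdsWithin] with x hx
    have hx0 : 0 < x := hx
    simp only [Function.comp]
    exact Zf_eq _ (by simp; linarith)
  rw [e]
  exact mul_ne_zero (sub_ne_zero.mpr h1) hz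

noncomputable def Gc (s : ℂ) : ℂ := -dslope Zf 1 s - deriv Zf s / Zf s

def Om : Set ℂ := {s | 0 < s.re} ∩ {s | Zf s ≠ 0}

lemma Om_open : IsOpen Om := by
  have h0 : IsOpen {s : ℂ | 0 < s.re} := isOpen_lt continuous_const Complex.continuous_re
  have hc : ContinuousOn Zf {s : ℂ | 0 < s.re} := fun s hs => (Zf_diff s hs).continuousAt.continuousWithinAt
  exact hc.isOpen_inter_preimage h0 isOpen_ne

lemma Gc_diff : DifferentiableOn ℂ Gc Om := by
  have h0 : IsOpen {s : ℂ | 0 < s.re} := isOpen_lt continuous_const Complex.continuous_re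
  have hZ : DifferentiableOn ℂ Zf {s : ℂ | 0 < s.re} := fun s hs => (Zf_diff s hs).differentiableWithinAt
  have h1 : DifferentiableOn ℂ (dslope Zf 1) {s : ℂ | 0 < s.re} :=
    (Complex.differentiableOn_dslope (h0.mem_nhds (by simp))).mpr hZ
  have h2 := hZ.deriv h0
  have hs : Om ⊆ {s : ℂ | 0 < s.re} := Set.inter_subset_left
  exact (h1.mono hs).neg.sub ((h2.mono hs).div (hZ.mono hs) (fun s hs => hs.2))

lemma Gc_far (k : ℕ) : ∃ C, 0 < C ∧ ∀ s : ℂ, 1 < s.re → s.re ≤ 3/2 → 2 ≤ |s.im| → ‖iteratedDeriv k Gc s‖ ≤ C*(2+|s.im|) := by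
  set η : ℝ := 1/(5*(k+1)) with hη
  have hη0 : 0 < η := by positivity
  have hη1 : 5*η ≤ 1 := by
    rw [hη]; field_simp; linarith [show (0:ℝ) ≤ k by positivity]
  obtain ⟨C, hC, hB⟩ := Zf_bound η hη0 (by linarith)
  obtain ⟨c, hc, hc4, hL⟩ := Zf_lower η hη0 (by linarith)
  set c2 := c/2 with hc2
  have hc20 : 0 < c2 := by positivity
  refine ⟨k.factorial*(8*C+2/c)/c2^k, by positivity, ?_⟩
  intro s h1 h2 h3
  set T := 2+|s.im| with hT
  have hT4 : 4 ≤ T := by linarith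
  have hT0 : 0 < T := by linarith
  set R := c2*T^(-(5*η)) with hR
  have hR0 : 0 < R := by positivity
  have hTm : T^(-(5*η)) ≤ 1 := rpow_le_one_of_one_le_of_nonpos (by linarith) (by linarith)
  have hR1 : R ≤ c2 := by nlinarith
  have h2p : ∀ a : ℝ, 0 < a → a ≤ 1 → (2*T)^a ≤ 2*T^a := by
    intro a ha ha1
    rw [mul_rpow (by norm_num) hT0.le]
    have : (2:ℝ)^a ≤ 2^(1:ℝ) := rpow_le_rpow_of_exponent_le (by norm_num) ha1
    rw [rpow_one] at this
    gcongr
  have hpt : ∀ w ∈ Metric.closedBall s R, 1 - R ≤ w.re ∧ w.re ≤ 2 ∧ |w.im| ≤ |s.im| + 1 ∧ |s.im| - 1/2 ≤ |w.im| := by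
    intro w hw
    rw [Metric.mem_closedBall, dist_eq_norm] at hw
    have a1 := (Complex.abs_re_le_norm (w-s)).trans hw
    have a2 := (Complex.abs_im_le_norm (w-s)).trans hw
    rw [Complex.sub_re, abs_le] at a1
    rw [Complex.sub_im] at a2
    have := abs_sub_abs_le_abs_sub w.im s.im
    have := abs_sub_abs_le_abs_sub s.im w.im
    rw [abs_sub_comm] at this
    refine ⟨by linarith, by linarith, by linarith, by linarith⟩
  have hpl : ∀ w ∈ Metric.closedBall s R, Zf w ≠ 0 ∧ ‖Gc w‖ ≤ (8*C+2/c)*T^(5*η) := by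
    intro w hw
    obtain ⟨b1, b2, b3, b4⟩ := hpt w hw
    have hw0 : 0 < 2+|w.im| := by linarith [abs_nonneg w.im]
    have hwT : 2+|w.im| ≤ 2*T := by linarith
    have hp1 : (2+|w.im|)^(5*η) ≤ 2*T^(5*η) :=
      (rpow_le_rpow hw0.le hwT (by positivity)).trans (h2p _ (by positivity) hη1)
    have hRw : R ≤ c*(2+|w.im|)^(-(5*η)) := by
      rw [hR, hc2, rpow_neg hw0.le, rpow_neg hT0.le, ← div_eq_mul_inv, ← div_eq_mul_inv, div_le_div_iff₀ (by positivity) (by positivity)]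
      have : c/2*(2+|w.im|)^(5*η) ≤ c/2*(2*T^(5*η)) := by gcongr
      linarith
    obtain ⟨q1, q2⟩ := hL w (by linarith) (by linarith) b2
    refine ⟨q1, ?_⟩
    have hw1 : w ≠ 1 := by
      intro h; rw [h] at b4; simp at b4; linarith
    have q3 : ‖dslope Zf 1 w‖ ≤ 8*C*T^(5*η) := by
      rw [dslope_of_ne _ hw1, slope_def_field, Zf_one, norm_div]
      have n1 : T/4 ≤ ‖w-1‖ := by
        have := Complex.abs_im_le_norm (w-1)
        simp at this
        linarith
      have n2 : ‖Zf w - 1‖ ≤ 2*C*(T*T^(5*η)) := by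
        have g1 := hB w (by linarith) (by linarith)
        have g2 : ‖Zf w - 1‖ ≤ ‖Zf w‖ + 1 := (norm_sub_le _ _).trans (by simp)
        have g3 : (2+|w.im|)^(1+η) ≤ (T+1)*(2*T)^η := by
          rw [rpow_add hw0, rpow_one]
          exact mul_le_mul (by linarith) (rpow_le_rpow hw0.le hwT hη0.le) (by positivity) (by linarith)
        have g4 : (2*T)^η ≤ 5/4*T^(5*η) := by
          have e5 : T^(5*η) = T^(4*η)*T^η := by rw [← rpow_add hT0]; congr 1; ring
          have e6 : (2:ℝ)^η ≤ T^(4*η) := by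
            calc (2:ℝ)^η ≤ T^η := rpow_le_rpow (by norm_num) (by linarith) hη0.le
              _ ≤ T^(4*η) := rpow_le_rpow_of_exponent_le (by linarith) (by linarith)
          rw [mul_rpow (by norm_num) hT0.le, e5]
          have : 2^η*T^η ≤ T^(4*η)*T^η := by gcongr
          have : 0 < T^(4*η)*T^η := by positivity
          linarith
        have g5 : 1 ≤ T^(5*η) := Real.one_le_rpow (by linarith) (by positivity)
        have g6 : (T+1)*(2*T)^η ≤ (5/4*T)*(5/4*T^(5*η)) := by gcongr; linarith
        have g7 : C*(2+|w.im|)^(1+η) ≤ C*((5/4*T)*(5/4*T^(5*η))) := by gcongr; exact g3.trans g6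
        have g8 : 4 ≤ C*(T*T^(5*η)) := by
          have : 4*1 ≤ T*T^(5*η) := by gcongr
          nlinarith
        nlinarith
      rw [div_le_iff₀ (by linarith)]
      calc _ ≤ 2*C*(T*T^(5*η)) := n2
        _ = 8*C*T^(5*η)*(T/4) := by ring
        _ ≤ _ := by gcongr
    have q4 : ‖Gc w‖ ≤ ‖dslope Zf 1 w‖ + ‖deriv Zf w/Zf w‖ := by
      unfold Gc
      exact (norm_sub_le _ _).trans (by rw [norm_neg])
    have q5 : (2+|w.im|)^(5*η)/c ≤ 2*T^(5*η)/c := by gcongr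
    calc _ ≤ 8*C*T^(5*η) + 2*T^(5*η)/c := by linarith
      _ = _ := by ring
  have hd : DiffContOnCl ℂ Gc (Metric.ball s R) := by
    apply DifferentiableOn.diffContOnCl
    rw [closure_ball _ hR0.ne']
    refine Gc_diff.mono (fun w hw => ⟨?_, (hpl w hw).1⟩)
    change 0 < w.re
    linarith [(hpt w hw).1]
  refine (Complex.norm_iteratedDeriv_le_of_forall_mem_sphere_norm_le k hR0 hd (fun w hw => (hpl w (Metric.sphere_subset_closedBall hw)).2)).trans ?_
  have e : R^k * T = c2^k * T^(5*η) := by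
    rw [hR, mul_pow, mul_assoc]
    congr 1
    rw [← rpow_natCast, ← rpow_mul hT0.le]
    nth_rewrite 2 [← rpow_one T]
    rw [← rpow_add hT0]
    congr 1
    rw [hη]; field_simp; ring
  rw [div_le_iff₀ (by positivity)]
  have : ↑k.factorial*(8*C+2/c)/c2^k*T*R^k = ↑k.factorial*(8*C+2/c)/c2^k*(R^k*T) := by ring
  rw [this, e]
  have : ↑k.factorial*(8*C+2/c)/c2^k*(c2^k*T^(5*η)) = ↑k.factorial*((8*C+2/c)*T^(5*η)) := by
    field_simp
  rw [this]

lemma Gc_bound (k : ℕ) : ∃ C, 0 < C ∧ ∀ s : ℂ, 1 < s.re → s.re ≤ 3/2 → ‖iteratedDeriv k Gc s‖ ≤ C*(2+|s.im|) := by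
  obtain ⟨C, hC, h⟩ := Gc_far k
  have hcomp : IsCompact ((Set.Icc (1:ℝ) (3/2)) ×ℂ (Set.Icc (-2:ℝ) 2)) := isCompact_Icc.reProdIm isCompact_Icc
  have hcont : ContinuousOn (iteratedDeriv k Gc) ((Set.Icc (1:ℝ) (3/2)) ×ℂ (Set.Icc (-2:ℝ) 2)) := by
    intro s hs
    have h1 : 1 ≤ s.re := hs.1.1
    have hO : s ∈ Om := ⟨by change 0 < s.re; linarith, Zf_ne s h1⟩
    have ha : AnalyticAt ℂ Gc s := Gc_diff.analyticAt (Om_open.mem_nhds hO)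
    have := (ha.iterated_deriv k).continuousAt
    rw [iteratedDeriv_eq_iterate]
    exact this.continuousWithinAt
  obtain ⟨D, hD⟩ := hcomp.exists_bound_of_continuousOn hcont
  refine ⟨max C D, lt_max_of_lt_left hC, ?_⟩
  intro s h1 h2
  have hs0 := abs_nonneg s.im
  by_cases hs : 2 ≤ |s.im|
  · exact (h s h1 h2 hs).trans (by gcongr; exact le_max_left _ _)
  · push Not at hs
    have := hD s ⟨⟨h1.le, h2⟩, abs_le.mp hs.le⟩
    have h3 : D ≤ max C D := le_max_right _ _
    have h4 : C ≤ max C D := le_max_left _ _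
    nlinarith

noncomputable def Wt (k : ℕ) (σ : ℝ) (n : ℕ) : ℝ := (log n)^k * (n:ℝ)^(-σ)

lemma Wt_nonneg (k : ℕ) (σ : ℝ) (n : ℕ) : 0 ≤ Wt k σ n :=
  mul_nonneg (pow_nonneg (log_natCast_nonneg n) k) (by positivity)

lemma Wt_le (k : ℕ) (hk : 1 ≤ k) (σ : ℝ) (hσ : 1 < σ) (n : ℕ) :
    Wt k σ n ≤ (2*k/(σ-1))^k * (n:ℝ)^(-(1+(σ-1)/2)) := by
  unfold Wt
  rcases Nat.eq_zero_or_pos n with rfl | hn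
  · rw [Nat.cast_zero, Real.zero_rpow (by linarith : -σ ≠ 0), Real.zero_rpow (by linarith : -(1+(σ-1)/2) ≠ 0)]
    simp
  have hn0 : (0:ℝ) < n := by exact_mod_cast hn
  have hk0 : (0:ℝ) < k := by exact_mod_cast hk
  have hσ0 : 0 < σ - 1 := by linarith
  have h1 := log_le_rpow_div hn0.le (show 0 < (σ-1)/(2*k) by positivity)
  have h2 : (log n)^k ≤ ((n:ℝ)^((σ-1)/(2*k))/((σ-1)/(2*k)))^k :=
    pow_le_pow_left₀ (log_natCast_nonneg n) h1 k
  have h3 : ((n:ℝ)^((σ-1)/(2*k))/((σ-1)/(2*k)))^k = (2*k/(σ-1))^k * (n:ℝ)^((σ-1)/2) := by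
    rw [div_eq_mul_inv, mul_pow, inv_div, ← rpow_natCast, ← rpow_mul hn0.le, mul_comm]
    congr 2; field_simp
  calc _ ≤ (2*k/(σ-1))^k * (n:ℝ)^((σ-1)/2) * (n:ℝ)^(-σ) := by rw [← h3]; gcongr
    _ = _ := by rw [mul_assoc, ← rpow_add hn0]; congr 2; ring

lemma sum_rpow (s : ℝ) (hs : 1 < s) : ∑' n : ℕ, (n:ℝ)^(-s) ≤ 1 + 1/(s-1) := by
  have hsm : Summable (fun n : ℕ => (n:ℝ)^(-s)) := Real.summable_nat_rpow.mpr (by linarith)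
  have h := ZetaAsymptotics.zeta_limit_aux1 hs
  have h0 : 0 ≤ ZetaAsymptotics.termTSum s := tsum_nonneg (fun n => ZetaAsymptotics.term_nonneg _ _)
  rw [hsm.tsum_eq_zero_add]
  simp only [Nat.cast_zero, Real.zero_rpow (by linarith : -s ≠ 0), zero_add]
  have e : (∑' n : ℕ, ((n+1:ℕ):ℝ)^(-s)) = ∑' n : ℕ, 1/(n+1:ℝ)^s := by
    congr 1; ext n; rw [rpow_neg (by positivity)]; push_cast; rw [one_div]
  rw [e]
  nlinarith

lemma Wt_summable (k : ℕ) (hk : 1 ≤ k) (σ : ℝ) (hσ : 1 < σ) : Summable (Wt k σ) ∧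
    ∑' n, Wt k σ n ≤ (2*k/(σ-1))^k * (1+2/(σ-1)) := by
  have hσ0 : 0 < σ - 1 := by linarith
  have hs : Summable (fun n : ℕ => (n:ℝ)^(-(1+(σ-1)/2))) := Real.summable_nat_rpow.mpr (by linarith)
  have h1 := hs.mul_left ((2*k/(σ-1))^k)
  have h2 := Summable.of_nonneg_of_le (Wt_nonneg k σ) (Wt_le k hk σ hσ) h1
  refine ⟨h2, (h2.tsum_le_tsum (Wt_le k hk σ hσ) h1).trans ?_⟩
  rw [tsum_mul_left]
  gcongr
  refine (sum_rpow _ (by linarith)).trans (le_of_eq ?_)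
  rw [add_sub_cancel_left, one_div_div]

lemma LWt_le (k : ℕ) (σ : ℝ) (n : ℕ) : vonMangoldt n * Wt k σ n ≤ Wt (k+1) σ n := by
  have := ArithmeticFunction.vonMangoldt_le_log (n := n)
  have h := Wt_nonneg k σ n
  calc _ ≤ log n * Wt k σ n := by gcongr
    _ = _ := by unfold Wt; ring

lemma logMul_iter (f : ℕ → ℂ) (k n : ℕ) : (LSeries.logMul^[k] f) n = ((log n : ℝ):ℂ)^k * f n := by
  induction k with
  | zero => simp
  | succ k ih =>
    rw [Function.iterate_succ_apply', LSeries.logMul, ih, pow_succ', ← Complex.natCast_log]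
    ring

noncomputable def fL : ℕ → ℂ := (fun n => (vonMangoldt n : ℂ)) - 1

lemma fL_summable (s : ℂ) (hs : 1 < s.re) : LSeriesSummable fL s :=
  (ArithmeticFunction.LSeriesSummable_vonMangoldt hs).sub (LSeriesSummable_one_iff.mpr hs)

lemma Gc_eq (s : ℂ) (hs : 1 < s.re) : Gc s = LSeries fL s := by
  have hs1 : s ≠ 1 := by rintro rfl; simp at hs
  have hz := riemannZeta_ne_zero_of_one_lt_re hs
  have hev : Zf =ᶠ[nhds s] fun z => (z-1)*riemannZeta z := by
    filter_upwards [(isOpen_lt continuous_const Complex.continuous_re).mem_nhds hs] with z hz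
    exact Zf_eq z hz
  have hd : deriv Zf s = riemannZeta s + (s-1)*deriv riemannZeta s := by
    rw [hev.deriv_eq]
    have := ((hasDerivAt_id s).sub_const 1).mul (differentiableAt_riemannZeta hs1).hasDerivAt
    have h := this.deriv
    simp only [id, one_mul] at h
    exact h
  unfold fL Gc
  rw [LSeries_sub (ArithmeticFunction.LSeriesSummable_vonMangoldt hs) (LSeriesSummable_one_iff.mpr hs), ArithmeticFunction.LSeries_vonMangoldt_eq_deriv_riemannZeta_div hs, LSeries_one_eq_riemannZeta hs, dslope_of_ne _ hs1, slope_def_field, Zf_one, hd, Zf_eq s hs]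
  have := sub_ne_zero.mpr hs1
  field_simp
  ring

lemma Gc_hasSum (k : ℕ) (σ t : ℝ) (hσ : 1 < σ) : ∑' n : ℕ, (((vonMangoldt n - 1)*Wt k σ n : ℝ):ℂ) * ee (-(t*log n/(2*π))) = (-1)^k * iteratedDeriv k Gc (σ+Complex.I*t) := by
  set s : ℂ := σ+Complex.I*t with hs
  have hre : 1 < s.re := by simp [hs, hσ]
  have hev : Gc =ᶠ[nhds s] LSeries fL := by
    filter_upwards [(isOpen_lt continuous_const Complex.continuous_re).mem_nhds hre] with z hz
    exact Gc_eq z hz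
  have hab : LSeries.abscissaOfAbsConv fL < s.re := by
    have : LSeries.abscissaOfAbsConv fL ≤ 1 := LSeries.abscissaOfAbsConv_le_of_forall_lt_LSeriesSummable (fun y hy => fL_summable y (by simpa using hy))
    exact this.trans_lt (by exact_mod_cast hre)
  rw [hev.iteratedDeriv_eq k, LSeries_iteratedDeriv k hab, ← mul_assoc, ← mul_pow]
  norm_num
  unfold LSeries
  congr 1; ext n
  rcases Nat.eq_zero_or_pos n with rfl | hn
  · simp [Wt, Real.zero_rpow (by linarith : -σ ≠ 0)]
  have hn0 : (0:ℝ) < n := by exact_mod_cast hn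
  have hnc : (n:ℂ) ≠ 0 := by exact_mod_cast hn.ne'
  rw [LSeries.term_of_ne_zero hn.ne', logMul_iter, div_eq_mul_inv _ ((n:ℂ)^s), ← Complex.cpow_neg]
  have e : (n:ℂ)^(-s) = (((n:ℝ)^(-σ):ℝ):ℂ) * ee (-(t*log n/(2*π))) := by
    rw [show -s = ((-σ:ℝ):ℂ) + -(Complex.I*t) by rw [hs]; push_cast; ring, Complex.cpow_add _ _ hnc, Complex.ofReal_cpow hn0.le]
    congr 1
    rw [Complex.cpow_def_of_ne_zero hnc, ee, ← Complex.natCast_log]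
    congr 1
    push_cast
    field_simp
  rw [e]
  unfold Wt fL
  simp
  ring

lemma aW_summable (k : ℕ) (hk : 1 ≤ k) (σ : ℝ) (hσ : 1 < σ) :
    Summable (fun n => |(vonMangoldt n - 1)*Wt k σ n|) := by
  refine Summable.of_nonneg_of_le (fun n => abs_nonneg _) (fun n => ?_) ((Wt_summable (k+1) (by omega) σ hσ).1.add (Wt_summable k hk σ hσ).1)
  have h1 := LWt_le k σ n
  have h2 := Wt_nonneg k σ n
  have h3 := mul_nonneg (ArithmeticFunction.vonMangoldt_nonneg (n := n)) h2
  rw [sub_mul, one_mul, abs_le]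
  constructor <;> linarith

lemma smooth_bound (k : ℕ) (hk : 1 ≤ k) : ∃ C, 0 < C ∧ ∀ σ ρ u : ℝ, 1 < σ → σ ≤ 3/2 → 1 ≤ ρ →
    |∑' n : ℕ, (vonMangoldt n - 1)*Wt k σ n * rexp (-π*ρ^2*((u-log n)/(2*π))^2)| ≤ C*ρ := by
  obtain ⟨C, hC, hG⟩ := Gc_bound k
  refine ⟨6*C, by positivity, ?_⟩
  intro σ ρ u hσ hσ2 hρ
  have hρ0 : 0 < ρ := by linarith
  set a : ℕ → ℝ := fun n => (vonMangoldt n - 1)*Wt k σ n with ha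
  set F : ℕ → ℝ → ℂ := fun n t => (a n:ℂ) * (((rexp (-(π/ρ^2)*t^2) : ℝ):ℂ) * ee (t*((u-log n)/(2*π)))) with hF
  have hint : ∀ n, Integrable (F n) := fun n => (gauss_ee_integrable ρ _ hρ0).const_mul _
  have hnorm : ∀ n, ∫ t, ‖F n t‖ = |a n| * ∫ t : ℝ, rexp (-(π/ρ^2)*t^2) := by
    intro n
    rw [← integral_const_mul]
    congr 1; ext t
    simp only [hF]
    rw [norm_mul, norm_mul, norm_ee, Complex.norm_real, Complex.norm_real, Real.norm_eq_abs, Real.norm_eq_abs, abs_of_pos (Real.exp_pos _), mul_one]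
  have hs : Summable (fun n => ∫ t, ‖F n t‖) := by
    simp_rw [hnorm]
    exact (aW_summable k hk σ hσ).mul_right _
  have hH := (hasSum_integral_of_summable_integral_norm hint hs).tsum_eq
  have hL : ∀ n, ∫ t, F n t = ((a n * (ρ * rexp (-π*ρ^2*((u-log n)/(2*π))^2)) : ℝ):ℂ) := by
    intro n
    simp only [hF]
    rw [integral_const_mul, gauss_ee ρ _ hρ0]; push_cast; ring
  simp_rw [hL] at hH
  rw [← Complex.ofReal_tsum] at hH
  have hb : π/(2*ρ^2) > 0 := by positivity
  have hpt : ∀ t, ‖∑' n, F n t‖ ≤ 3*C*ρ*rexp (-(π/(2*ρ^2))*t^2) := by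
    intro t
    have e : ∑' n, F n t = (((rexp (-(π/ρ^2)*t^2) : ℝ):ℂ) * ee (t*u/(2*π))) * ((-1)^k * iteratedDeriv k Gc (σ+Complex.I*t)) := by
      rw [← Gc_hasSum k σ t hσ, ← tsum_mul_left]
      congr 1; ext n
      simp only [hF]
      rw [show t*((u-log n)/(2*π)) = t*u/(2*π) + -(t*log n/(2*π)) by ring, ee_add]
      ring
    rw [e, norm_mul, norm_mul, norm_mul, norm_ee, Complex.norm_real, Real.norm_eq_abs, abs_of_pos (Real.exp_pos _), norm_pow, norm_neg, norm_one, one_pow, one_mul, mul_one]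
    have h1 := hG (σ+Complex.I*t) (by simpa using hσ) (by simpa using hσ2)
    have h1' : ‖iteratedDeriv k Gc (σ+Complex.I*t)‖ ≤ C*(2+|t|) := by simpa using h1
    have h2 : 2+|t| ≤ 3*ρ*rexp ((π/(2*ρ^2))*t^2) := by
      have h3 := Real.add_one_le_exp ((π/(2*ρ^2))*t^2)
      set x := |t|/ρ with hx
      have e1 : |t| = x*ρ := by rw [hx]; field_simp
      have e2 : (π/(2*ρ^2))*t^2 = π/2*x^2 := by
        rw [← sq_abs t, e1]; field_simp
      rw [e2] at h3 ⊢
      have hp := Real.pi_gt_three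
      have h4 : x ≤ rexp (π/2*x^2) := by nlinarith [sq_nonneg (x-1)]
      have h5 : 1 ≤ rexp (π/2*x^2) := by nlinarith [sq_nonneg x]
      rw [e1]
      nlinarith
    have e3 : rexp (-(π/ρ^2)*t^2) * rexp ((π/(2*ρ^2))*t^2) = rexp (-(π/(2*ρ^2))*t^2) := by
      rw [← Real.exp_add]; congr 1; field_simp; ring
    calc _ ≤ rexp (-(π/ρ^2)*t^2) * (C*(3*ρ*rexp ((π/(2*ρ^2))*t^2))) := by
          gcongr; exact h1'.trans (by gcongr)
      _ = _ := by rw [← e3]; ring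
  have hfin : ‖∫ t, ∑' n, F n t‖ ≤ 6*C*ρ^2 := by
    refine (norm_integral_le_of_norm_le ((integrable_exp_neg_mul_sq hb).const_mul _) (Filter.Eventually.of_forall hpt)).trans ?_
    rw [integral_const_mul, integral_gaussian]
    have : √(π/(π/(2*ρ^2))) ≤ 2*ρ := by
      rw [show π/(π/(2*ρ^2)) = 2*ρ^2 by field_simp]
      apply Real.sqrt_le_iff.mpr
      constructor
      · positivity
      · nlinarith
    calc _ ≤ 3*C*ρ*(2*ρ) := by gcongr
      _ = _ := by ring
  rw [← hH, Complex.norm_real, Real.norm_eq_abs] at hfin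
  have e : ∑' n, a n * (ρ * rexp (-π*ρ^2*((u-log n)/(2*π))^2)) = ρ * ∑' n, a n * rexp (-π*ρ^2*((u-log n)/(2*π))^2) := by
    rw [← tsum_mul_left]; congr 1; ext n; ring
  rw [e, abs_mul, abs_of_pos hρ0] at hfin
  nlinarith

lemma gauss_sum_le : ∃ C0, 0 < C0 ∧ ∀ (M : ℕ) (v : ℝ), ∑ j ∈ range M, rexp (-(j-v)^2/(4*π)) ≤ C0 := by
  have hb : 0 < 1/(8*π) := by positivity
  have hint := integrable_exp_neg_mul_sq hb
  have hI : 0 < ∫ x : ℝ, rexp (-(1/(8*π))*x^2) := by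
    rw [integral_gaussian]; positivity
  refine ⟨rexp (1/(4*π)) * ∫ x : ℝ, rexp (-(1/(8*π))*x^2), by positivity, ?_⟩
  intro M v
  have hcont : Continuous (fun x : ℝ => rexp (-(1/(8*π))*x^2)) := by fun_prop
  have h1 : ∀ j ∈ range M, rexp (-(j-v)^2/(4*π)) ≤ rexp (1/(4*π)) * ∫ x in (j:ℝ)-v..((j+1:ℕ):ℝ)-v, rexp (-(1/(8*π))*x^2) := by
    intro j _
    rw [← intervalIntegral.integral_const_mul]
    have : rexp (-(j-v)^2/(4*π)) = ∫ x in (j:ℝ)-v..((j+1:ℕ):ℝ)-v, rexp (-(j-v)^2/(4*π)) := by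
      rw [intervalIntegral.integral_const]; push_cast; simp
    rw [this]
    apply intervalIntegral.integral_mono_on (by push_cast; linarith) (by simp) ((hcont.const_mul _).intervalIntegrable _ _)
    intro x hx
    rw [← Real.exp_add]
    apply Real.exp_le_exp.mpr
    have hx1 : x - (j-v) ∈ Set.Icc (0:ℝ) 1 := ⟨by linarith [hx.1], by have := hx.2; push_cast at this; linarith⟩
    have h3 : x^2 ≤ 2*(j-v)^2+2 := by
      have := hx1.1; have := hx1.2
      nlinarith [sq_nonneg ((j:ℝ)-v-(x-(j-v)))]
    rw [show 1/(4*π) + -(1/(8*π))*x^2 = (2-x^2)/(8*π) by field_simp; ring, show -((j:ℝ)-v)^2/(4*π) = (-(2*(j-v)^2))/(8*π) by field_simp; ring]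
    gcongr
    linarith
  refine (Finset.sum_le_sum h1).trans ?_
  rw [← Finset.mul_sum, intervalIntegral.sum_integral_adjacent_intervals (a := fun j : ℕ => (j:ℝ)-v) (fun j _ => hcont.intervalIntegrable _ _)]
  gcongr
  rw [intervalIntegral.integral_of_le (by simp)]
  exact setIntegral_le_integral hint (Filter.Eventually.of_forall fun x => (Real.exp_pos _).le)

lemma hasSum_ite_mem (s : Finset ℕ) (f : ℕ → ℝ) : HasSum (fun n => if n ∈ s then f n else 0) (∑ n ∈ s, f n) := by
  have := hasSum_sum_of_ne_finset_zero (f := fun n => if n ∈ s then f n else 0) (s := s) (L := SummationFilter.unconditional ℕ) (fun n hn => by simp [hn])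
  rwa [Finset.sum_congr rfl (fun n hn => if_pos hn)] at this

set_option maxHeartbeats 1000000 in
lemma pnt_core (k : ℕ) (hk : 1 ≤ k) : ∃ C0 C D : ℝ, 0 < C0 ∧ 0 < C ∧ 0 < D ∧ ∀ (X : ℝ) (y1 y2 : ℕ), 14 ≤ log X → X/8 ≤ y1 → (y2:ℝ) ≤ X → y1 + 6 ≤ y2 →
    ((y2:ℝ)-y1)*(log X)^k/(12*2^k*X) ≤ C0*((log X)^k/X)*(∑ n ∈ Ioc y1 y2, vonMangoldt n) + C*log X*(log X*X/((y2:ℝ)-y1)) + D*(log X)^(k+3)*rexp (-(log X)^2/(256*π)) := by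
  obtain ⟨C, hC, hsm⟩ := smooth_bound k hk
  obtain ⟨C0, hC0, hgs⟩ := gauss_sum_le
  refine ⟨8*C0, 9*C, 27*(2*(k+1))^(k+1), by positivity, by positivity, by positivity, ?_⟩
  intro X y1 y2 hL hy1 hy2 hy
  have hX0 : 0 < X := by
    have : (0:ℝ) ≤ y2 := by positivity
    rcases eq_or_lt_of_le (this.trans hy2) with h | h
    · rw [← h] at hL; simp at hL; linarith
    · exact h
  set L := log X with hLd
  have hL0 : 0 < L := by linarith
  set q := (y2-y1)/4 with hq
  have hyr : (y1:ℝ)+6 ≤ y2 := by exact_mod_cast hy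
  set h := (y2:ℝ)-y1 with hh
  have hq1 : 4*(q:ℝ) ≤ h := by
    have : 4*q + y1 ≤ y2 := by omega
    have : (4:ℝ)*q + y1 ≤ y2 := by exact_mod_cast this
    linarith
  have hq2 : h/8 ≤ q := by
    have : y2 ≤ y1 + 4*q + 3 := by omega
    have : (y2:ℝ) ≤ y1 + 4*q + 3 := by exact_mod_cast this
    linarith
  set z1 := y1 + q with hz1
  set z2 := y2 - q with hz2
  have z1r : (z1:ℝ) = y1+q := by rw [hz1]; push_cast; ring
  have z2r : (z2:ℝ) = y2-q := by rw [hz2, Nat.cast_sub (by omega)]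
  have hh0 : 6 ≤ h := by linarith
  have hy10 : (0:ℝ) < y1 := by linarith
  have hz10 : (0:ℝ) < z1 := by linarith
  have hz12 : (z1:ℝ) < z2 := by linarith
  have hhX : h ≤ X := by linarith
  set ρ := L*X/h with hρ
  have hρ0 : 0 < ρ := by positivity
  have hρ1 : 1 ≤ ρ := by rw [hρ, le_div_iff₀ (by linarith)]; nlinarith
  have hρh : ρ*(h/8/X) = L/8 := by rw [hρ]; field_simp
  set σ := 1+1/L with hσ
  have hσ1 : 1 < σ := by rw [hσ]; linarith [show 0 < 1/L by positivity]
  have hσ2 : σ ≤ 3/2 := by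
    have : 1/L ≤ 1/2 := by gcongr; linarith
    linarith
  set v : ℕ → ℝ := fun n => ρ*(log n - log z1) with hv
  set Λ' := ρ*(log z2 - log z1) with hΛ'
  set M := ⌈Λ'⌉₊ with hM
  set S : ℕ → ℝ := fun n => ∑ j ∈ range M, rexp (-(j-v n)^2/(4*π)) with hS
  set E := rexp (-L^2/(256*π)) with hE
  set W := Wt k σ with hW
  have hS0 : ∀ n, 0 ≤ S n := fun n => Finset.sum_nonneg (fun j _ => (Real.exp_pos _).le)
  have logd : ∀ x y : ℝ, 0 < x → x ≤ y → (y-x)/y ≤ log y - log x := by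
    intro x y hx hxy
    have := Real.one_sub_inv_le_log_of_pos (show 0 < y/x by have := hx.trans_le hxy; positivity)
    rw [log_div (by linarith) (by linarith), inv_div] at this
    rwa [sub_div, div_self (by linarith)]
  have hMle : (M:ℝ) ≤ 9*L := by
    have h1 : log z2 - log z1 ≤ 8*(h/X) := by
      have := log_le_sub_one_of_pos (show 0 < (z2:ℝ)/z1 by have := hz10.trans hz12; positivity)
      rw [log_div (by linarith) (by linarith)] at this
      have h2 : (z2:ℝ)/z1 - 1 = (z2-z1)/z1 := by field_simp
      rw [h2] at this
      refine this.trans ?_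
      calc ((z2:ℝ)-z1)/z1 ≤ h/(X/8) := by gcongr <;> linarith
        _ = _ := by field_simp
    have h2 : Λ' ≤ 8*L := by
      calc Λ' ≤ ρ*(8*(h/X)) := by rw [hΛ']; gcongr
        _ = 64*(ρ*(h/8/X)) := by ring
        _ = _ := by rw [hρh]; ring
    have h0 : 0 ≤ Λ' := mul_nonneg hρ0.le (sub_nonneg.mpr (log_le_log hz10 hz12.le))
    have := Nat.ceil_lt_add_one h0
    rw [← hM] at this
    linarith
  have hSout : ∀ n : ℕ, 0 < n → n ∉ Ioc y1 y2 → S n ≤ M*E := by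
    intro n hn hnn
    have hn0 : (0:ℝ) < n := by exact_mod_cast hn
    have : ∀ j ∈ range M, rexp (-(j-v n)^2/(4*π)) ≤ E := by
      intro j hj
      have hj1 : (j:ℝ) < Λ' := Nat.lt_ceil.mp (mem_range.mp hj)
      have hj0 : (0:ℝ) ≤ j := by positivity
      have hsq : (L/8)^2 ≤ ((j:ℝ)-v n)^2 := by
        rw [mem_Ioc, not_and_or, not_lt, not_le] at hnn
        rcases hnn with h1 | h1
        · have h1r : (n:ℝ) ≤ y1 := by exact_mod_cast h1
          have h2 := log_le_log hn0 h1r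
          have h3 := logd y1 z1 hy10 (by linarith)
          have h4 : h/8/X ≤ ((z1:ℝ)-y1)/z1 := by
            have : (z1:ℝ) ≤ X := by linarith
            exact div_le_div₀ (by linarith) (by linarith) hz10 this
          have h5 : ρ*(h/8/X) ≤ ρ*(log z1 - log n) := by gcongr; linarith
          rw [hρh] at h5
          have : v n = -(ρ*(log z1 - log n)) := by simp only [hv]; ring
          rw [this]
          apply pow_le_pow_left₀ (by positivity)
          linarith
        · have h1r : (y2:ℝ) ≤ n := by exact_mod_cast h1.le
          have h2 := log_le_log (by linarith) h1r
          have h3 := logd z2 y2 (by linarith) (by linarith)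
          have h4 : h/8/X ≤ ((y2:ℝ)-z2)/y2 :=
            div_le_div₀ (by linarith) (by linarith) (by linarith) hy2
          have h5 : ρ*(h/8/X) ≤ ρ*(log n - log z2) := by gcongr; linarith
          rw [hρh] at h5
          have : v n = Λ' + ρ*(log n - log z2) := by simp only [hv, hΛ']; ring
          rw [this, ← neg_sq ((j:ℝ)-_)]
          apply pow_le_pow_left₀ (by positivity)
          linarith
      rw [hE]
      apply Real.exp_le_exp.mpr
      rw [show -L^2/(256*π) = -(L/8)^2/(4*π) by ring]
      gcongr
    calc S n ≤ ∑ j ∈ range M, E := Finset.sum_le_sum this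
      _ = _ := by simp
  have hSin : ∀ n ∈ Ioc z1 z2, 1/2 ≤ S n := by
    intro n hn
    rw [mem_Ioc] at hn
    have n1 : (z1:ℝ) < n := by exact_mod_cast hn.1
    have n2 : (n:ℝ) ≤ z2 := by exact_mod_cast hn.2
    have hv0 : 0 < v n := mul_pos hρ0 (sub_pos.mpr (log_lt_log hz10 n1))
    have hv1 : v n ≤ Λ' := by
      simp only [hv, hΛ']
      have := log_le_log (by linarith) n2
      gcongr
    have hc0 : 0 < ⌈v n⌉₊ := Nat.ceil_pos.mpr hv0
    have hcM : ⌈v n⌉₊ ≤ M := Nat.ceil_mono hv1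
    have hj : ⌈v n⌉₊ - 1 ∈ range M := mem_range.mpr (by omega)
    refine le_trans ?_ (Finset.single_le_sum (f := fun j : ℕ => rexp (-(j-v n)^2/(4*π))) (fun j _ => (Real.exp_pos _).le) hj)
    have a1 := Nat.le_ceil (v n)
    have a2 := Nat.ceil_lt_add_one hv0.le
    have e : ((⌈v n⌉₊ - 1 : ℕ):ℝ) = (⌈v n⌉₊:ℝ) - 1 := by rw [Nat.cast_sub hc0]; simp
    simp only [e]
    set d := (⌈v n⌉₊:ℝ) - 1 - v n with hd
    have hd2 : d^2 ≤ 1 := by rw [sq_le_one_iff_abs_le_one, abs_le]; constructor <;> linarith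
    have := Real.add_one_le_exp (-d^2/(4*π))
    have hp : d^2/(4*π) ≤ 1/2 := by
      rw [div_le_iff₀ (by positivity)]; linarith [Real.pi_gt_three]
    rw [neg_div] at this ⊢
    linarith
  -- the smoothed sum over all bumps
  have hk1 : ∀ (j n : ℕ), rexp (-π*ρ^2*((log z1 + j/ρ-log n)/(2*π))^2) = rexp (-(j-v n)^2/(4*π)) := by
    intro j n
    congr 1
    simp only [hv]
    field_simp
    ring
  have hsj : ∀ j : ℕ, Summable (fun n => (vonMangoldt n - 1)*W n*rexp (-(j-v n)^2/(4*π))) := by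
    intro j
    refine Summable.of_norm_bounded (aW_summable k hk σ hσ1) (fun n => ?_)
    rw [norm_mul, Real.norm_eq_abs, Real.norm_eq_abs, abs_of_pos (Real.exp_pos _)]
    have : rexp (-(j-v n)^2/(4*π)) ≤ 1 := Real.exp_le_one_iff.mpr (by
      rw [neg_div]; exact neg_nonpos.mpr (by positivity))
    exact mul_le_of_le_one_right (abs_nonneg _) this
  have hA : HasSum (fun n => (vonMangoldt n - 1)*W n*S n) (∑ j ∈ range M, ∑' n, (vonMangoldt n - 1)*W n*rexp (-(j-v n)^2/(4*π))) := by
    have := hasSum_sum (s := range M) (fun j _ => (hsj j).hasSum)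
    simpa only [hS, Finset.mul_sum] using this
  have hAlow : -(M*(C*ρ)) ≤ ∑ j ∈ range M, ∑' n, (vonMangoldt n - 1)*W n*rexp (-(j-v n)^2/(4*π)) := by
    calc -(M*(C*ρ)) = ∑ j ∈ range M, -(C*ρ) := by simp
      _ ≤ _ := by
        apply Finset.sum_le_sum
        intro j _
        have := hsm σ ρ (log z1 + j/ρ) hσ1 hσ2 hρ1
        simp only [hk1] at this
        exact (abs_le.mp this).1
  have hWs := Wt_summable (k+1) (by omega) σ hσ1
  have hB := ((hasSum_ite_mem (Ioc y1 y2) (fun n => C0*(vonMangoldt n*W n))).sub (hasSum_ite_mem (Ioc z1 z2) (fun n => W n*(1/2)))).add (hWs.1.hasSum.mul_left (M*E))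
  have hE0 : 0 < E := Real.exp_pos _
  have hsub : Ioc z1 z2 ⊆ Ioc y1 y2 := Finset.Ioc_subset_Ioc (by omega) (by omega)
  have hAB := hasSum_le (fun n => by
    have w0 : 0 ≤ W n := Wt_nonneg k σ n
    have w1 : 0 ≤ M*E*Wt (k+1) σ n := mul_nonneg (by positivity) (Wt_nonneg _ _ _)
    have l0 := ArithmeticFunction.vonMangoldt_nonneg (n := n)
    have s0 := hS0 n
    change (vonMangoldt n - 1)*W n*S n ≤ (if n ∈ Ioc y1 y2 then C0*(vonMangoldt n*W n) else 0) - (if n ∈ Ioc z1 z2 then W n*(1/2) else 0) + M*E*Wt (k+1) σ n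
    by_cases hn : n ∈ Ioc y1 y2
    · have c1 : vonMangoldt n*W n*S n ≤ vonMangoldt n*W n*C0 := by
        gcongr; exact hgs M (v n)
      rw [if_pos hn]
      by_cases hn2 : n ∈ Ioc z1 z2
      · rw [if_pos hn2]
        have : W n*(1/2) ≤ W n*S n := by gcongr; exact hSin n hn2
        linarith
      · rw [if_neg hn2]
        have : 0 ≤ W n*S n := by positivity
        linarith
    · rw [if_neg hn, if_neg (fun hh => hn (hsub hh))]
      rcases Nat.eq_zero_or_pos n with h0 | hn0
      · have : W n = 0 := by rw [hW, h0]; simp [Wt, Real.zero_rpow (by linarith : -σ ≠ 0)]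
        rw [this]; linarith
      · have c1 := LWt_le k σ n
        have c2 : vonMangoldt n*W n*S n ≤ Wt (k+1) σ n*(M*E) :=
          mul_le_mul c1 (hSout n hn0 hn) s0 (Wt_nonneg _ _ _)
        have : 0 ≤ W n*S n := by positivity
        linarith) hA hB
  have u1 : ∑ n ∈ Ioc y1 y2, C0*(vonMangoldt n*W n) ≤ 8*C0*(L^k/X)*∑ n ∈ Ioc y1 y2, vonMangoldt n := by
    rw [Finset.mul_sum]
    apply Finset.sum_le_sum
    intro n hn
    rw [mem_Ioc] at hn
    have n1 : (y1:ℝ) < n := by exact_mod_cast hn.1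
    have n2 : (n:ℝ) ≤ y2 := by exact_mod_cast hn.2
    have l0 := ArithmeticFunction.vonMangoldt_nonneg (n := n)
    have hw : W n ≤ L^k*(8/X) := by
      simp only [hW, Wt]
      have b1 : log n ≤ L := log_le_log (by linarith) (by linarith)
      have b0 := log_natCast_nonneg n
      have b2 : (n:ℝ)^(-σ) ≤ 8/X := by
        calc (n:ℝ)^(-σ) ≤ (n:ℝ)^(-1:ℝ) := rpow_le_rpow_of_exponent_le (by exact_mod_cast (show 1 ≤ n by omega)) (by linarith)
          _ = 1/(n:ℝ) := by rw [rpow_neg_one, one_div]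
          _ ≤ 1/(X/8) := by gcongr; linarith
          _ = _ := by field_simp
      gcongr
    calc _ ≤ C0*(vonMangoldt n*(L^k*(8/X))) := by gcongr
      _ = _ := by ring
  have u2 : h*L^k/(12*2^k*X) ≤ ∑ n ∈ Ioc z1 z2, W n*(1/2) := by
    have : ∀ n ∈ Ioc z1 z2, (L/2)^k*(1/(3*X))*(1/2) ≤ W n*(1/2) := by
      intro n hn
      rw [mem_Ioc] at hn
      have n1 : (z1:ℝ) < n := by exact_mod_cast hn.1
      have n2 : (n:ℝ) ≤ z2 := by exact_mod_cast hn.2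
      simp only [hW, Wt]
      have b1 : L/2 ≤ log n := by
        have c1 := log_le_log (show 0 < X/8 by positivity) (show X/8 ≤ n by linarith)
        rw [log_div hX0.ne' (by norm_num)] at c1
        have c2 := log_le_sub_one_of_pos (show (0:ℝ) < 8 by norm_num)
        linarith
      have b2 : 1/(3*X) ≤ (n:ℝ)^(-σ) := by
        have c1 : X^(-σ) ≤ (n:ℝ)^(-σ) := rpow_le_rpow_of_nonpos (by linarith) (by linarith) (by linarith)
        have c2 : X^(-σ) = 1/(rexp 1*X) := by
          rw [rpow_def_of_pos hX0, ← hLd, show L*(-σ) = -(1+L) by rw [hσ]; field_simp; ring, Real.exp_neg, Real.exp_add, hLd, Real.exp_log hX0, one_div]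
        rw [c2] at c1
        refine le_trans ?_ c1
        gcongr
        linarith [Real.exp_one_lt_d9]
      gcongr
    refine le_trans ?_ (Finset.sum_le_sum this)
    rw [Finset.sum_const, Nat.card_Ioc, nsmul_eq_mul, Nat.cast_sub (by exact_mod_cast hz12.le)]
    have hc : h/2 ≤ (z2:ℝ)-z1 := by linarith
    calc h*L^k/(12*2^k*X) = h/2*((L/2)^k*(1/(3*X))*(1/2)) := by rw [div_pow]; field_simp; norm_num
      _ ≤ _ := by gcongr
  have u3 : M*E*∑' n, Wt (k+1) σ n ≤ 27*(2*(k+1))^(k+1)*L^(k+3)*E := by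
    have c1 := hWs.2
    have e1 : σ - 1 = 1/L := by rw [hσ]; ring
    rw [e1] at c1
    have e2 : (2*((k+1:ℕ):ℝ)/(1/L))^(k+1)*(1+2/(1/L)) = (2*(k+1))^(k+1)*L^(k+1)*(1+2*L) := by
      push_cast
      rw [div_div_eq_mul_div, div_div_eq_mul_div, div_one, div_one, mul_pow]
    rw [e2] at c1
    have c0 : 0 ≤ ∑' n, Wt (k+1) σ n := tsum_nonneg (Wt_nonneg _ _)
    calc _ ≤ 9*L*E*((2*(k+1))^(k+1)*L^(k+1)*(1+2*L)) := by gcongr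
      _ ≤ 9*L*E*((2*(k+1))^(k+1)*L^(k+1)*(3*L)) := by gcongr; linarith
      _ = _ := by ring
  have u4 : M*(C*ρ) ≤ 9*C*L*ρ := by
    calc M*(C*ρ) ≤ 9*L*(C*ρ) := by gcongr
      _ = _ := by ring
  linarith

lemma pnt_short : PNTShort := by
  intro B
  obtain ⟨C0, C, D, hC0, hC, hD, hcore⟩ := pnt_core (2*B+3) (by omega)
  set k := 2*B+3 with hk
  refine ⟨1/(24*2^k*C0), by positivity, ?_⟩
  filter_upwards [Filter.eventually_gt_atTop 1, Real.tendsto_log_atTop.eventually_ge_atTop (256*π), Real.tendsto_log_atTop.eventually_ge_atTop (48*2^k*C), ev_log (48*2^k*D) (B+3) 1 one_pos, ev_log 6 B 1 one_pos] with X hX1 hL1 hL2 hL3 hL4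
  intro y1 y2 hy1 hy2 hh
  rw [rpow_one] at hL3 hL4
  have hX0 : 0 < X := by linarith
  set L := log X with hL
  have hL14 : 14 ≤ L := by linarith [Real.pi_gt_three]
  have hL0 : 0 < L := by linarith
  set h := (y2:ℝ) - y1 with hhd
  have hXh : X ≤ h*L^B := (div_le_iff₀ (by positivity)).mp hh
  have hh6 : 6 ≤ h := le_trans ((le_div_iff₀ (by positivity)).mpr hL4) hh
  have h0 : 0 < h := by linarith
  have hy : y1 + 6 ≤ y2 := by
    have : (y1:ℝ)+6 ≤ y2 := by linarith
    exact_mod_cast this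
  have key := hcore X y1 y2 hL14 hy1 hy2 hy
  rw [← hL, ← hhd] at key
  set P := ∑ n ∈ Ioc y1 y2, vonMangoldt n
  set m := h*L^k/(12*2^k*X) with hm
  have hE : rexp (-L^2/(256*π)) ≤ 1/X := by
    have : rexp (-L^2/(256*π)) ≤ rexp (-L) := by
      apply Real.exp_le_exp.mpr
      rw [neg_div, neg_le_neg_iff, le_div_iff₀ (by positivity)]
      nlinarith
    rw [Real.exp_neg, hL, Real.exp_log hX0, ← one_div] at this
    exact this
  have b1 : C*L*(L*X/h) ≤ m/4 := by
    have e1 : X^2 ≤ h^2*L^(2*B) := by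
      calc X^2 ≤ (h*L^B)^2 := by gcongr
        _ = _ := by ring
    rw [hm, div_div, mul_div_assoc', div_le_div_iff₀ h0 (by positivity)]
    calc C*L*(L*X)*(12*2^k*X*4) = (48*2^k*C)*(L^2*X^2) := by ring
      _ ≤ L*(L^2*(h^2*L^(2*B))) := by gcongr
      _ = _ := by rw [hk]; ring
  have b2 : D*L^(k+3)*rexp (-L^2/(256*π)) ≤ m/4 := by
    calc _ ≤ D*L^(k+3)*(1/X) := by gcongr
      _ ≤ m/4 := by
        rw [hm, div_div, mul_one_div, div_le_div_iff₀ hX0 (by positivity)]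
        have e1 : 48*2^k*D*L^(B+3) ≤ h*L^B := hL3.trans hXh
        have e2 : 48*2^k*D*L^3 ≤ h := by
          have : (48*2^k*D*L^3)*L^B ≤ h*L^B := by
            calc _ = 48*2^k*D*L^(B+3) := by ring
              _ ≤ _ := e1
          exact le_of_mul_le_mul_right this (by positivity)
        calc D*L^(k+3)*(12*2^k*X*4) = (48*2^k*D*L^3)*(L^k*X) := by ring
          _ ≤ h*(L^k*X) := by gcongr
          _ = _ := by ring
  have b3 : m/2 ≤ C0*(L^k/X)*P := by linarith
  have e : m/2 = (1/(24*2^k*C0)*h)*(C0*(L^k/X)) := by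
    rw [hm]; field_simp; norm_num
  rw [e, mul_comm (C0*(L^k/X)) P] at b3
  exact le_of_mul_le_mul_right b3 (by positivity)

theorem baker_thm5 (c : ℝ) (hc1 : 1 < c) (hc2 : c < 3581/3106) :
    ∃ c₀ > 0, ∃ r₀ : ℕ, ∀ r : ℕ, r₀ ≤ r →
      c₀ * (r : ℝ) ^ (3/c - 1) / (Real.log r) ^ 3 ≤ (countSolFloor c r 3 : ℝ) := by
  exact baker_of_PNT pnt_short c hc1 hc2
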